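/- Let π ∈ ℤ[i] be a primary prime with p = π·π̄, and let α_π be the coefficient of the elliptic Gauss sum. Then: α_π = ᾱ_π if p ≡ 13 (mod 16); α_π = i·χ_π(2)·ᾱ_π if p ≡ 5 (mod 16); α_π = −χ̄_π(1+i)·ᾱ_π if p ≡ 1 (mod 16); and α_π = −i·χ̄_π(1+i)·ᾱ_π if p ≡ 9 (mod 16), where ᾱ_π denotes the complex conjugate of α_π. -/

import Mathlib

open Complex BigOperators

noncomputable section

/-- The ring of Gaussian integers `ℤ[i]`, realized as a subring of `ℂ`. -/
def O4 : Subring ℂ := Subring.closure {Complex.I}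

/-- `ζ₈ = e^{2πi/8}`, a primitive eighth root of unity. -/
def zeta8 : ℂ := Complex.exp (2 * Real.pi * Complex.I / 8)

/-- The ring `ℤ[ζ₈]`, realized as a subring of `ℂ`. -/
def O8 : Subring ℂ := Subring.closure {zeta8}

/-- The congruence `a ≡ b (mod c)` in `ℤ[i]`. -/
def GCong (a b c : ℂ) : Prop := ∃ d ∈ O4, a - b = c * d

/-- `a` and `b` are coprime in `ℤ[i]`. -/
def GCoprime (a b : ℂ) : Prop := ∃ u ∈ O4, ∃ v ∈ O4, u * a + v * b = 1

/-- The real period `ϖ = 2∫₀¹ (1−x⁴)^{−1/2} dx`. -/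
def varpi : ℝ := 2 * ∫ x in (0:ℝ)..(1:ℝ), (1 - x ^ 4) ^ (-(1:ℝ)/2)

/-- The points of the period lattice `ϖ·ℤ[i]`. -/
def ω4 (m : ℤ × ℤ) : ℂ := (varpi : ℂ) * ((m.1 : ℂ) + (m.2 : ℂ) * Complex.I)

/-- The Weierstrass `℘`-function of the period lattice `ϖ·ℤ[i]`
(so that `℘′² = 4℘³ − 4℘`). -/
def wp4 (u : ℂ) : ℂ :=
  (u ^ 2)⁻¹ + ∑' m : ℤ × ℤ, if m = 0 then 0 else (((u - ω4 m) ^ 2)⁻¹ - ((ω4 m) ^ 2)⁻¹)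

/-- The derivative `℘′` of the Weierstrass `℘`-function of `ϖ·ℤ[i]`. -/
def wp4' (u : ℂ) : ℂ := ∑' m : ℤ × ℤ, (-2) * ((u - ω4 m) ^ 3)⁻¹

/-- The Weierstrass `ζ`-function of the period lattice `ϖ·ℤ[i]`. -/
def wzeta4 (u : ℂ) : ℂ :=
  u⁻¹ + ∑' m : ℤ × ℤ, if m = 0 then 0 else ((u - ω4 m)⁻¹ + (ω4 m)⁻¹ + u * ((ω4 m) ^ 2)⁻¹)

/-- The non-analytic doubly periodic function `Z(u) = ζ(ϖu) − (π/ϖ)·ū`. -/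
def Z4 (u : ℂ) : ℂ :=
  wzeta4 ((varpi : ℂ) * u) - ((Real.pi / varpi : ℝ) : ℂ) * (starRingEnd ℂ) u

/-- The lemniscatic sine `φ(u) = sl((1−i)ϖu) = −2(1−i)·℘(ϖu)/℘′(ϖu)`,
of period lattice `ℤ[i]`. -/
def phi4 (u : ℂ) : ℂ :=
  -2 * (1 - Complex.I) * wp4 ((varpi : ℂ) * u) / wp4' ((varpi : ℂ) * u)

/-- The lemniscatic cosine `ψ(u) = cl((1−i)ϖu) = (℘(ϖu)+i)/(℘(ϖu)−i)`,
of period lattice `ℤ[i]`. -/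
def psi4 (u : ℂ) : ℂ :=
  (wp4 ((varpi : ℂ) * u) + Complex.I) / (wp4 ((varpi : ℂ) * u) - Complex.I)

/-- A residue class character modulo `β` on `ℤ[i]`. -/
structure IsResChar4 (β : ℂ) (χ : ℂ → ℂ) : Prop where
  periodic : ∀ a ∈ O4, ∀ b ∈ O4, GCong a b β → χ a = χ b
  map_mul : ∀ a ∈ O4, ∀ b ∈ O4, χ (a * b) = χ a * χ b
  map_one : χ 1 = 1
  vanish : ∀ a ∈ O4, ¬ GCoprime a β → χ a = 0

/-- The quartic residue character `χ_π = (·/π)₄` modulo a prime `π` with `p = π·π̄`: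
`χ_π(ν)⁴ = 1` and `χ_π(ν) ≡ ν^{(p−1)/4} (mod π)`. -/
structure IsQuarticChar (π : ℂ) (p : ℕ) (χ : ℂ → ℂ) : Prop where
  resChar : IsResChar4 π χ
  quart : ∀ ν ∈ O4, GCoprime ν π → χ ν ^ 4 = 1
  euler : ∀ ν ∈ O4, GCoprime ν π → GCong (χ ν) (ν ^ ((p - 1) / 4)) π

/-- The elliptic Gauss sum `G_π(χ, f) = (1/4)·Σ_{ν ∈ (ℤ[i]/(π))^×} χ(ν)·f(ν/π)`,
computed via the integer representatives `1, …, p−1` of `(ℤ[i]/(π))^× ≅ (ℤ/p)^×`. -/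
def EGS4 (p : ℕ) (χ f : ℂ → ℂ) (π : ℂ) : ℂ :=
  (1/4 : ℂ) * ∑ r ∈ Finset.Icc 1 (p - 1), χ (r : ℂ) * f ((r : ℂ) / π)

/-- `S` is a quarter set of `(ℤ[i]/(π))^×`, i.e. `(ℤ[i]/(π))^× = S ∪ −S ∪ iS ∪ −iS`. -/
def IsQuarterSet (π : ℂ) (S : Finset ℂ) : Prop :=
  (∀ ν ∈ S, ν ∈ O4 ∧ GCoprime ν π) ∧
  (∀ a ∈ O4, GCoprime a π →
    ∃ ν ∈ S, ∃ ε ∈ ({1, -1, Complex.I, -Complex.I} : Set ℂ), GCong a (ε * ν) π) ∧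
  (∀ ν ∈ S, ∀ μ ∈ S, ∀ ε ∈ ({1, -1, Complex.I, -Complex.I} : Set ℂ),
    ∀ ε' ∈ ({1, -1, Complex.I, -Complex.I} : Set ℂ),
      GCong (ε * ν) (ε' * μ) π → ν = μ ∧ ε = ε')

/-- `γ(S)`: if `p ≡ 5 (mod 8)`, the fourth root of unity with
`γ(S) ≡ ∏_{ν∈S} ν (mod π)`; if `p ≡ 1 (mod 8)`, the fourth root of `−1` with
`γ(S) ≡ ∏_{ν∈S} ν (mod Π)` for a fixed prime `Π` of `ℤ[ζ₈]` with `π = Π·Π′`. -/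
def IsGamma4 (π : ℂ) (p : ℕ) (S : Finset ℂ) (γ : ℂ) : Prop :=
  (p % 8 = 5 → γ ^ 4 = 1 ∧ GCong γ (∏ ν ∈ S, ν) π) ∧
  (p % 8 = 1 → γ ^ 4 = -1 ∧
    ∃ P : O8, Prime P ∧ (∃ Q : O8, π = (P : ℂ) * (Q : ℂ)) ∧
      ∃ d ∈ O8, γ - ∏ ν ∈ S, ν = (P : ℂ) * d)

/-- `L` is the value at `s = 1` of the analytic continuation of the Hecke `L`-series
`L(s, χ̃) = Σ_𝔞 χ̃(𝔞)·N𝔞^{−s} = (1/4)·Σ_{ν ∈ ℤ[i]} χ₁(ν)·ν̄·|ν|^{−2s}` attached to the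
weight-one Hecke character `χ̃((ν)) = χ₁(ν)·ν̄` of `ℚ(i)`. -/
def IsLValue4 (χ₁ : ℂ → ℂ) (L : ℂ) : Prop :=
  ∃ F : ℂ → ℂ, DifferentiableOn ℂ F {s : ℂ | 0 < s.re} ∧
    (∀ s : ℂ, 3/2 < s.re →
      F s = (1/4 : ℂ) *
        ∑' ν : O4, χ₁ (ν : ℂ) * (starRingEnd ℂ) (ν : ℂ) *
          ((Complex.normSq (ν : ℂ) : ℂ) ^ (-s))) ∧
    F 1 = L

/-- `T` is a complete residue system modulo `β` in `ℤ[i]`. -/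
def IsCRS4 (β : ℂ) (T : Finset ℂ) : Prop :=
  (∀ a ∈ T, a ∈ O4) ∧ (∀ a ∈ T, ∀ b ∈ T, GCong a b β → a = b) ∧
  (∀ z ∈ O4, ∃ a ∈ T, GCong z a β)

/-- `e^{2πi·Re(z)}`. -/
def eRe4 (z : ℂ) : ℂ := Complex.exp (2 * Real.pi * Complex.I * (z.re : ℂ))

/-- `χ₀`: the character mod `(1+i)³` giving the natural isomorphism
`(ℤ[i]/(1+i)³)^× ≅ W`, i.e. `χ₀(ν) = ε` for `ν ≡ ε (mod (1+i)³)`, `ε ∈ W = {±1, ±i}`. -/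
def IsChi0₄ (χ₀ : ℂ → ℂ) : Prop :=
  IsResChar4 ((1 + Complex.I) ^ 3) χ₀ ∧
    ∀ ε ∈ ({1, -1, Complex.I, -Complex.I} : Set ℂ), χ₀ ε = ε

/-- `χ₀′`: the character mod `(1+i)² = 2i` giving `(ℤ[i]/(2))^× ≅ {±1}`, i.e.
`χ₀′(ν) = δ²` for `ν ≡ δ (mod (1+i)²)`, `δ ∈ {1, i}`. -/
def IsChi0'₄ (χ₀' : ℂ → ℂ) : Prop :=
  IsResChar4 2 χ₀' ∧ χ₀' Complex.I = -1

/-- The classical quartic Gauss sum `G₄(π) = Σ_{r=1}^{p−1} (r/π)₄·e^{2πir/p}`. -/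
def G4sum (p : ℕ) (χ : ℂ → ℂ) : ℂ :=
  ∑ r ∈ Finset.Icc 1 (p - 1), χ (r : ℂ) * Complex.exp (2 * Real.pi * Complex.I * (r : ℂ) / (p : ℂ))

open Filter Topology

/-- `f` is meromorphic at `z` with at most a simple pole there, of residue `r`. -/
def HasResidue (f : ℂ → ℂ) (z r : ℂ) : Prop :=
  MeromorphicAt f z ∧ Tendsto (fun w => (w - z) * f w) (𝓝[≠] z) (𝓝 r)

lemma tendsto_sub_punctured (z : ℂ) : Tendsto (fun w : ℂ => w - z) (𝓝[≠] z) (𝓝 0) := by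
  have : Tendsto (fun w : ℂ => w - z) (𝓝 z) (𝓝 (z - z)) := by
    apply Continuous.tendsto; fun_prop
  rw [sub_self] at this
  exact this.mono_left nhdsWithin_le_nhds

lemma AnalyticAt.hasResidue {f : ℂ → ℂ} {z : ℂ} (h : AnalyticAt ℂ f z) : HasResidue f z 0 := by
  refine ⟨h.meromorphicAt, ?_⟩
  have := (tendsto_sub_punctured z).mul (h.continuousAt.tendsto.mono_left nhdsWithin_le_nhds)
  simpa using this

lemma HasResidue.add {f g : ℂ → ℂ} {z r s : ℂ} (hf : HasResidue f z r) (hg : HasResidue g z s) :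
    HasResidue (fun w => f w + g w) z (r + s) := by
  refine ⟨hf.1.add hg.1, ?_⟩
  refine (hf.2.add hg.2).congr fun w => ?_
  ring

lemma HasResidue.analytic_mul {f g : ℂ → ℂ} {z r : ℂ} (hf : HasResidue f z r)
    (hg : AnalyticAt ℂ g z) : HasResidue (fun w => g w * f w) z (g z * r) := by
  refine ⟨hg.meromorphicAt.mul hf.1, ?_⟩
  refine ((hg.continuousAt.tendsto.mono_left nhdsWithin_le_nhds).mul hf.2).congr fun w => ?_
  ring

lemma HasResidue.const_mul {f : ℂ → ℂ} {z r : ℂ} (hf : HasResidue f z r) (c : ℂ) :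
    HasResidue (fun w => c * f w) z (c * r) :=
  hf.analytic_mul (g := fun _ => c) analyticAt_const

lemma HasResidue.sum {ι : Type*} {s : Finset ι} {f : ι → ℂ → ℂ} {z : ℂ} {r : ι → ℂ}
    (h : ∀ i ∈ s, HasResidue (f i) z (r i)) :
    HasResidue (fun w => ∑ i ∈ s, f i w) z (∑ i ∈ s, r i) := by
  classical
  induction s using Finset.induction_on with
  | empty => simpa using (analyticAt_const (v := (0 : ℂ))).hasResidue
  | insert a s ha ih =>
    simp only [Finset.sum_insert ha]
    exact (h a (by simp)).add (ih fun i hi => h i (by simp [hi]))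

lemma HasResidue.congr {f g : ℂ → ℂ} {z r : ℂ} (hf : HasResidue f z r)
    (h : ∀ᶠ w in 𝓝[≠] z, f w = g w) : HasResidue g z r := by
  refine ⟨hf.1.congr h, hf.2.congr' ?_⟩
  filter_upwards [h] with w hw
  rw [hw]

lemma tendsto_affine_punctured {a : ℂ} (ha : a ≠ 0) (b z : ℂ) :
    Tendsto (fun w : ℂ => a * w + b) (𝓝[≠] z) (𝓝[≠] (a * z + b)) := by
  apply tendsto_nhdsWithin_of_tendsto_nhds_of_eventually_within
  · apply Tendsto.mono_left _ nhdsWithin_le_nhds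
    apply Continuous.tendsto (f := fun w : ℂ => a * w + b); fun_prop
  · filter_upwards [self_mem_nhdsWithin] with w hw
    simpa [ha] using hw

lemma HasResidue.comp_affine {f : ℂ → ℂ} {a b z r : ℂ} (ha : a ≠ 0)
    (hf : HasResidue f (a * z + b) r) : HasResidue (fun w => f (a * w + b)) z (r / a) := by
  refine ⟨?_, ?_⟩
  · exact hf.1.comp_analyticAt (f := f) (g := fun w => a * w + b) (x := z) (by fun_prop)
  · have := (hf.2.comp (tendsto_affine_punctured ha b z)).div_const a
    refine this.congr fun w => ?_
    simp only [Function.comp]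
    field_simp
    ring

lemma HasResidue.comp_add {f : ℂ → ℂ} {b z r : ℂ}
    (hf : HasResidue f (z + b) r) : HasResidue (fun w => f (w + b)) z r := by
  have := HasResidue.comp_affine (a := 1) (b := b) (z := z) (r := r) (f := f) one_ne_zero (by simpa using hf)
  simpa using this

lemma HasResidue.translate {f : ℂ → ℂ} {l M z r : ℂ} (hf : HasResidue f z r)
    (h : ∀ w, f (w + l) = M * f w) : HasResidue f (z + l) (M * r) := by
  have : HasResidue f (z + l + -l) r := by simpa using hf
  refine (this.comp_add.const_mul M).congr (Eventually.of_forall fun w => ?_)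
  rw [← h]; simp

lemma HasResidue.order_nonneg {f : ℂ → ℂ} {z : ℂ} (hf : HasResidue f z 0) :
    0 ≤ meromorphicOrderAt f z := by
  have hm : MeromorphicAt (fun w : ℂ => w - z) z := by fun_prop
  have h1 : 0 < meromorphicOrderAt ((fun w : ℂ => w - z) * f) z :=
    (tendsto_zero_iff_meromorphicOrderAt_pos (hm.mul hf.1)).1 hf.2
  rw [meromorphicOrderAt_mul hm hf.1] at h1
  have h2 : meromorphicOrderAt (fun w : ℂ => w - z) z = 1 := meromorphicOrderAt_id_sub_const
  rw [h2] at h1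
  cases h : meromorphicOrderAt f z with
  | top => simp
  | coe n =>
    rw [h] at h1
    have : (0 : ℤ) < 1 + n := by exact_mod_cast h1
    have : 0 ≤ n := by omega
    exact_mod_cast this

/-- A meromorphic function without poles whose absolute value has periods `1` and `i` is
constant. -/
theorem eq_const_of_norm_periodic {d : ℂ → ℂ} (hp : ∀ z, HasResidue d z 0)
    (h1 : ∀ z, ‖d (z + 1)‖ = ‖d z‖) (hi : ∀ z, ‖d (z + I)‖ = ‖d z‖) :
    ∃ c, ∀ z, ContinuousAt d z → d z = c := by
  have hm : MeromorphicOn d Set.univ := fun z _ => (hp z).1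
  set D := toMeromorphicNFOn d Set.univ with hD
  have hEq : ∀ z, ∀ᶠ w in 𝓝[≠] z, D w = d w := fun z =>
    by
    filter_upwards [hm.toMeromorphicNFOn_eq_self_on_nhdsNE (Set.mem_univ z)] with w hw using hw
  have hA : ∀ z, AnalyticAt ℂ D z := by
    intro z
    have hNF : MeromorphicNFAt D z := meromorphicNFOn_toMeromorphicNFOn d Set.univ (Set.mem_univ z)
    rw [← hNF.meromorphicOrderAt_nonneg_iff_analyticAt]
    rw [meromorphicOrderAt_congr (hEq z)]
    exact (hp z).order_nonneg
  have hdiff : Differentiable ℂ D := fun z => (hA z).differentiableAt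
  have hval : ∀ z, ContinuousAt d z → d z = D z := by
    intro z hz
    have a1 : Tendsto d (𝓝[≠] z) (𝓝 (d z)) := hz.tendsto.mono_left nhdsWithin_le_nhds
    have a2 : Tendsto D (𝓝[≠] z) (𝓝 (D z)) :=
      hdiff.continuous.continuousAt.tendsto.mono_left nhdsWithin_le_nhds
    exact tendsto_nhds_unique a1 (a2.congr' (hEq z))
  have hper : ∀ l, (∀ z, ‖d (z + l)‖ = ‖d z‖) → ∀ z, ‖D (z + l)‖ = ‖D z‖ := by
    intro l hl z
    have a1 : Tendsto (fun w => ‖D (w + l)‖) (𝓝[≠] z) (𝓝 ‖D (z + l)‖) := by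
      apply Tendsto.mono_left _ nhdsWithin_le_nhds
      have hc := hdiff.continuous
      apply Continuous.tendsto (f := fun w => ‖D (w + l)‖); fun_prop
    have a2 : Tendsto (fun w => ‖D w‖) (𝓝[≠] z) (𝓝 ‖D z‖) := by
      apply Tendsto.mono_left _ nhdsWithin_le_nhds
      have hc := hdiff.continuous
      apply Continuous.tendsto (f := fun w => ‖D w‖); fun_prop
    refine tendsto_nhds_unique a1 (a2.congr' ?_)
    have h3 := tendsto_affine_punctured (one_ne_zero (α := ℂ)) l z
    simp only [one_mul] at h3
    filter_upwards [hEq z, h3.eventually (hEq (z + l))] with w hw hw'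
    rw [hw, hw', hl]
  have hp1 := hper 1 h1
  have hpi := hper I hi
  have int1 : ∀ (n : ℤ) z, ‖D (z + n)‖ = ‖D z‖ := by
    intro n
    induction n with
    | zero => simp
    | succ n ih => intro z; rw [← ih z, ← hp1 (z + (n : ℤ))]; congr 2; push_cast; ring
    | pred n ih => intro z; rw [← ih z, ← hp1 (z + ((-(n : ℤ) - 1 : ℤ) : ℂ))]; congr 2; push_cast; ring
  have inti : ∀ (n : ℤ) z, ‖D (z + n * I)‖ = ‖D z‖ := by
    intro n
    induction n with
    | zero => simp
    | succ n ih => intro z; rw [← ih z, ← hpi (z + (n : ℤ) * I)]; congr 2; push_cast; ring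
    | pred n ih => intro z; rw [← ih z, ← hpi (z + ((-(n : ℤ) - 1 : ℤ) : ℂ) * I)]; congr 2; push_cast; ring
  have hbdd : Bornology.IsBounded (Set.range D) := by
    obtain ⟨C, hC⟩ := (isCompact_closedBall (0 : ℂ) 2).exists_bound_of_continuousOn
      hdiff.continuous.continuousOn
    refine isBounded_iff_forall_norm_le.2 ⟨C, ?_⟩
    rintro _ ⟨z, rfl⟩
    have : ‖D z‖ = ‖D (z + ((-⌊z.re⌋ : ℤ) : ℂ) + ((-⌊z.im⌋ : ℤ) : ℂ) * I)‖ := by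
      rw [inti, int1]
    rw [this]
    apply hC
    rw [mem_closedBall_zero_iff]
    refine (Complex.norm_le_abs_re_add_abs_im _).trans ?_
    have e1 := Int.floor_le z.re
    have e2 := Int.lt_floor_add_one z.re
    have e3 := Int.floor_le z.im
    have e4 := Int.lt_floor_add_one z.im
    simp
    rw [abs_of_nonneg (by linarith), abs_of_nonneg (by linarith)]
    linarith
  exact ⟨D 0, fun z hz => (hval z hz).trans (hdiff.apply_eq_apply_of_bounded hbdd z 0)⟩

theorem eq_zero_of_multiplier {d : ℂ → ℂ} (hp : ∀ z, HasResidue d z 0)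
    (h1 : ∀ z, ‖d (z + 1)‖ = ‖d z‖) (hi : ∀ z, ‖d (z + I)‖ = ‖d z‖)
    {l M : ℂ} (hM : M ≠ 1) (hl : ∀ z, d (z + l) = M * d z) :
    ∀ z, ContinuousAt d z → d z = 0 := by
  obtain ⟨c, hc⟩ := eq_const_of_norm_periodic hp h1 hi
  have h3 := tendsto_affine_punctured (one_ne_zero (α := ℂ)) l 0
  simp only [one_mul] at h3
  obtain ⟨z, hz1, hz2⟩ := ((hp 0).1.eventually_continuousAt.and
    (h3.eventually (hp (0 + l)).1.eventually_continuousAt)).exists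
  have e := hl z
  rw [hc z hz1, hc _ hz2] at e
  have : c = 0 := by
    have : (M - 1) * c = 0 := by linear_combination -e
    rcases mul_eq_zero.1 this with h | h
    · exact absurd (sub_eq_zero.1 h) hM
    · exact h
  intro z hz
  rw [hc z hz, this]

/-- The terms of the doubly quasi-periodic series `kser`. -/
def kterm (y v : ℂ) (n : ℤ) : ℂ :=
  (-1) ^ n * exp (Real.pi * I * (2 * n + 1) * y) / cos (Real.pi * (v + (n + 1 / 2) * I))

/-- A meromorphic function of `v` with simple poles at the points congruent to `(1+i)/2` modulo
`ℤ[i]` and with constant multipliers `-1` and `-e^{-2πiy}` for the periods `1` and `i`. -/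
def kser (y v : ℂ) : ℂ := ∑' n : ℤ, kterm y v n

lemma norm_cos_ge {w : ℂ} (h : 1 ≤ |w.im|) : Real.exp |w.im| / 4 ≤ ‖cos w‖ := by
  have h1 : cos w = (exp (w * I) + exp (-w * I)) / 2 := rfl
  have n1 : ‖exp (w * I)‖ = Real.exp (-w.im) := by rw [norm_exp]; simp
  have n2 : ‖exp (-w * I)‖ = Real.exp (w.im) := by rw [norm_exp]; simp
  have key : Real.exp |w.im| - Real.exp (-|w.im|) ≤ ‖exp (w * I) + exp (-w * I)‖ := by
    rcases abs_cases w.im with ⟨e, _⟩ | ⟨e, _⟩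
    · rw [e, ← n1, ← n2, add_comm]
      have := norm_sub_norm_le (exp (-w * I)) (-exp (w * I))
      rwa [sub_neg_eq_add, norm_neg] at this
    · rw [e, neg_neg, ← n1, ← n2]
      have := norm_sub_norm_le (exp (w * I)) (-exp (-w * I))
      rwa [sub_neg_eq_add, norm_neg] at this
  have h2 : Real.exp (-|w.im|) ≤ Real.exp |w.im| / 2 := by
    have e1 : Real.exp (-|w.im|) ≤ 1 := by
      rw [Real.exp_le_one_iff]; linarith
    have e2 := Real.add_one_le_exp |w.im|
    linarith
  rw [h1, norm_div]
  simp only [Complex.norm_ofNat]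
  linarith

lemma summable_exp_neg_mul_int {c : ℝ} (hc : 0 < c) :
    Summable fun n : ℤ => Real.exp (-c * |(n : ℝ) + 1 / 2|) := by
  have h : Summable fun n : ℕ => Real.exp (-c * ((n : ℝ))) := by
    have : Summable fun n : ℕ => Real.exp (-c) ^ n :=
      summable_geometric_of_lt_one (Real.exp_nonneg _) (by rw [Real.exp_lt_one_iff]; linarith)
    refine this.congr fun n => ?_
    rw [← Real.exp_nat_mul]; ring_nf
  apply Summable.of_nat_of_neg_add_one
  · refine (h.mul_left (Real.exp (-c * (1 / 2)))).congr fun n => ?_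
    rw [← Real.exp_add, abs_of_nonneg (by positivity)]
    push_cast; ring_nf
  · refine (h.mul_left (Real.exp (-c * (1 / 2)))).congr fun n => ?_
    rw [← Real.exp_add]
    have : (((-((n : ℤ) + 1) : ℤ)) : ℝ) + 1 / 2 = -((n : ℝ) + 1 / 2) := by push_cast; ring
    rw [this, abs_neg, abs_of_nonneg (by positivity)]
    ring_nf

lemma norm_kterm_le {y v : ℂ} {R : ℝ} (hv : |v.im| < R) {n : ℤ}
    (hn : R + 1 ≤ |(n : ℝ) + 1 / 2|) :
    ‖kterm y v n‖ ≤ 4 * Real.exp (Real.pi * R) *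
      Real.exp (-(Real.pi * (1 - 2 * |y.im|)) * |(n : ℝ) + 1 / 2|) := by
  have hpi := Real.pi_pos
  have hpi3 := Real.pi_gt_three
  set w : ℂ := Real.pi * (v + (n + 1 / 2) * I) with hw
  have him : w.im = Real.pi * (v.im + ((n : ℝ) + 1 / 2)) := by
    simp [hw]
  have hge : Real.pi * (|(n : ℝ) + 1 / 2| - R) ≤ |w.im| := by
    rw [him, abs_mul, abs_of_pos hpi]
    apply mul_le_mul_of_nonneg_left _ hpi.le
    have := abs_sub_abs_le_abs_sub ((n : ℝ) + 1 / 2) (-v.im)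
    rw [abs_neg, sub_neg_eq_add, add_comm _ v.im] at this
    linarith
  have h1 : 1 ≤ |w.im| := by nlinarith
  have hcos := norm_cos_ge h1
  have hcos2 : Real.exp (Real.pi * (|(n : ℝ) + 1 / 2| - R)) / 4 ≤ ‖cos w‖ :=
    (div_le_div_of_nonneg_right (Real.exp_le_exp.2 hge) (by norm_num)).trans hcos
  have hnum : ‖exp (Real.pi * I * (2 * n + 1) * y)‖ ≤
      Real.exp (2 * Real.pi * |y.im| * |(n : ℝ) + 1 / 2|) := by
    rw [norm_exp, Real.exp_le_exp]
    have : (Real.pi * I * (2 * n + 1) * y : ℂ).re = -(2 * Real.pi * (y.im * ((n : ℝ) + 1 / 2))) := by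
      have : (Real.pi * I * (2 * n + 1) * y : ℂ) = ((Real.pi * (2 * (n : ℝ) + 1) : ℝ) : ℂ) * (I * y) := by
        push_cast; ring
      rw [this, re_ofReal_mul]; simp; ring
    rw [this]
    have h3 := neg_abs_le (y.im * ((n : ℝ) + 1 / 2))
    rw [abs_mul] at h3
    nlinarith
  rw [kterm, norm_div, norm_mul, norm_zpow, norm_neg, norm_one, one_zpow, one_mul, ← hw]
  have hpos : 0 < Real.exp (Real.pi * (|(n : ℝ) + 1 / 2| - R)) / 4 := by positivity
  calc _ ≤ Real.exp (2 * Real.pi * |y.im| * |(n : ℝ) + 1 / 2|) /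
        (Real.exp (Real.pi * (|(n : ℝ) + 1 / 2| - R)) / 4) :=
        div_le_div₀ (Real.exp_nonneg _) hnum hpos hcos2
    _ = _ := by
      rw [div_div_eq_mul_div, div_eq_iff (Real.exp_ne_zero _), mul_assoc 4, mul_assoc 4,
        ← Real.exp_add, ← Real.exp_add, mul_comm]
      congr 2; ring

lemma kterm_bound_summable {y : ℂ} (hy : |y.im| < 1 / 2) (R : ℝ) :
    Summable fun n : ℤ => 4 * Real.exp (Real.pi * R) *
      Real.exp (-(Real.pi * (1 - 2 * |y.im|)) * |(n : ℝ) + 1 / 2|) := by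
  apply Summable.mul_left
  apply summable_exp_neg_mul_int
  have := Real.pi_pos
  apply mul_pos this; linarith

lemma cofinite_abs_ge (R : ℝ) {n : ℤ} (hn : n ∉ Finset.Icc (-(⌈R⌉ + 3)) (⌈R⌉ + 3)) :
    R ≤ |(n : ℝ) + 1 / 2| := by
  have h := Int.le_ceil R
  rw [Finset.mem_Icc, not_and_or] at hn
  rcases hn with hn | hn
  · have : n + 1 ≤ -(⌈R⌉ + 3) := by omega
    have h2 : (n : ℝ) + 1 ≤ -(⌈R⌉ + 3) := by exact_mod_cast this
    rw [le_abs]; right; linarith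
  · have : (⌈R⌉ + 3) + 1 ≤ n := by omega
    have h2 : (⌈R⌉ + 3 : ℝ) + 1 ≤ n := by exact_mod_cast this
    rw [le_abs]; left; linarith

lemma kterm_summable {y : ℂ} (hy : |y.im| < 1 / 2) (v : ℂ) : Summable (kterm y v) := by
  refine Summable.of_norm_bounded_eventually (kterm_bound_summable hy (|v.im| + 1)) ?_
  rw [eventually_cofinite]
  refine (Finset.Icc (-(⌈|v.im| + 1 + 1⌉ + 3)) (⌈|v.im| + 1 + 1⌉ + 3)).finite_toSet.subset ?_
  intro n hn
  by_contra hc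
  exact hn (norm_kterm_le (by linarith) (cofinite_abs_ge _ hc))

lemma cos_pi_ne_zero {v : ℂ} {n : ℤ} (h : ∀ k : ℤ, v + (n + 1 / 2) * I ≠ k + 1 / 2) :
    cos (Real.pi * (v + (n + 1 / 2) * I)) ≠ 0 := by
  rw [Ne, Complex.cos_eq_zero_iff]
  rintro ⟨k, hk⟩
  apply h k
  have hpi : (Real.pi : ℂ) ≠ 0 := by exact_mod_cast Real.pi_ne_zero
  apply mul_left_cancel₀ hpi
  rw [hk]; ring

lemma kterm_analyticAt {y v : ℂ} {n : ℤ} (h : ∀ k : ℤ, v + (n + 1 / 2) * I ≠ k + 1 / 2) :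
    AnalyticAt ℂ (fun v => kterm y v n) v := by
  unfold kterm
  apply AnalyticAt.div
  · exact analyticAt_const
  · have : Differentiable ℂ fun v : ℂ => cos (Real.pi * (v + (n + 1 / 2) * I)) := by fun_prop
    exact this.analyticAt _
  · exact cos_pi_ne_zero h

lemma kser_split {y : ℂ} (hy : |y.im| < 1 / 2) (R : ℝ) :
    ∃ (s : Finset ℤ) (T : ℂ → ℂ), 0 ∈ s ∧ DifferentiableOn ℂ T {v | |v.im| < R} ∧
      ∀ v, kser y v = ∑ n ∈ s, kterm y v n + T v := by
  by_cases hR : 0 < R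
  swap
  · refine ⟨{0}, fun v => kser y v - kterm y v 0, by simp, ?_, by simp⟩
    intro v hv
    simp only [Set.mem_ofPred_eq] at hv
    have := abs_nonneg v.im
    exact absurd (lt_of_le_of_lt this hv) hR
  set s := Finset.Icc (-(⌈R + 1⌉ + 3)) (⌈R + 1⌉ + 3) with hs
  have hU : IsOpen {v : ℂ | |v.im| < R} :=
    isOpen_lt (by fun_prop) continuous_const
  refine ⟨s, fun v => ∑' n : { n // n ∉ s }, kterm y v n, ?_, ?_, ?_⟩
  · have : 0 ≤ ⌈R + 1⌉ := Int.ceil_nonneg (by linarith)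
    rw [hs, Finset.mem_Icc]; omega
  · refine differentiableOn_tsum_of_summable_norm (u := fun n : { n // n ∉ s } => 4 * Real.exp (Real.pi * R) *
      Real.exp (-(Real.pi * (1 - 2 * |y.im|)) * |(n : ℝ) + 1 / 2|)) ?_ ?_ hU ?_
    · exact (kterm_bound_summable hy R).subtype _
    · intro n v hv
      simp only [Set.mem_ofPred_eq] at hv
      apply DifferentiableAt.differentiableWithinAt
      apply AnalyticAt.differentiableAt
      apply kterm_analyticAt
      intro k hk
      have := congrArg Complex.im hk
      simp at this
      have h3 := cofinite_abs_ge _ n.2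
      have : v.im = -((n : ℝ) + 1 / 2) := by norm_num; linarith
      rw [this, abs_neg] at hv
      linarith
    · intro n v hv
      exact norm_kterm_le hv (cofinite_abs_ge _ n.2)
  · intro v
    exact ((kterm_summable hy v).sum_add_tsum_compl (s := s)).symm

lemma isOpen_strip (R : ℝ) : IsOpen {v : ℂ | |v.im| < R} :=
  isOpen_lt (by fun_prop) continuous_const

/-- The pole set of `kser y` (and of the lemniscatic sine). -/
def IsPoleK (v : ℂ) : Prop := ∃ m n : ℤ, v = (1 + I) / 2 + m + n * I

lemma kser_analyticAt {y v : ℂ} (hy : |y.im| < 1 / 2) (hv : ¬ IsPoleK v) :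
    AnalyticAt ℂ (kser y) v := by
  obtain ⟨s, T, -, hT, h⟩ := kser_split hy (|v.im| + 1)
  have e : kser y = fun v => ∑ n ∈ s, kterm y v n + T v := funext h
  rw [e]
  apply AnalyticAt.add
  · apply Finset.analyticAt_fun_sum
    intro n _
    apply kterm_analyticAt
    intro k hk
    apply hv
    refine ⟨k, -n - 1, ?_⟩
    push_cast
    linear_combination hk
  · apply hT.analyticAt
    exact (isOpen_strip _).mem_nhds (by simp)

lemma cos_residue : Tendsto (fun w : ℂ => (w - (1 - I) / 2) /
    cos (Real.pi * (w + (((0 : ℤ) : ℂ) + 1 / 2) * I))) (𝓝[≠] ((1 - I) / 2)) (𝓝 (-1 / Real.pi)) := by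
  have hpi : (Real.pi : ℂ) ≠ 0 := by exact_mod_cast Real.pi_ne_zero
  set f : ℂ → ℂ := fun w => cos (Real.pi * (w + (((0 : ℤ) : ℂ) + 1 / 2) * I)) with hf
  have harg : (Real.pi * ((1 - I) / 2 + (((0 : ℤ) : ℂ) + 1 / 2) * I) : ℂ) = Real.pi / 2 := by
    push_cast; ring
  have h0 : f ((1 - I) / 2) = 0 := by
    simp only [hf]; rw [harg, Complex.cos_pi_div_two]
  have hd : HasDerivAt f (-Real.pi) ((1 - I) / 2) := by
    have h1 : HasDerivAt (fun w : ℂ => (Real.pi * (w + (((0 : ℤ) : ℂ) + 1 / 2) * I) : ℂ)) Real.pi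
        ((1 - I) / 2) := by
      simpa using ((hasDerivAt_id ((1 - I) / 2)).add_const ((((0 : ℤ) : ℂ) + 1 / 2) * I)).const_mul
        (Real.pi : ℂ)
    have h2 := h1.ccos
    rw [harg, Complex.sin_pi_div_two] at h2
    convert h2 using 1; simp
  have h3 := (hasDerivAt_iff_tendsto_slope.1 hd).inv₀ (by simp)
  have : (-(Real.pi : ℂ))⁻¹ = -1 / Real.pi := by field_simp
  rw [this] at h3
  refine h3.congr fun w => ?_
  simp only [slope, h0, vsub_eq_sub, sub_zero, smul_eq_mul, mul_inv, inv_inv]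
  simp only [hf, div_eq_mul_inv, mul_comm]

lemma kser_hasResidue {y : ℂ} (hy : |y.im| < 1 / 2) :
    HasResidue (kser y) ((1 - I) / 2) (-exp (Real.pi * I * y) / Real.pi) := by
  obtain ⟨s, T, h0, hT, h⟩ := kser_split hy 1
  have e : kser y = fun v => kterm y v 0 + (∑ n ∈ s.erase 0, kterm y v n + T v) := by
    funext v
    rw [h, ← Finset.add_sum_erase s _ h0]; ring
  rw [e]
  have hA : AnalyticAt ℂ (fun v => ∑ n ∈ s.erase 0, kterm y v n + T v) ((1 - I) / 2) := by
    apply AnalyticAt.add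
    · apply Finset.analyticAt_fun_sum
      intro n hn
      apply kterm_analyticAt
      intro k hk
      have h1 := congrArg Complex.im hk
      simp at h1
      have : n = 0 := by
        have : (n : ℝ) = 0 := by linarith
        exact_mod_cast this
      exact (Finset.mem_erase.1 hn).1 this
    · apply hT.analyticAt
      apply (isOpen_strip _).mem_nhds
      simp only [Set.mem_ofPred_eq]
      norm_num [abs_lt]
  have hB : HasResidue (fun v => kterm y v 0) ((1 - I) / 2) (-exp (Real.pi * I * y) / Real.pi) := by
    constructor
    · unfold kterm
      apply MeromorphicAt.div
      · exact (analyticAt_const).meromorphicAt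
      · have : Differentiable ℂ fun v : ℂ => cos (Real.pi * (v + (((0 : ℤ) : ℂ) + 1 / 2) * I)) := by fun_prop
        exact (this.analyticAt _).meromorphicAt
    · have := cos_residue.const_mul (exp (Real.pi * I * y))
      have e2 : exp (Real.pi * I * y) * (-1 / (Real.pi : ℂ)) = -exp (Real.pi * I * y) / Real.pi := by ring
      rw [e2] at this
      refine this.congr fun w => ?_
      unfold kterm
      push_cast
      simp
      ring
  have := hB.add hA.hasResidue
  simpa using this

lemma kser_add_one (y v : ℂ) : kser y (v + 1) = -kser y v := by
  unfold kser
  rw [← tsum_neg]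
  congr 1; funext n
  unfold kterm
  have : (Real.pi * (v + 1 + (n + 1 / 2) * I) : ℂ) = Real.pi * (v + (n + 1 / 2) * I) + Real.pi := by
    ring
  rw [this, cos_add_pi, div_neg]

lemma kser_add_I (y v : ℂ) : kser y (v + I) = -exp (-(2 * Real.pi * I * y)) * kser y v := by
  unfold kser
  rw [← tsum_mul_left, ← (Equiv.addRight (1 : ℤ)).tsum_eq (fun n => -exp (-(2 * Real.pi * I * y)) * _)]
  congr 1; funext n
  simp only [Equiv.coe_addRight]
  unfold kterm
  have h1 : (v + I + (n + 1 / 2) * I : ℂ) = v + (((n + 1 : ℤ) : ℂ) + 1 / 2) * I := by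
    push_cast; ring
  have h2 : exp (Real.pi * I * (2 * n + 1) * y) =
      exp (-(2 * Real.pi * I * y)) * exp (Real.pi * I * (2 * ((n + 1 : ℤ) : ℂ) + 1) * y) := by
    rw [← Complex.exp_add]; congr 1; push_cast; ring
  rw [h1, h2, zpow_add₀ (by norm_num)]
  simp; ring

lemma kser_neg_neg (y v : ℂ) : kser (-y) (-v) = -kser y v := by
  unfold kser
  rw [← tsum_neg, ← ((Equiv.neg ℤ).trans (Equiv.addRight (-1))).tsum_eq (fun n => -_)]
  congr 1; funext n
  simp only [Equiv.trans_apply, Equiv.neg_apply, Equiv.coe_addRight]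
  unfold kterm
  have h1 : (Real.pi * (v + (((-n + -1 : ℤ) : ℂ) + 1 / 2) * I) : ℂ) =
      -(Real.pi * (-v + (n + 1 / 2) * I)) := by
    push_cast; ring
  have h2 : (Real.pi * I * (2 * n + 1) * -y : ℂ) =
      (Real.pi * I * (2 * ((-n + -1 : ℤ) : ℂ) + 1) * y) := by
    push_cast; ring
  have h3 : (-1 : ℂ) ^ (-n + -1) = -(-1) ^ n := by
    rw [zpow_add₀ (by norm_num), zpow_neg, ← inv_zpow]
    norm_num
  rw [h1, h2, h3, Complex.cos_neg]
  ring

lemma kser_conj (y v : ℂ) :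
    starRingEnd ℂ (kser y v) = -kser (starRingEnd ℂ y) (starRingEnd ℂ v) := by
  unfold kser
  rw [conj_tsum, ← tsum_neg, ← ((Equiv.neg ℤ).trans (Equiv.addRight (-1))).tsum_eq (fun n => -_)]
  congr 1; funext n
  simp only [Equiv.trans_apply, Equiv.neg_apply, Equiv.coe_addRight]
  unfold kterm
  have h1 : (Real.pi * (starRingEnd ℂ v + (((-n + -1 : ℤ) : ℂ) + 1 / 2) * I) : ℂ) =
      starRingEnd ℂ (Real.pi * (v + (n + 1 / 2) * I)) := by
    simp only [map_mul, map_add, map_div₀, map_one, conj_ofReal, conj_I, map_intCast, map_ofNat]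
    push_cast; ring
  have h2 : starRingEnd ℂ (Real.pi * I * (2 * n + 1) * y : ℂ) =
      (Real.pi * I * (2 * ((-n + -1 : ℤ) : ℂ) + 1) * starRingEnd ℂ y) := by
    simp only [map_mul, map_add, map_one, conj_ofReal, conj_I, map_intCast, map_ofNat]
    push_cast; ring
  have h3 : (-1 : ℂ) ^ (-n + -1) = -(-1) ^ n := by
    rw [zpow_add₀ (by norm_num), zpow_neg, ← inv_zpow]
    norm_num
  rw [map_div₀, map_mul, ← Complex.exp_conj, ← Complex.cos_conj, h1, h2, h3]
  simp; ring

/-- The terms of the double geometric series underlying `kser`. -/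
def kdbl (y v : ℂ) (q : ℕ × ℕ) : ℂ :=
  2 * (-1) ^ (q.1 + q.2) * exp (Real.pi * I * ((2 * q.1 + 1) * y + (2 * q.2 + 1) * v)
    - Real.pi * ((2 * q.1 + 1) * (2 * q.2 + 1)) / 2)

lemma kdbl_summable {y v : ℂ} (hy : |y.im| < 1 / 2) (hv : |v.im| < 1 / 2) :
    Summable (kdbl y v) := by
  have hpi := Real.pi_pos
  have geo : ∀ c : ℝ, 0 < c → Summable fun n : ℕ => Real.exp (-c * ((2 * n + 1 : ℝ))) := by
    intro c hc
    have : Summable fun n : ℕ => Real.exp (-(2 * c)) ^ n :=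
      summable_geometric_of_lt_one (Real.exp_nonneg _) (by rw [Real.exp_lt_one_iff]; linarith)
    refine (this.mul_left (Real.exp (-c))).congr fun n => ?_
    rw [← Real.exp_nat_mul, ← Real.exp_add]; ring_nf
  have h1 := geo (Real.pi * (1 / 2 - |y.im|)) (mul_pos hpi (by linarith))
  have h2 := geo (Real.pi * (1 / 2 - |v.im|)) (mul_pos hpi (by linarith))
  have h3 := (h1.mul_of_nonneg h2 (fun _ => Real.exp_nonneg _) (fun _ => Real.exp_nonneg _)).mul_left
    (2 * Real.exp (Real.pi / 2))
  refine Summable.of_norm_bounded h3 ?_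
  rintro ⟨n, m⟩
  simp only [kdbl, norm_mul, norm_pow, norm_neg, norm_one, one_pow, mul_one, Complex.norm_ofNat, norm_exp]
  rw [mul_assoc 2, ← Real.exp_add, ← Real.exp_add]
  apply mul_le_mul_of_nonneg_left _ (by norm_num)
  rw [Real.exp_le_exp]
  have hre : (Real.pi * I * ((2 * n + 1) * y + (2 * m + 1) * v)
    - Real.pi * ((2 * n + 1) * (2 * m + 1)) / 2 : ℂ).re =
      -Real.pi * ((2 * n + 1) * y.im + (2 * m + 1) * v.im) -
      Real.pi * ((2 * n + 1) * (2 * m + 1)) / 2 := by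
    have : (Real.pi * I * ((2 * n + 1) * y + (2 * m + 1) * v)
      - Real.pi * ((2 * n + 1) * (2 * m + 1)) / 2 : ℂ) =
      ((Real.pi * (2 * n + 1) : ℝ) : ℂ) * (I * y) + ((Real.pi * (2 * m + 1) : ℝ) : ℂ) * (I * v) -
        ((Real.pi * ((2 * n + 1) * (2 * m + 1)) / 2 : ℝ) : ℂ) := by
      push_cast; ring
    rw [this, sub_re, add_re, re_ofReal_mul, re_ofReal_mul, ofReal_re]
    simp; ring
  rw [hre]
  have a1 := neg_abs_le y.im
  have a2 := neg_abs_le v.im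
  have n0 : (0 : ℝ) ≤ n := Nat.cast_nonneg n
  have m0 : (0 : ℝ) ≤ m := Nat.cast_nonneg m
  have b1 : -((2 * n + 1) * y.im) ≤ (2 * n + 1) * |y.im| := by nlinarith
  have b2 : -((2 * m + 1) * v.im) ≤ (2 * m + 1) * |v.im| := by nlinarith
  have nm : (0 : ℝ) ≤ n * m := by positivity
  have key : -((2 * n + 1) * y.im + (2 * m + 1) * v.im) - ((2 * n + 1) * (2 * m + 1)) / 2 ≤
      1 / 2 - (1 / 2 - |y.im|) * (2 * n + 1) - (1 / 2 - |v.im|) * (2 * m + 1) := by nlinarith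
  have := mul_le_mul_of_nonneg_left key hpi.le
  linarith

lemma kdbl_swap (y v : ℂ) (n m : ℕ) : kdbl y v (n, m) = kdbl v y (m, n) := by
  simp only [kdbl]
  rw [add_comm n m]
  congr 2; ring

lemma hasSum_inv_cos {w : ℂ} (hw : 0 < w.im) :
    HasSum (fun m : ℕ => 2 * (-1) ^ m * exp (I * (2 * m + 1) * w)) (1 / cos w) := by
  have h1 : ‖-exp (2 * I * w)‖ < 1 := by
    rw [norm_neg, norm_exp, Real.exp_lt_one_iff]
    simp; linarith
  have h := (hasSum_geometric_of_norm_lt_one h1).mul_left (2 * exp (I * w))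
  have e : 2 * exp (I * w) * (1 - -exp (2 * I * w))⁻¹ = 1 / cos w := by
    have h2 : cos w = (exp (w * I) + exp (-w * I)) / 2 := rfl
    have h3 : (1 - -exp (2 * I * w)) = exp (I * w) * (2 * cos w) := by
      have e1 : exp (w * I) = exp (I * w) := by rw [mul_comm]
      have e2 : exp (2 * I * w) = exp (I * w) * exp (I * w) := by
        rw [← Complex.exp_add]; congr 1; ring
      have e3 : exp (I * w) * exp (-w * I) = 1 := by
        rw [← Complex.exp_add, ← Complex.exp_zero]; congr 1; ring
      rw [h2, e1, e2]; linear_combination -e3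
    rw [h3, mul_inv]
    have h4 : exp (I * w) ≠ 0 := Complex.exp_ne_zero _
    rw [mul_inv]; field_simp
  rw [e] at h
  refine h.congr_fun fun m => ?_
  rw [neg_pow (exp (2 * I * w)), ← Complex.exp_nat_mul]
  rw [show 2 * exp (I * w) * ((-1) ^ m * exp (↑m * (2 * I * w))) =
    2 * (-1) ^ m * (exp (I * w) * exp (↑m * (2 * I * w))) by ring, ← Complex.exp_add]
  congr 2
  ring

lemma kser_eq_kdbl {y v : ℂ} (hy : |y.im| < 1 / 2) (hv : |v.im| < 1 / 2) :
    kser y v = ∑' q, kdbl y v q - ∑' q, kdbl (-y) (-v) q := by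
  have hpi := Real.pi_pos
  have s1 := kdbl_summable hy hv
  have s2 := kdbl_summable (y := -y) (v := -v) (by simpa using hy) (by simpa using hv)
  have hv' := abs_lt.1 hv
  have step : ∀ {y v : ℂ}, |y.im| < 1 / 2 → |v.im| < 1 / 2 → ∀ n : ℕ,
      HasSum (fun m => kdbl y v (n, m)) (kterm y v n) := by
    intro y v hy hv n
    have hv' := abs_lt.1 hv
    have hw : 0 < (Real.pi * (v + (((n : ℤ) : ℂ) + 1 / 2) * I) : ℂ).im := by
      rw [im_ofReal_mul]
      apply mul_pos hpi
      have : (0 : ℝ) ≤ n := Nat.cast_nonneg n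
      simp; linarith
    have := (hasSum_inv_cos hw).mul_left ((-1) ^ n * exp (Real.pi * I * (2 * n + 1) * y))
    have e1 : (fun m => kdbl y v (n, m)) = fun m : ℕ => (-1) ^ n * exp (Real.pi * I * (2 * n + 1) * y) *
        (2 * (-1) ^ m * exp (I * (2 * m + 1) * (Real.pi * (v + (((n : ℤ) : ℂ) + 1 / 2) * I)))) := by
      funext m
      simp only [kdbl]
      rw [pow_add, show (-1 : ℂ) ^ n * exp (Real.pi * I * (2 * n + 1) * y) *
        (2 * (-1) ^ m * exp (I * (2 * m + 1) * (Real.pi * (v + (((n : ℤ) : ℂ) + 1 / 2) * I)))) =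
        2 * ((-1) ^ n * (-1) ^ m) * (exp (Real.pi * I * (2 * n + 1) * y) *
          exp (I * (2 * m + 1) * (Real.pi * (v + (((n : ℤ) : ℂ) + 1 / 2) * I)))) by ring,
        ← Complex.exp_add]
      congr 2
      push_cast
      linear_combination -(Real.pi * (2 * m + 1) * (n + 1 / 2) : ℂ) * I_sq
    have e2 : kterm y v n = (-1) ^ n * exp (Real.pi * I * (2 * n + 1) * y) *
        (1 / cos (Real.pi * (v + (((n : ℤ) : ℂ) + 1 / 2) * I))) := by
      simp [kterm, div_eq_mul_inv]
    rw [e1, e2]; exact this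
  have t1 : HasSum (fun n : ℕ => kterm y v n) (∑' q, kdbl y v q) :=
    s1.hasSum.prod_fiberwise (step hy hv)
  have t2 : HasSum (fun n : ℕ => kterm y v (-((n : ℤ) + 1))) (-∑' q, kdbl (-y) (-v) q) := by
    have := (s2.hasSum.prod_fiberwise (step (y := -y) (v := -v) (by simpa using hy) (by simpa using hv))).neg
    refine this.congr_fun fun n => ?_
    unfold kterm
    have h1 : (Real.pi * (-v + (((n : ℤ) : ℂ) + 1 / 2) * I) : ℂ) =
        -(Real.pi * (v + (((-((n : ℤ) + 1) : ℤ) : ℂ) + 1 / 2) * I)) := by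
      push_cast; ring
    have h2 : (Real.pi * I * (2 * ((n : ℤ) : ℂ) + 1) * -y : ℂ) =
        (Real.pi * I * (2 * ((-((n : ℤ) + 1) : ℤ) : ℂ) + 1) * y) := by
      push_cast; ring
    have h3 : (-1 : ℂ) ^ (-((n : ℤ) + 1)) = -(-1) ^ (n : ℤ) := by
      rw [zpow_neg, ← inv_zpow, zpow_add₀ (by norm_num)]
      norm_num
    rw [h1, h2, h3, Complex.cos_neg]
    ring
  have := t1.of_nat_of_neg_add_one t2
  rw [sub_eq_add_neg]
  exact this.tsum_eq

lemma kser_symm {y v : ℂ} (hy : |y.im| < 1 / 2) (hv : |v.im| < 1 / 2) : kser y v = kser v y := by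
  rw [kser_eq_kdbl hy hv, kser_eq_kdbl hv hy]
  have h : ∀ y v : ℂ, ∑' q, kdbl y v q = ∑' q, kdbl v y q := by
    intro y v
    rw [← (Equiv.prodComm ℕ ℕ).tsum_eq]
    congr 1; funext q
    exact kdbl_swap y v q.2 q.1
  rw [h y v, h (-y) (-v)]

lemma HasResidue.translate_zpow {f : ℂ → ℂ} {l M z r : ℂ} (hf : HasResidue f z r) (hM : M ≠ 0)
    (h : ∀ w, f (w + l) = M * f w) (n : ℤ) : HasResidue f (z + n * l) (M ^ n * r) := by
  induction n using Int.induction_on with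
  | zero => simpa using hf
  | succ k ih =>
    have := ih.translate h
    rw [zpow_add₀ hM, zpow_one]
    convert this using 1 <;> (push_cast; ring)
  | pred k ih =>
    have h' : ∀ w, f (w + -l) = M⁻¹ * f w := by
      intro w
      have := h (w + -l)
      rw [neg_add_cancel_right] at this
      rw [this, inv_mul_cancel_left₀ hM]
    have := ih.translate h'
    rw [zpow_sub₀ hM, zpow_one]
    convert this using 1
    · push_cast; ring
    · field_simp

lemma HasResidue.all {f : ℂ → ℂ} {M N z r : ℂ} (hf : HasResidue f z r) (hM : M ≠ 0) (hN : N ≠ 0)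
    (h1 : ∀ w, f (w + 1) = M * f w) (hI : ∀ w, f (w + I) = N * f w) (m n : ℤ) :
    HasResidue f (z + m + n * I) (N ^ n * (M ^ m * r)) := by
  have := (hf.translate_zpow hM h1 m).translate_zpow hN hI n
  simpa using this

lemma isPoleK_iff {v : ℂ} : IsPoleK v ↔ ∃ m n : ℤ, v = (1 - I) / 2 + m + n * I := by
  constructor
  · rintro ⟨m, n, rfl⟩
    exact ⟨m, n + 1, by push_cast; ring⟩
  · rintro ⟨m, n, rfl⟩
    exact ⟨m, n - 1, by push_cast; ring⟩

lemma residue_zero_everywhere {d : ℂ → ℂ} {M N : ℂ} (hd : ∀ v, ¬ IsPoleK v → AnalyticAt ℂ d v)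
    (hr : HasResidue d ((1 - I) / 2) 0) (h1 : ∀ w, d (w + 1) = M * d w)
    (hI : ∀ w, d (w + I) = N * d w) (hM : ‖M‖ = 1) (hN : ‖N‖ = 1) (z : ℂ) : HasResidue d z 0 := by
  by_cases hz : IsPoleK z
  · obtain ⟨m, n, rfl⟩ := isPoleK_iff.1 hz
    have := hr.all (norm_ne_zero_iff.1 (by rw [hM]; exact one_ne_zero))
      (norm_ne_zero_iff.1 (by rw [hN]; exact one_ne_zero)) h1 hI m n
    simpa using this
  · exact (hd z hz).hasResidue

/-- A quasi-periodic function with at most simple poles, all residues vanishing and a nontrivial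
multiplier, is zero. -/
theorem ell_zero {d : ℂ → ℂ} {M N : ℂ} (hd : ∀ v, ¬ IsPoleK v → AnalyticAt ℂ d v)
    (hr : HasResidue d ((1 - I) / 2) 0) (h1 : ∀ w, d (w + 1) = M * d w)
    (hI : ∀ w, d (w + I) = N * d w) (hM : ‖M‖ = 1) (hN : ‖N‖ = 1) (hM1 : M ≠ 1) :
    ∀ v, ¬ IsPoleK v → d v = 0 := by
  intro v hv
  refine eq_zero_of_multiplier (residue_zero_everywhere hd hr h1 hI hM hN) ?_ ?_ hM1 h1 v
    (hd v hv).continuousAt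
  · intro z; rw [h1, norm_mul, hM, one_mul]
  · intro z; rw [hI, norm_mul, hN, one_mul]

/-- Membership in `ℤ[i]`. -/
def IsLat (v : ℂ) : Prop := ∃ m n : ℤ, v = m + n * I

lemma IsLat.neg {v : ℂ} : IsLat v → IsLat (-v) := by
  rintro ⟨m, n, rfl⟩; exact ⟨-m, -n, by push_cast; ring⟩

lemma IsLat.add {v w : ℂ} : IsLat v → IsLat w → IsLat (v + w) := by
  rintro ⟨m, n, rfl⟩ ⟨m', n', rfl⟩; exact ⟨m + m', n + n', by push_cast; ring⟩

lemma IsLat.sub {v w : ℂ} (h : IsLat v) (h' : IsLat w) : IsLat (v - w) := by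
  rw [sub_eq_add_neg]; exact h.add h'.neg

lemma IsLat.mul {v w : ℂ} : IsLat v → IsLat w → IsLat (v * w) := by
  rintro ⟨m, n, rfl⟩ ⟨m', n', rfl⟩
  exact ⟨m * m' - n * n', m * n' + n * m', by push_cast; linear_combination (n * n' : ℂ) * I_sq⟩

lemma isLat_int (n : ℤ) : IsLat n := ⟨n, 0, by simp⟩
lemma isLat_zero : IsLat 0 := ⟨0, 0, by simp⟩
lemma isLat_one : IsLat 1 := ⟨1, 0, by simp⟩
lemma isLat_I : IsLat I := ⟨0, 1, by simp⟩

lemma isPoleK_iff_isLat {v : ℂ} : IsPoleK v ↔ IsLat (v - (1 + I) / 2) := by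
  constructor
  · rintro ⟨m, n, rfl⟩; exact ⟨m, n, by ring⟩
  · rintro ⟨m, n, h⟩; exact ⟨m, n, by linear_combination h⟩

lemma IsPoleK.add_lat {v l : ℂ} (h : IsPoleK v) (hl : IsLat l) : IsPoleK (v + l) := by
  rw [isPoleK_iff_isLat] at *
  have := h.add hl
  rwa [sub_add_eq_add_sub] at this

lemma isPoleK_add_lat_iff {v l : ℂ} (hl : IsLat l) : IsPoleK (v + l) ↔ IsPoleK v :=
  ⟨fun h => by simpa using h.add_lat hl.neg, fun h => h.add_lat hl⟩

lemma isPoleK_neg_iff {v : ℂ} : IsPoleK (-v) ↔ IsPoleK v := by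
  have : ∀ {v : ℂ}, IsPoleK v → IsPoleK (-v) := by
    rintro v ⟨m, n, rfl⟩; exact ⟨-m - 1, -n - 1, by push_cast; ring⟩
  exact ⟨fun h => by simpa using this h, this⟩

lemma isPoleK_I_mul_iff {v : ℂ} : IsPoleK (I * v) ↔ IsPoleK v := by
  have : ∀ {v : ℂ}, IsPoleK v → IsPoleK (I * v) := by
    rintro v ⟨m, n, rfl⟩
    exact ⟨-n - 1, m, by push_cast; linear_combination (1 / 2 + n : ℂ) * I_sq⟩
  refine ⟨fun h => ?_, this⟩
  have h2 := this (this (this h))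
  have : I * (I * (I * (I * v))) = v := by
    linear_combination (v * (I ^ 2 - 1)) * I_sq
  rwa [this] at h2

lemma not_int_half (k : ℤ) : (k : ℝ) ≠ 1 / 2 := by
  intro h
  have : (2 * k : ℤ) = 1 := by
    have : (2 * k : ℝ) = 1 := by linarith
    exact_mod_cast this
  omega

lemma not_isPoleK_of_isLat {v : ℂ} (h : IsLat v) : ¬ IsPoleK v := by
  intro h'
  rw [isPoleK_iff_isLat] at h'
  obtain ⟨m, n, e⟩ := h.sub h'
  have := congrArg Complex.re e
  simp at this
  exact not_int_half m (by rw [← this]; norm_num)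

lemma not_isPoleK_zero : ¬ IsPoleK 0 := not_isPoleK_of_isLat isLat_zero

lemma not_isPoleK_half : ¬ IsPoleK (1 / 2) := by
  rintro ⟨m, n, e⟩
  have := congrArg Complex.im e
  simp at this
  apply not_int_half (-n)
  push_cast; linarith

lemma not_isLat_half : ¬ IsLat (1 / 2) := by
  rintro ⟨m, n, e⟩
  have := congrArg Complex.re e
  simp at this
  exact not_int_half m (by rw [← this]; norm_num)

lemma isPoleK_add_delta_iff {v : ℂ} : IsPoleK (v + (1 + I) / 2) ↔ IsLat v := by
  rw [isPoleK_iff_isLat]; simp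

lemma isLat_add_delta_iff {v : ℂ} : IsLat (v + (1 + I) / 2) ↔ IsPoleK v := by
  rw [isPoleK_iff_isLat]
  have : v + (1 + I) / 2 = v - (1 + I) / 2 + (1 + I) := by ring
  rw [this]
  have h1 : IsLat (1 + I) := isLat_one.add isLat_I
  exact ⟨fun h => by simpa using h.sub h1, fun h => h.add h1⟩

lemma countable_isLat : {v | IsLat v}.Countable := by
  refine (Set.countable_range (fun q : ℤ × ℤ => (q.1 + q.2 * I : ℂ))).mono ?_
  rintro v ⟨m, n, rfl⟩
  exact ⟨(m, n), rfl⟩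

lemma countable_isPoleK : {v | IsPoleK v}.Countable := by
  refine (Set.countable_range (fun q : ℤ × ℤ => ((1 + I) / 2 + q.1 + q.2 * I : ℂ))).mono ?_
  rintro v ⟨m, n, rfl⟩
  exact ⟨(m, n), rfl⟩

/-- Identity theorem on the complement of a countable set. -/
lemma identity_countable {f : ℂ → ℂ} {A : Set ℂ} (hA : A.Countable)
    (hf : ∀ v ∉ A, AnalyticAt ℂ f v) {z : ℂ} (hz : z ∉ A) (h : ∀ᶠ w in 𝓝 z, f w = 0) :
    ∀ v ∉ A, f v = 0 := by
  have hconn : IsPreconnected Aᶜ :=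
    (hA.isPathConnected_compl_of_one_lt_rank (by simp)).isConnected.isPreconnected
  have : AnalyticOnNhd ℂ f Aᶜ := fun v hv => hf v hv
  intro v hv
  exact this.eqOn_zero_of_preconnected_of_eventuallyEq_zero hconn hz h hv

/-! ### The lemniscatic sine -/

lemma k0_add_one (v : ℂ) : kser 0 (v + 1) = -1 * kser 0 v := by rw [kser_add_one]; ring
lemma k0_add_I (v : ℂ) : kser 0 (v + I) = -1 * kser 0 v := by rw [kser_add_I]; simp
lemma k0_neg (v : ℂ) : kser 0 (-v) = -kser 0 v := by simpa using kser_neg_neg 0 v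
lemma k0_conj (v : ℂ) : starRingEnd ℂ (kser 0 v) = -kser 0 (starRingEnd ℂ v) := by
  simpa using kser_conj 0 v
lemma k0_analyticAt {v : ℂ} (hv : ¬ IsPoleK v) : AnalyticAt ℂ (kser 0) v :=
  kser_analyticAt (by simp) hv
lemma k0_hasResidue : HasResidue (kser 0) ((1 - I) / 2) (-1 / Real.pi) := by
  simpa using kser_hasResidue (y := 0) (by simp)

lemma k0_I_mul {v : ℂ} (hv : ¬ IsPoleK v) : kser 0 (I * v) = I * kser 0 v := by
  have hI : I ≠ 0 := I_ne_zero
  have hr : HasResidue (fun v => kser 0 (I * v) + -I * kser 0 v) ((1 - I) / 2) 0 := by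
    have h1 : HasResidue (kser 0) (I * ((1 - I) / 2) + 0) (-1 * (-1 / Real.pi)) := by
      have := k0_hasResidue.translate k0_add_I
      convert this using 1
      linear_combination (-1 / 2 : ℂ) * I_sq
    have h2 := (h1.comp_affine hI).add (k0_hasResidue.const_mul (-I))
    simp only [add_zero] at h2
    convert h2 using 1
    have hpi : (Real.pi : ℂ) ≠ 0 := by exact_mod_cast Real.pi_ne_zero
    field_simp
    linear_combination (-1 : ℂ) * I_sq
  have := ell_zero (d := fun v => kser 0 (I * v) + -I * kser 0 v) (M := -1) (N := -1) ?_ hr ?_ ?_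
    (by simp) (by simp) (by norm_num) v hv
  · linear_combination this
  · intro w hw
    apply AnalyticAt.add
    · exact (k0_analyticAt (isPoleK_I_mul_iff.not.2 hw)).comp_of_eq (by fun_prop) rfl
    · exact analyticAt_const.mul (k0_analyticAt hw)
  · intro w
    rw [mul_add, mul_one, k0_add_I, k0_add_one]; ring
  · intro w
    have : I * (w + I) + 1 = I * w := by linear_combination I_sq
    have h2 := k0_add_one (I * (w + I))
    rw [this] at h2
    rw [k0_add_I, h2]; ring

lemma k0_lat {v : ℂ} (h : IsLat v) : kser 0 v = 0 := by
  have h0 : kser 0 0 = 0 := by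
    have := k0_neg 0
    rw [neg_zero] at this
    linear_combination (1 / 2 : ℂ) * this
  obtain ⟨m, n, rfl⟩ := h
  have hz : ∀ {l : ℂ}, (∀ w, kser 0 (w + l) = -1 * kser 0 w) → ∀ (z : ℂ), kser 0 z = 0 →
      ∀ n : ℤ, kser 0 (z + n * l) = 0 := by
    intro l hl z hz n
    induction n using Int.induction_on with
    | zero => simpa using hz
    | succ k ih =>
      have : z + ((k : ℤ) + 1 : ℤ) * l = z + (k : ℤ) * l + l := by push_cast; ring
      rw [this, hl, ih]; simp
    | pred k ih =>
      have := hl (z + (-(k : ℤ) - 1 : ℤ) * l)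
      have e : z + (-(k : ℤ) - 1 : ℤ) * l + l = z + (-(k : ℤ) : ℤ) * l := by push_cast; ring
      rw [e, ih] at this
      linear_combination this
  have := hz k0_add_I m (by simpa using hz k0_add_one 0 h0 m) n
  exact this

lemma k0_mul_delta : ∃ c : ℂ, ∀ v, ¬ IsPoleK v → ¬ IsLat v →
    kser 0 v * kser 0 (v + (1 + I) / 2) = c := by
  set d : ℂ → ℂ := fun v => kser 0 v * kser 0 (v + (1 + I) / 2) with hd
  have hana : ∀ v, ¬ IsPoleK v → ¬ IsLat v → AnalyticAt ℂ d v := by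
    intro v h1 h2
    apply (k0_analyticAt h1).mul
    exact (k0_analyticAt (isPoleK_add_delta_iff.not.2 h2)).comp_of_eq (by fun_prop) rfl
  have hres : ∀ z, HasResidue d z 0 := by
    intro z
    by_cases h1 : IsPoleK z
    · have hl := isLat_add_delta_iff.2 h1
      obtain ⟨m, n, e⟩ := isPoleK_iff.1 h1
      have h2 := k0_hasResidue.all (by norm_num) (by norm_num) k0_add_one k0_add_I m n
      rw [← e] at h2
      have hA : AnalyticAt ℂ (fun w => kser 0 (w + (1 + I) / 2)) z :=
        (k0_analyticAt (not_isPoleK_of_isLat hl)).comp_of_eq (by fun_prop) rfl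
      have := h2.analytic_mul hA
      rw [k0_lat hl, zero_mul] at this
      exact this.congr (Eventually.of_forall fun w => by simp only [hd]; ring)
    by_cases h2 : IsLat z
    · have hp := isPoleK_add_delta_iff.2 h2
      obtain ⟨m, n, e⟩ := isPoleK_iff.1 hp
      have h3 := k0_hasResidue.all (by norm_num) (by norm_num) k0_add_one k0_add_I m n
      rw [← e] at h3
      have := h3.comp_add.analytic_mul (k0_analyticAt h1)
      rw [k0_lat h2, zero_mul] at this
      exact this
    · exact (hana z h1 h2).hasResidue
  obtain ⟨c, hc⟩ := eq_const_of_norm_periodic hres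
    (fun z => by
      simp only [hd]
      rw [add_right_comm, k0_add_one, k0_add_one]; simp)
    (fun z => by
      simp only [hd]
      rw [add_right_comm, k0_add_I, k0_add_I]; simp)
  exact ⟨c, fun v h1 h2 => hc v (hana v h1 h2).continuousAt⟩

lemma k0_ne_zero {v : ℂ} (hv : ¬ IsPoleK v) (hl : ¬ IsLat v) : kser 0 v ≠ 0 := by
  obtain ⟨c, hc⟩ := k0_mul_delta
  intro h0
  have c0 : c = 0 := by rw [← hc v hv hl, h0, zero_mul]
  rw [c0] at hc
  have hpi : (Real.pi : ℂ) ≠ 0 := by exact_mod_cast Real.pi_ne_zero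
  have hp : ∀ᶠ w in 𝓝[≠] ((1 - I) / 2 : ℂ), kser 0 w ≠ 0 := by
    have h1 := k0_hasResidue.2.eventually_ne (show (-1 / Real.pi : ℂ) ≠ 0 by simp [hpi])
    filter_upwards [h1] with w hw h
    rw [h, mul_zero] at hw; exact hw rfl
  have hsep : ∀ᶠ w in 𝓝[≠] ((1 - I) / 2 : ℂ), ¬ IsPoleK w ∧ ¬ IsLat w := by
    have hball : Metric.ball ((1 - I) / 2 : ℂ) (1 / 2) ∈ 𝓝 ((1 - I) / 2 : ℂ) :=
      Metric.ball_mem_nhds _ (by norm_num)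
    filter_upwards [mem_nhdsWithin_of_mem_nhds hball, self_mem_nhdsWithin] with w hw hne
    rw [Metric.mem_ball, dist_eq_norm] at hw
    have hre := (abs_re_le_norm _).trans_lt hw
    have him := (abs_im_le_norm _).trans_lt hw
    constructor
    · intro h
      obtain ⟨m, n, e⟩ := isPoleK_iff.1 h
      rw [e] at hre him
      simp at hre him
      have hm : m = 0 := by
        rw [abs_lt] at hre
        have h1 : (-1 : ℝ) < m := by linarith [hre.1]
        have h2 : (m : ℝ) < 1 := by linarith [hre.2]
        have h1' : -1 < m := by exact_mod_cast h1
        have h2' : m < 1 := by exact_mod_cast h2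
        omega
      have hn : n = 0 := by
        rw [abs_lt] at him
        have h1 : (-1 : ℝ) < n := by linarith [him.1]
        have h2 : (n : ℝ) < 1 := by linarith [him.2]
        have h1' : -1 < n := by exact_mod_cast h1
        have h2' : n < 1 := by exact_mod_cast h2
        omega
      apply hne
      rw [e, hm, hn]; simp
    · rintro ⟨m, n, e⟩
      rw [e] at hre
      simp at hre
      rw [abs_lt] at hre
      have h1 : (0 : ℝ) < m := by linarith [hre.1]
      have h2 : (m : ℝ) < 1 := by linarith [hre.2]
      have h1' : 0 < m := by exact_mod_cast h1
      have h2' : m < 1 := by exact_mod_cast h2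
      omega
  have hz : ∀ᶠ w in 𝓝[≠] ((1 - I) / 2 : ℂ), kser 0 (w + (1 + I) / 2) = 0 := by
    filter_upwards [hp, hsep] with w h1 h2
    exact (mul_eq_zero.1 (hc w h2.1 h2.2)).resolve_left h1
  have h1 : ((1 - I) / 2 + (1 + I) / 2 : ℂ) = 1 := by ring
  have hA : AnalyticAt ℂ (fun w => kser 0 (w + (1 + I) / 2)) ((1 - I) / 2) := by
    refine (k0_analyticAt ?_).comp_of_eq (f := fun w : ℂ => w + (1 + I) / 2) (y := 1) (by fun_prop) h1
    exact not_isPoleK_of_isLat isLat_one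
  have hz' : ∀ᶠ w in 𝓝 ((1 - I) / 2 : ℂ), kser 0 (w + (1 + I) / 2) = 0 :=
    hA.frequently_zero_iff_eventually_zero.1 hz.frequently
  have hz1 : ∀ᶠ w in 𝓝 (1 : ℂ), kser 0 w = 0 := by
    have ht : Tendsto (fun w : ℂ => w - (1 + I) / 2) (𝓝 1) (𝓝 ((1 - I) / 2)) := by
      have : Continuous (fun w : ℂ => w - (1 + I) / 2) := by fun_prop
      have := this.tendsto 1
      convert this using 2; ring
    filter_upwards [ht.eventually hz'] with w hw
    simpa using hw
  have hall := identity_countable countable_isPoleK (f := kser 0) (fun v hv => k0_analyticAt hv)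
    (not_isPoleK_of_isLat isLat_one) hz1
  obtain ⟨w, h1, h2⟩ := (hp.and hsep).exists
  exact h1 (hall w h2.1)

/-- The lemniscatic sine, normalised to have period lattice generated by `2`, `1 + i`. -/
def sl (v : ℂ) : ℂ := kser 0 v / kser 0 (1 / 2)

lemma k0_half_ne : kser 0 (1 / 2) ≠ 0 := k0_ne_zero not_isPoleK_half not_isLat_half

lemma sl_half : sl (1 / 2) = 1 := div_self k0_half_ne
lemma sl_add_one (v : ℂ) : sl (v + 1) = -sl v := by rw [sl, k0_add_one, sl]; ring
lemma sl_add_I (v : ℂ) : sl (v + I) = -sl v := by rw [sl, k0_add_I, sl]; ring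
lemma sl_neg (v : ℂ) : sl (-v) = -sl v := by rw [sl, k0_neg, sl]; ring
lemma sl_I_mul {v : ℂ} (hv : ¬ IsPoleK v) : sl (I * v) = I * sl v := by
  rw [sl, k0_I_mul hv, sl]; ring
lemma sl_conj (v : ℂ) : starRingEnd ℂ (sl v) = sl (starRingEnd ℂ v) := by
  have : starRingEnd ℂ (kser 0 (1 / 2)) = -kser 0 (1 / 2) := by
    rw [k0_conj]; simp [map_ofNat]
  rw [sl, map_div₀, k0_conj, this, sl, neg_div_neg_eq]
lemma sl_analyticAt {v : ℂ} (hv : ¬ IsPoleK v) : AnalyticAt ℂ sl v :=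
  (k0_analyticAt hv).div analyticAt_const k0_half_ne
lemma sl_lat {v : ℂ} (h : IsLat v) : sl v = 0 := by rw [sl, k0_lat h, zero_div]
lemma sl_zero : sl 0 = 0 := sl_lat isLat_zero
lemma sl_ne_zero {v : ℂ} (hv : ¬ IsPoleK v) (hl : ¬ IsLat v) : sl v ≠ 0 :=
  div_ne_zero (k0_ne_zero hv hl) k0_half_ne

lemma sl_hasResidue : HasResidue sl ((1 - I) / 2) (-1 / Real.pi / kser 0 (1 / 2)) := by
  have := k0_hasResidue.const_mul (kser 0 (1 / 2))⁻¹
  convert this using 1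
  · funext w; rw [sl]; ring
  · ring

lemma sl_mul_delta {v : ℂ} (hv : ¬ IsPoleK v) (hl : ¬ IsLat v) :
    sl v * sl (v + (1 + I) / 2) = -I := by
  obtain ⟨c, hc⟩ := k0_mul_delta
  have h1 := hc v hv hl
  have h2 := hc (1 / 2) not_isPoleK_half not_isLat_half
  have e : (1 / 2 + (1 + I) / 2 : ℂ) = I * (1 / 2) + 1 := by ring
  rw [e, k0_add_one, k0_I_mul not_isPoleK_half] at h2
  rw [sl, sl, div_mul_div_comm, h1, ← h2, div_eq_iff (mul_ne_zero k0_half_ne k0_half_ne)]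
  ring

lemma sl_delta_eq {v : ℂ} (hv : ¬ IsPoleK v) (hl : ¬ IsLat v) :
    sl (v + (1 + I) / 2) = -I / sl v := by
  rw [← sl_mul_delta hv hl, mul_div_cancel_left₀ _ (sl_ne_zero hv hl)]

/-- The Gaussian period pair. -/
def gaussPair : PeriodPair where
  ω₁ := 1
  ω₂ := I
  indep := by
    rw [LinearIndependent.pair_iff]
    intro s t h
    have h1 := congrArg Complex.re h
    have h2 := congrArg Complex.im h
    simp at h1 h2
    exact ⟨h1, h2⟩

lemma mem_gauss {v : ℂ} : v ∈ gaussPair.lattice ↔ IsLat v := by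
  rw [PeriodPair.mem_lattice]
  simp only [gaussPair, mul_one, IsLat]
  exact ⟨fun ⟨m, n, h⟩ => ⟨m, n, h.symm⟩, fun ⟨m, n, h⟩ => ⟨m, n, h.symm⟩⟩

lemma isClosed_isLat : IsClosed {v | IsLat v} := by
  have := gaussPair.isClosed_lattice
  convert this using 1
  ext v
  exact mem_gauss.symm

lemma isClosed_isPoleK : IsClosed {v | IsPoleK v} := by
  have : {v | IsPoleK v} = (fun v => v + (1 + I) / 2) ⁻¹' {v | IsLat v} := by
    ext v; exact isLat_add_delta_iff.symm
  rw [this]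
  exact isClosed_isLat.preimage (by fun_prop)

lemma eventually_not_isLat {v : ℂ} (h : ¬ IsLat v) : ∀ᶠ w in 𝓝 v, ¬ IsLat w :=
  isClosed_isLat.isOpen_compl.mem_nhds h

lemma eventually_not_isPoleK {v : ℂ} (h : ¬ IsPoleK v) : ∀ᶠ w in 𝓝 v, ¬ IsPoleK w :=
  isClosed_isPoleK.isOpen_compl.mem_nhds h

lemma eventually_not_isLat_punctured (v : ℂ) : ∀ᶠ w in 𝓝[≠] v, ¬ IsLat w := by
  have := gaussPair.compl_lattice_sdiff_singleton_mem_nhds v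
  filter_upwards [mem_nhdsWithin_of_mem_nhds this, self_mem_nhdsWithin] with w hw hne hl
  exact hw ⟨mem_gauss.2 hl, hne⟩

open PeriodPair in
lemma wpL_I_mul (v : ℂ) : ℘[gaussPair] (I * v) = -℘[gaussPair] v := by
  let e : gaussPair.lattice ≃ gaussPair.lattice :=
    { toFun := fun l => ⟨I * l, mem_gauss.2 (isLat_I.mul (mem_gauss.1 l.2))⟩
      invFun := fun l => ⟨-(I * l), mem_gauss.2 (isLat_I.mul (mem_gauss.1 l.2)).neg⟩
      left_inv := fun l => by ext; simp [← mul_assoc]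
      right_inv := fun l => by ext; simp [← mul_assoc] }
  unfold PeriodPair.weierstrassP
  rw [← e.tsum_eq, ← tsum_neg]
  congr 1; funext l
  change 1 / (I * v - I * l) ^ 2 - 1 / (I * l : ℂ) ^ 2 = _
  rw [← mul_sub, mul_pow, mul_pow, I_sq, neg_one_mul, neg_one_mul, div_neg, div_neg]
  ring

/-- The derivative of `sl` at the origin. -/
def slL : ℂ := deriv sl 0

lemma sl_hasDerivAt_zero : HasDerivAt sl slL 0 :=
  (sl_analyticAt not_isPoleK_zero).differentiableAt.hasDerivAt

lemma tendsto_sl_div : Tendsto (fun w => sl w / w) (𝓝[≠] 0) (𝓝 slL) := by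
  have := hasDerivAt_iff_tendsto_slope.1 sl_hasDerivAt_zero
  refine this.congr fun w => ?_
  simp [slope, sl_zero]; ring

lemma sl_residue_delta : HasResidue (fun w => sl (w + (1 + I) / 2)) 0
    (1 / Real.pi / kser 0 (1 / 2)) := by
  have h1 := sl_hasResidue.translate (l := I) (M := -1) (fun w => by rw [sl_add_I]; ring)
  have e : ((1 - I) / 2 + I : ℂ) = 0 + (1 + I) / 2 := by ring
  rw [e] at h1
  convert h1.comp_add using 1
  ring

lemma slL_ne_zero : slL ≠ 0 := by
  intro h
  have h1 := sl_residue_delta.2.mul tendsto_sl_div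
  rw [h, mul_zero] at h1
  have h2 : ∀ᶠ w in 𝓝[≠] (0 : ℂ), (w - 0) * sl (w + (1 + I) / 2) * (sl w / w) = -I := by
    filter_upwards [self_mem_nhdsWithin, eventually_not_isLat_punctured 0,
      mem_nhdsWithin_of_mem_nhds (eventually_not_isPoleK not_isPoleK_zero)] with w h1 h2 h3
    rw [← sl_mul_delta h3 h2]
    have : w ≠ 0 := h1
    field_simp; ring
  have h3 := tendsto_nhds_unique (h1.congr' h2) tendsto_const_nhds
  exact I_ne_zero (by simpa using h3.symm)

lemma even_hasDerivAt_zero {g : ℂ → ℂ} {a : ℂ} (hg : HasDerivAt g a 0)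
    (he : ∀ᶠ w in 𝓝 0, g (-w) = g w) : a = 0 := by
  have h1 : HasDerivAt (fun w => g (-w)) (a * -1) 0 := by
    have h2 : HasDerivAt g a (-0) := by simpa using hg
    exact h2.comp 0 (hasDerivAt_neg 0)
  have h3 := (h1.congr_of_eventuallyEq (f₁ := g) (he.mono fun w hw => hw.symm)).unique hg
  linear_combination (-1 / 2 : ℂ) * h3

open PeriodPair in
lemma wpL_eq {v : ℂ} (hl : ¬ IsLat v) :
    ℘[gaussPair] v = -slL ^ 2 * sl (v + (1 + I) / 2) ^ 2 := by
  set d : ℂ → ℂ := fun v => ℘[gaussPair] v + slL ^ 2 * sl (v + (1 + I) / 2) ^ 2 with hd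
  have hana : ∀ v, ¬ IsLat v → AnalyticAt ℂ d v := by
    intro v hv
    apply AnalyticAt.add
    · exact gaussPair.analyticOnNhd_weierstrassP v (by simpa [mem_gauss] using hv)
    · have : AnalyticAt ℂ (fun w => sl (w + (1 + I) / 2)) v :=
        (sl_analyticAt (isPoleK_add_delta_iff.not.2 hv)).comp_of_eq (by fun_prop) rfl
      exact analyticAt_const.mul (this.pow 2)
  have hper1 : ∀ v, d (v + 1) = 1 * d v := by
    intro v
    have := gaussPair.weierstrassP_add_coe v ⟨1, mem_gauss.2 isLat_one⟩
    simp only [hd]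
    rw [add_right_comm, sl_add_one]
    change ℘[gaussPair] (v + 1) = _ at this
    rw [this]; ring
  have hperI : ∀ v, d (v + I) = 1 * d v := by
    intro v
    have := gaussPair.weierstrassP_add_coe v ⟨I, mem_gauss.2 isLat_I⟩
    simp only [hd]
    rw [add_right_comm, sl_add_I]
    change ℘[gaussPair] (v + I) = _ at this
    rw [this]; ring
  have hres0 : HasResidue d 0 0 := by
    have hsl0 := sl_analyticAt not_isPoleK_zero
    set h := dslope sl 0 with hh
    have hhA : AnalyticAt ℂ h 0 := by
      obtain ⟨q, hq⟩ := hsl0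
      exact ⟨_, hq.has_fpower_series_dslope_fslope⟩
    have hh0 : h 0 = slL := dslope_same _ _
    have hhne : ∀ w, w ≠ 0 → h w = sl w / w := by
      intro w hw
      rw [hh, dslope_of_ne _ hw]; simp [slope, sl_zero]; ring
    set g : ℂ → ℂ := fun w => 1 - slL ^ 2 / h w ^ 2 with hg
    have hgA : AnalyticAt ℂ g 0 := by
      apply AnalyticAt.sub analyticAt_const
      exact analyticAt_const.div (hhA.pow 2) (by rw [hh0]; exact pow_ne_zero 2 slL_ne_zero)
    have hg0 : g 0 = 0 := by
      simp only [hg, hh0]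
      rw [div_self (pow_ne_zero 2 slL_ne_zero), sub_self]
    have hgd : deriv g 0 = 0 := by
      apply even_hasDerivAt_zero hgA.differentiableAt.hasDerivAt
      apply Eventually.of_forall
      intro w
      by_cases hw : w = 0
      · rw [hw, neg_zero]
      · simp only [hg]
        rw [hhne w hw, hhne (-w) (neg_ne_zero.2 hw), sl_neg, neg_div_neg_eq]
    have hgr : HasResidue (fun w => (w ^ 2)⁻¹ * g w) 0 0 := by
      constructor
      · have : MeromorphicAt (fun w : ℂ => (w ^ 2)⁻¹) 0 := by fun_prop
        exact this.mul hgA.meromorphicAt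
      · have := hasDerivAt_iff_tendsto_slope.1 hgA.differentiableAt.hasDerivAt
        rw [hgd] at this
        refine this.congr' ?_
        filter_upwards [self_mem_nhdsWithin] with w hw
        have : w ≠ 0 := hw
        simp only [slope, hg0, vsub_eq_sub, sub_zero, smul_eq_mul]
        field_simp
    have hex : HasResidue (gaussPair.weierstrassPExcept 0) 0 0 :=
      (gaussPair.analyticAt_weierstrassPExcept 0).hasResidue
    have := hex.add hgr
    rw [add_zero] at this
    refine this.congr ?_
    filter_upwards [self_mem_nhdsWithin, eventually_not_isLat_punctured 0,
      mem_nhdsWithin_of_mem_nhds (eventually_not_isPoleK not_isPoleK_zero)] with w h1 h2 h3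
    have hw : w ≠ 0 := h1
    have h4 := gaussPair.weierstrassPExcept_def 0 w
    simp only [Submodule.coe_zero] at h4
    simp only [hd]
    rw [h4, sl_delta_eq h3 h2, hg]
    simp only
    rw [hhne w hw]
    have := sl_ne_zero h3 h2
    field_simp
    rw [I_sq]; simp; ring
  have hres : ∀ z, HasResidue d z 0 := by
    intro z
    by_cases hz : IsLat z
    · obtain ⟨m, n, rfl⟩ := hz
      simpa using hres0.all one_ne_zero one_ne_zero hper1 hperI m n
    · exact (hana z hz).hasResidue
  obtain ⟨c, hc⟩ := eq_const_of_norm_periodic hres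
    (fun z => by rw [hper1, one_mul]) (fun z => by rw [hperI, one_mul])
  have h1 := hc (1 / 2) (hana _ not_isLat_half).continuousAt
  have hI : ¬ IsLat (I * (1 / 2)) := by
    intro h
    have := isLat_I.mul h
    rw [← mul_assoc, I_mul_I] at this
    exact not_isLat_half (by simpa using this.neg)
  have h2 := hc (I * (1 / 2)) (hana _ hI).continuousAt
  simp only [hd] at h1 h2
  have e1 : (1 / 2 + (1 + I) / 2 : ℂ) = I * (1 / 2) + 1 := by ring
  have e2 : (I * (1 / 2) + (1 + I) / 2 : ℂ) = 1 / 2 + I := by ring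
  rw [e1, sl_add_one, sl_I_mul not_isPoleK_half, sl_half] at h1
  rw [e2, sl_add_I, sl_half, wpL_I_mul] at h2
  have h1' : ℘[gaussPair] (1 / 2) = c + slL ^ 2 := by linear_combination h1 - slL ^ 2 * I_sq
  have c0 : c = 0 := by linear_combination (-1 / 2 : ℂ) * h1' - (1 / 2 : ℂ) * h2
  have := hc v (hana v hl).continuousAt
  simp only [hd] at this
  rw [c0] at this
  linear_combination this

lemma sl_deriv_half : deriv sl (1 / 2) = 0 := by
  have h := (sl_analyticAt not_isPoleK_half).differentiableAt.hasDerivAt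
  have h1 : HasDerivAt (fun w => sl (1 - w)) (deriv sl (1 / 2) * -1) (1 / 2) := by
    have h2 : HasDerivAt sl (deriv sl (1 / 2)) (1 - 1 / 2) := by
      have : (1 - 1 / 2 : ℂ) = 1 / 2 := by norm_num
      rw [this]; exact h
    exact h2.comp (1 / 2) ((hasDerivAt_id _).const_sub 1)
  have e : (fun w => sl (1 - w)) = sl := by
    funext w
    rw [sub_eq_add_neg, add_comm, sl_add_one, sl_neg, neg_neg]
  rw [e] at h1
  have := h1.unique h
  linear_combination (-1 / 2 : ℂ) * this

lemma sl_ode {v : ℂ} (hv : ¬ IsPoleK v) : deriv sl v ^ 2 = slL ^ 2 * (1 - sl v ^ 4) := by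
  have key : ∀ w, ¬ IsPoleK w → 4 * slL ^ 4 * sl w ^ 2 * deriv sl w ^ 2 =
      -4 * slL ^ 6 * sl w ^ 6 + gaussPair.g₂ * slL ^ 2 * sl w ^ 2 - gaussPair.g₃ := by
    intro w hw
    set z := w - (1 + I) / 2 with hz
    have hwz : w = z + (1 + I) / 2 := by rw [hz]; ring
    have hzl : ¬ IsLat z := by
      rw [hwz] at hw; exact isPoleK_add_delta_iff.not.1 hw
    have h1 := gaussPair.derivWeierstrassP_sq z (by rwa [mem_gauss])
    have h2 : HasDerivAt (gaussPair.weierstrassP) (-slL ^ 2 * (2 * sl w * deriv sl w)) z := by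
      have h3 : HasDerivAt (fun z => sl (z + (1 + I) / 2)) (deriv sl w) z := by
        have := (sl_analyticAt hw).differentiableAt.hasDerivAt
        rw [hwz] at this ⊢
        exact this.comp_add_const z ((1 + I) / 2)
      have h4 := (h3.pow 2).const_mul (-slL ^ 2)
      have h5 : (fun z => -slL ^ 2 * sl (z + (1 + I) / 2) ^ 2) =ᶠ[𝓝 z] gaussPair.weierstrassP := by
        filter_upwards [eventually_not_isLat hzl] with y hy
        exact (wpL_eq hy).symm
      have h6 := h4.congr_of_eventuallyEq h5.symm
      rw [← hwz] at h6
      simpa using h6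
    rw [← gaussPair.deriv_weierstrassP, h2.deriv, wpL_eq hzl, ← hwz] at h1
    linear_combination h1
  have g3 : gaussPair.g₃ = 0 := by
    have := key 0 not_isPoleK_zero
    rw [sl_zero] at this
    linear_combination this
  have g2 : gaussPair.g₂ = 4 * slL ^ 4 := by
    have := key (1 / 2) not_isPoleK_half
    rw [sl_half, sl_deriv_half, g3] at this
    apply mul_right_cancel₀ (pow_ne_zero 2 slL_ne_zero)
    linear_combination -this
  have key2 : ∀ w, ¬ IsPoleK w → ¬ IsLat w → deriv sl w ^ 2 = slL ^ 2 * (1 - sl w ^ 4) := by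
    intro w hw hl
    have := key w hw
    rw [g3, g2] at this
    have hL := slL_ne_zero
    have hs := sl_ne_zero hw hl
    apply mul_left_cancel₀ (mul_ne_zero (mul_ne_zero (by norm_num : (4 : ℂ) ≠ 0) (pow_ne_zero 4 hL)) (pow_ne_zero 2 hs))
    linear_combination this
  have := identity_countable (f := fun w => deriv sl w ^ 2 - slL ^ 2 * (1 - sl w ^ 4))
    countable_isPoleK ?_ not_isPoleK_half ?_ v hv
  · linear_combination this
  · intro w hw
    have h1 := sl_analyticAt hw
    have h2 := h1.deriv
    fun_prop
  · filter_upwards [eventually_not_isPoleK not_isPoleK_half, eventually_not_isLat not_isLat_half]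
      with w h1 h2
    rw [key2 w h1 h2, sub_self]

def cl (v : ℂ) : ℂ := deriv sl v / slL

lemma sl_hasDerivAt {v : ℂ} (hv : ¬ IsPoleK v) : HasDerivAt sl (slL * cl v) v := by
  rw [cl, mul_div_cancel₀ _ slL_ne_zero]
  exact (sl_analyticAt hv).differentiableAt.hasDerivAt

lemma cl_sq {v : ℂ} (hv : ¬ IsPoleK v) : cl v ^ 2 = 1 - sl v ^ 4 := by
  rw [cl, div_pow, sl_ode hv, mul_div_cancel_left₀ _ (pow_ne_zero 2 slL_ne_zero)]

lemma cl_analyticAt {v : ℂ} (hv : ¬ IsPoleK v) : AnalyticAt ℂ cl v :=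
  (sl_analyticAt hv).deriv.div analyticAt_const slL_ne_zero

lemma cl_zero : cl 0 = 1 := div_self slL_ne_zero

lemma cl_half : cl (1 / 2) = 0 := by rw [cl, sl_deriv_half, zero_div]

lemma cl_add_one (v : ℂ) : cl (v + 1) = -cl v := by
  have h : deriv (fun w => sl (w + 1)) v = deriv (fun w => -sl w) v := by simp only [sl_add_one]
  rw [deriv_comp_add_const, deriv.fun_neg] at h
  rw [cl, h, cl, neg_div]

lemma cl_add_I (v : ℂ) : cl (v + I) = -cl v := by
  have h : deriv (fun w => sl (w + I)) v = deriv (fun w => -sl w) v := by simp only [sl_add_I]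
  rw [deriv_comp_add_const, deriv.fun_neg] at h
  rw [cl, h, cl, neg_div]

lemma cl_neg (v : ℂ) : cl (-v) = cl v := by
  have h : deriv (fun w => sl (-w)) v = deriv (fun w => -sl w) v := by simp only [sl_neg]
  rw [deriv_comp_neg, deriv.fun_neg] at h
  rw [cl, neg_inj.1 h, cl]

lemma cl_I_mul {v : ℂ} (hv : ¬ IsPoleK v) : cl (I * v) = cl v := by
  have h1 : HasDerivAt (fun w => sl (I * w)) (slL * cl (I * v) * I) v := by
    have h2 := sl_hasDerivAt (v := I * v) (by rwa [isPoleK_I_mul_iff])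
    have h3 : HasDerivAt (fun w => I * w) (I * 1) v := (hasDerivAt_id v).const_mul I
    rw [mul_one] at h3
    exact h2.comp v h3
  have h4 : HasDerivAt (fun w => sl (I * w)) (I * (slL * cl v)) v := by
    refine ((sl_hasDerivAt hv).const_mul I).congr_of_eventuallyEq ?_
    filter_upwards [eventually_not_isPoleK hv] with w hw
    exact sl_I_mul hw
  have := h1.unique h4
  apply mul_left_cancel₀ (mul_ne_zero I_ne_zero slL_ne_zero)
  linear_combination this

lemma slL_conj : starRingEnd ℂ slL = slL := by
  have h : deriv (starRingEnd ℂ ∘ sl ∘ starRingEnd ℂ) 0 = starRingEnd ℂ (deriv sl (starRingEnd ℂ 0)) :=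
    congrFun deriv_conj_conj _
  have e : starRingEnd ℂ ∘ sl ∘ starRingEnd ℂ = sl := by
    funext w; simp [sl_conj]
  rw [e, map_zero] at h
  exact h.symm

lemma cl_conj (v : ℂ) : starRingEnd ℂ (cl v) = cl (starRingEnd ℂ v) := by
  have h : deriv (starRingEnd ℂ ∘ sl ∘ starRingEnd ℂ) (starRingEnd ℂ v) =
      starRingEnd ℂ (deriv sl (starRingEnd ℂ (starRingEnd ℂ v))) :=
    congrFun deriv_conj_conj _
  have e : starRingEnd ℂ ∘ sl ∘ starRingEnd ℂ = sl := by
    funext w; simp [sl_conj]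
  rw [e, conj_conj] at h
  rw [cl, map_div₀, slL_conj, ← h, cl]

lemma cl_hasDerivAt {v : ℂ} (hv : ¬ IsPoleK v) : HasDerivAt cl (-2 * slL * sl v ^ 3) v := by
  have h0 := (cl_analyticAt hv).differentiableAt.hasDerivAt
  suffices deriv cl v = -2 * slL * sl v ^ 3 by rwa [this] at h0
  have key : ∀ w, ¬ IsPoleK w → 2 * cl w * (deriv cl w + 2 * slL * sl w ^ 3) = 0 := by
    intro w hw
    have h1 := ((cl_analyticAt hw).differentiableAt.hasDerivAt).pow 2
    have h2 := (((sl_hasDerivAt hw).pow 4).const_sub 1)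
    have h3 := h1.congr_of_eventuallyEq (f₁ := fun v => 1 - sl v ^ 4) (by
      filter_upwards [eventually_not_isPoleK hw] with z hz
      exact (cl_sq hz).symm)
    have := h3.unique h2
    simp at this
    linear_combination this
  have := identity_countable (f := fun w => deriv cl w + 2 * slL * sl w ^ 3)
    countable_isPoleK ?_ not_isPoleK_zero ?_ v hv
  · linear_combination this
  · intro w hw
    have h1 := sl_analyticAt hw
    have h2 := (cl_analyticAt hw).deriv
    fun_prop
  · have hc : ∀ᶠ w in 𝓝 (0 : ℂ), cl w ≠ 0 :=
      (cl_analyticAt not_isPoleK_zero).continuousAt.eventually_ne (by rw [cl_zero]; exact one_ne_zero)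
    filter_upwards [eventually_not_isPoleK not_isPoleK_zero, hc] with w h1 h2
    exact (mul_eq_zero.1 (key w h1)).resolve_left (mul_ne_zero two_ne_zero h2)

lemma sl_add_aux {k v : ℂ} (hk : ¬ IsPoleK k) (hv : ¬ IsPoleK v) (hkv : ¬ IsPoleK (k - v)) :
    sl v * cl (k - v) + sl (k - v) * cl v - sl k * (1 + sl v ^ 2 * sl (k - v) ^ 2) = 0 := by
  set N : ℂ → ℂ := fun v => sl v * cl (k - v) + sl (k - v) * cl v with hN
  set D : ℂ → ℂ := fun v => 1 + sl v ^ 2 * sl (k - v) ^ 2 with hD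
  have hder : ∀ v, ¬ IsPoleK v → ¬ IsPoleK (k - v) →
      HasDerivAt sl (slL * cl v) v ∧ HasDerivAt cl (-2 * slL * sl v ^ 3) v ∧
      HasDerivAt (fun v => sl (k - v)) (slL * cl (k - v) * -1) v ∧
      HasDerivAt (fun v => cl (k - v)) (-2 * slL * sl (k - v) ^ 3 * -1) v := by
    intro v hv hkv
    have h0 : HasDerivAt (fun v => k - v) (-1) v := (hasDerivAt_id v).const_sub k
    exact ⟨sl_hasDerivAt hv, cl_hasDerivAt hv, (sl_hasDerivAt hkv).comp v h0,
      (cl_hasDerivAt hkv).comp v h0⟩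
  have hana : ∀ v, ¬ IsPoleK v → ¬ IsPoleK (k - v) → AnalyticAt ℂ sl v ∧ AnalyticAt ℂ cl v ∧
      AnalyticAt ℂ (fun v => sl (k - v)) v ∧ AnalyticAt ℂ (fun v => cl (k - v)) v := by
    intro v hv hkv
    have h0 : AnalyticAt ℂ (fun v => k - v) v := by fun_prop
    exact ⟨sl_analyticAt hv, cl_analyticAt hv, (sl_analyticAt hkv).fun_comp h0,
      (cl_analyticAt hkv).fun_comp h0⟩
  have hev : ∀ᶠ w in 𝓝 (0 : ℂ), ¬ IsPoleK w ∧ ¬ IsPoleK (k - w) ∧ D w ≠ 0 := by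
    have h1 : ∀ᶠ w in 𝓝 (0 : ℂ), ¬ IsPoleK (k - w) := by
      have : Tendsto (fun w => k - w) (𝓝 0) (𝓝 k) := by
        have : ContinuousAt (fun w : ℂ => k - w) 0 := by fun_prop
        simpa [ContinuousAt] using this
      exact this.eventually (eventually_not_isPoleK hk)
    have h2 : ContinuousAt D 0 := by
      obtain ⟨a1, a2, a3, a4⟩ := hana 0 not_isPoleK_zero (by simpa using hk)
      have := a1.continuousAt
      have := a3.continuousAt
      fun_prop
    have h3 : ∀ᶠ w in 𝓝 (0 : ℂ), D w ≠ 0 := h2.eventually_ne (by simp [hD, sl_zero])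
    filter_upwards [eventually_not_isPoleK not_isPoleK_zero, h1, h3] with w a b c
    exact ⟨a, b, c⟩
  obtain ⟨r, hr, hball⟩ := Metric.eventually_nhds_iff_ball.1 hev
  have hq : ∀ w ∈ Metric.ball (0 : ℂ) r, HasDerivAt (fun v => N v / D v) 0 w := by
    intro w hw
    obtain ⟨h1, h2, h3⟩ := hball w hw
    obtain ⟨d1, d2, d3, d4⟩ := hder w h1 h2
    have dN := (d1.mul d4).add (d3.mul d2)
    have dD := ((d1.pow 2).mul (d3.pow 2)).const_add 1
    have := dN.div dD h3
    refine (this.congr_deriv ?_).congr_of_eventuallyEq (Eventually.of_forall fun _ => rfl)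
    rw [div_eq_zero_iff]; left
    have c1 := cl_sq h1
    have c2 := cl_sq h2
    simp only [Pi.add_apply, Pi.mul_apply, Pi.pow_apply]
    push_cast
    linear_combination (2 * slL * sl w * sl (k-w)) * (sl w ^ 2 * c2 - sl (k-w) ^ 2 * c1)
  refine identity_countable (A := {v | IsPoleK v} ∪ {v | IsPoleK (k - v)})
    (f := fun v => N v - sl k * D v) ?_ ?_ (z := 0) ?_ ?_ v ?_
  · refine countable_isPoleK.union ?_
    exact countable_isPoleK.preimage_of_injOn (f := fun v => k - v)
      (fun a _ b _ h => by simpa using h)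
  · intro w hw
    rw [Set.mem_union, not_or] at hw
    obtain ⟨a1, a2, a3, a4⟩ := hana w hw.1 hw.2
    fun_prop
  · rw [Set.mem_union, not_or]
    exact ⟨not_isPoleK_zero, by simpa [Set.mem_ofPred_eq] using hk⟩
  · filter_upwards [Metric.ball_mem_nhds (0 : ℂ) hr] with w hw
    have := Metric.isOpen_ball.is_const_of_deriv_eq_zero
      (convex_ball (0 : ℂ) r).isPreconnected
      (fun w hw => (hq w hw).differentiableAt.differentiableWithinAt)
      (fun w hw => (hq w hw).deriv) hw (Metric.mem_ball_self hr)
    have h0 : N 0 / D 0 = sl k := by simp [hN, hD, sl_zero, cl_zero]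
    rw [h0, div_eq_iff (hball w hw).2.2] at this
    rw [this, sub_self]
  · rw [Set.mem_union, not_or]; exact ⟨hv, hkv⟩

theorem sl_add {a b : ℂ} (ha : ¬ IsPoleK a) (hb : ¬ IsPoleK b) (hab : ¬ IsPoleK (a + b)) :
    sl (a + b) * (1 + sl a ^ 2 * sl b ^ 2) = sl a * cl b + sl b * cl a := by
  have := sl_add_aux (k := a + b) (v := a) hab ha (by simpa using hb)
  rw [add_sub_cancel_left] at this
  linear_combination -this

lemma not_isPoleK_ofReal (t : ℝ) : ¬ IsPoleK t := by
  rintro ⟨m, n, e⟩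
  have := congrArg Complex.im e
  simp at this
  have h2 : (2 * n : ℝ) = -1 := by linarith
  have h3 : (2 * n : ℤ) = -1 := by exact_mod_cast h2
  omega

lemma isLat_ofReal {t : ℝ} (h : IsLat t) : ∃ m : ℤ, t = m := by
  obtain ⟨m, n, e⟩ := h
  have := congrArg Complex.re e
  exact ⟨m, by simpa using this⟩

def slR (t : ℝ) : ℝ := (sl t).re
def clR (t : ℝ) : ℝ := (cl t).re

lemma sl_ofReal (t : ℝ) : sl t = slR t :=
  (conj_eq_iff_re.1 (by rw [sl_conj, conj_ofReal])).symm
lemma cl_ofReal (t : ℝ) : cl t = clR t :=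
  (conj_eq_iff_re.1 (by rw [cl_conj, conj_ofReal])).symm
lemma slL_ofReal : slL = slL.re := (conj_eq_iff_re.1 slL_conj).symm

lemma slR_hasDerivAt (t : ℝ) : HasDerivAt slR (slL.re * clR t) t := by
  have h := (sl_hasDerivAt (not_isPoleK_ofReal t)).real_of_complex
  rw [slL_ofReal, cl_ofReal, ← ofReal_mul, ofReal_re] at h
  exact h

lemma clR_sq (t : ℝ) : clR t ^ 2 = 1 - slR t ^ 4 := by
  have := cl_sq (not_isPoleK_ofReal t)
  rw [cl_ofReal, sl_ofReal] at this
  exact_mod_cast this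

lemma clR_continuous : Continuous clR := by
  have : clR = fun t : ℝ => (cl t).re := rfl
  rw [this, continuous_iff_continuousAt]
  intro t
  have h1 := (cl_analyticAt (not_isPoleK_ofReal t)).continuousAt
  exact continuous_re.continuousAt.comp (h1.comp (f := fun t : ℝ => (t : ℂ)) continuous_ofReal.continuousAt)

lemma sl_two_mul {a : ℂ} (ha : ¬ IsPoleK a) (ha2 : ¬ IsPoleK (2 * a)) :
    sl (2 * a) * (1 + sl a ^ 4) = 2 * sl a * cl a := by
  have := sl_add ha ha (by rwa [← two_mul])
  rw [two_mul]
  linear_combination this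

lemma clR_ne_zero {t : ℝ} (h0 : 0 ≤ t) (h1 : t < 1 / 2) : clR t ≠ 0 := by
  intro h
  have h2 := clR_sq t
  have h3 := sl_two_mul (not_isPoleK_ofReal t) (by exact_mod_cast not_isPoleK_ofReal (2 * t))
  rw [cl_ofReal, h, ofReal_zero, mul_zero, sl_ofReal t] at h3
  rw [h] at h2
  have h4 : slR t ^ 4 = 1 := by linarith
  rw [← ofReal_pow, h4] at h3
  have h5 : sl (2 * t) = 0 := by
    have : (1 + ((1 : ℝ) : ℂ)) ≠ 0 := by norm_num
    exact (mul_eq_zero.1 h3).resolve_right this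
  have h6 : IsLat (2 * t : ℝ) := by
    by_contra hl
    exact sl_ne_zero (not_isPoleK_ofReal _) hl (by exact_mod_cast h5)
  obtain ⟨m, hm⟩ := isLat_ofReal h6
  have h7 : m = 0 := by
    have a : (-1 : ℝ) < m := by rw [← hm]; linarith
    have b : (m : ℝ) < 1 := by rw [← hm]; linarith
    have a' : -1 < m := by exact_mod_cast a
    have b' : m < 1 := by exact_mod_cast b
    omega
  rw [h7] at hm
  have : t = 0 := by simpa using hm
  have h8 := cl_zero
  rw [← ofReal_zero, ← this, cl_ofReal, h] at h8
  simp at h8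

lemma clR_pos {t : ℝ} (h0 : 0 ≤ t) (h1 : t < 1 / 2) : 0 < clR t := by
  by_contra! hle
  have hc0 : clR 0 = 1 := by rw [clR, ofReal_zero, cl_zero, one_re]
  obtain ⟨x, hx, hx0⟩ := intermediate_value_Icc' h0 clR_continuous.continuousOn
    (show (0 : ℝ) ∈ Set.Icc (clR t) (clR 0) from ⟨hle, by rw [hc0]; norm_num⟩)
  exact clR_ne_zero hx.1 (lt_of_le_of_lt hx.2 h1) hx0

lemma slR_zero : slR 0 = 0 := by rw [slR, ofReal_zero, sl_zero, zero_re]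
lemma slR_half : slR (1 / 2) = 1 := by
  have : ((1 / 2 : ℝ) : ℂ) = 1 / 2 := by push_cast; rfl
  rw [slR, this, sl_half, one_re]

lemma slR_continuous : Continuous slR :=
  continuous_iff_continuousAt.2 fun t => (slR_hasDerivAt t).continuousAt

lemma slL_re_pos : 0 < slL.re := by
  by_contra! h
  have h1 : AntitoneOn slR (Set.Icc 0 (1 / 2)) := by
    apply antitoneOn_of_deriv_nonpos (convex_Icc _ _) slR_continuous.continuousOn
      (fun x _ => (slR_hasDerivAt x).differentiableAt.differentiableWithinAt)
    intro x hx
    rw [interior_Icc] at hx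
    rw [(slR_hasDerivAt x).deriv]
    exact mul_nonpos_of_nonpos_of_nonneg h (clR_pos hx.1.le hx.2).le
  have := h1 (Set.left_mem_Icc.2 (by norm_num)) (Set.right_mem_Icc.2 (by norm_num)) (by norm_num)
  rw [slR_zero, slR_half] at this
  linarith

lemma slR_strictMonoOn : StrictMonoOn slR (Set.Icc 0 (1 / 2)) := by
  apply strictMonoOn_of_deriv_pos (convex_Icc _ _) slR_continuous.continuousOn
  intro x hx
  rw [interior_Icc] at hx
  rw [(slR_hasDerivAt x).deriv]
  exact mul_pos slL_re_pos (clR_pos hx.1.le hx.2)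

lemma slR_image : slR '' Set.Ioo 0 (1 / 2) = Set.Ioo 0 1 := by
  apply Set.Subset.antisymm
  · rintro _ ⟨t, ht, rfl⟩
    constructor
    · rw [← slR_zero]
      exact slR_strictMonoOn (Set.left_mem_Icc.2 (by norm_num)) (Set.Ioo_subset_Icc_self ht) ht.1
    · rw [← slR_half]
      exact slR_strictMonoOn (Set.Ioo_subset_Icc_self ht) (Set.right_mem_Icc.2 (by norm_num)) ht.2
  · have := intermediate_value_Ioo (show (0 : ℝ) ≤ 1 / 2 by norm_num) slR_continuous.continuousOn
    rwa [slR_zero, slR_half] at this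

lemma varpi_eq : varpi = slL.re := by
  have h := MeasureTheory.integral_image_eq_integral_abs_deriv_smul (s := Set.Ioo (0 : ℝ) (1 / 2))
    measurableSet_Ioo (fun x _ => (slR_hasDerivAt x).hasDerivWithinAt)
    (slR_strictMonoOn.injOn.mono Set.Ioo_subset_Icc_self)
    (fun x : ℝ => (1 - x ^ 4) ^ (-(1 : ℝ) / 2))
  have h2 : ∫ x in Set.Ioo (0 : ℝ) (1 / 2),
      |slL.re * clR x| • ((1 - slR x ^ 4) ^ (-(1 : ℝ) / 2)) =
      ∫ x in Set.Ioo (0 : ℝ) (1 / 2), slL.re := by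
    apply MeasureTheory.setIntegral_congr_fun measurableSet_Ioo
    intro x hx
    have hc := clR_pos hx.1.le hx.2
    have e : ((1 - slR x ^ 4) ^ (-(1 : ℝ) / 2)) = (clR x)⁻¹ := by
      rw [← clR_sq, ← Real.rpow_natCast, ← Real.rpow_mul hc.le]
      norm_num
      exact Real.rpow_neg_one _
    simp only [smul_eq_mul]
    rw [e, abs_of_pos (mul_pos slL_re_pos hc), mul_assoc, mul_inv_cancel₀ hc.ne', mul_one]
  rw [h2, slR_image] at h
  rw [varpi, intervalIntegral.integral_of_le zero_le_one, MeasureTheory.integral_Ioc_eq_integral_Ioo,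
    h]
  simp

lemma varpi_cast : (varpi : ℂ) = slL := by rw [varpi_eq, ← slL_ofReal]

def latE : ℤ × ℤ ≃ gaussPair.lattice := gaussPair.latticeEquivProd.symm.toEquiv

lemma latE_apply (m : ℤ × ℤ) : ((latE m : gaussPair.lattice) : ℂ) = m.1 + m.2 * I := by
  have := gaussPair.latticeEquiv_symm_apply m
  change ((gaussPair.latticeEquivProd.symm m : gaussPair.lattice) : ℂ) = _
  rw [this]
  change (m.1 : ℂ) * 1 + m.2 * I = _
  rw [mul_one]

lemma ω4_eq (m : ℤ × ℤ) : ω4 m = slL * (latE m : ℂ) := by rw [latE_apply, ω4, varpi_cast]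

lemma latE_zero : ((latE 0 : gaussPair.lattice) : ℂ) = 0 := by rw [latE_apply]; simp

lemma wp4_eq_wp (u : ℂ) : wp4 (slL * u) = (slL ^ 2)⁻¹ * gaussPair.weierstrassP u := by
  have hL := slL_ne_zero
  have h := gaussPair.hasSum_weierstrassP u
  have h1 := latE.hasSum_iff.2 h
  have h2 := h1.mul_left (slL ^ 2)⁻¹
  have h3 := (hasSum_ite_eq (0 : ℤ × ℤ) ((slL ^ 2)⁻¹ * (u ^ 2)⁻¹))
  have h4 := h2.sub h3
  have h5 : HasSum (fun m : ℤ × ℤ => if m = 0 then 0 else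
      (((slL * u - ω4 m) ^ 2)⁻¹ - ((ω4 m) ^ 2)⁻¹))
      ((slL ^ 2)⁻¹ * gaussPair.weierstrassP u - (slL ^ 2)⁻¹ * (u ^ 2)⁻¹) := by
    refine h4.congr_fun ?_
    intro m
    simp only [Function.comp]
    split_ifs with hm
    · subst hm; rw [latE_zero]; simp
    · rw [ω4_eq, ← mul_sub, mul_pow, mul_pow, mul_inv, mul_inv, sub_zero]; ring
  rw [wp4, h5.tsum_eq, mul_pow, mul_inv]; ring

lemma wp4'_eq_wp (u : ℂ) : wp4' (slL * u) = (slL ^ 3)⁻¹ * gaussPair.derivWeierstrassP u := by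
  have h := gaussPair.hasSum_derivWeierstrassP u
  have h1 := latE.hasSum_iff.2 h
  have h2 := h1.mul_left (slL ^ 3)⁻¹
  rw [wp4', ← h2.tsum_eq]
  refine tsum_congr fun m => ?_
  simp only [Function.comp]
  rw [ω4_eq, ← mul_sub, mul_pow, mul_inv]; ring

lemma wpL_eq' {v : ℂ} (hv : ¬ IsPoleK v) (hl : ¬ IsLat v) :
    gaussPair.weierstrassP v = slL ^ 2 * (sl v ^ 2)⁻¹ := by
  rw [wpL_eq hl, sl_delta_eq hv hl, div_pow, neg_sq, I_sq]; ring

lemma wp4_eq {v : ℂ} (hv : ¬ IsPoleK v) (hl : ¬ IsLat v) : wp4 (varpi * v) = (sl v ^ 2)⁻¹ := by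
  rw [varpi_cast, wp4_eq_wp, wpL_eq' hv hl, inv_mul_cancel_left₀ (pow_ne_zero 2 slL_ne_zero)]

lemma wp4'_eq {v : ℂ} (hv : ¬ IsPoleK v) (hl : ¬ IsLat v) :
    wp4' (varpi * v) = -2 * cl v / sl v ^ 3 := by
  rw [varpi_cast, wp4'_eq_wp, ← PeriodPair.deriv_weierstrassP]
  have hs := sl_ne_zero hv hl
  have h1 : HasDerivAt (fun v => slL ^ 2 * (sl v ^ 2)⁻¹) _ v :=
    (((sl_hasDerivAt hv).pow 2).inv (pow_ne_zero 2 hs)).const_mul (slL ^ 2)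
  have h2 := h1.congr_of_eventuallyEq (f₁ := gaussPair.weierstrassP) (by
    filter_upwards [eventually_not_isPoleK hv, eventually_not_isLat hl] with w a b
    exact wpL_eq' a b)
  rw [h2.deriv]
  have := slL_ne_zero
  simp only [Pi.pow_apply]
  push_cast
  field_simp

lemma phi4_eq {v : ℂ} (hv : ¬ IsPoleK v) (hl : ¬ IsLat v) :
    phi4 v = (1 - I) * sl v / cl v := by
  have hs := sl_ne_zero hv hl
  rw [phi4, wp4_eq hv hl, wp4'_eq hv hl]
  by_cases hc : cl v = 0
  · simp [hc]
  field_simp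

/-- A primary Gaussian prime of odd prime norm `p`. -/
structure PrimaryPrime where
  p : ℕ
  hp : p.Prime
  hp2 : p ≠ 2
  q : GaussianInt
  norm_q : q.re ^ 2 + q.im ^ 2 = p
  even_im : Even q.im
  primary : (4 : ℤ) ∣ q.re - 1 - q.im

lemma GaussianInt.coe_def (g : GaussianInt) : (g : ℂ) = g.re + g.im * I := GaussianInt.toComplex_def g

lemma isLat_coe (g : GaussianInt) : IsLat g := ⟨g.re, g.im, GaussianInt.coe_def g⟩

lemma IsLat.exists_coe {v : ℂ} (h : IsLat v) : ∃ g : GaussianInt, v = g := by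
  obtain ⟨m, n, rfl⟩ := h
  exact ⟨⟨m, n⟩, by rw [GaussianInt.coe_def]⟩

def gI : GaussianInt := ⟨0, 1⟩
@[simp] lemma gI_coe : (gI : ℂ) = I := by rw [GaussianInt.coe_def]; simp [gI]
lemma gI_mul_gI : gI * gI = -1 := by ext <;> simp [gI]

lemma sl_add_even (v : ℂ) (g : GaussianInt) : sl (v + (1 - I) * g) = sl v := by
  have h1 : ∀ v, sl (v + (1 - I)) = sl v := by
    intro v
    have := sl_add_I (v + (1 - I))
    rw [show v + (1 - I) + I = v + 1 by ring, sl_add_one] at this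
    exact (neg_injective this).symm
  have h2 : ∀ v, sl (v + (1 + I)) = sl v := by
    intro v
    rw [← add_assoc, sl_add_I, sl_add_one, neg_neg]
  have p1 : Function.Periodic sl (1 - I) := h1
  have p2 : Function.Periodic sl (1 + I) := h2
  rw [GaussianInt.coe_def]
  have e : v + (1 - I) * (g.re + g.im * I) = v + g.re * (1 - I) + g.im * (1 + I) := by
    linear_combination (-g.im : ℂ) * I_sq
  rw [e, p2.int_mul, p1.int_mul]

lemma cl_add_even (v : ℂ) (g : GaussianInt) : cl (v + (1 - I) * g) = cl v := by
  have h1 : ∀ v, cl (v + (1 - I)) = cl v := by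
    intro v
    have := cl_add_I (v + (1 - I))
    rw [show v + (1 - I) + I = v + 1 by ring, cl_add_one] at this
    exact (neg_injective this).symm
  have h2 : ∀ v, cl (v + (1 + I)) = cl v := by
    intro v
    rw [← add_assoc, cl_add_I, cl_add_one, neg_neg]
  have p1 : Function.Periodic cl (1 - I) := h1
  have p2 : Function.Periodic cl (1 + I) := h2
  rw [GaussianInt.coe_def]
  have e : v + (1 - I) * (g.re + g.im * I) = v + g.re * (1 - I) + g.im * (1 + I) := by
    linear_combination (-g.im : ℂ) * I_sq
  rw [e, p2.int_mul, p1.int_mul]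

namespace PrimaryPrime
variable (D : PrimaryPrime)

instance : Fact D.p.Prime := ⟨D.hp⟩

lemma odd_re : Odd D.q.re := by
  obtain ⟨k, hk⟩ := D.even_im
  obtain ⟨m, hm⟩ := D.primary
  exact ⟨2 * m + k, by omega⟩

lemma odd_p : Odd D.p := D.hp.odd_of_ne_two D.hp2

lemma p_pos : 0 < D.p := D.hp.pos

lemma p_ne_zero : (D.p : ℂ) ≠ 0 := by exact_mod_cast D.p_pos.ne'

lemma q_mul_star : D.q * star D.q = D.p := by
  have := D.norm_q
  ext
  · simp; nlinarith
  · simp; ring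

lemma q_coe_ne_zero : (D.q : ℂ) ≠ 0 := by
  intro h
  have := congrArg (GaussianInt.toComplex) D.q_mul_star
  rw [map_mul, h, zero_mul] at this
  simp at this
  exact D.hp.ne_zero (by exact_mod_cast this.symm)

lemma coe_mul_conj : (D.q : ℂ) * starRingEnd ℂ D.q = D.p := by
  have := congrArg (GaussianInt.toComplex) D.q_mul_star
  rw [map_mul] at this
  simpa using this

lemma im_ne_zero : (D.q.im : ZMod D.p) ≠ 0 := by
  intro h
  rw [ZMod.intCast_zmod_eq_zero_iff_dvd] at h
  have h1 := D.norm_q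
  have hp1 : (1 : ℤ) < D.p := by exact_mod_cast D.hp.one_lt
  have h2 : (D.p : ℤ) ∣ D.q.re ^ 2 := ⟨1 - D.q.im * (D.q.im / D.p), by
    obtain ⟨k, hk⟩ := h
    have : D.q.im / D.p = k := by rw [hk]; exact Int.mul_ediv_cancel_left _ (by omega)
    rw [this]; rw [hk] at h1 ⊢; linear_combination h1⟩
  have h3 := (Nat.prime_iff_prime_int.1 D.hp).dvd_of_dvd_pow h2
  obtain ⟨x, hx⟩ := h
  obtain ⟨y, hy⟩ := h3
  rw [hx, hy] at h1
  have : (D.p : ℤ) * (y ^ 2 + x ^ 2) = 1 := by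
    have h0 : (D.p : ℤ) ≠ 0 := by omega
    apply mul_left_cancel₀ h0
    linear_combination h1
  have h5 : (D.p : ℤ) ∣ 1 := ⟨_, this.symm⟩
  exact absurd (Int.le_of_dvd one_pos h5) (by omega)

/-- The image of `i` in the residue field. -/
def iF : ZMod D.p := -(D.q.re * (D.q.im : ZMod D.p)⁻¹)

lemma iF_mul : D.iF * D.iF = -1 := by
  have h := D.im_ne_zero
  have h1 : (D.q.re : ZMod D.p) ^ 2 + (D.q.im : ZMod D.p) ^ 2 = 0 := by
    have := congrArg (Int.cast : ℤ → ZMod D.p) D.norm_q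
    simpa using this
  rw [iF]; field_simp; linear_combination h1

def red : GaussianInt →+* ZMod D.p :=
  Zsqrtd.lift ⟨D.iF, by rw [D.iF_mul]; simp⟩

lemma red_apply (g : GaussianInt) : D.red g = g.re + g.im * D.iF := rfl

@[simp] lemma red_gI : D.red gI = D.iF := by simp [red_apply, gI]

lemma red_q : D.red D.q = 0 := by
  rw [red_apply, iF]; field_simp [D.im_ne_zero]; ring

lemma red_eq_zero_iff {g : GaussianInt} : D.red g = 0 ↔ D.q ∣ g := by
  constructor
  · intro h
    have h0 := D.im_ne_zero
    have h1 : D.red (g * star D.q) = 0 := by rw [map_mul, h, zero_mul]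
    have hn : (D.q.re : ZMod D.p) ^ 2 + (D.q.im : ZMod D.p) ^ 2 = 0 := by
      have := congrArg (Int.cast : ℤ → ZMod D.p) D.norm_q
      simpa using this
    rw [red_apply, iF] at h
    have h' : (g.re : ZMod D.p) * D.q.im = g.im * D.q.re := by
      field_simp at h; linear_combination h
    have e1 : ((g.im * D.q.re - g.re * D.q.im : ℤ) : ZMod D.p) = 0 := by
      push_cast; linear_combination -h'
    have e2 : ((g.re * D.q.re + g.im * D.q.im : ℤ) : ZMod D.p) = 0 := by
      apply mul_right_cancel₀ h0
      push_cast; linear_combination (D.q.re : ZMod D.p) * h' + (g.im : ZMod D.p) * hn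
    rw [ZMod.intCast_zmod_eq_zero_iff_dvd] at e1 e2
    obtain ⟨y, hy⟩ := e1
    obtain ⟨x, hx⟩ := e2
    refine ⟨⟨x, y⟩, ?_⟩
    have hq : D.q ≠ 0 := by
      intro h; exact D.q_coe_ne_zero (by rw [h, map_zero])
    have hs : star D.q ≠ 0 := star_ne_zero.2 hq
    apply mul_right_cancel₀ hs
    rw [mul_right_comm, D.q_mul_star]
    ext
    · simp; linarith
    · simp; linarith
  · rintro ⟨k, rfl⟩
    rw [map_mul, red_q, zero_mul]

lemma red_natCast_val (t : ZMod D.p) : D.red (t.val : GaussianInt) = t := by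
  rw [map_natCast, ZMod.natCast_zmod_val]

lemma two_ne_zero : (2 : ZMod D.p) ≠ 0 := by
  intro h
  have : ((2 : ℕ) : ZMod D.p) = 0 := by exact_mod_cast h
  rw [ZMod.natCast_eq_zero_iff] at this
  exact D.hp2 ((Nat.prime_dvd_prime_iff_eq D.hp Nat.prime_two).1 this)

lemma iF_ne_zero : D.iF ≠ 0 := by
  intro h; have := D.iF_mul; rw [h] at this; simp at this

lemma one_sub_iF_ne_zero : 1 - D.iF ≠ 0 := by
  intro h
  have : (1 - D.iF) * (1 - D.iF) = -2 * D.iF := by linear_combination D.iF_mul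
  rw [h] at this
  exact mul_ne_zero (neg_ne_zero.2 D.two_ne_zero) D.iF_ne_zero (by rw [← this, mul_zero])

lemma one_add_iF_ne_zero : 1 + D.iF ≠ 0 := by
  intro h
  have : (1 + D.iF) * (1 + D.iF) = 2 * D.iF := by linear_combination D.iF_mul
  rw [h] at this
  exact mul_ne_zero D.two_ne_zero D.iF_ne_zero (by rw [← this, mul_zero])

lemma not_isPoleK_div (g : GaussianInt) : ¬ IsPoleK (g / D.q) := by
  intro h
  rw [isPoleK_iff_isLat] at h
  obtain ⟨k, hk⟩ := h.exists_coe
  have hq := D.q_coe_ne_zero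
  have h1 : (2 * g : ℂ) = D.q * (1 + I) + 2 * (D.q * k) := by
    have : (g : ℂ) = (k + (1 + I) / 2) * D.q := by
      rw [← hk]; field_simp; ring
    rw [this]; ring
  have h2 : 2 * g = D.q * (1 + gI) + 2 * (D.q * k) := by
    apply GaussianInt.toComplex_injective
    simp only [map_mul, map_add, map_ofNat, map_one, gI_coe]
    exact h1
  have h3 := congrArg Zsqrtd.re h2
  have e1 : (2 * g).re = 2 * g.re := by rw [two_mul, two_mul]; rfl
  have e2 : (2 * (D.q * k)).re = 2 * (D.q * k).re := by rw [two_mul, two_mul]; rfl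
  rw [Zsqrtd.re_add, e1, e2, Zsqrtd.re_mul] at h3
  obtain ⟨x, hx⟩ := D.odd_re
  obtain ⟨y, hy⟩ := D.even_im
  simp [gI] at h3
  omega

lemma not_isLat_div {g : GaussianInt} (h : D.red g ≠ 0) : ¬ IsLat (g / D.q) := by
  intro hl
  obtain ⟨k, hk⟩ := hl.exists_coe
  apply h
  rw [red_eq_zero_iff]
  refine ⟨k, GaussianInt.toComplex_injective ?_⟩
  rw [map_mul, ← hk, mul_div_cancel₀ _ D.q_coe_ne_zero]

lemma one_sub_mul_div (g : GaussianInt) :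
    (1 - I) * g / D.q = ((((1 - gI) * g : GaussianInt) : ℂ)) / D.q := by
  simp

lemma not_isPoleK_pt (g : GaussianInt) : ¬ IsPoleK ((1 - I) * g / D.q) := by
  rw [one_sub_mul_div]; exact D.not_isPoleK_div _

def X (t : ZMod D.p) : ℂ := sl ((1 - I) * (t.val : GaussianInt) / D.q)
def C (t : ZMod D.p) : ℂ := cl ((1 - I) * (t.val : GaussianInt) / D.q)

lemma exists_eq_of_red_eq {g h : GaussianInt} (e : D.red g = D.red h) (w : ℂ) :
    ∃ k : GaussianInt, (w + (1 - I) * g) / D.q = (w + (1 - I) * h) / D.q + (1 - I) * k := by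
  have : D.red (g - h) = 0 := by rw [map_sub, e, sub_self]
  rw [red_eq_zero_iff] at this
  obtain ⟨k, hk⟩ := this
  refine ⟨k, ?_⟩
  have h2 : (g : ℂ) = h + D.q * k := by
    rw [← map_mul, ← hk, ← map_add]; congr 1; ring
  have := D.q_coe_ne_zero
  rw [h2]; field_simp; ring

lemma X_red (g : GaussianInt) : sl ((1 - I) * g / D.q) = D.X (D.red g) := by
  obtain ⟨k, hk⟩ := D.exists_eq_of_red_eq (D.red_natCast_val (D.red g)).symm 0
  rw [zero_add, zero_add] at hk
  rw [hk, sl_add_even, X]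

lemma C_red (g : GaussianInt) : cl ((1 - I) * g / D.q) = D.C (D.red g) := by
  obtain ⟨k, hk⟩ := D.exists_eq_of_red_eq (D.red_natCast_val (D.red g)).symm 0
  rw [zero_add, zero_add] at hk
  rw [hk, cl_add_even, C]

lemma red_surjective : Function.Surjective D.red := fun t => ⟨_, D.red_natCast_val t⟩

lemma X_zero : D.X 0 = 0 := by
  have := D.X_red 0
  rw [map_zero, map_zero, mul_zero, zero_div, sl_zero] at this
  exact this.symm

lemma C_zero : D.C 0 = 1 := by
  have := D.C_red 0
  rw [map_zero, map_zero, mul_zero, zero_div, cl_zero] at this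
  exact this.symm

lemma X_neg (t : ZMod D.p) : D.X (-t) = -D.X t := by
  obtain ⟨g, rfl⟩ := D.red_surjective t
  rw [← map_neg, ← X_red, ← X_red, ← sl_neg]; congr 1; rw [map_neg]; ring

lemma C_neg (t : ZMod D.p) : D.C (-t) = D.C t := by
  obtain ⟨g, rfl⟩ := D.red_surjective t
  rw [← map_neg, ← C_red, ← C_red, ← cl_neg]; congr 1; rw [map_neg]; ring

lemma X_iF (t : ZMod D.p) : D.X (D.iF * t) = I * D.X t := by
  obtain ⟨g, rfl⟩ := D.red_surjective t
  rw [← red_gI, ← map_mul, ← X_red, ← X_red, ← sl_I_mul (D.not_isPoleK_pt g)]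
  congr 1; rw [map_mul, gI_coe]; ring

lemma C_iF (t : ZMod D.p) : D.C (D.iF * t) = D.C t := by
  obtain ⟨g, rfl⟩ := D.red_surjective t
  rw [← red_gI, ← map_mul, ← C_red, ← C_red, ← cl_I_mul (D.not_isPoleK_pt g)]
  congr 1; rw [map_mul, gI_coe]; ring

lemma C_sq (t : ZMod D.p) : D.C t ^ 2 = 1 - D.X t ^ 4 := cl_sq (D.not_isPoleK_pt _)

lemma X_add_mul (t u : ZMod D.p) :
    D.X (t + u) * (1 + D.X t ^ 2 * D.X u ^ 2) = D.X t * D.C u + D.X u * D.C t := by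
  obtain ⟨g, rfl⟩ := D.red_surjective t
  obtain ⟨h, rfl⟩ := D.red_surjective u
  rw [← map_add]
  simp only [← X_red, ← C_red]
  have e : (1 - I) * ((g + h : GaussianInt) : ℂ) / D.q =
    (1 - I) * g / D.q + (1 - I) * h / D.q := by rw [map_add]; ring
  rw [e]
  apply sl_add (D.not_isPoleK_pt _) (D.not_isPoleK_pt _)
  rw [← e]; exact D.not_isPoleK_pt _

lemma X_ne_zero {t : ZMod D.p} (h : t ≠ 0) : D.X t ≠ 0 := by
  rw [X]
  apply sl_ne_zero (D.not_isPoleK_pt _)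
  rw [one_sub_mul_div]
  apply not_isLat_div
  rw [map_mul, red_natCast_val, map_sub, map_one, red_gI]
  exact mul_ne_zero D.one_sub_iF_ne_zero h

lemma C_ne_zero (t : ZMod D.p) : D.C t ≠ 0 := by
  intro h
  have h1 := D.C_sq t
  have h2 := D.X_add_mul t t
  rw [h] at h1 h2
  have h3 : D.X t ^ 4 = 1 := by linear_combination h1
  have h4 : D.X (t + t) = 0 := by linear_combination h2 / 2 - D.X (t + t) / 2 * h3
  have h5 : t + t = 0 := by by_contra hh; exact D.X_ne_zero hh h4
  have h6 : t = 0 := by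
    rw [← two_mul] at h5
    exact (mul_eq_zero.1 h5).resolve_left D.two_ne_zero
  rw [h6, X_zero] at h3
  simp at h3

lemma X_add_denom_ne_zero (t u : ZMod D.p) : 1 + D.X t ^ 2 * D.X u ^ 2 ≠ 0 := by
  intro h
  have h1 := D.X_add_mul t u
  have h2 := D.X_add_mul t (-u)
  rw [X_neg, C_neg] at h2
  rw [neg_sq] at h2
  rw [h] at h1 h2
  have h3 : D.X t * D.C u = 0 := by linear_combination -h1 / 2 - h2 / 2
  have h4 := (mul_eq_zero.1 h3).resolve_right (D.C_ne_zero u)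
  rw [h4] at h
  simp at h

lemma one_sub_X_mul_ne_zero (t u : ZMod D.p) : 1 - D.X t ^ 4 * D.X u ^ 4 ≠ 0 := by
  have h1 := D.X_add_denom_ne_zero t u
  have h2 := D.X_add_denom_ne_zero t (D.iF * u)
  rw [X_iF] at h2
  have : 1 - D.X t ^ 4 * D.X u ^ 4 = (1 + D.X t ^ 2 * D.X u ^ 2) * (1 + D.X t ^ 2 * (I * D.X u) ^ 2) := by
    rw [mul_pow, I_sq]; ring
  rw [this]; exact mul_ne_zero h1 h2

lemma X_two_mul (t : ZMod D.p) : D.X (2 * t) * (1 + D.X t ^ 4) = 2 * D.X t * D.C t := by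
  have := D.X_add_mul t t
  rw [← two_mul] at this
  linear_combination this

lemma X_one_add_iF_mul (t : ZMod D.p) : D.X ((1 + D.iF) * t) = (1 + I) * D.X t / D.C t := by
  have := D.X_add_mul t (D.iF * t)
  rw [X_iF, C_iF, mul_pow I, I_sq] at this
  rw [add_mul, one_mul, eq_div_iff (D.C_ne_zero t)]
  apply mul_right_cancel₀ (D.C_ne_zero t)
  linear_combination this + D.X (t + D.iF * t) * D.C_sq t

lemma X_one_sub_iF_mul (t : ZMod D.p) : D.X ((1 - D.iF) * t) = (1 - I) * D.X t / D.C t := by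
  have := D.X_add_mul t (-(D.iF * t))
  rw [X_neg, C_neg, X_iF, C_iF, neg_sq, mul_pow I, I_sq] at this
  rw [sub_mul, one_mul, eq_div_iff (D.C_ne_zero t), sub_eq_add_neg]
  apply mul_right_cancel₀ (D.C_ne_zero t)
  linear_combination this + D.X (t + -(D.iF * t)) * D.C_sq t

end PrimaryPrime

lemma sl_one_sub_I_mul {v : ℂ} (hv : ¬ IsPoleK v) (hv2 : ¬ IsPoleK ((1 - I) * v))
    (hc : cl v ≠ 0) : sl ((1 - I) * v) = (1 - I) * sl v / cl v := by
  have hv3 : ¬ IsPoleK (-(I * v)) := by rwa [isPoleK_neg_iff, isPoleK_I_mul_iff]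
  have e : (1 - I) * v = v + -(I * v) := by ring
  have := sl_add hv hv3 (by rwa [← e])
  rw [← e, sl_neg, cl_neg, sl_I_mul hv, cl_I_mul hv, neg_sq, mul_pow I, I_sq] at this
  rw [eq_div_iff hc]
  apply mul_right_cancel₀ hc
  linear_combination this + sl ((1 - I) * v) * cl_sq hv

lemma cl_one_sub_I_mul {v : ℂ} (hv : ¬ IsPoleK v) (hv2 : ¬ IsPoleK ((1 - I) * v))
    (hc : cl v ≠ 0) : cl ((1 - I) * v) = (1 + sl v ^ 4) / cl v ^ 2 := by
  have h0 : HasDerivAt (fun w => (1 - I) * w) ((1 - I) * 1) v := (hasDerivAt_id v).const_mul _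
  have h1 : HasDerivAt (fun w => sl ((1 - I) * w)) (slL * cl ((1 - I) * v) * ((1 - I) * 1)) v :=
    (sl_hasDerivAt hv2).comp v h0
  have h2 := ((sl_hasDerivAt hv).const_mul (1 - I)).div (cl_hasDerivAt hv) hc
  have hcont : ContinuousAt (fun w => (1 - I) * w) v := by fun_prop
  have h3 := h2.congr_of_eventuallyEq (f₁ := fun w => sl ((1 - I) * w)) (by
    filter_upwards [eventually_not_isPoleK hv, hcont.eventually (eventually_not_isPoleK hv2),
      (cl_analyticAt hv).continuousAt.eventually_ne hc] with w a b c
    exact sl_one_sub_I_mul a b c)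
  have h4 := h1.unique h3
  have hi : (1 - I) ≠ 0 := by
    intro h; have := congrArg Complex.re h; simp at this
  rw [eq_div_iff (pow_ne_zero 2 hc)] at h4 ⊢
  apply mul_left_cancel₀ (mul_ne_zero slL_ne_zero hi)
  linear_combination h4 + slL * (1 - I) * cl_sq hv

namespace PrimaryPrime
variable (D : PrimaryPrime)

lemma cl_div_ne_zero (g : GaussianInt) : cl (g / D.q) ≠ 0 := by
  intro h
  have h1 := cl_sq (D.not_isPoleK_div g)
  have e : (2 * (g / D.q) : ℂ) = ((2 * g : GaussianInt) : ℂ) / D.q := by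
    rw [map_mul, map_ofNat]; ring
  have h2 := sl_two_mul (D.not_isPoleK_div g) (by rw [e]; exact D.not_isPoleK_div _)
  rw [h] at h1 h2
  have h3 : sl (g / D.q) ^ 4 = 1 := by linear_combination h1
  have h4 : sl (2 * (g / D.q)) = 0 := by
    linear_combination h2 / 2 - sl (2 * (g / D.q)) / 2 * h3
  have h5 : D.red (2 * g) = 0 := by
    by_contra hh
    rw [e] at h4
    exact sl_ne_zero (D.not_isPoleK_div _) (D.not_isLat_div hh) h4
  have h6 : D.red g = 0 := by
    rw [map_mul, map_ofNat] at h5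
    exact (mul_eq_zero.1 h5).resolve_left D.two_ne_zero
  rw [red_eq_zero_iff] at h6
  obtain ⟨k, rfl⟩ := h6
  rw [map_mul, mul_div_cancel_left₀ _ D.q_coe_ne_zero, sl_lat (isLat_coe k)] at h3
  simp at h3

theorem phi4_div {g : GaussianInt} (hg : D.red g ≠ 0) : phi4 (g / D.q) = D.X (D.red g) := by
  rw [phi4_eq (D.not_isPoleK_div g) (D.not_isLat_div hg), ← X_red, mul_div_assoc (1 - I) (g : ℂ),
    sl_one_sub_I_mul (D.not_isPoleK_div g) _ (D.cl_div_ne_zero g)]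
  rw [← mul_div_assoc]; exact D.not_isPoleK_pt g

/-- The values of `ψ` at the division points. -/
def Ps (t : ZMod D.p) : ℂ := D.C t / (1 + D.X t ^ 2)

lemma one_add_X_sq_ne_zero (t : ZMod D.p) : 1 + D.X t ^ 2 ≠ 0 := by
  intro h
  have := D.C_sq t
  have h2 : D.X t ^ 2 = -1 := by linear_combination h
  rw [show D.X t ^ 4 = (D.X t ^ 2) ^ 2 by ring, h2] at this
  exact D.C_ne_zero t (by simpa using this)

theorem psi4_div {g : GaussianInt} (hg : D.red g ≠ 0) : psi4 (g / D.q) = D.Ps (D.red g) := by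
  have hv := D.not_isPoleK_div g
  have hl := D.not_isLat_div hg
  have hc := D.cl_div_ne_zero g
  have hs := sl_ne_zero hv hl
  have hv2 : ¬ IsPoleK ((1 - I) * (g / D.q)) := by
    rw [← mul_div_assoc]; exact D.not_isPoleK_pt g
  have hX := D.one_add_X_sq_ne_zero (D.red g)
  rw [Ps]
  rw [← X_red, mul_div_assoc, sl_one_sub_I_mul hv hv2 hc] at *
  rw [← C_red, mul_div_assoc, cl_one_sub_I_mul hv hv2 hc, psi4, wp4_eq hv hl]
  have hsq := cl_sq hv
  set s := sl (g / D.q)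
  set c := cl (g / D.q)
  have e : 1 + ((1 - I) * s / c) ^ 2 = (1 - I * s ^ 2) ^ 2 / c ^ 2 := by
    rw [eq_div_iff (pow_ne_zero 2 hc), div_pow, add_mul, div_mul_cancel₀ _ (pow_ne_zero 2 hc)]
    linear_combination hsq + (s ^ 2 - s ^ 4) * I_sq
  have hd : 1 - I * s ^ 2 ≠ 0 := by
    intro h; rw [e, h] at hX; simp at hX
  rw [e, div_div_div_cancel_right₀ (pow_ne_zero 2 hc), eq_div_iff (pow_ne_zero 2 hd)]
  have : (s ^ 2)⁻¹ - I = (1 - I * s ^ 2) / s ^ 2 := by field_simp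
  rw [this]
  have : (s ^ 2)⁻¹ + I = (1 + I * s ^ 2) / s ^ 2 := by field_simp
  rw [this, div_div_div_cancel_right₀ (pow_ne_zero 2 hs)]
  rw [pow_two (1 - I * s ^ 2), ← mul_assoc, div_mul_cancel₀ _ hd]
  linear_combination (-s ^ 4) * I_sq

end PrimaryPrime

namespace PrimaryPrime
variable (D : PrimaryPrime)

lemma exists_one_sub : ∃ g : GaussianInt, (1 - gI) * (2 * g) = 1 - D.q := by
  obtain ⟨k, hk⟩ := D.even_im
  obtain ⟨m, hm⟩ := D.odd_re
  obtain ⟨l, hl⟩ := D.primary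
  have h2 : ∀ g : GaussianInt, (2 * g).re = 2 * g.re ∧ (2 * g).im = 2 * g.im := fun g => by
    rw [two_mul, two_mul, two_mul]; exact ⟨rfl, rfl⟩
  refine ⟨⟨-l, -l - k⟩, ?_⟩
  ext
  · simp [gI, h2]; omega
  · simp [gI, h2]; omega

/-- A Gaussian integer with `2(1-i)g = 1 - q`. -/
def gq : GaussianInt := D.exists_one_sub.choose
lemma gq_spec : (1 - gI) * (2 * D.gq) = 1 - D.q := D.exists_one_sub.choose_spec
lemma gq_coe : (1 - I) * (2 * (D.gq : ℂ)) = 1 - D.q := by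
  have := congrArg GaussianInt.toComplex D.gq_spec
  simpa only [map_mul, map_sub, map_one, gI_coe, map_ofNat] using this

def j : ZMod D.p := (1 - D.iF)⁻¹
lemma j_mul : (1 - D.iF) * D.j = 1 := mul_inv_cancel₀ D.one_sub_iF_ne_zero
lemma red_gq : 2 * D.red D.gq = D.j := by
  have := congrArg D.red D.gq_spec
  simp only [map_mul, map_sub, map_one, red_gI, red_q, map_ofNat, sub_zero] at this
  apply mul_left_cancel₀ D.one_sub_iF_ne_zero
  rw [this, j_mul]

def fam (t : ZMod D.p) (w : ℂ) : ℂ := sl ((w + (1 - I) * (t.val : GaussianInt)) / D.q)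

lemma fam_red (g : GaussianInt) (w : ℂ) : sl ((w + (1 - I) * g) / D.q) = D.fam (D.red g) w := by
  obtain ⟨k, hk⟩ := D.exists_eq_of_red_eq (D.red_natCast_val (D.red g)).symm w
  rw [hk, sl_add_even, fam]

lemma fam_zero (t : ZMod D.p) : D.fam t 0 = D.X t := by rw [fam, X, zero_add]

lemma fam_add_one (t : ZMod D.p) (w : ℂ) : D.fam t (w + 1) = -D.fam (t + D.j) w := by
  obtain ⟨g, rfl⟩ := D.red_surjective t
  rw [← fam_red, ← red_gq, ← map_ofNat D.red, ← map_mul, ← map_add, ← fam_red, ← sl_add_one]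
  congr 1
  have := D.q_coe_ne_zero
  field_simp
  simp only [map_add, map_mul, map_ofNat]
  linear_combination -D.gq_coe

lemma fam_add_I (t : ZMod D.p) (w : ℂ) : D.fam t (w + I) = -D.fam (t + D.iF * D.j) w := by
  obtain ⟨g, rfl⟩ := D.red_surjective t
  rw [← fam_red, ← red_gq, ← map_ofNat D.red, ← red_gI, ← map_mul, ← map_mul, ← map_add,
    ← fam_red, ← sl_add_I]
  congr 1
  have := D.q_coe_ne_zero
  field_simp
  simp only [map_add, map_mul, map_ofNat, gI_coe]
  linear_combination -I * D.gq_coe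

lemma fam_half (t : ZMod D.p) : D.fam t (D.q / 2) = D.fam (t - D.red D.gq) (1 / 2) := by
  obtain ⟨g, rfl⟩ := D.red_surjective t
  rw [← fam_red, ← map_sub, ← fam_red]
  congr 2
  rw [map_sub]
  linear_combination D.gq_coe / 2

lemma not_isPoleK_pt_half (g : GaussianInt) : ¬ IsPoleK ((1 - I) * g / D.q + 1 / 2) := by
  intro h
  rw [isPoleK_iff_isLat] at h
  obtain ⟨k, hk⟩ := h.exists_coe
  have hq := D.q_coe_ne_zero
  have e : 2 * ((1 - I) * (g : ℂ)) = D.q * (I + 2 * k) := by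
    rw [← hk]; field_simp; ring
  have e2 : 2 * ((1 - gI) * g) = D.q * (gI + 2 * k) := by
    apply GaussianInt.toComplex_injective
    simp only [map_mul, map_sub, map_one, gI_coe, map_ofNat, map_add]
    exact e
  have h2 : ∀ g : GaussianInt, (2 * g).re = 2 * g.re ∧ (2 * g).im = 2 * g.im := fun g => by
    rw [two_mul, two_mul, two_mul]; exact ⟨rfl, rfl⟩
  have h3 := congrArg Zsqrtd.im e2
  obtain ⟨x, hx⟩ := D.odd_re
  obtain ⟨y, hy⟩ := D.even_im
  rw [(h2 _).2, Zsqrtd.im_mul, Zsqrtd.im_mul, Zsqrtd.im_add, Zsqrtd.re_add, (h2 _).1, (h2 _).2, hx, hy] at h3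
  simp [gI] at h3
  have h4 : (2 * x + 1) * (1 + 2 * k.im) = 2 * (x + 2 * x * k.im + k.im) + 1 := by ring
  have h5 : (y + y) * (2 * k.re) = 2 * (2 * y * k.re) := by ring
  rw [h4, h5] at h3
  omega

lemma Ps_eq (g : GaussianInt) : sl ((1 - I) * g / D.q + 1 / 2) = D.Ps (D.red g) := by
  have h := D.not_isPoleK_pt g
  have h2 := D.not_isPoleK_pt_half g
  have := sl_add h not_isPoleK_half h2
  rw [sl_half, cl_half] at this
  rw [Ps, eq_div_iff (D.one_add_X_sq_ne_zero _), ← X_red, ← C_red]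
  linear_combination this

lemma fam_half' (t : ZMod D.p) : D.fam t (D.q / 2) = D.Ps t := by
  obtain ⟨g, rfl⟩ := D.red_surjective t
  rw [← fam_red, ← Ps_eq]
  congr 1
  have := D.q_coe_ne_zero
  field_simp; ring

lemma fam_analyticAt (t : ZMod D.p) {w : ℂ} (h : ¬ IsPoleK ((w + (1 - I) * (t.val : GaussianInt)) / D.q)) :
    AnalyticAt ℂ (D.fam t) w := by
  have h1 : AnalyticAt ℂ (fun w => (w + (1 - I) * (t.val : GaussianInt)) / D.q) w :=
    (analyticAt_id.add analyticAt_const).div analyticAt_const D.q_coe_ne_zero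
  exact AnalyticAt.fun_comp (g := sl) (f := fun w => (w + (1 - I) * (t.val : GaussianInt)) / D.q) (sl_analyticAt h) h1

lemma fam_analyticAt' (t : ZMod D.p) {w : ℂ} (h : ¬ IsPoleK w) : AnalyticAt ℂ (D.fam t) w := by
  apply D.fam_analyticAt
  intro h1
  apply h
  rw [isPoleK_iff_isLat] at h1 ⊢
  obtain ⟨k, hk⟩ := h1.exists_coe
  have hq := D.q_coe_ne_zero
  have e : w - (1 + I) / 2 = ((D.q * k - (1 - gI) * (t.val : GaussianInt) - 2 * D.gq : GaussianInt) : ℂ) := by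
    simp only [map_sub, map_mul, map_one, gI_coe, map_ofNat]
    rw [← hk]; field_simp
    linear_combination (D.gq * 2) * I_sq + (1 + I) * D.gq_coe
  rw [e]; exact isLat_coe _

lemma fam_analyticAt_z {t : ZMod D.p} (h : 2 * t + 1 ≠ 0) : AnalyticAt ℂ (D.fam t) ((1 - I) / 2) := by
  apply D.fam_analyticAt
  intro h1
  apply h
  rw [isPoleK_iff_isLat] at h1
  obtain ⟨k, hk⟩ := h1.exists_coe
  have hq := D.q_coe_ne_zero
  have e : (1 - I) * (1 + 2 * ((t.val : GaussianInt) : ℂ)) = D.q * (1 + I + 2 * k) := by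
    rw [← hk]; field_simp; ring
  have e2 : (1 - gI) * (1 + 2 * (t.val : GaussianInt)) = D.q * (1 + gI + 2 * k) := by
    apply GaussianInt.toComplex_injective
    simp only [map_mul, map_sub, map_one, gI_coe, map_ofNat, map_add]
    exact e
  have e3 := congrArg D.red e2
  rw [map_mul, map_mul, red_q, zero_mul, map_sub, map_one, red_gI, map_add, map_one, map_mul,
    red_natCast_val, map_ofNat] at e3
  rw [add_comm]
  exact (mul_eq_zero.1 e3).resolve_left D.one_sub_iF_ne_zero

/-- The index of the singular translate. -/
def t0 : ZMod D.p := -2⁻¹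
lemma two_t0 : 2 * D.t0 = -1 := by rw [t0, mul_neg, mul_inv_cancel₀ D.two_ne_zero]

lemma fam_t0 (w : ℂ) : D.fam D.t0 w = sl ((D.q : ℂ)⁻¹ * w + ((1 - I) / 2 - (1 - I) / 2 / D.q)) := by
  have h : D.t0 = D.red (-(1 - gI) * D.gq) := by
    apply mul_left_cancel₀ D.two_ne_zero
    rw [two_t0, map_mul, map_neg, map_sub, map_one, red_gI, mul_left_comm, red_gq, neg_mul, j_mul]
  rw [h, ← fam_red]
  congr 1
  have := D.q_coe_ne_zero
  simp only [map_mul, map_neg, map_sub, map_one, gI_coe]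
  field_simp
  linear_combination -(1 - I) * D.gq_coe

lemma fam_t0_hasResidue :
    HasResidue (D.fam D.t0) ((1 - I) / 2) (D.q * (-1 / Real.pi / kser 0 (1 / 2))) := by
  have hq := D.q_coe_ne_zero
  have h1 : (D.q : ℂ)⁻¹ * ((1 - I) / 2) + ((1 - I) / 2 - (1 - I) / 2 / D.q) = (1 - I) / 2 := by
    field_simp; ring
  have h := HasResidue.comp_affine (f := sl) (z := (1 - I) / 2) (inv_ne_zero hq)
    (by rw [h1]; exact sl_hasResidue)
  rw [div_inv_eq_mul, mul_comm] at h
  exact h.congr (Eventually.of_forall fun w => (D.fam_t0 w).symm)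

lemma eq_t0 {t : ZMod D.p} : t = D.t0 ↔ 2 * t + 1 = 0 := by
  constructor
  · rintro rfl; rw [two_t0]; ring
  · intro h
    apply mul_left_cancel₀ D.two_ne_zero
    rw [two_t0]; linear_combination h

/-- The Fourier combination of the translates. -/
def famSum (c : ZMod D.p → ℂ) (w : ℂ) : ℂ := ∑ t, c t * D.fam t w

lemma famSum_analyticAt (c : ZMod D.p → ℂ) {w : ℂ} (h : ¬ IsPoleK w) :
    AnalyticAt ℂ (D.famSum c) w :=
  Finset.analyticAt_fun_sum _ fun t _ => analyticAt_const.mul (D.fam_analyticAt' t h)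

lemma famSum_hasResidue (c : ZMod D.p → ℂ) :
    HasResidue (D.famSum c) ((1 - I) / 2) (c D.t0 * (D.q * (-1 / Real.pi / kser 0 (1 / 2)))) := by
  have h : ∀ t ∈ (Finset.univ : Finset (ZMod D.p)), HasResidue (fun w => c t * D.fam t w) ((1 - I) / 2)
      (if t = D.t0 then c D.t0 * (D.q * (-1 / Real.pi / kser 0 (1 / 2))) else 0) := by
    intro t _
    split_ifs with ht
    · subst ht; exact D.fam_t0_hasResidue.const_mul _
    · rw [eq_t0] at ht
      exact (analyticAt_const.mul (D.fam_analyticAt_z ht)).hasResidue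
  have := HasResidue.sum h
  rw [Finset.sum_ite_eq' Finset.univ D.t0, if_pos (Finset.mem_univ _)] at this
  exact this

/-- A quarter system for the multiplicative group of the residue field. -/
structure IsQSet (S : Finset (ZMod D.p)) : Prop where
  inj : Set.InjOn (fun x : ZMod D.p × ℕ => D.iF ^ x.2 * x.1) (S ×ˢ Finset.range 4 : Finset _)
  img : (S ×ˢ Finset.range 4).image (fun x : ZMod D.p × ℕ => D.iF ^ x.2 * x.1) = Finset.univ.erase 0

variable {D}
lemma IsQSet.prod_eq {S : Finset (ZMod D.p)} (hS : D.IsQSet S) {M : Type*} [CommMonoid M]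
    (f : ZMod D.p → M) :
    ∏ t ∈ Finset.univ.erase 0, f t = ∏ ν ∈ S, ∏ k ∈ Finset.range 4, f (D.iF ^ k * ν) := by
  rw [← hS.img, Finset.prod_image hS.inj, Finset.prod_product]

lemma IsQSet.sum_eq {S : Finset (ZMod D.p)} (hS : D.IsQSet S) {M : Type*} [AddCommMonoid M]
    (f : ZMod D.p → M) :
    ∑ t ∈ Finset.univ.erase 0, f t = ∑ ν ∈ S, ∑ k ∈ Finset.range 4, f (D.iF ^ k * ν) := by
  rw [← hS.img, Finset.sum_image hS.inj, Finset.sum_product]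

lemma IsQSet.card {S : Finset (ZMod D.p)} (hS : D.IsQSet S) : D.p = 4 * S.card + 1 := by
  have h := congrArg Finset.card hS.img
  rw [Finset.card_image_of_injOn hS.inj, Finset.card_product, Finset.card_range,
    Finset.card_erase_of_mem (Finset.mem_univ _), Finset.card_univ, ZMod.card] at h
  have := D.p_pos
  omega

lemma IsQSet.ne_zero {S : Finset (ZMod D.p)} (hS : D.IsQSet S) {ν : ZMod D.p} (h : ν ∈ S) :
    ν ≠ 0 := by
  have : D.iF ^ 0 * ν ∈ Finset.univ.erase 0 := by
    rw [← hS.img]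
    exact Finset.mem_image_of_mem (fun x : ZMod D.p × ℕ => D.iF ^ x.2 * x.1)
      (Finset.mk_mem_product h (by simp : 0 ∈ Finset.range 4))
  simpa using this
variable (D)

lemma Ps_zero : D.Ps 0 = 1 := by rw [Ps, X_zero, C_zero]; simp
lemma Ps_neg (t : ZMod D.p) : D.Ps (-t) = D.Ps t := by rw [Ps, Ps, X_neg, C_neg, neg_sq]
lemma Ps_mul_iF (t : ZMod D.p) : D.Ps t * D.Ps (D.iF * t) = 1 := by
  have h1 := D.one_add_X_sq_ne_zero t
  have h2 := D.one_add_X_sq_ne_zero (D.iF * t)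
  rw [Ps, Ps, div_mul_div_comm, div_eq_one_iff_eq (mul_ne_zero h1 h2), C_iF, X_iF, mul_pow, I_sq]
  linear_combination D.C_sq t

lemma prod_range_four {M : Type*} [CommMonoid M] (f : ℕ → M) :
    ∏ k ∈ Finset.range 4, f k = f 0 * f 1 * f 2 * f 3 := by
  simp [Finset.prod_range_succ]

lemma iF_pow_two : D.iF ^ 2 = -1 := by rw [pow_two, iF_mul]
lemma iF_pow_three : D.iF ^ 3 = -D.iF := by rw [pow_succ, iF_pow_two]; ring

lemma prod_Ps {S : Finset (ZMod D.p)} (hS : D.IsQSet S) : ∏ t, D.Ps t = 1 := by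
  rw [← Finset.mul_prod_erase _ _ (Finset.mem_univ 0), Ps_zero, one_mul, hS.prod_eq]
  apply Finset.prod_eq_one
  intro ν _
  rw [prod_range_four, pow_zero, pow_one, iF_pow_two, iF_pow_three, one_mul, neg_mul, neg_mul,
    one_mul, Ps_neg, Ps_neg, mul_assoc, Ps_mul_iF, one_mul]

lemma half_q_eq : (D.q : ℂ) / 2 = 1 / 2 + (1 - I) * ((-D.gq : GaussianInt) : ℂ) := by
  rw [map_neg]; linear_combination D.gq_coe / 2

lemma norm_neg_one : ‖(-1 : ℂ)‖ = 1 := by simp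

lemma prod_fam {S : Finset (ZMod D.p)} (hS : D.IsQSet S) {w : ℂ} (hw : ¬ IsPoleK w) :
    ∏ t, D.fam t w = sl w := by
  have hodd := D.odd_p
  set c : ℂ := D.q * ∏ t ∈ Finset.univ.erase D.t0, D.fam t ((1 - I) / 2) with hc
  have key : ∀ v, ¬ IsPoleK v → ∏ t, D.fam t v - c * sl v = 0 := by
    apply ell_zero (M := -1) (N := -1) _ _ _ _ norm_neg_one norm_neg_one (by norm_num)
    · intro v hv
      exact (Finset.analyticAt_fun_prod _ fun t _ => D.fam_analyticAt' t hv).sub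
        (analyticAt_const.mul (sl_analyticAt hv))
    · have h1 : AnalyticAt ℂ (fun w => ∏ t ∈ Finset.univ.erase D.t0, D.fam t w) ((1 - I) / 2) := by
        apply Finset.analyticAt_fun_prod
        intro t ht
        apply D.fam_analyticAt_z
        rw [ne_eq, ← eq_t0]; exact (Finset.mem_erase.1 ht).1
      have h2 := D.fam_t0_hasResidue.analytic_mul h1
      have h3 := h2.add (sl_hasResidue.const_mul (-c))
      have e : (∏ t ∈ Finset.univ.erase D.t0, D.fam t ((1 - I) / 2)) * (D.q * (-1 / Real.pi / kser 0 (1 / 2)))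
        + -c * (-1 / Real.pi / kser 0 (1 / 2)) = 0 := by rw [hc]; ring
      rw [e] at h3
      apply h3.congr
      refine Eventually.of_forall fun w => ?_
      show _ = _ - _
      rw [← Finset.mul_prod_erase _ (fun t => D.fam t w) (Finset.mem_univ D.t0)]; ring
    · intro v
      have e := Equiv.prod_comp (Equiv.addRight D.j) (fun t => D.fam t v)
      simp only [Equiv.coe_addRight] at e
      rw [Finset.prod_congr rfl fun t _ => D.fam_add_one t v, sl_add_one, Finset.prod_neg,
        Finset.card_univ, ZMod.card, hodd.neg_one_pow, e]
      ring
    · intro v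
      have e := Equiv.prod_comp (Equiv.addRight (D.iF * D.j)) (fun t => D.fam t v)
      simp only [Equiv.coe_addRight] at e
      rw [Finset.prod_congr rfl fun t _ => D.fam_add_I t v, sl_add_I, Finset.prod_neg,
        Finset.card_univ, ZMod.card, hodd.neg_one_pow, e]
      ring
  have h1 : ¬ IsPoleK ((D.q : ℂ) / 2) := by
    rw [half_q_eq]
    have : IsLat ((1 - I) * ((-D.gq : GaussianInt) : ℂ)) := by
      rw [show (1 - I) * ((-D.gq : GaussianInt) : ℂ) = (((1 - gI) * -D.gq : GaussianInt) : ℂ) by simp]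
      exact isLat_coe _
    rw [isPoleK_add_lat_iff this]
    exact not_isPoleK_half
  have h2 := key _ h1
  rw [Finset.prod_congr rfl fun t _ => D.fam_half' t, D.prod_Ps hS, half_q_eq, sl_add_even, sl_half] at h2
  have h3 := key w hw
  have hc1 : c = 1 := by linear_combination -h2
  rw [hc1] at h3
  linear_combination h3

theorem prod_X {S : Finset (ZMod D.p)} (hS : D.IsQSet S) : ∏ t ∈ Finset.univ.erase 0, D.X t = D.q := by
  have hq := D.q_coe_ne_zero
  have h1 : Tendsto (fun w => ∏ t ∈ Finset.univ.erase 0, D.fam t w) (𝓝[≠] 0)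
      (𝓝 (∏ t ∈ Finset.univ.erase 0, D.X t)) := by
    apply tendsto_finsetProd
    intro t _
    rw [← fam_zero]
    exact (D.fam_analyticAt' t not_isPoleK_zero).continuousAt.tendsto.mono_left nhdsWithin_le_nhds
  have h2 : Tendsto (fun w : ℂ => w / D.q) (𝓝[≠] 0) (𝓝[≠] 0) := by
    apply tendsto_nhdsWithin_of_tendsto_nhds_of_eventually_within
    · have : ContinuousAt (fun w : ℂ => w / D.q) 0 := by fun_prop
      have := this.tendsto
      rw [zero_div] at this
      exact this.mono_left nhdsWithin_le_nhds
    · filter_upwards [self_mem_nhdsWithin] with w hw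
      exact div_ne_zero hw hq
  have h3 := (tendsto_sl_div.comp h2).mul h1
  have h4 : Tendsto (fun w => D.q * (sl w / w)) (𝓝[≠] 0) (𝓝 (D.q * slL)) := tendsto_sl_div.const_mul _
  have h5 : (fun w => sl (w / D.q) / (w / D.q) * ∏ t ∈ Finset.univ.erase 0, D.fam t w)
      =ᶠ[𝓝[≠] 0] fun w => D.q * (sl w / w) := by
    filter_upwards [self_mem_nhdsWithin, nhdsWithin_le_nhds (eventually_not_isPoleK not_isPoleK_zero)] with w hw hw2
    have := D.prod_fam hS hw2
    rw [← Finset.mul_prod_erase _ _ (Finset.mem_univ 0)] at this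
    have e : D.fam 0 w = sl (w / D.q) := by rw [fam]; simp
    rw [e] at this
    rw [← this]
    have : w ≠ 0 := hw
    field_simp
  have h6 := tendsto_nhds_unique (h3.congr' h5) h4
  apply mul_left_cancel₀ slL_ne_zero
  rw [h6]; ring

end PrimaryPrime

namespace PrimaryPrime
variable (D : PrimaryPrime)

/-- The standard additive character of the residue field. -/
def E (x : ZMod D.p) : ℂ := ZMod.stdAddChar x

lemma E_add (x y : ZMod D.p) : D.E (x + y) = D.E x * D.E y := AddChar.map_add_eq_mul _ _ _
lemma E_zero : D.E 0 = 1 := AddChar.map_zero_eq_one _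
lemma E_intCast (m : ℤ) : D.E m = exp (2 * Real.pi * I * m / D.p) := ZMod.stdAddChar_coe m
lemma E_neg (x : ZMod D.p) : D.E (-x) = (D.E x)⁻¹ := by
  have := D.E_add x (-x)
  rw [add_neg_cancel, E_zero] at this
  exact eq_inv_of_mul_eq_one_right this.symm
lemma E_pow_p (x : ZMod D.p) : D.E x ^ D.p = 1 := by
  rw [E, ← AddChar.map_nsmul_eq_pow, nsmul_eq_mul, CharP.cast_eq_zero, zero_mul,
    AddChar.map_zero_eq_one]
lemma E_norm (x : ZMod D.p) : ‖D.E x‖ = 1 := norm_eq_one_of_pow_eq_one (D.E_pow_p x) D.p_pos.ne'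
lemma E_conj (x : ZMod D.p) : starRingEnd ℂ (D.E x) = D.E (-x) := by
  rw [E_neg, Complex.inv_eq_conj (D.E_norm x)]
lemma neg_E_ne_one (x : ZMod D.p) : -D.E x ≠ 1 := by
  intro h
  have h1 : D.E x = -1 := by rw [← h, neg_neg]
  have h2 := D.E_pow_p x
  rw [h1, D.odd_p.neg_one_pow] at h2
  norm_num at h2

lemma exists_lift : ∃ m : ℤ, Odd m ∧ (m : ZMod D.p) = D.iF := by
  rcases Nat.even_or_odd D.iF.val with h | h
  · refine ⟨D.iF.val + D.p, ?_, by simp⟩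
    exact_mod_cast h.add_odd D.odd_p
  · exact ⟨D.iF.val, by exact_mod_cast h, by simp⟩

/-- An odd integer congruent to `i`. -/
def Iz : ℤ := D.exists_lift.choose
lemma Iz_odd : Odd D.Iz := D.exists_lift.choose_spec.1
lemma Iz_cast : (D.Iz : ZMod D.p) = D.iF := D.exists_lift.choose_spec.2

/-- The integer frequency attached to `a`. -/
def frq (a : ZMod D.p) : ℤ := (a * D.j).valMinAbs
lemma frq_cast (a : ZMod D.p) : (D.frq a : ZMod D.p) = a * D.j := ZMod.coe_valMinAbs _
/-- The dual point attached to `a`. -/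
def ypt (a : ZMod D.p) : ℂ := D.frq a * (I - D.Iz) / D.p

lemma ypt_im (a : ZMod D.p) : (D.ypt a).im = D.frq a / D.p := by
  have h : D.ypt a = ((-(D.frq a * D.Iz) / D.p : ℝ) : ℂ) + ((D.frq a / D.p : ℝ) : ℂ) * I := by
    rw [ypt]; push_cast; ring
  rw [h]; simp

lemma ypt_im_lt (a : ZMod D.p) : |(D.ypt a).im| < 1 / 2 := by
  rw [ypt_im, abs_div, Nat.abs_cast]
  have hp : (0 : ℝ) < D.p := by exact_mod_cast D.p_pos
  rw [div_lt_div_iff₀ hp two_pos]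
  have h := ZMod.natAbs_valMinAbs_le (a * D.j)
  obtain ⟨k, hk⟩ := D.odd_p
  have h2 : (D.frq a).natAbs * 2 < D.p := by
    have : (D.frq a).natAbs ≤ D.p / 2 := h
    omega
  have h3 : |(D.frq a : ℝ)| = ((D.frq a).natAbs : ℝ) := by
    rw [Nat.cast_natAbs, Int.cast_abs]
  rw [h3, one_mul]
  exact_mod_cast h2

lemma famSum_add_one (a : ZMod D.p) (v : ℂ) : D.famSum (fun t => D.E (-(a * t))) (v + 1) =
    -exp (2 * Real.pi * I * D.frq a / D.p) * D.famSum (fun t => D.E (-(a * t))) v := by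
  have e := Equiv.sum_comp (Equiv.addRight D.j) (fun t => D.E (-(a * t)) * D.fam t v)
  simp only [Equiv.coe_addRight] at e
  rw [famSum, famSum, ← e, Finset.mul_sum]
  apply Finset.sum_congr rfl
  intro t _
  rw [fam_add_one, ← E_intCast, frq_cast,
    show -(a * t) = -(a * (t + D.j)) + a * D.j by ring, E_add]
  ring

lemma famSum_add_I (a : ZMod D.p) (v : ℂ) : D.famSum (fun t => D.E (-(a * t))) (v + I) =
    -exp (2 * Real.pi * I * (D.frq a * D.Iz) / D.p) * D.famSum (fun t => D.E (-(a * t))) v := by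
  have e := Equiv.sum_comp (Equiv.addRight (D.iF * D.j)) (fun t => D.E (-(a * t)) * D.fam t v)
  simp only [Equiv.coe_addRight] at e
  rw [famSum, famSum, ← e, Finset.mul_sum]
  apply Finset.sum_congr rfl
  intro t _
  rw [fam_add_I, ← Int.cast_mul, ← E_intCast, Int.cast_mul, frq_cast, Iz_cast,
    show -(a * t) = -(a * (t + D.iF * D.j)) + a * D.j * D.iF by ring, E_add]
  ring

lemma famSum_eq (a : ZMod D.p) {v : ℂ} (hv : ¬ IsPoleK v) : D.famSum (fun t => D.E (-(a * t))) v =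
    D.q / kser 0 (1 / 2) * (exp (2 * Real.pi * I * D.frq a / D.p * v) * kser (D.ypt a) v) := by
  have hy := D.ypt_im_lt a
  have hp := D.p_ne_zero
  suffices key : ∀ v, ¬ IsPoleK v → D.famSum (fun t => D.E (-(a * t))) v -
      D.q / kser 0 (1 / 2) * (exp (2 * Real.pi * I * D.frq a / D.p * v) * kser (D.ypt a) v) = 0 from
    sub_eq_zero.1 (key v hv)
  have hexp : ∀ v, AnalyticAt ℂ (fun v => exp (2 * Real.pi * I * D.frq a / D.p * v)) v := fun v =>
    (analyticAt_const.mul analyticAt_id).cexp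
  apply ell_zero (M := -exp (2 * Real.pi * I * D.frq a / D.p))
    (N := -exp (2 * Real.pi * I * (D.frq a * D.Iz) / D.p))
  · intro v hv
    exact (D.famSum_analyticAt _ hv).sub
      (analyticAt_const.mul ((hexp v).mul (kser_analyticAt hy hv)))
  · have h1 := (kser_hasResidue hy).analytic_mul (hexp _)
    have h2 := (D.famSum_hasResidue (fun t => D.E (-(a * t)))).add
      (h1.const_mul (-(D.q / kser 0 (1 / 2))))
    have e0 : D.E (-(a * D.t0)) = exp (Real.pi * I * (D.frq a * (1 - D.Iz)) / D.p) := by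
      obtain ⟨k, hk⟩ := D.Iz_odd
      have : -(a * D.t0) = ((-(D.frq a * k) : ℤ) : ZMod D.p) := by
        apply mul_left_cancel₀ D.two_ne_zero
        have h3 : (D.iF : ZMod D.p) = 2 * k + 1 := by rw [← Iz_cast, hk]; push_cast; ring
        have h4 := D.j_mul
        push_cast; rw [frq_cast]
        linear_combination (-a) * D.two_t0 - a * h4 - a * D.j * h3
      rw [this, E_intCast, hk]
      congr 1; push_cast; ring
    have e1 : exp (2 * Real.pi * I * D.frq a / D.p * ((1 - I) / 2)) * exp (Real.pi * I * D.ypt a) =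
        exp (Real.pi * I * (D.frq a * (1 - D.Iz)) / D.p) := by
      rw [← Complex.exp_add]; congr 1; rw [ypt]; ring
    have e : D.E (-(a * D.t0)) * (D.q * (-1 / Real.pi / kser 0 (1 / 2))) +
        -(D.q / kser 0 (1 / 2)) * (exp (2 * Real.pi * I * D.frq a / D.p * ((1 - I) / 2)) *
          (-exp (Real.pi * I * D.ypt a) / Real.pi)) = 0 := by
      rw [e0, ← e1]; ring
    rw [e] at h2
    apply h2.congr
    refine Eventually.of_forall fun w => ?_
    show _ = _ - _
    ring
  · intro v
    rw [famSum_add_one, kser_add_one, mul_add, mul_one, Complex.exp_add]; ring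
  · intro v
    rw [famSum_add_I, kser_add_I, mul_add, Complex.exp_add]
    have : exp (2 * Real.pi * I * (D.frq a * D.Iz) / D.p) =
        exp (2 * Real.pi * I * D.frq a / D.p * I) * exp (-(2 * Real.pi * I * D.ypt a)) := by
      rw [← Complex.exp_add]; congr 1; rw [ypt]; ring
    rw [this]; ring
  · rw [norm_neg, ← E_intCast, E_norm]
  · rw [norm_neg, ← Int.cast_mul, ← E_intCast, E_norm]
  · rw [← E_intCast]; exact D.neg_E_ne_one _

/-- The dual parameter attached to `ν`. -/
def cb : ZMod D.p := D.red (star D.q)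

lemma exists_tau : ∃ g k : GaussianInt, gI - D.Iz = D.q * star ((1 - gI) * g) ∧
    g + D.q = (1 - gI) * k := by
  have h : D.red (gI - D.Iz) = 0 := by rw [map_sub, red_gI, map_intCast, Iz_cast, sub_self]
  rw [red_eq_zero_iff] at h
  obtain ⟨t, ht⟩ := h
  have h1 := congrArg Zsqrtd.re ht
  have h2 := congrArg Zsqrtd.im ht
  obtain ⟨a, ha⟩ := D.even_im
  obtain ⟨b, hb⟩ := D.odd_re
  obtain ⟨c, hc⟩ := D.Iz_odd
  rw [Zsqrtd.re_mul, ha, hb] at h1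
  rw [Zsqrtd.im_mul, ha, hb] at h2
  simp [gI] at h1 h2
  rw [hc] at h1
  have hx : Odd t.re := by
    rw [← Int.not_even_iff_odd]
    rintro ⟨x, hx⟩
    rw [hx] at h1
    have : -(2 * c + 1) = 2 * ((2 * b + 1) * x - a * t.im) := by linear_combination h1
    omega
  have hy : Odd t.im := by
    rw [← Int.not_even_iff_odd]
    rintro ⟨x, hx⟩
    rw [hx] at h2
    have : 1 = 2 * ((2 * b + 1) * x + a * t.re) := by linear_combination h2
    omega
  obtain ⟨x, hx⟩ := hx
  obtain ⟨y, hy⟩ := hy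
  refine ⟨⟨x + y + 1, x - y⟩, ⟨y + b + 1 - a, x + b + 1 + a⟩, ?_, ?_⟩
  · rw [ht]; congr 1
    ext
    · simp [gI]; omega
    · simp [gI]; omega
  · ext
    · simp [gI]; omega
    · simp [gI]; omega

end PrimaryPrime

lemma isPoleK_one_add_I_mul {u : ℂ} (hv : ¬ IsPoleK ((1 + I) * u)) :
    ¬ IsPoleK (u + 1 / 2) ∧ ¬ IsPoleK (u - I / 2) := by
  have hl : IsLat (1 + I) := isLat_one.add isLat_I
  constructor
  · intro h
    apply hv
    rw [isPoleK_iff_isLat] at h ⊢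
    have := (hl.mul h).sub (isLat_one)
    rwa [show (1 + I) * (u + 1 / 2 - (1 + I) / 2) - 1 = (1 + I) * u - (1 + I) / 2 by
      linear_combination (-1 / 2) * I_sq] at this
  · intro h
    apply hv
    rw [isPoleK_iff_isLat] at h ⊢
    have := (hl.mul h).add isLat_I |>.sub isLat_one
    rwa [show (1 + I) * (u - I / 2 - (1 + I) / 2) + I - 1 = (1 + I) * u - (1 + I) / 2 by
      linear_combination (-1) * I_sq] at this

lemma kser_half {v : ℂ} (hv : ¬ IsPoleK v) : kser (1 / 2) v =
    kser 0 (1 / 2) * ((1 + I) / 2) * (sl ((1 - I) / 2 * v + 1 / 2) + sl ((1 - I) / 2 * v - I / 2)) := by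
  have key : ∀ v, ¬ IsPoleK v → kser (1 / 2) v - kser 0 (1 / 2) * ((1 + I) / 2) *
      (sl ((1 - I) / 2 * v + 1 / 2) + sl ((1 - I) / 2 * v - I / 2)) = 0 := by
    have hy : |(1 / 2 : ℂ).im| < 1 / 2 := by norm_num
    apply ell_zero (M := -1) (N := 1) _ _ _ _ (by simp) (by simp) (by norm_num)
    · intro v hv
      have h := isPoleK_one_add_I_mul (u := (1 - I) / 2 * v) (by
        rwa [show (1 + I) * ((1 - I) / 2 * v) = v by linear_combination (-v / 2) * I_sq])
      have h1 : AnalyticAt ℂ (fun v => (1 - I) / 2 * v + 1 / 2) v :=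
        (analyticAt_const.mul analyticAt_id).add analyticAt_const
      have h2 : AnalyticAt ℂ (fun v => (1 - I) / 2 * v - I / 2) v :=
        (analyticAt_const.mul analyticAt_id).sub analyticAt_const
      exact (kser_analyticAt hy hv).sub (analyticAt_const.mul
        ((AnalyticAt.fun_comp (g := sl) (f := fun v => (1 - I) / 2 * v + 1 / 2) (sl_analyticAt h.1) h1).add
        (AnalyticAt.fun_comp (g := sl) (f := fun v => (1 - I) / 2 * v - I / 2) (sl_analyticAt h.2) h2)))
    · have hi : (1 - I) / 2 ≠ 0 := by
        intro h; have := congrArg Complex.re h; simp at this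
      have e1 : (1 - I) / 2 * ((1 - I) / 2) + 1 / 2 = (1 - I) / 2 := by
        linear_combination (1 / 4) * I_sq
      have e2 : (1 - I) / 2 * ((1 - I) / 2) - I / 2 = -I := by
        linear_combination (1 / 4) * I_sq
      have h1 := HasResidue.comp_affine (f := sl) (z := (1 - I) / 2) (b := 1 / 2) hi
        (by rw [e1]; exact sl_hasResidue)
      have h2 : AnalyticAt ℂ (fun v => (1 - I) / 2 * v - I / 2) ((1 - I) / 2) :=
        (analyticAt_const.mul analyticAt_id).sub analyticAt_const
      have h3 := (AnalyticAt.fun_comp (g := sl) (f := fun v => (1 - I) / 2 * v - I / 2)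
        (sl_analyticAt (by show ¬ IsPoleK _; simp only [e2]; exact not_isPoleK_of_isLat isLat_I.neg)) h2).hasResidue
      have h4 := (kser_hasResidue hy).add ((h1.add h3).const_mul (-(kser 0 (1 / 2) * ((1 + I) / 2))))
      have e5 : exp (Real.pi * I * (1 / 2)) = I := by
        rw [show (Real.pi : ℂ) * I * (1 / 2) = Real.pi / 2 * I by ring, Complex.exp_pi_div_two_mul_I]
      have hp : (Real.pi : ℂ) ≠ 0 := by exact_mod_cast Real.pi_ne_zero
      have hi2 : (1 - I) ≠ 0 := by
        intro h; apply hi; rw [h]; simp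
      have e : -exp (Real.pi * I * (1 / 2)) / Real.pi + -(kser 0 (1 / 2) * ((1 + I) / 2)) *
          (-1 / Real.pi / kser 0 (1 / 2) / ((1 - I) / 2) + 0) = 0 := by
        have := k0_half_ne
        rw [e5]; field_simp; linear_combination 2 * I_sq
      rw [e] at h4
      apply h4.congr
      refine Eventually.of_forall fun w => ?_
      show _ = _ - _
      ring
    · intro v
      rw [kser_add_one]
      have e1 : sl ((1 - I) / 2 * (v + 1) + 1 / 2) = -sl ((1 - I) / 2 * v - I / 2) := by
        rw [← sl_add_one]; congr 1; ring
      have e2 : sl ((1 - I) / 2 * (v + 1) - I / 2) = -sl ((1 - I) / 2 * v + 1 / 2) := by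
        have := sl_add_I ((1 - I) / 2 * (v + 1) - I / 2)
        rw [show (1 - I) / 2 * (v + 1) - I / 2 + I = (1 - I) / 2 * v + 1 / 2 by ring] at this
        rw [this, neg_neg]
      rw [e1, e2]; ring
    · intro v
      rw [kser_add_I]
      have e1 : sl ((1 - I) / 2 * (v + I) + 1 / 2) = sl ((1 - I) / 2 * v - I / 2) := by
        rw [← neg_neg (sl ((1 - I) / 2 * v - I / 2)), ← sl_add_one, ← sl_add_I]
        congr 1; linear_combination (-1 / 2) * I_sq
      have e2 : sl ((1 - I) / 2 * (v + I) - I / 2) = sl ((1 - I) / 2 * v + 1 / 2) := by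
        congr 1; linear_combination (-1 / 2) * I_sq
      have e3 : exp (-(2 * Real.pi * I * (1 / 2))) = -1 := by
        rw [Complex.exp_neg, show 2 * (Real.pi : ℂ) * I * (1 / 2) = Real.pi * I by ring,
          Complex.exp_pi_mul_I]; norm_num
      rw [e1, e2, e3]; ring
  exact sub_eq_zero.1 (key v hv)

namespace PrimaryPrime
variable (D : PrimaryPrime)

lemma exists_dual : ∃ g k : GaussianInt, g + D.q = (1 - gI) * k ∧
    (∀ a, D.ypt a = starRingEnd ℂ ((1 - I) * ((D.frq a * g : GaussianInt) : ℂ) / D.q)) ∧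
    (∀ ν, D.red (D.frq (D.cb * ν) * g : GaussianInt) = ν) := by
  obtain ⟨g, k, h1, h2⟩ := D.exists_tau
  refine ⟨g, k, h2, fun a => ?_, fun ν => ?_⟩
  · have e := congrArg GaussianInt.toComplex h1
    simp only [map_mul, map_sub, gI_coe, map_intCast, GaussianInt.toComplex_star, map_one] at e
    rw [ypt, e, ← coe_mul_conj]
    have h3 := D.q_coe_ne_zero
    have h4 : starRingEnd ℂ (D.q : ℂ) ≠ 0 := (map_ne_zero _).2 h3
    simp only [map_div₀, map_mul, map_sub, map_one, map_intCast]
    rw [mul_div_assoc, mul_div_mul_left _ _ h3]; ring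
  · have e := congrArg star h1
    rw [star_mul, star_star, star_sub] at e
    have e2 : star gI = -gI := by ext <;> simp [gI]
    have e3 : star (D.Iz : GaussianInt) = D.Iz := by ext <;> simp
    rw [e2, e3] at e
    have e4 := congrArg D.red e
    rw [map_sub, map_neg, red_gI, map_intCast, Iz_cast, map_mul, map_mul, map_sub, map_one, red_gI,
      ← cb] at e4
    rw [map_mul, map_intCast, frq_cast]
    linear_combination (-D.j ^ 2 * ν) * e4 - D.cb * ν * D.j * D.red g * D.j_mul +
      ν * ((1 - D.iF) * D.j + 1) * D.j_mul - ν * D.j ^ 2 * D.iF_mul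

theorem X_dual (ν : ZMod D.p) :
    ∑ t, D.E (-(D.cb * ν * t)) * D.X t = D.q * starRingEnd ℂ (D.X ν) := by
  have h := D.famSum_eq (D.cb * ν) not_isPoleK_zero
  obtain ⟨g, k, -, h1, h2⟩ := D.exists_dual
  rw [famSum, mul_zero, Complex.exp_zero, one_mul, kser_symm (D.ypt_im_lt _) (by norm_num)] at h
  simp only [fam_zero] at h
  rw [h, ← h2 ν, ← X_red, sl_conj, ← h1, h2, sl]
  ring

lemma sl_add_intCast (v : ℂ) (n : ℤ) : sl (v + n) = (-1) ^ n * sl v := by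
  induction n with
  | zero => simp
  | succ n ih =>
    push_cast at ih ⊢
    rw [← add_assoc, sl_add_one, ih, zpow_add_one₀ (by norm_num)]; ring
  | pred n ih =>
    push_cast at ih ⊢
    have := sl_add_one (v + (-n - 1))
    rw [show v + (-n - 1 : ℂ) + 1 = v + -n by ring, ih] at this
    rw [zpow_sub_one₀ (by norm_num)]
    rw [← neg_eq_iff_eq_neg] at this
    rw [← this]; norm_num

lemma ypt_not_isPoleK (a : ZMod D.p) : ¬ IsPoleK (D.ypt a) := by
  rintro ⟨m, n, h⟩
  have h1 := D.ypt_im_lt a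
  rw [h] at h1
  simp at h1
  rw [abs_lt] at h1
  have h2 : (-1 : ℝ) < n := by linarith [h1.1]
  have h3 : (n : ℝ) < 0 := by linarith [h1.2]
  have h4 : -1 < n := by exact_mod_cast h2
  have h5 : n < 0 := by exact_mod_cast h3
  omega

lemma E_half_exp (a : ZMod D.p) :
    D.E (-(a * D.red D.gq)) * exp (2 * Real.pi * I * D.frq a / D.p * (1 / 2)) = (-1) ^ (D.frq a) := by
  obtain ⟨m, hm⟩ := D.odd_p
  have h1 : -(a * D.red D.gq) = ((-(D.frq a * (m + 1)) : ℤ) : ZMod D.p) := by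
    apply mul_left_cancel₀ D.two_ne_zero
    have h2 : (2 * m + 1 : ZMod D.p) = 0 := by
      have := congrArg (Nat.cast : ℕ → ZMod D.p) hm
      rw [CharP.cast_eq_zero] at this
      rw [this]; push_cast; ring
    push_cast
    rw [frq_cast]
    linear_combination (-a) * D.red_gq + a * D.j * h2
  have hp := D.p_ne_zero
  have e : 2 * (Real.pi : ℂ) * I * ((-(D.frq a * (m + 1)) : ℤ) : ℂ) / D.p +
      2 * Real.pi * I * D.frq a / D.p * (1 / 2) = ((-D.frq a : ℤ) : ℂ) * (Real.pi * I) := by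
    have : (D.p : ℂ) = 2 * m + 1 := by exact_mod_cast hm
    field_simp; push_cast; rw [this]; ring
  rw [h1, E_intCast, ← Complex.exp_add, e, Complex.exp_int_mul, Complex.exp_pi_mul_I, zpow_neg,
    ← inv_zpow, inv_neg_one]

theorem Ps_dual (ν : ZMod D.p) :
    ∑ t, D.E (-(D.cb * ν * t)) * D.Ps t =
      D.q * starRingEnd ℂ ((1 - I) / 2 * (D.Ps (D.j * ν) + I * D.Ps (D.iF * (D.j * ν)))) := by
  have h := D.famSum_eq (D.cb * ν) not_isPoleK_half
  obtain ⟨g, k, h0, h1, h2⟩ := D.exists_dual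
  rw [kser_symm (D.ypt_im_lt _) (by norm_num), kser_half (D.ypt_not_isPoleK _)] at h
  have e1 : ∑ t, D.E (-(D.cb * ν * t)) * D.Ps t =
      D.E (-(D.cb * ν * D.red D.gq)) * D.famSum (fun t => D.E (-(D.cb * ν * t))) (1 / 2) := by
    have e := Equiv.sum_comp (Equiv.subRight (D.red D.gq)) (fun t => D.E (-(D.cb * ν * t)) * D.fam t (1 / 2))
    simp only [Equiv.subRight_apply] at e
    rw [famSum, ← e, Finset.mul_sum]
    apply Finset.sum_congr rfl
    intro t _
    rw [← fam_half', fam_half, ← mul_assoc, ← E_add]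
    congr 2; ring
  set n := D.frq (D.cb * ν) with hn
  have hq := D.q_coe_ne_zero
  have e2 : (1 - I) / 2 * D.ypt (D.cb * ν) = starRingEnd ℂ (n * g / D.q) := by
    rw [h1, ← hn]
    simp only [map_div₀, map_mul, map_sub, map_one, conj_I, map_intCast]
    linear_combination (-(n * starRingEnd ℂ (g : ℂ) / starRingEnd ℂ (D.q : ℂ)) / 2) * I_sq
  have e3 : (n * g / D.q : ℂ) + n = (1 - I) * ((n * k : GaussianInt) : ℂ) / D.q := by
    have := congrArg GaussianInt.toComplex h0
    simp only [map_mul, map_sub, gI_coe, map_one, map_add] at this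
    rw [map_mul, map_intCast]
    field_simp; linear_combination (n : ℂ) * this
  have hr : D.red (n * k) = D.j * ν := by
    have h3 := congrArg D.red h0
    have h4 := h2 ν
    rw [map_mul, map_sub, red_gI, map_add, red_q, map_one, add_zero] at h3
    rw [map_mul, h3] at h4
    rw [map_mul]
    linear_combination D.j * h4 - D.red n * D.red k * D.j_mul
  have e4 : sl ((1 - I) / 2 * D.ypt (D.cb * ν) + 1 / 2) =
      (-1) ^ n * starRingEnd ℂ (D.Ps (D.j * ν)) := by
    have h5 := sl_add_intCast (n * g / D.q + 1 / 2) n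
    rw [add_right_comm, e3, Ps_eq, hr] at h5
    have h6 := congrArg (starRingEnd ℂ) h5
    rw [map_mul, map_zpow₀, map_neg, map_one, sl_conj, map_add, ← e2] at h6
    have h7 : starRingEnd ℂ (1 / 2 : ℂ) = 1 / 2 := by simp [map_ofNat]
    rw [h7] at h6
    rw [h6, ← mul_assoc, ← mul_zpow]; norm_num
  have e5 : sl ((1 - I) / 2 * D.ypt (D.cb * ν) - I / 2) =
      (-1) ^ n * starRingEnd ℂ (I * D.Ps (D.iF * (D.j * ν))) := by
    have h5 := sl_add_intCast (n * g / D.q + I / 2) n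
    have h8 : (1 - I) * ((n * k : GaussianInt) : ℂ) / D.q + I / 2 =
      I * ((1 - I) * ((-(gI * (n * k)) : GaussianInt) : ℂ) / D.q + 1 / 2) := by
      rw [map_neg, map_mul _ gI, gI_coe]
      linear_combination ((1 - I) * ((n * k : GaussianInt) : ℂ) / D.q) * I_sq
    rw [add_right_comm, e3, h8, sl_I_mul (D.not_isPoleK_pt_half _), Ps_eq, map_neg, map_mul D.red gI,
      red_gI, hr, Ps_neg] at h5
    have h6 := congrArg (starRingEnd ℂ) h5
    rw [map_mul (starRingEnd ℂ) (_ ^ _), map_zpow₀, map_neg, map_one, sl_conj, map_add, ← e2] at h6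
    have h7 : starRingEnd ℂ (I / 2 : ℂ) = -(I / 2) := by simp [map_ofNat]; ring
    rw [h7, ← sub_eq_add_neg] at h6
    rw [h6, ← mul_assoc, ← mul_zpow]; norm_num
  rw [e1, h, e4, e5]
  have e6 := D.E_half_exp (D.cb * ν)
  have e7 : ((-1 : ℂ) ^ n) * (-1) ^ n = 1 := by rw [← mul_zpow]; norm_num
  have e8 : starRingEnd ℂ ((1 - I) / 2) = (1 + I) / 2 := by simp [map_ofNat]
  rw [map_mul _ ((1 - I) / 2), e8, map_add]
  have hK := inv_mul_cancel₀ k0_half_ne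
  rw [← hn] at e6
  generalize starRingEnd ℂ (D.Ps (D.j * ν)) = c1
  generalize starRingEnd ℂ (I * D.Ps (D.iF * (D.j * ν))) = c2
  rw [div_eq_mul_inv]
  linear_combination (D.q * ((1 + I) / 2) * (c1 + c2)) *
    (D.E (-(D.cb * ν * D.red D.gq)) * exp (2 * Real.pi * I * n / D.p * (1 / 2)) * (-1) ^ n * hK +
      (-1) ^ n * e6 + e7)

end PrimaryPrime

/-- The regular part of the Weierstrass zeta function of `ℤ[i]` at the origin. -/
def zetaReg (u : ℂ) : ℂ :=
  ∑' l : gaussPair.lattice, if l.1 = 0 then 0 else (1 / (u - l) + 1 / l + u / l ^ 2)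

lemma zetaReg_bound (r : ℝ) (hr : 0 < r) (s : ℂ) (hs : ‖s‖ < r) (l : ℂ) (h : 2 * r ≤ ‖l‖) :
    ‖1 / (s - l) + 1 / l + s / l ^ 2‖ ≤ 2 * r ^ 2 * ‖l‖ ^ (-3 : ℝ) := by
  have h0 : 0 < ‖l‖ := by linarith
  have hl : l ≠ 0 := norm_pos_iff.1 h0
  have h1 : ‖l‖ / 2 ≤ ‖s - l‖ := by
    rw [norm_sub_rev]
    exact .trans (by linarith) (norm_sub_norm_le l s)
  have hsl : s - l ≠ 0 := norm_pos_iff.1 (by linarith)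
  have e : 1 / (s - l) + 1 / l + s / l ^ 2 = s ^ 2 / (l ^ 2 * (s - l)) := by
    field_simp; ring
  have e2 : ‖l‖ ^ (-3 : ℝ) = (‖l‖ ^ 3)⁻¹ := by
    rw [Real.rpow_neg h0.le]; norm_cast
  rw [e, e2, norm_div, norm_mul, norm_pow, norm_pow, ← div_eq_mul_inv,
    div_le_div_iff₀ (by positivity) (by positivity)]
  have h2 : ‖s‖ ^ 2 ≤ r ^ 2 := by gcongr
  calc ‖s‖ ^ 2 * ‖l‖ ^ 3 ≤ r ^ 2 * ‖l‖ ^ 3 := by gcongr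
    _ = 2 * r ^ 2 * (‖l‖ ^ 2 * (‖l‖ / 2)) := by ring
    _ ≤ _ := by gcongr

lemma hasSumLocallyUniformly_zetaReg : HasSumLocallyUniformly
    (fun (l : gaussPair.lattice) (u : ℂ) =>
      if l.1 = 0 then 0 else (1 / (u - l) + 1 / l + u / l ^ 2)) zetaReg := by
  refine gaussPair.hasSumLocallyUniformly_aux (u := fun r l => 2 * r ^ 2 * ‖l‖ ^ (-3 : ℝ)) _
    (fun _ _ => (ZLattice.summable_norm_rpow _ _ (by simp; norm_num)).mul_left _) fun r hr =>
    Filter.eventually_atTop.mpr ⟨2 * r, ?_⟩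
  rintro _ h s hs l rfl
  split_ifs
  · rw [norm_zero]; positivity
  · exact zetaReg_bound r hr s hs l h

lemma hasSum_zetaReg (u : ℂ) : HasSum (fun l : gaussPair.lattice =>
    if l.1 = 0 then 0 else (1 / (u - l) + 1 / l + u / l ^ 2)) (zetaReg u) :=
  hasSumLocallyUniformly_zetaReg.hasSum

lemma differentiableAt_zeta_term {z : ℂ} {l : gaussPair.lattice}
    (hz : z ∈ ((gaussPair.lattice : Set ℂ) \ {0})ᶜ) :
    DifferentiableAt ℂ (fun u : ℂ => if l.1 = 0 then 0 else (1 / (u - l) + 1 / l + u / l ^ 2)) z := by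
  by_cases hl : l.1 = 0
  · simp only [hl, if_true]; fun_prop
  · simp only [hl, if_false]
    have : z - l ≠ 0 := by
      intro e
      apply hz
      rw [sub_eq_zero.1 e]
      exact ⟨l.2, hl⟩
    have d1 : DifferentiableAt ℂ (fun u : ℂ => 1 / (u - l)) z :=
      (differentiableAt_const _).div (differentiableAt_id.sub_const _) this
    exact (d1.add_const _).fun_add (differentiableAt_id.div_const _)

lemma isOpen_zetaReg : IsOpen ((gaussPair.lattice : Set ℂ) \ {0})ᶜ :=
  gaussPair.isOpen_compl_lattice_sdiff

lemma differentiableOn_zetaReg : DifferentiableOn ℂ zetaReg ((gaussPair.lattice : Set ℂ) \ {0})ᶜ := by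
  refine hasSumLocallyUniformly_zetaReg.hasSumLocallyUniformlyOn.differentiableOn
    (.of_forall fun s => .fun_sum fun i _ => ?_) isOpen_zetaReg
  exact fun z hz => (differentiableAt_zeta_term hz).differentiableWithinAt

lemma deriv_zetaReg {z : ℂ} (hz : z ∈ ((gaussPair.lattice : Set ℂ) \ {0})ᶜ) :
    deriv zetaReg z = -gaussPair.weierstrassPExcept 0 z := by
  have h := hasSumLocallyUniformly_zetaReg.tendstoLocallyUniformlyOn.deriv
    (.of_forall fun s => .fun_sum fun i _ z hz => (differentiableAt_zeta_term hz).differentiableWithinAt)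
    isOpen_zetaReg
  have h1 := h.tendsto_at hz
  refine tendsto_nhds_unique h1 ?_
  have h2 := (gaussPair.hasSum_weierstrassPExcept 0 z).neg
  refine h2.congr fun s => ?_
  simp only [Function.comp_apply]
  rw [deriv_fun_sum (fun i _ => differentiableAt_zeta_term hz)]
  refine Finset.sum_congr rfl fun l _ => ?_
  by_cases hl : l.1 = 0
  · have : (l : ℂ) = ((0 : ℂ)) := hl
    simp [hl]
  · have hzl : z - l ≠ 0 := by
      intro e
      apply hz
      rw [sub_eq_zero.1 e]
      exact ⟨l.2, hl⟩
    simp only [hl, if_false]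
    have d1 : HasDerivAt (fun u : ℂ => 1 / (u - l)) (-(1 / (z - l) ^ 2)) z := by
      have := ((hasDerivAt_id z).sub_const (l : ℂ)).fun_inv hzl
      simpa [neg_div] using this
    have d2 : HasDerivAt (fun u : ℂ => u / (l : ℂ) ^ 2) (1 / (l : ℂ) ^ 2) z :=
      (hasDerivAt_id z).div_const _
    rw [((d1.add_const (1 / (l : ℂ))).fun_add d2).deriv]
    ring

lemma zetaReg_neg (u : ℂ) : zetaReg (-u) = -zetaReg u := by
  have h := (Equiv.neg gaussPair.lattice).hasSum_iff.2 (hasSum_zetaReg (-u))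
  refine h.unique ((hasSum_zetaReg u).neg.congr_fun ?_)
  intro l
  simp only [Function.comp_apply, Equiv.neg_apply, NegMemClass.coe_neg, neg_eq_zero]
  by_cases hl : l.1 = 0
  · simp [hl]
  · rw [if_neg hl, if_neg hl, show -u - -(l : ℂ) = -(u - l) by ring, div_neg, div_neg, neg_sq]; ring

lemma zetaReg_I_mul (u : ℂ) : zetaReg (I * u) = -I * zetaReg u := by
  let e : gaussPair.lattice ≃ gaussPair.lattice :=
    { toFun := fun l => ⟨I * l, mem_gauss.2 (isLat_I.mul (mem_gauss.1 l.2))⟩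
      invFun := fun l => ⟨-(I * l), mem_gauss.2 (isLat_I.mul (mem_gauss.1 l.2)).neg⟩
      left_inv := fun l => by ext; simp [← mul_assoc]
      right_inv := fun l => by ext; simp [← mul_assoc] }
  have h := e.hasSum_iff.2 (hasSum_zetaReg (I * u))
  refine h.unique (((hasSum_zetaReg u).mul_left (-I)).congr_fun ?_)
  intro l
  have he : ((e l : gaussPair.lattice) : ℂ) = I * l := rfl
  simp only [Function.comp_apply, he, mul_eq_zero, I_ne_zero, false_or]
  by_cases hl : l.1 = 0
  · simp [hl]
  · have hi : (1 : ℂ) / I = -I := by rw [one_div, inv_I]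
    have hi2 : I / I ^ 2 = -I := by rw [I_sq]; ring
    rw [if_neg hl, if_neg hl, ← mul_sub, mul_pow, mul_div_mul_comm, hi2]
    simp only [one_div, mul_inv, inv_I]
    ring

/-- The Weierstrass zeta function of the lattice `ℤ[i]`. -/
def wz (u : ℂ) : ℂ := 1 / u + zetaReg u

lemma wz_neg (u : ℂ) : wz (-u) = -wz u := by rw [wz, wz, zetaReg_neg, div_neg]; ring

lemma wz_I_mul (u : ℂ) : wz (I * u) = -I * wz u := by
  rw [wz, wz, zetaReg_I_mul, one_div, mul_inv, inv_I]; ring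

lemma isLat_zetaReg {z : ℂ} (hz : ¬ IsLat z) : z ∈ ((gaussPair.lattice : Set ℂ) \ {0})ᶜ :=
  fun h => hz (mem_gauss.1 h.1)

lemma zetaReg_analyticAt {z : ℂ} (hz : z ∈ ((gaussPair.lattice : Set ℂ) \ {0})ᶜ) :
    AnalyticAt ℂ zetaReg z :=
  differentiableOn_zetaReg.analyticAt (isOpen_zetaReg.mem_nhds hz)

lemma wz_analyticAt {z : ℂ} (hz : ¬ IsLat z) : AnalyticAt ℂ wz z := by
  have h0 : z ≠ 0 := by rintro rfl; exact hz isLat_zero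
  exact (analyticAt_const.div analyticAt_id h0).add (zetaReg_analyticAt (isLat_zetaReg hz))

lemma wz_hasDerivAt {z : ℂ} (hz : ¬ IsLat z) : HasDerivAt wz (-gaussPair.weierstrassP z) z := by
  have h0 : z ≠ 0 := by rintro rfl; exact hz isLat_zero
  have h1 := (zetaReg_analyticAt (isLat_zetaReg hz)).differentiableAt.hasDerivAt
  rw [deriv_zetaReg (isLat_zetaReg hz)] at h1
  have h2 := (hasDerivAt_inv h0).fun_add h1
  have h3 : -gaussPair.weierstrassP z = -(z ^ 2)⁻¹ + -gaussPair.weierstrassPExcept 0 z := by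
    have := gaussPair.weierstrassPExcept_def 0 z
    simp at this
    rw [this]; ring
  rw [h3]
  refine h2.congr_of_eventuallyEq (Eventually.of_forall fun w => ?_)
  simp [wz]

lemma wz_hasResidue : HasResidue wz 0 1 := by
  have h0 : (0 : ℂ) ∈ ((gaussPair.lattice : Set ℂ) \ {0})ᶜ := by simp
  have h1 : HasResidue (fun u : ℂ => 1 / u) 0 1 := by
    refine ⟨?_, ?_⟩
    · exact analyticAt_const.meromorphicAt.div analyticAt_id.meromorphicAt
    · refine tendsto_const_nhds.congr' ?_
      filter_upwards [self_mem_nhdsWithin] with w hw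
      have hw' : w ≠ 0 := hw
      rw [sub_zero, one_div, mul_inv_cancel₀ hw']
  have := h1.add (zetaReg_analyticAt h0).hasResidue
  rw [add_zero] at this
  exact this

lemma not_isLat_add_one {z : ℂ} (hz : ¬ IsLat z) : ¬ IsLat (z + 1) := by
  intro h
  apply hz
  have := h.sub isLat_one
  rwa [add_sub_cancel_right] at this

lemma exists_quasiperiod : ∃ η : ℂ, ∀ z, ¬ IsLat z → wz (z + 1) = wz z + η := by
  have hpc : IsPreconnected {v | IsLat v}ᶜ :=
    (countable_isLat.isPathConnected_compl_of_one_lt_rank (by simp)).isConnected.isPreconnected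
  have hd : ∀ z, ¬ IsLat z → HasDerivAt (fun z => wz (z + 1) - wz z) 0 z := by
    intro z hz
    have h1 := (wz_hasDerivAt (not_isLat_add_one hz)).comp_add_const z 1
    have h2 := h1.fun_sub (wz_hasDerivAt hz)
    have := gaussPair.weierstrassP_add_coe z ⟨1, mem_gauss.2 isLat_one⟩
    change gaussPair.weierstrassP (z + 1) = _ at this
    rw [this, sub_self] at h2
    exact h2
  obtain ⟨η, hη⟩ := isClosed_isLat.isOpen_compl.exists_is_const_of_deriv_eq_zero hpc
    (fun z hz => (hd z hz).differentiableAt.differentiableWithinAt) (fun z hz => (hd z hz).deriv)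
  exact ⟨η, fun z hz => by rw [← hη z hz]; ring⟩

lemma isLat_eq_zero_of_small {v : ℂ} (h : IsLat v) (h1 : |v.re| ≤ 1 / 2) (h2 : |v.im| ≤ 1 / 2) :
    v = 0 := by
  obtain ⟨m, n, rfl⟩ := h
  simp at h1 h2
  have aux : ∀ k : ℤ, |(k : ℝ)| ≤ 1 / 2 → k = 0 := by
    intro k hk
    rw [← Int.cast_abs] at hk
    have : |k| < 1 := by
      have : ((|k| : ℤ) : ℝ) < 1 := lt_of_le_of_lt hk (by norm_num)
      exact_mod_cast this
    exact Int.abs_lt_one_iff.1 this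
  rw [aux m (by linarith), aux n (by linarith)]; simp

lemma not_isLat_half_add_I (y : ℝ) : ¬ IsLat (-1 / 2 + y * I) := by
  rintro ⟨m, n, h⟩
  have := congrArg Complex.re h
  simp at this
  have h2 : (2 * m : ℝ) = -1 := by rw [← this]; norm_num
  have h3 : (2 * m : ℤ) = -1 := by exact_mod_cast h2
  omega

lemma zetaReg_edge_integral : ∫ y in (-1 / 2 : ℝ)..(1 / 2), zetaReg (1 / 2 + y * I) = 0 := by
  set J := ∫ y in (-1 / 2 : ℝ)..(1 / 2), zetaReg (1 / 2 + y * I) with hJ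
  have hJn : ∫ y in (-1 / 2 : ℝ)..(1 / 2), zetaReg (1 / 2 - y * I) = J := by
    have := intervalIntegral.integral_comp_neg (a := -1 / 2) (b := 1 / 2)
      (fun y : ℝ => zetaReg (1 / 2 - y * I))
    rw [show -(1 / 2 : ℝ) = -1 / 2 by norm_num, show -(-1 / 2 : ℝ) = 1 / 2 by norm_num] at this
    rw [← this, hJ]
    congr 1; funext y; congr 1; push_cast; ring
  have h := Complex.integral_boundary_rect_eq_zero_of_differentiableOn zetaReg
    (⟨-1 / 2, -1 / 2⟩ : ℂ) (⟨1 / 2, 1 / 2⟩ : ℂ) (by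
      refine differentiableOn_zetaReg.mono ?_
      rintro z hz ⟨hz1, hz2⟩
      apply hz2
      rw [mem_reProdIm, Set.uIcc_of_le (by norm_num)] at hz
      obtain ⟨⟨a, b⟩, c, d⟩ := hz
      exact isLat_eq_zero_of_small (mem_gauss.1 hz1) (abs_le.2 ⟨by linarith, by linarith⟩)
        (abs_le.2 ⟨by linarith, by linarith⟩))
  simp only [smul_eq_mul] at h
  have e1 : ∀ x : ℝ, zetaReg (x + ((-1 / 2 : ℝ) : ℂ) * I) = I * zetaReg (1 / 2 + x * I) := by
    intro x
    have := zetaReg_I_mul (1 / 2 + x * I)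
    rw [show I * zetaReg (1 / 2 + x * I) = -zetaReg (I * (1 / 2 + x * I)) by rw [this]; ring,
      ← zetaReg_neg]
    congr 1; push_cast; linear_combination (x : ℂ) * I_sq
  have e2 : ∀ x : ℝ, zetaReg (x + ((1 / 2 : ℝ) : ℂ) * I) = -I * zetaReg (1 / 2 - x * I) := by
    intro x
    rw [← zetaReg_I_mul]
    congr 1; push_cast; linear_combination (x : ℂ) * I_sq
  have e3 : ∀ y : ℝ, zetaReg (((-1 / 2 : ℝ) : ℂ) + y * I) = -zetaReg (1 / 2 - y * I) := by
    intro y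
    rw [← zetaReg_neg]; congr 1; push_cast; ring
  have e4 : ∀ y : ℝ, zetaReg (((1 / 2 : ℝ) : ℂ) + y * I) = zetaReg (1 / 2 + y * I) := by
    intro y; push_cast; rfl
  simp only [e1, e2, e3, e4, intervalIntegral.integral_const_mul, intervalIntegral.integral_neg] at h
  rw [hJn, ← hJ] at h
  have h2 : (4 * I) * J = 0 := by linear_combination h
  exact (mul_eq_zero.1 h2).resolve_left (by simp)

lemma wz_add_one {z : ℂ} (hz : ¬ IsLat z) : wz (z + 1) = wz z + Real.pi := by
  obtain ⟨η, hη⟩ := exists_quasiperiod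
  have key : ∀ y : ℝ, zetaReg (1 / 2 + y * I) + zetaReg (1 / 2 - y * I) =
      η - ((4 * (1 + (2 * y) ^ 2)⁻¹ : ℝ) : ℂ) := by
    intro y
    have h := hη _ (not_isLat_half_add_I y)
    have h2 := wz_neg (1 / 2 - y * I)
    rw [show -(1 / 2 - y * I : ℂ) = -1 / 2 + y * I by ring] at h2
    rw [show (-1 / 2 + y * I + 1 : ℂ) = 1 / 2 + y * I by ring, h2, wz, wz] at h
    have h3 : (1 / (1 / 2 + y * I) + 1 / (1 / 2 - y * I) : ℂ) = ((4 * (1 + (2 * y) ^ 2)⁻¹ : ℝ) : ℂ) := by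
      have a1 : (1 / 2 + y * I : ℂ) ≠ 0 := by
        intro h; have := congrArg Complex.re h; simp at this
      have a2 : (1 / 2 - y * I : ℂ) ≠ 0 := by
        intro h; have := congrArg Complex.re h; simp at this
      have a3 : (1 + (2 * y) ^ 2 : ℂ) ≠ 0 := by
        have : (1 + (2 * y) ^ 2 : ℝ) ≠ 0 := by positivity
        exact_mod_cast this
      push_cast
      rw [div_add_div _ _ a1 a2, ← div_eq_mul_inv, div_eq_div_iff (mul_ne_zero a1 a2) a3]
      linear_combination (4 * (y : ℂ) ^ 2) * I_sq
    rw [← h3]; linear_combination h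
  have hc : ContinuousOn (fun y : ℝ => zetaReg (1 / 2 + y * I)) (Set.uIcc (-1 / 2) (1 / 2)) := by
    intro y _
    have hl : ¬ IsLat (1 / 2 + y * I : ℂ) := by
      have := not_isLat_add_one (not_isLat_half_add_I y)
      rwa [show (-1 / 2 + y * I + 1 : ℂ) = 1 / 2 + y * I by ring] at this
    have h1 := (zetaReg_analyticAt (isLat_zetaReg hl)).continuousAt
    exact (ContinuousAt.comp (f := fun y : ℝ => (1 / 2 + y * I : ℂ)) h1
      (by fun_prop)).continuousWithinAt
  have hc2 : ContinuousOn (fun y : ℝ => zetaReg (1 / 2 - y * I)) (Set.uIcc (-1 / 2) (1 / 2)) := by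
    have : (fun y : ℝ => zetaReg (1 / 2 - y * I)) =
        (fun y : ℝ => zetaReg (1 / 2 + y * I)) ∘ (fun y => -y) := by
      funext y; simp only [Function.comp]; congr 1; push_cast; ring
    rw [this]
    refine hc.comp (by fun_prop) ?_
    intro y hy
    rw [Set.uIcc_of_le (by norm_num)] at *
    constructor <;> linarith [hy.1, hy.2]
  have h0 := zetaReg_edge_integral
  have h0n : ∫ y in (-1 / 2 : ℝ)..(1 / 2), zetaReg (1 / 2 - y * I) = 0 := by
    have := intervalIntegral.integral_comp_neg (a := -1 / 2) (b := 1 / 2)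
      (fun y : ℝ => zetaReg (1 / 2 - y * I))
    rw [show -(1 / 2 : ℝ) = -1 / 2 by norm_num, show -(-1 / 2 : ℝ) = 1 / 2 by norm_num] at this
    rw [← this, ← h0]
    congr 1; funext y; congr 1; push_cast; ring
  have h1 := intervalIntegral.integral_add hc.intervalIntegrable hc2.intervalIntegrable (μ := MeasureTheory.volume)
  simp only [key] at h1
  have hcr : Continuous (fun y : ℝ => 4 * (1 + (2 * y) ^ 2)⁻¹) :=
    continuous_const.mul (Continuous.inv₀ (by fun_prop) (fun y => by positivity))
  have hci : Continuous (fun y : ℝ => ((4 * (1 + (2 * y) ^ 2)⁻¹ : ℝ) : ℂ)) :=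
    continuous_ofReal.comp hcr
  rw [h0, h0n, intervalIntegral.integral_sub (by simp) (hci.intervalIntegrable _ _), intervalIntegral.integral_const,
    intervalIntegral.integral_ofReal, intervalIntegral.integral_const_mul,
    intervalIntegral.integral_comp_mul_left (fun y : ℝ => (1 + y ^ 2)⁻¹) two_ne_zero,
    integral_inv_one_add_sq] at h1
  rw [show (2 * (1 / 2) : ℝ) = 1 by norm_num, show (2 * (-1 / 2) : ℝ) = -1 by norm_num,
    Real.arctan_neg, Real.arctan_one] at h1
  have h2 : η = Real.pi := by
    simp at h1
    norm_num at h1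
    linear_combination h1
  rw [hη z hz, h2]

/-- The doubly periodic modification of the Weierstrass zeta function of `ℤ[i]`. -/
def Zs (u : ℂ) : ℂ := wz u - Real.pi * starRingEnd ℂ u

lemma Zs_neg (u : ℂ) : Zs (-u) = -Zs u := by rw [Zs, Zs, wz_neg, map_neg]; ring
lemma wz_add_I {z : ℂ} (hz : ¬ IsLat z) : wz (z + I) = wz z - Real.pi * I := by
  have hz' : ¬ IsLat (-(I * z)) := by
    intro h
    apply hz
    have := isLat_I.mul h
    rwa [show I * -(I * z) = z by linear_combination (-z) * I_sq] at this
  have h := wz_add_one hz'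
  have h1 := wz_I_mul (-(I * z) + 1)
  have h2 := wz_I_mul (-(I * z))
  rw [show I * (-(I * z) + 1) = z + I by linear_combination (-z) * I_sq] at h1
  rw [show I * -(I * z) = z by linear_combination (-z) * I_sq] at h2
  rw [h1, h, h2]; ring

lemma Zs_add_one {z : ℂ} (hz : ¬ IsLat z) : Zs (z + 1) = Zs z := by
  rw [Zs, Zs, wz_add_one hz, map_add, map_one]; ring
lemma Zs_add_I {z : ℂ} (hz : ¬ IsLat z) : Zs (z + I) = Zs z := by
  rw [Zs, Zs, wz_add_I hz, map_add, conj_I]; ring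

lemma IsLat.of_add {z l : ℂ} (hl : IsLat l) (h : IsLat (z + l)) : IsLat z := by
  have := h.sub hl
  rwa [add_sub_cancel_right] at this

lemma Zs_add_lat {z l : ℂ} (hz : ¬ IsLat z) (hl : IsLat l) : Zs (z + l) = Zs z := by
  have step : ∀ (w : ℂ), IsLat w → (∀ z, ¬ IsLat z → Zs (z + w) = Zs z) → ∀ (n : ℤ) (z : ℂ), ¬ IsLat z →
      Zs (z + n * w) = Zs z := by
    intro w hw h n
    induction n using Int.induction_on with
    | zero => intro z _; simp
    | succ k ih =>
      intro z hz
      rw [show z + ((k : ℤ) + 1 : ℤ) * w = z + (k : ℤ) * w + w by push_cast; ring, h, ih z hz]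
      exact fun hh => hz (IsLat.of_add ((isLat_int _).mul hw) hh)
    | pred k ih =>
      intro z hz
      rw [← ih z hz, ← h (z + (-(k : ℤ) - 1 : ℤ) * w)]
      · congr 1; push_cast; ring
      · exact fun hh => hz (IsLat.of_add ((isLat_int _).mul hw) hh)
  obtain ⟨m, n, rfl⟩ := hl
  rw [← add_assoc, step I isLat_I (fun z => Zs_add_I), ← mul_one (m : ℂ),
    step 1 isLat_one (fun z => Zs_add_one) m z hz]
  exact fun hh => hz (IsLat.of_add (isLat_int _) hh)

lemma Z4_eq (u : ℂ) : Z4 u = slL⁻¹ * Zs u := by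
  have hL := slL_ne_zero
  have h := latE.hasSum_iff.2 (hasSum_zetaReg u)
  have h5 : HasSum (fun m : ℤ × ℤ => if m = 0 then 0 else
      ((slL * u - ω4 m)⁻¹ + (ω4 m)⁻¹ + slL * u * ((ω4 m) ^ 2)⁻¹)) (slL⁻¹ * zetaReg u) := by
    refine (h.mul_left slL⁻¹).congr_fun ?_
    intro m
    simp only [Function.comp]
    by_cases hm : m = 0
    · rw [if_pos hm, hm, latE_zero, if_pos rfl, mul_zero]
    · have : (latE m : ℂ) ≠ 0 := by
        intro h0
        apply hm
        apply latE.injective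
        apply Subtype.ext
        rw [h0, latE_zero]
      rw [if_neg hm, if_neg this, ω4_eq, ← mul_sub, mul_pow, mul_inv, mul_inv, mul_inv]
      have := inv_mul_cancel₀ hL
      linear_combination (slL⁻¹ * u * ((latE m : ℂ) ^ 2)⁻¹) * this
  rw [Z4, wzeta4, varpi_cast, h5.tsum_eq, Zs, wz, ofReal_div, varpi_cast, mul_inv]
  ring

open Classical in
def Zp (u : ℂ) : ℂ := if IsLat u then 0 else Zs u

lemma Zp_lat {u : ℂ} (h : IsLat u) : Zp u = 0 := if_pos h
lemma Zp_eq {u : ℂ} (h : ¬ IsLat u) : Zp u = Zs u := if_neg h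

lemma isLat_neg_iff {u : ℂ} : IsLat (-u) ↔ IsLat u :=
  ⟨fun h => by simpa using h.neg, fun h => h.neg⟩
lemma isLat_add_iff {u l : ℂ} (hl : IsLat l) : IsLat (u + l) ↔ IsLat u :=
  ⟨IsLat.of_add hl, fun h => h.add hl⟩

lemma Zp_neg (u : ℂ) : Zp (-u) = -Zp u := by
  by_cases h : IsLat u
  · rw [Zp_lat h, Zp_lat (isLat_neg_iff.2 h), neg_zero]
  · rw [Zp_eq h, Zp_eq (isLat_neg_iff.not.2 h), Zs_neg]
lemma Zp_add_lat (u : ℂ) {l : ℂ} (hl : IsLat l) : Zp (u + l) = Zp u := by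
  by_cases h : IsLat u
  · rw [Zp_lat h, Zp_lat (h.add hl)]
  · rw [Zp_eq h, Zp_eq ((isLat_add_iff hl).not.2 h), Zs_add_lat h hl]

lemma not_isLat_of_not_isPoleK {v : ℂ} (hv : ¬ IsPoleK v) :
    ¬ IsLat ((1 - I) / 2 * v - 1 / 2) ∧ ¬ IsLat ((1 - I) / 2 * v + I / 2) := by
  have hl : IsLat (1 + I) := isLat_one.add isLat_I
  constructor
  · intro h
    apply hv
    rw [isPoleK_iff_isLat]
    convert hl.mul h using 1
    linear_combination (v / 2) * I_sq
  · intro h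
    apply hv
    rw [isPoleK_iff_isLat]
    convert (hl.mul h).sub isLat_I using 1
    linear_combination (v / 2 - 1 / 2) * I_sq

lemma eventually_not_isPoleK_punctured (v : ℂ) : ∀ᶠ w in 𝓝[≠] v, ¬ IsPoleK w := by
  have h := eventually_not_isLat_punctured (v - (1 + I) / 2)
  have ht : Tendsto (fun w => w - (1 + I) / 2) (𝓝[≠] v) (𝓝[≠] (v - (1 + I) / 2)) := by
    apply tendsto_nhdsWithin_of_tendsto_nhds_of_eventually_within
    · exact ((continuous_id.sub continuous_const).tendsto v).mono_left nhdsWithin_le_nhds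
    · filter_upwards [self_mem_nhdsWithin] with w hw
      intro h; apply hw; exact sub_left_injective h
  filter_upwards [ht.eventually h] with w hw
  rwa [isPoleK_iff_isLat]

lemma delta_half_ne : (1 - I) / 2 ≠ 0 := by
  intro h; have := congrArg Complex.re h; simp at this

lemma wz_minus_analyticAt {v : ℂ} (h : ¬ IsLat ((1 - I) / 2 * v - 1 / 2)) :
    AnalyticAt ℂ (fun v => wz ((1 - I) / 2 * v - 1 / 2)) v :=
  AnalyticAt.fun_comp (g := wz) (f := fun v => (1 - I) / 2 * v - 1 / 2) (wz_analyticAt h)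
    ((analyticAt_const.mul analyticAt_id).sub analyticAt_const)
lemma wz_plus_analyticAt {v : ℂ} (h : ¬ IsLat ((1 - I) / 2 * v + I / 2)) :
    AnalyticAt ℂ (fun v => wz ((1 - I) / 2 * v + I / 2)) v :=
  AnalyticAt.fun_comp (g := wz) (f := fun v => (1 - I) / 2 * v + I / 2) (wz_analyticAt h)
    ((analyticAt_const.mul analyticAt_id).add analyticAt_const)

lemma wz_plus_hasResidue :
    HasResidue (fun v => wz ((1 - I) / 2 * v + I / 2)) ((1 - I) / 2) (1 + I) := by
  have e : (1 - I) / 2 * ((1 - I) / 2) + I / 2 = 0 := by linear_combination (1 / 4) * I_sq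
  have := HasResidue.comp_affine (f := wz) (z := (1 - I) / 2) (b := I / 2) delta_half_ne
    (by rw [e]; exact wz_hasResidue)
  rwa [show (1 : ℂ) / ((1 - I) / 2) = 1 + I by
    rw [div_eq_iff delta_half_ne]; linear_combination (1 / 2) * I_sq] at this

lemma not_isLat_neg_delta : ¬ IsLat ((1 - I) / 2 * ((1 - I) / 2) - 1 / 2) := by
  rintro ⟨m, n, h⟩
  have := congrArg Complex.re h
  simp at this
  have h2 : ((2 * m : ℤ) : ℝ) = ((-1 : ℤ) : ℝ) := by push_cast; linarith
  have h3 : 2 * m = -1 := by exact_mod_cast h2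
  omega

lemma wz_minus_hasResidue :
    HasResidue (fun v => wz ((1 - I) / 2 * v - 1 / 2)) ((1 - I) / 2) 0 :=
  (wz_minus_analyticAt not_isLat_neg_delta).hasResidue

lemma slL_eq : slL = -I * Real.pi * kser 0 (1 / 2) := by
  have h1 := tendsto_sl_div
  have h2 := sl_residue_delta.2
  have h3 : Tendsto (fun w : ℂ => -I) (𝓝[≠] 0) (𝓝 (slL * (1 / Real.pi / kser 0 (1 / 2)))) := by
    refine (h1.mul h2).congr' ?_
    filter_upwards [self_mem_nhdsWithin, eventually_not_isLat_punctured 0,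
      eventually_not_isPoleK_punctured 0] with w hw hl hp
    have hw' : w ≠ 0 := hw
    rw [sub_zero, ← sl_mul_delta hp hl]
    field_simp
  have h4 := tendsto_nhds_unique h3 tendsto_const_nhds
  have hp : (Real.pi : ℂ) ≠ 0 := by exact_mod_cast Real.pi_ne_zero
  have := k0_half_ne
  field_simp at h4
  linear_combination h4

lemma Zs_sub_eq (v : ℂ) :
    Zs ((1 - I) / 2 * v - 1 / 2) - Zs ((1 - I) / 2 * v + I / 2) =
      wz ((1 - I) / 2 * v - 1 / 2) - wz ((1 - I) / 2 * v + I / 2) + Real.pi * ((1 - I) / 2) := by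
  simp [Zs, map_ofNat]
  ring

lemma Zs_sub_half {v : ℂ} (hv : ¬ IsPoleK v) :
    Zs ((1 - I) / 2 * v - 1 / 2) - Zs ((1 - I) / 2 * v + I / 2) = -(1 - I) * slL * sl v := by
  have hZ : ∀ {w}, ¬ IsPoleK w → Zp ((1 - I) / 2 * w - 1 / 2) - Zp ((1 - I) / 2 * w + I / 2) =
      wz ((1 - I) / 2 * w - 1 / 2) - wz ((1 - I) / 2 * w + I / 2) + Real.pi * ((1 - I) / 2) := by
    intro w hw
    obtain ⟨h1, h2⟩ := not_isLat_of_not_isPoleK hw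
    rw [← Zs_sub_eq, Zp_eq h1, Zp_eq h2]
  have key : ∀ v, ¬ IsPoleK v → Zp ((1 - I) / 2 * v - 1 / 2) - Zp ((1 - I) / 2 * v + I / 2)
      + (1 - I) * slL * sl v = 0 := by
    apply ell_zero (M := -1) (N := -1) _ _ _ _ (by simp) (by simp) (by norm_num)
    · intro v hv
      obtain ⟨h1, h2⟩ := not_isLat_of_not_isPoleK hv
      have h3 : AnalyticAt ℂ (fun v => wz ((1 - I) / 2 * v - 1 / 2) - wz ((1 - I) / 2 * v + I / 2)
          + Real.pi * ((1 - I) / 2) + (1 - I) * slL * sl v) v :=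
        (((wz_minus_analyticAt h1).sub (wz_plus_analyticAt h2)).add analyticAt_const).add
          (analyticAt_const.mul (sl_analyticAt hv))
      refine h3.congr ?_
      filter_upwards [eventually_not_isPoleK hv] with w hw
      rw [hZ hw]
    · have h := ((wz_minus_hasResidue.add (wz_plus_hasResidue.const_mul (-1))).add
        (analyticAt_const (v := (Real.pi : ℂ) * ((1 - I) / 2))).hasResidue).add
        (sl_hasResidue.const_mul ((1 - I) * slL))
      have e : 0 + -1 * (1 + I) + 0 + (1 - I) * slL * (-1 / Real.pi / kser 0 (1 / 2)) = 0 := by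
        have hp : (Real.pi : ℂ) ≠ 0 := by exact_mod_cast Real.pi_ne_zero
        have := k0_half_ne
        rw [slL_eq]; field_simp; linear_combination -I_sq
      rw [e] at h
      apply h.congr
      filter_upwards [eventually_not_isPoleK_punctured ((1 - I) / 2)] with w hw
      rw [hZ hw]; ring
    · intro w
      rw [sl_add_one]
      have e1 := Zp_add_lat ((1 - I) / 2 * w + I / 2) isLat_I.neg
      have e2 := Zp_add_lat ((1 - I) / 2 * w - 1 / 2) isLat_one
      rw [← e1, ← e2]
      ring_nf
    · intro w
      rw [sl_add_I]
      have e2 := Zp_add_lat ((1 - I) / 2 * w - 1 / 2) (isLat_one.add isLat_I)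
      rw [← e2]
      have a1 : (1 - I) / 2 * (w + I) - 1 / 2 = (1 - I) / 2 * w + I / 2 := by
        linear_combination (-1 / 2) * I_sq
      have a2 : (1 - I) / 2 * (w + I) + I / 2 = (1 - I) / 2 * w - 1 / 2 + (1 + I) := by
        linear_combination (-1 / 2) * I_sq
      rw [a1, a2]
      ring
  obtain ⟨h1, h2⟩ := not_isLat_of_not_isPoleK hv
  have := key v hv
  rw [Zp_eq h1, Zp_eq h2] at this
  linear_combination this

lemma not_isLat_sub_delta {v : ℂ} (hv : ¬ IsPoleK v) : ¬ IsLat (v - (1 + I) / 2) := by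
  rwa [← isPoleK_iff_isLat]

lemma Zs_add_eq (v : ℂ) :
    Zs ((1 - I) / 2 * v - 1 / 2) + Zs ((1 - I) / 2 * v + I / 2) - (1 + I) * Zs (v - (1 + I) / 2) =
      wz ((1 - I) / 2 * v - 1 / 2) + wz ((1 - I) / 2 * v + I / 2) - (1 + I) * wz (v - (1 + I) / 2)
        - Real.pi * ((1 - I) / 2) := by
  simp [Zs, map_ofNat]
  linear_combination (Real.pi / 2 : ℂ) * I_sq

lemma wz_delta_hasResidue : HasResidue (fun v => wz (v - (1 + I) / 2)) ((1 - I) / 2) 1 := by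
  have h1 : HasResidue (fun w => wz (w + I)) (-I) 1 :=
    HasResidue.comp_add (by rw [neg_add_cancel]; exact wz_hasResidue)
  have h2 : HasResidue wz (-I) (1 + 0) := by
    refine (h1.add (analyticAt_const (v := (Real.pi : ℂ) * I)).hasResidue).congr ?_
    filter_upwards [eventually_not_isLat_punctured (-I)] with w hw
    rw [wz_add_I hw]; ring
  rw [add_zero] at h2
  have := HasResidue.comp_add (f := wz) (z := (1 - I) / 2) (b := -((1 + I) / 2))
    (by rw [show (1 - I) / 2 + -((1 + I) / 2) = -I by ring]; exact h2)
  simpa [sub_eq_add_neg] using this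

lemma Zs_add_half {v : ℂ} (hv : ¬ IsPoleK v) :
    Zs ((1 - I) / 2 * v - 1 / 2) + Zs ((1 - I) / 2 * v + I / 2) = (1 + I) * Zs (v - (1 + I) / 2) := by
  set d : ℂ → ℂ := fun v => Zp ((1 - I) / 2 * v - 1 / 2) + Zp ((1 - I) / 2 * v + I / 2) -
    (1 + I) * Zp (v - (1 + I) / 2) with hd
  have hZ : ∀ {w}, ¬ IsPoleK w → d w =
      wz ((1 - I) / 2 * w - 1 / 2) + wz ((1 - I) / 2 * w + I / 2) - (1 + I) * wz (w - (1 + I) / 2)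
        - Real.pi * ((1 - I) / 2) := by
    intro w hw
    obtain ⟨h1, h2⟩ := not_isLat_of_not_isPoleK hw
    simp only [hd]
    rw [← Zs_add_eq, Zp_eq h1, Zp_eq h2, Zp_eq (not_isLat_sub_delta hw)]
  have han : ∀ v, ¬ IsPoleK v → AnalyticAt ℂ d v := by
    intro v hv
    obtain ⟨h1, h2⟩ := not_isLat_of_not_isPoleK hv
    have h3 : AnalyticAt ℂ (fun w => wz ((1 - I) / 2 * w - 1 / 2) + wz ((1 - I) / 2 * w + I / 2) -
        (1 + I) * wz (w - (1 + I) / 2) - Real.pi * ((1 - I) / 2)) v :=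
      (((wz_minus_analyticAt h1).add (wz_plus_analyticAt h2)).sub (analyticAt_const.mul
        (AnalyticAt.fun_comp (g := wz) (f := fun v => v - (1 + I) / 2)
          (wz_analyticAt (not_isLat_sub_delta hv)) (analyticAt_id.sub analyticAt_const)))).sub
        analyticAt_const
    refine h3.congr ?_
    filter_upwards [eventually_not_isPoleK hv] with w hw
    rw [hZ hw]
  have h1 : ∀ w, d (w + 1) = 1 * d w := by
    intro w
    have e1 := Zp_add_lat ((1 - I) / 2 * w + I / 2) isLat_I.neg
    have e2 := Zp_add_lat ((1 - I) / 2 * w - 1 / 2) isLat_one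
    have e3 := Zp_add_lat (w - (1 + I) / 2) isLat_one
    simp only [hd]
    rw [← e1, ← e2, ← e3]
    ring_nf
  have hI : ∀ w, d (w + I) = 1 * d w := by
    intro w
    have e2 := Zp_add_lat ((1 - I) / 2 * w - 1 / 2) (isLat_one.add isLat_I)
    have e3 := Zp_add_lat (w - (1 + I) / 2) isLat_I
    have a1 : (1 - I) / 2 * (w + I) - 1 / 2 = (1 - I) / 2 * w + I / 2 := by
      linear_combination (-1 / 2) * I_sq
    have a2 : (1 - I) / 2 * (w + I) + I / 2 = (1 - I) / 2 * w - 1 / 2 + (1 + I) := by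
      linear_combination (-1 / 2) * I_sq
    simp only [hd]
    rw [← e2, ← e3, a1, a2]
    ring_nf
  have hr : HasResidue d ((1 - I) / 2) 0 := by
    have h := ((wz_minus_hasResidue.add wz_plus_hasResidue).add
      (wz_delta_hasResidue.const_mul (-(1 + I)))).add
        (analyticAt_const (v := -(Real.pi : ℂ) * ((1 - I) / 2))).hasResidue
    rw [show (0 : ℂ) + (1 + I) + -(1 + I) * 1 + 0 = 0 by ring] at h
    apply h.congr
    filter_upwards [eventually_not_isPoleK_punctured ((1 - I) / 2)] with w hw
    rw [hZ hw]; ring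
  have hres := residue_zero_everywhere han hr h1 hI norm_one norm_one
  obtain ⟨c, hc⟩ := eq_const_of_norm_periodic hres (fun z => by rw [h1, one_mul])
    (fun z => by rw [hI, one_mul])
  have hodd : d (-0) = -d 0 := by
    have e1 := Zp_add_lat (-((1 - I) / 2 * 0 - 1 / 2)) isLat_one.neg
    have e2 := Zp_add_lat (-((1 - I) / 2 * 0 + I / 2)) isLat_I
    have e3 := Zp_add_lat (-(0 - (1 + I) / 2)) (isLat_one.add isLat_I).neg
    rw [Zp_neg] at e1 e2 e3
    have f1 : d (-0) = Zp (-((1 - I) / 2 * 0 - 1 / 2) + -1) + Zp (-((1 - I) / 2 * 0 + I / 2) + I) -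
        (1 + I) * Zp (-(0 - (1 + I) / 2) + -(1 + I)) := by
      simp only [hd]; ring_nf
    rw [f1, e1, e2, e3]
    simp only [hd]
    ring
  rw [neg_zero] at hodd
  have h0 : d 0 = 0 := by linear_combination hodd / 2
  have hc0 : c = 0 := by rw [← hc 0 (han 0 not_isPoleK_zero).continuousAt, h0]
  have := hc v (han v hv).continuousAt
  obtain ⟨h1, h2⟩ := not_isLat_of_not_isPoleK hv
  rw [hc0, hd] at this
  simp only [] at this
  rw [Zp_eq h1, Zp_eq h2, Zp_eq (not_isLat_sub_delta hv)] at this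
  linear_combination this

lemma wz_hasResidue_lat {l : ℂ} (hl : IsLat l) : HasResidue wz l 1 := by
  have h1 : HasResidue (fun w => wz (w + -l)) l 1 :=
    HasResidue.comp_add (by rw [add_neg_cancel]; exact wz_hasResidue)
  have h2 := h1.add (analyticAt_const (v := (Real.pi : ℂ) * starRingEnd ℂ l)).hasResidue
  rw [add_zero] at h2
  refine h2.congr ?_
  filter_upwards [eventually_not_isLat_punctured l] with w hw
  have := Zs_add_lat hw hl.neg
  rw [Zs, Zs, map_add, map_neg] at this
  linear_combination this

lemma IsLat.conj {l : ℂ} (h : IsLat l) : IsLat (starRingEnd ℂ l) := by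
  obtain ⟨m, n, rfl⟩ := h
  refine ⟨m, -n, ?_⟩
  simp
lemma isLat_conj_iff {l : ℂ} : IsLat (starRingEnd ℂ l) ↔ IsLat l :=
  ⟨fun h => by simpa using h.conj, IsLat.conj⟩
lemma isPoleK_conj_iff {v : ℂ} : IsPoleK (starRingEnd ℂ v) ↔ IsPoleK v := by
  rw [isPoleK_iff_isLat, isPoleK_iff_isLat, ← isLat_conj_iff, ← isLat_add_iff isLat_I.neg]
  have : starRingEnd ℂ (starRingEnd ℂ v - (1 + I) / 2) + -I = v - (1 + I) / 2 := by
    simp [map_ofNat]; ring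
  rw [this]

namespace PrimaryPrime
variable (D : PrimaryPrime)

lemma sum_E_eq_zero {a : ZMod D.p} (ha : a ≠ 0) : ∑ t, D.E (-(a * t)) = 0 := by
  have e := Equiv.sum_comp (Equiv.addRight (1 : ZMod D.p)) (fun t => D.E (-(a * t)))
  simp only [Equiv.coe_addRight, mul_add, mul_one, neg_add, E_add] at e
  rw [← Finset.sum_mul] at e
  have h1 : D.E (-a) ≠ 1 := by
    rw [← D.E_zero]
    intro h
    exact ha (neg_eq_zero.1 (ZMod.injective_stdAddChar h))
  have : (∑ t, D.E (-(a * t))) * (D.E (-a) - 1) = 0 := by linear_combination e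
  exact (mul_eq_zero.1 this).resolve_right (sub_ne_zero.2 h1)

def Zt (t : ZMod D.p) (w : ℂ) : ℂ := Zp ((w + t.val) / D.q)

lemma Zt_red (g : GaussianInt) (w : ℂ) : Zp ((w + g) / D.q) = D.Zt (D.red g) w := by
  have : D.red (g - ((D.red g).val : GaussianInt)) = 0 := by
    rw [map_sub, D.red_natCast_val, sub_self]
  rw [red_eq_zero_iff] at this
  obtain ⟨k, hk⟩ := this
  rw [Zt, ← Zp_add_lat ((w + (D.red g).val) / D.q) (isLat_coe k)]
  congr 1
  have h2 := congrArg GaussianInt.toComplex hk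
  rw [map_sub, map_mul, map_natCast] at h2
  have := D.q_coe_ne_zero
  field_simp
  linear_combination h2

lemma Zt_add (t : ZMod D.p) (w : ℂ) (g : GaussianInt) : D.Zt t (w + g) = D.Zt (t + D.red g) w := by
  obtain ⟨h, rfl⟩ := D.red_surjective t
  rw [← Zt_red, ← map_add, ← Zt_red, map_add]
  congr 1; ring

def ZF (a : ZMod D.p) (w : ℂ) : ℂ := ∑ t, D.E (-(a * t)) * D.Zt t w

lemma ZF_add (a : ZMod D.p) (w : ℂ) (g : GaussianInt) :
    D.ZF a (w + g) = D.E (a * D.red g) * D.ZF a w := by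
  have e := Equiv.sum_comp (Equiv.addRight (D.red g)) (fun t => D.E (-(a * t)) * D.Zt t w)
  simp only [Equiv.coe_addRight] at e
  rw [ZF, ZF, ← e, Finset.mul_sum]
  apply Finset.sum_congr rfl
  intro t _
  rw [Zt_add, ← mul_assoc, ← E_add]
  congr 2; ring

lemma not_isLat_of_div {w : ℂ} (h : ¬ IsLat w) (t : ZMod D.p) : ¬ IsLat ((w + t.val) / D.q) := by
  intro hl
  apply h
  have := ((isLat_coe D.q).mul hl).sub (isLat_int t.val)
  have hq := D.q_coe_ne_zero
  rw [mul_div_cancel₀ _ hq] at this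
  simpa using this

lemma ZF_eq {a : ZMod D.p} (ha : a ≠ 0) {w : ℂ} (hw : ¬ IsLat w) : D.ZF a w =
    ∑ t, D.E (-(a * t)) * wz ((w + t.val) / D.q) +
      -(Real.pi * ∑ t, D.E (-(a * t)) * (t.val / starRingEnd ℂ (D.q : ℂ))) := by
  have h0 := D.sum_E_eq_zero ha
  have : D.ZF a w = ∑ t, D.E (-(a * t)) * wz ((w + t.val) / D.q) +
      -(Real.pi * ∑ t, D.E (-(a * t)) * (t.val / starRingEnd ℂ (D.q : ℂ))) -
      (∑ t, D.E (-(a * t))) * (Real.pi * starRingEnd ℂ w / starRingEnd ℂ (D.q : ℂ)) := by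
    rw [ZF, Finset.mul_sum, Finset.sum_mul, ← Finset.sum_neg_distrib, ← Finset.sum_add_distrib,
      ← Finset.sum_sub_distrib]
    apply Finset.sum_congr rfl
    intro t _
    rw [Zt, Zp_eq (D.not_isLat_of_div hw t), Zs]
    simp only [map_div₀, map_add, map_natCast]
    ring
  rw [this, h0]; ring

lemma wz_aff_analyticAt {w : ℂ} (t : ZMod D.p) (h : ¬ IsLat ((w + t.val) / D.q)) :
    AnalyticAt ℂ (fun w => wz ((w + t.val) / D.q)) w :=
  AnalyticAt.fun_comp (g := wz) (f := fun w => (w + t.val) / D.q) (wz_analyticAt h)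
    ((analyticAt_id.add analyticAt_const).div_const)

lemma wz_aff_hasResidue (t : ZMod D.p) :
    HasResidue (fun w => wz ((w + t.val) / D.q)) (-I) (if t = D.iF then (D.q : ℂ) else 0) := by
  have hq := D.q_coe_ne_zero
  by_cases ht : t = D.iF
  · rw [if_pos ht]
    have hl : IsLat ((-I + t.val) / D.q) := by
      have : D.red ((t.val : GaussianInt) - gI) = 0 := by
        rw [map_sub, red_gI, ht, red_natCast_val, sub_self]
      rw [red_eq_zero_iff] at this
      obtain ⟨k, hk⟩ := this
      have h2 := congrArg GaussianInt.toComplex hk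
      rw [map_sub, map_mul, map_natCast, gI_coe] at h2
      rw [show (-I + t.val) / (D.q : ℂ) = k by field_simp; linear_combination h2]
      exact isLat_coe k
    have := HasResidue.comp_affine (f := wz) (a := (D.q : ℂ)⁻¹) (z := -I) (b := t.val / D.q) (r := 1)
      (inv_ne_zero hq) (wz_hasResidue_lat (by
        rwa [show (D.q : ℂ)⁻¹ * -I + t.val / D.q = (-I + t.val) / D.q by ring]))
    rw [one_div, inv_inv] at this
    refine this.congr (Eventually.of_forall fun w => ?_)
    congr 1; ring
  · rw [if_neg ht]
    refine (D.wz_aff_analyticAt t ?_).hasResidue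
    intro hl
    obtain ⟨k, hk⟩ := hl.exists_coe
    apply ht
    have h2 : ((t.val : GaussianInt) - gI) = D.q * k := by
      apply GaussianInt.toComplex_injective
      rw [map_sub, map_mul, map_natCast, gI_coe, ← hk]
      field_simp; ring
    have := congrArg D.red h2
    rw [map_sub, red_gI, red_natCast_val, map_mul, red_q, zero_mul] at this
    exact sub_eq_zero.1 this

end PrimaryPrime

namespace PrimaryPrime
variable (D : PrimaryPrime)

def nz (a : ZMod D.p) : ℤ := -((-a).val : ℤ)
lemma nz_cast (a : ZMod D.p) : (D.nz a : ZMod D.p) = a := by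
  rw [nz]; push_cast; rw [ZMod.natCast_zmod_val]; ring

lemma nz_neg {a : ZMod D.p} (ha : a ≠ 0) : D.nz a < 0 := by
  rw [nz, Left.neg_neg_iff]
  have : (-a).val ≠ 0 := by rw [Ne, ZMod.val_eq_zero, neg_eq_zero]; exact ha
  omega
lemma neg_p_lt_nz (a : ZMod D.p) : -(D.p : ℤ) < D.nz a := by
  have := ZMod.val_lt (-a)
  rw [nz]; omega

def yz (a : ZMod D.p) : ℂ := D.nz a * (I - D.Iz) / D.p + (I - 1) / 2

lemma yz_im (a : ZMod D.p) : (D.yz a).im = D.nz a / D.p + 1 / 2 := by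
  have h : D.yz a = ((-(D.nz a * D.Iz) / D.p - 1 / 2 : ℝ) : ℂ) + ((D.nz a / D.p + 1 / 2 : ℝ) : ℂ) * I := by
    rw [yz]; push_cast; ring
  rw [h]; simp

lemma yz_im_lt {a : ZMod D.p} (ha : a ≠ 0) : |(D.yz a).im| < 1 / 2 := by
  rw [yz_im]
  have h1 : (D.nz a : ℝ) < 0 := by exact_mod_cast D.nz_neg ha
  have h2 : (-D.p : ℝ) < D.nz a := by exact_mod_cast D.neg_p_lt_nz a
  have hp : (0 : ℝ) < D.p := by exact_mod_cast D.p_pos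
  have h3 : (D.nz a : ℝ) / D.p < 0 := div_neg_of_neg_of_pos h1 hp
  have h4 : -1 < (D.nz a : ℝ) / D.p := by rw [lt_div_iff₀ hp]; linarith
  rw [abs_lt]; constructor <;> linarith

lemma two_j : 2 * D.j = 1 + D.iF := by
  linear_combination (1 + D.iF) * D.j_mul + D.j * D.iF_mul

def kz (a : ZMod D.p) : ℂ := D.nz a / D.p + 1 / 2

lemma exp_two_pi_half (x : ℂ) : exp (2 * Real.pi * I * (x + 1 / 2)) = -exp (2 * Real.pi * I * x) := by
  rw [mul_add, Complex.exp_add, show 2 * (Real.pi : ℂ) * I * (1 / 2) = Real.pi * I by ring,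
    Complex.exp_pi_mul_I]; ring

lemma E_nz (a : ZMod D.p) : D.E a = exp (2 * Real.pi * I * (D.nz a / D.p)) := by
  conv_lhs => rw [← D.nz_cast a]
  rw [E_intCast]; congr 1; ring
lemma E_nz_iF (a : ZMod D.p) : D.E (a * D.iF) = exp (2 * Real.pi * I * (D.nz a * D.Iz / D.p)) := by
  conv_lhs => rw [← D.nz_cast a, ← D.Iz_cast, ← Int.cast_mul]
  rw [E_intCast]; congr 1; push_cast; ring

lemma ZF_kser {a : ZMod D.p} (ha : a ≠ 0) {v : ℂ} (hv : ¬ IsPoleK v) : D.ZF a (v - (1 + I) / 2) =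
    -Real.pi * D.q * D.E (-(a * D.j)) * (exp (2 * Real.pi * I * D.kz a * v) * kser (D.yz a) v) := by
  have hy := D.yz_im_lt ha
  have hp := D.p_ne_zero
  have hpi : (Real.pi : ℂ) ≠ 0 := by exact_mod_cast Real.pi_ne_zero
  suffices key : ∀ v, ¬ IsPoleK v → D.ZF a (v - (1 + I) / 2) + Real.pi * D.q * D.E (-(a * D.j)) *
      (exp (2 * Real.pi * I * D.kz a * v) * kser (D.yz a) v) = 0 by
    linear_combination key v hv
  have hexp : ∀ v, AnalyticAt ℂ (fun v => exp (2 * Real.pi * I * D.kz a * v)) v := fun v =>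
    (analyticAt_const.mul analyticAt_id).cexp
  have e1 : exp (2 * Real.pi * I * D.kz a) = -D.E a := by
    rw [kz, exp_two_pi_half, ← E_nz]
  have e2 : exp (2 * Real.pi * I * D.kz a * I) * exp (-(2 * Real.pi * I * D.yz a)) = -D.E (a * D.iF) := by
    rw [E_nz_iF, ← exp_two_pi_half, ← Complex.exp_add]
    congr 1; rw [yz, kz]; ring
  set A := -(Real.pi * ∑ t, D.E (-(a * t)) * (t.val / starRingEnd ℂ (D.q : ℂ))) with hA
  apply ell_zero (M := D.E a) (N := D.E (a * D.iF))
  · intro v hv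
    have h1 : AnalyticAt ℂ (fun v => ∑ t, D.E (-(a * t)) * wz ((v - (1 + I) / 2 + t.val) / D.q) + A) v := by
      refine (Finset.analyticAt_fun_sum _ fun t _ => analyticAt_const.mul ?_).add analyticAt_const
      exact AnalyticAt.fun_comp (g := fun w => wz ((w + t.val) / D.q)) (f := fun v => v - (1 + I) / 2)
        (D.wz_aff_analyticAt t (D.not_isLat_of_div (not_isLat_sub_delta hv) t))
        (analyticAt_id.sub analyticAt_const)
    refine (AnalyticAt.congr h1 ?_).add (analyticAt_const.mul ((hexp v).mul (kser_analyticAt hy hv)))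
    filter_upwards [eventually_not_isPoleK hv] with w hw
    rw [D.ZF_eq ha (not_isLat_sub_delta hw)]
  · have h1 : HasResidue (fun w => ∑ t, D.E (-(a * t)) * wz ((w + t.val) / D.q)) (-I)
        (∑ t, D.E (-(a * t)) * (if t = D.iF then (D.q : ℂ) else 0)) :=
      HasResidue.sum fun t _ => (D.wz_aff_hasResidue t).const_mul _
    have h2 := HasResidue.comp_add (f := fun w => ∑ t, D.E (-(a * t)) * wz ((w + t.val) / D.q))
      (z := (1 - I) / 2) (b := -((1 + I) / 2))
      (by rw [show (1 - I) / 2 + -((1 + I) / 2) = -I by ring]; exact h1)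
    have h3 := (h2.add (analyticAt_const (v := A)).hasResidue).add
      (((kser_hasResidue hy).analytic_mul (hexp _)).const_mul (Real.pi * D.q * D.E (-(a * D.j))))
    simp only [mul_ite, mul_zero, Finset.sum_ite_eq', Finset.mem_univ, if_true] at h3
    have e3 : exp (2 * Real.pi * I * D.kz a * ((1 - I) / 2)) * exp (Real.pi * I * D.yz a) =
        D.E (-(a * (D.iF - D.j))) := by
      obtain ⟨k, hk⟩ := D.Iz_odd
      have : -(a * (D.iF - D.j)) = ((-(D.nz a * k) : ℤ) : ZMod D.p) := by
        apply mul_left_cancel₀ D.two_ne_zero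
        have h3 : (D.iF : ZMod D.p) = 2 * k + 1 := by rw [← Iz_cast, hk]; push_cast; ring
        push_cast; rw [nz_cast]
        linear_combination a * D.two_j - a * h3
      rw [this, E_intCast, ← Complex.exp_add]
      congr 1
      have hk' : (D.Iz : ℂ) = 2 * k + 1 := by exact_mod_cast hk
      rw [kz, yz, hk']; push_cast; ring
    have e : D.E (-(a * D.iF)) * D.q + 0 + Real.pi * D.q * D.E (-(a * D.j)) *
        (exp (2 * Real.pi * I * D.kz a * ((1 - I) / 2)) * (-exp (Real.pi * I * D.yz a) / Real.pi)) = 0 := by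
      have e4 : D.E (-(a * D.iF)) = D.E (-(a * D.j)) * D.E (-(a * (D.iF - D.j))) := by
        rw [← E_add]; congr 1; ring
      rw [e4, ← e3]; field_simp; ring
    rw [e] at h3
    refine h3.congr ?_
    filter_upwards [eventually_not_isPoleK_punctured ((1 - I) / 2)] with w hw
    rw [D.ZF_eq ha (not_isLat_sub_delta hw), sub_eq_add_neg]
  · intro w
    have := D.ZF_add a (w - (1 + I) / 2) 1
    rw [map_one, map_one, mul_one] at this
    rw [show w + 1 - (1 + I) / 2 = w - (1 + I) / 2 + 1 by ring, this, kser_add_one, mul_add, mul_one,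
      Complex.exp_add, e1]
    ring
  · intro w
    have := D.ZF_add a (w - (1 + I) / 2) gI
    rw [gI_coe, red_gI] at this
    rw [show w + I - (1 + I) / 2 = w - (1 + I) / 2 + I by ring, this, kser_add_I, mul_add,
      Complex.exp_add]
    linear_combination (-Real.pi * D.q * D.E (-(a * D.j)) * exp (2 * Real.pi * I * D.kz a * w) *
      kser (D.yz a) w) * e2
  · exact D.E_norm _
  · exact D.E_norm _
  · rw [← D.E_zero]
    intro h
    exact ha (ZMod.injective_stdAddChar h)

end PrimaryPrime

namespace PrimaryPrime
variable (D : PrimaryPrime)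

lemma ZF_delta {a : ZMod D.p} (ha : a ≠ 0) :
    D.ZF a ((1 + I) / 2) = -Real.pi * D.q * D.E (a * D.j) * kser 0 (1 / 2) * sl (D.yz a) := by
  have h := D.ZF_kser ha (v := 0 + 1 + I)
    (not_isPoleK_of_isLat ((isLat_zero.add isLat_one).add isLat_I))
  rw [show 0 + 1 + I - (1 + I) / 2 = (1 + I) / 2 by ring, kser_add_I, kser_add_one,
    kser_symm (D.yz_im_lt ha) (by norm_num)] at h
  have e : D.E (-(a * D.j)) * (exp (2 * Real.pi * I * D.kz a * (0 + 1 + I)) *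
      exp (-(2 * Real.pi * I * D.yz a))) = D.E (a * D.j) := by
    have h2 : D.E (a * D.j) = D.E (-(a * D.j)) * (D.E a * D.E (a * D.iF)) := by
      rw [← E_add, ← E_add]; congr 1; linear_combination a * D.two_j
    rw [h2, D.E_nz a, E_nz_iF, ← Complex.exp_add, ← Complex.exp_add]
    congr 1
    rw [kz, yz, show 2 * (Real.pi : ℂ) * I * (D.nz a / D.p + 1 / 2) * (0 + 1 + I) +
      -(2 * Real.pi * I * (D.nz a * (I - D.Iz) / D.p + (I - 1) / 2)) =
      2 * Real.pi * I * (D.nz a / D.p) + 2 * Real.pi * I * (D.nz a * D.Iz / D.p) + 2 * Real.pi * I by ring,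
      Complex.exp_periodic]
  rw [h, ← e, sl, mul_assoc (_ * _) (kser 0 (1 / 2)), mul_div_cancel₀ _ k0_half_ne]
  ring

lemma nz_dual : ∃ g : GaussianInt,
    (∀ n : ℤ, n * (I - D.Iz) / D.p = starRingEnd ℂ ((1 - I) * ((n * g : GaussianInt) : ℂ) / D.q)) ∧
    (∀ ν, D.red (D.nz (D.cb * ν) * g : GaussianInt) = (1 - D.iF) * ν) := by
  obtain ⟨g, k, h1, h2⟩ := D.exists_tau
  refine ⟨g, fun n => ?_, fun ν => ?_⟩
  · have e := congrArg GaussianInt.toComplex h1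
    simp only [map_mul, map_sub, gI_coe, map_intCast, GaussianInt.toComplex_star, map_one] at e
    rw [e, ← coe_mul_conj]
    have h3 := D.q_coe_ne_zero
    have h4 : starRingEnd ℂ (D.q : ℂ) ≠ 0 := (map_ne_zero _).2 h3
    simp only [map_div₀, map_mul, map_sub, map_one, map_intCast]
    rw [mul_div_assoc, mul_div_mul_left _ _ h3]; ring
  · have e := congrArg star h1
    rw [star_mul, star_star, star_sub] at e
    have e2 : star gI = -gI := by ext <;> simp [gI]
    have e3 : star (D.Iz : GaussianInt) = D.Iz := by ext <;> simp
    rw [e2, e3] at e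
    have e4 := congrArg D.red e
    rw [map_sub, map_neg, red_gI, map_intCast, Iz_cast, map_mul, map_mul, map_sub, map_one, red_gI,
      ← cb] at e4
    rw [map_mul, map_intCast, nz_cast]
    apply mul_left_cancel₀ D.one_sub_iF_ne_zero
    linear_combination (-ν) * e4 - ν * D.iF_mul

theorem Zt_dual {ν : ZMod D.p} (hν : ν ≠ 0) :
    ∑ t, D.E (-(D.cb * ν * t)) * Zp (t.val / D.q + (1 + I) / 2) =
      D.q * slL * starRingEnd ℂ (D.X ((1 - D.iF) * ν))⁻¹ := by
  obtain ⟨g, h1, h2⟩ := D.nz_dual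
  have hcb : D.cb ≠ 0 := by
    intro h
    have := h2 1
    rw [h, zero_mul, show D.nz 0 = 0 by rw [nz]; simp] at this
    simp at this
    exact D.one_sub_iF_ne_zero this.symm
  have ha : D.cb * ν ≠ 0 := mul_ne_zero hcb hν
  set a := D.cb * ν
  have hq := D.q_coe_ne_zero
  have e1 : ∑ t, D.E (-(a * t)) * Zp (t.val / D.q + (1 + I) / 2) = D.E (-(a * D.j)) * D.ZF a ((1 + I) / 2) := by
    have := D.ZF_add a ((1 + I) / 2) (-(2 * D.gq))
    have hr : D.red (-(2 * D.gq)) = -D.j := by rw [map_neg, map_mul, map_ofNat, red_gq]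
    rw [hr, mul_neg] at this
    rw [← this, ZF]
    apply Finset.sum_congr rfl
    intro t _
    rw [Zt]
    congr 2
    field_simp
    simp only [map_neg, map_mul, map_ofNat]
    linear_combination (1 + I) * D.gq_coe + 2 * D.gq * I_sq
  have e2 : D.E (-(a * D.j)) * D.E (a * D.j) = 1 := by rw [← E_add, neg_add_cancel, E_zero]
  set x : ℂ := D.nz a * (I - D.Iz) / D.p with hx
  have hX : sl x = starRingEnd ℂ (D.X ((1 - D.iF) * ν)) := by
    rw [hx, h1, ← sl_conj, X_red, h2]
  have hxp : ¬ IsPoleK x := by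
    rw [hx, h1, isPoleK_conj_iff]
    exact D.not_isPoleK_pt _
  have hx0 : sl x ≠ 0 := by
    rw [hX]
    exact (map_ne_zero _).2 (D.X_ne_zero (mul_ne_zero D.one_sub_iF_ne_zero hν))
  have hxl : ¬ IsLat x := fun h => hx0 (sl_lat h)
  have e3 : sl (D.yz a) = I / sl x := by
    have h5 := sl_delta_eq hxp hxl
    have h6 := sl_add_one (D.yz a)
    rw [show D.yz a + 1 = x + (1 + I) / 2 by rw [yz]; ring, h5] at h6
    linear_combination h6
  rw [e1, ZF_delta D ha, e3, map_inv₀, ← hX, slL_eq]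
  linear_combination (-(Real.pi * D.q * kser 0 (1 / 2) * I * (sl x)⁻¹)) * e2

end PrimaryPrime

namespace PrimaryPrime
variable (D : PrimaryPrime)

lemma cb_ne_zero : D.cb ≠ 0 := by
  intro h
  have h1 : D.red (star D.q + D.q) = 0 := by rw [map_add, red_q, ← cb, h, add_zero]
  have h2 : star D.q + D.q = ((2 * D.q.re : ℤ) : GaussianInt) := by
    ext <;> simp; ring
  have h3 : D.red (2 * D.q.im * gI : GaussianInt) = 0 := by
    have : (2 * D.q.im * gI : GaussianInt) = D.q - star D.q := by
      ext <;> simp [gI]; ring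
    rw [this, map_sub, red_q, ← cb, h, sub_zero]
  rw [map_mul, map_mul, red_gI, map_intCast, map_ofNat] at h3
  exact D.iF_ne_zero ((mul_eq_zero.1 h3).resolve_left (mul_ne_zero D.two_ne_zero D.im_ne_zero))

/-- A quartic character modulo `p`. -/
structure IsQuart (χ : MulChar (ZMod D.p) ℂ) : Prop where
  pow_four : ∀ t, t ≠ 0 → χ t ^ 4 = 1
  ne_one : χ ≠ 1

/-- The Gauss sum. -/
def gs (χ : MulChar (ZMod D.p) ℂ) : ℂ := ∑ r, χ r * D.E (D.cb * r)

variable {D} {χ : MulChar (ZMod D.p) ℂ}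

lemma IsQuart.conj_mul (hχ : D.IsQuart χ) {t : ZMod D.p} (ht : t ≠ 0) :
    starRingEnd ℂ (χ t) * χ t = 1 := by
  have : ‖χ t‖ = 1 := norm_eq_one_of_pow_eq_one (hχ.pow_four t ht) (by norm_num)
  rw [mul_comm, Complex.mul_conj, Complex.normSq_eq_norm_sq, this]; simp

lemma IsQuart.sum_mul (hχ : D.IsQuart χ) (f : ZMod D.p → ℂ) {a : ZMod D.p} (ha : a ≠ 0) :
    ∑ t, χ t * f (a * t) = starRingEnd ℂ (χ a) * ∑ t, χ t * f t := by
  have e : ∑ t, χ (a * t) * f (a * t) = ∑ t, χ t * f t :=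
    Equiv.sum_comp (Equiv.mulLeft₀ a ha) (fun t => χ t * f t)
  simp only [map_mul] at e
  rw [← e, Finset.mul_sum]
  apply Finset.sum_congr rfl
  intro t _
  linear_combination (-χ t * f (a * t)) * hχ.conj_mul ha

lemma IsQuart.dual (hχ : D.IsQuart χ) (f : ZMod D.p → ℂ) :
    ∑ ν, starRingEnd ℂ (χ ν) * ∑ t, D.E (-(D.cb * ν * t)) * f t =
      starRingEnd ℂ (D.gs χ) * ∑ t, χ t * f t := by
  simp only [Finset.mul_sum]
  rw [Finset.sum_comm]
  apply Finset.sum_congr rfl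
  intro t _
  by_cases ht : t = 0
  · have := MulChar.sum_eq_zero_of_ne_one hχ.ne_one
    simp only [ht, mul_zero, neg_zero, E_zero, MulChar.map_zero, one_mul, zero_mul]
    rw [← Finset.sum_mul, ← map_sum, this, map_zero, zero_mul]
  · have e := hχ.sum_mul (fun r => D.E (D.cb * r)) ht
    have e2 := congrArg (starRingEnd ℂ) e
    rw [map_mul, map_sum, conj_conj] at e2
    rw [gs, mul_comm, mul_right_comm, ← e2, Finset.sum_mul]
    apply Finset.sum_congr rfl
    intro ν _
    rw [map_mul, E_conj, ← mul_assoc]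
    congr 3
    ring_nf

lemma IsQuart.dual_X (hχ : D.IsQuart χ) :
    starRingEnd ℂ (D.gs χ) * ∑ t, χ t * D.X t = D.q * starRingEnd ℂ (∑ t, χ t * D.X t) := by
  rw [← hχ.dual, map_sum, Finset.mul_sum]
  apply Finset.sum_congr rfl
  intro ν _
  rw [X_dual, map_mul]; ring

lemma IsQuart.dual_Ps (hχ : D.IsQuart χ) :
    starRingEnd ℂ (D.gs χ) * ∑ t, χ t * D.Ps t =
      D.q * starRingEnd ℂ ((1 - I) / 2 * χ (1 - D.iF) * (1 + I * starRingEnd ℂ (χ D.iF)) *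
        ∑ t, χ t * D.Ps t) := by
  have hj : D.j ≠ 0 := inv_ne_zero D.one_sub_iF_ne_zero
  have e1 := hχ.sum_mul D.Ps hj
  have e2 := hχ.sum_mul D.Ps (mul_ne_zero D.iF_ne_zero hj)
  have e3 : starRingEnd ℂ (χ D.j) = χ (1 - D.iF) := by
    have h := congrArg χ D.j_mul
    rw [map_mul, map_one] at h
    have h1 := hχ.conj_mul hj
    have h2 : χ D.j ≠ 0 := right_ne_zero_of_mul_eq_one h1
    exact mul_right_cancel₀ h2 (h1.trans h.symm)
  rw [map_mul χ, map_mul (starRingEnd ℂ), e3] at e2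
  rw [e3] at e1
  rw [← hχ.dual]
  have : (1 - I) / 2 * χ (1 - D.iF) * (1 + I * starRingEnd ℂ (χ D.iF)) * ∑ t, χ t * D.Ps t =
      ∑ ν, χ ν * ((1 - I) / 2 * (D.Ps (D.j * ν) + I * D.Ps (D.iF * (D.j * ν)))) := by
    have : ∑ ν, χ ν * ((1 - I) / 2 * (D.Ps (D.j * ν) + I * D.Ps (D.iF * (D.j * ν)))) =
      (1 - I) / 2 * (∑ ν, χ ν * D.Ps (D.j * ν)) + (1 - I) / 2 * I * ∑ ν, χ ν * D.Ps (D.iF * D.j * ν) := by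
      rw [Finset.mul_sum, Finset.mul_sum, ← Finset.sum_add_distrib]
      apply Finset.sum_congr rfl
      intro ν _
      rw [mul_assoc D.iF]
      ring
    rw [this, e1, e2]; ring
  rw [this, map_sum, Finset.mul_sum]
  apply Finset.sum_congr rfl
  intro ν _
  rw [Ps_dual, map_mul (starRingEnd ℂ) (χ ν)]; ring

lemma not_isLat_val_div {t : ZMod D.p} (ht : t ≠ 0) : ¬ IsLat (t.val / D.q) := by
  have := D.not_isLat_div (g := (t.val : GaussianInt)) (by rwa [red_natCast_val])
  rwa [map_natCast] at this

lemma Zp_relations {t : ZMod D.p} (ht : t ≠ 0) :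
    Zp (t.val / D.q) + Zp (t.val / D.q + (1 + I) / 2) = (1 + I) * D.Zt ((1 + D.iF) * t) 0 ∧
    Zp (t.val / D.q) - Zp (t.val / D.q + (1 + I) / 2) = (1 - I) * slL * (D.X t)⁻¹ := by
  set u : ℂ := t.val / D.q with hu
  have h1 : ¬ IsLat ((1 + I) * u) := by
    have := D.not_isLat_div (g := (1 + gI) * (t.val : GaussianInt)) (by
      rw [map_mul, map_add, red_natCast_val, red_gI, map_one]
      exact mul_ne_zero D.one_add_iF_ne_zero ht)
    rwa [map_mul, map_add, map_one, gI_coe, map_natCast, mul_div_assoc] at this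
  have hv : ¬ IsPoleK ((1 + I) * u + (1 + I) / 2) := by
    rwa [isPoleK_iff_isLat, add_sub_cancel_right]
  have a1 : (1 - I) / 2 * ((1 + I) * u + (1 + I) / 2) - 1 / 2 = u := by
    linear_combination (-u / 2 - 1 / 4) * I_sq
  have a2 : (1 - I) / 2 * ((1 + I) * u + (1 + I) / 2) + I / 2 = u + (1 + I) / 2 := by
    linear_combination (-u / 2 - 1 / 4) * I_sq
  have h2 := not_isLat_of_not_isPoleK hv
  rw [a1, a2] at h2
  have r1 := Zs_add_half hv
  have r2 := Zs_sub_half hv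
  rw [a1, a2, add_sub_cancel_right] at r1
  rw [a1, a2] at r2
  rw [Zp_eq h2.1, Zp_eq h2.2, r1, r2]
  constructor
  · rw [← Zp_eq h1]
    have := D.Zt_red ((1 + gI) * (t.val : GaussianInt)) 0
    rw [map_mul D.red, map_add, red_natCast_val, red_gI, map_one] at this
    rw [← this, zero_add, map_mul, map_add, map_one, gI_coe, map_natCast, mul_div_assoc]
  · have hp := D.not_isPoleK_pt (t.val : GaussianInt)
    have e1 : (1 + I) * u = I * ((1 - I) * ((t.val : GaussianInt) : ℂ) / D.q) := by
      rw [map_natCast, hu]; linear_combination (t.val / (D.q : ℂ)) * I_sq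
    have hpole : ¬ IsPoleK ((1 + I) * u) := by
      rw [e1, isPoleK_I_mul_iff]; exact hp
    rw [sl_delta_eq hpole h1, e1, sl_I_mul hp, X_red, red_natCast_val]
    have hX := D.X_ne_zero ht
    field_simp

lemma IsQuart.dual_Z (hχ : D.IsQuart χ) (hi : χ D.iF = I) :
    starRingEnd ℂ (D.gs χ) * ∑ t, χ t * Zp (t.val / D.q) =
      -D.q * χ (1 + D.iF) ^ 2 * starRingEnd ℂ (∑ t, χ t * Zp (t.val / D.q)) := by
  set z := ∑ t, χ t * Zp (t.val / D.q) with hz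
  set zd := ∑ t, χ t * Zp (t.val / D.q + (1 + I) / 2) with hzd
  set w := ∑ t, χ t * (D.X t)⁻¹ with hw
  set c := χ (1 + D.iF) with hc
  have hcc := hχ.conj_mul D.one_add_iF_ne_zero
  rw [← hc] at hcc
  have r1 : z + zd = (1 + I) * starRingEnd ℂ c * z := by
    have e := hχ.sum_mul (fun t => D.Zt t 0) D.one_add_iF_ne_zero
    have e2 : ∑ t, χ t * D.Zt t 0 = z := by
      apply Finset.sum_congr rfl
      intro t _
      rw [Zt, zero_add]
    rw [e2] at e
    rw [mul_assoc, ← e, ← Finset.sum_add_distrib, Finset.mul_sum]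
    apply Finset.sum_congr rfl
    intro t _
    by_cases ht : t = 0
    · rw [ht, MulChar.map_zero]; ring
    · linear_combination (χ t) * (Zp_relations ht).1
  have r2 : z - zd = (1 - I) * slL * w := by
    rw [← Finset.sum_sub_distrib, Finset.mul_sum]
    apply Finset.sum_congr rfl
    intro t _
    by_cases ht : t = 0
    · rw [ht, MulChar.map_zero]; ring
    · linear_combination (χ t) * (Zp_relations ht).2
  have r3 : starRingEnd ℂ (D.gs χ) * zd = D.q * slL * (χ (1 - D.iF) * starRingEnd ℂ w) := by
    have e := hχ.sum_mul (fun t => (D.X t)⁻¹) D.one_sub_iF_ne_zero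
    have e2 := congrArg (starRingEnd ℂ) e
    rw [map_mul, conj_conj] at e2
    rw [← hχ.dual, ← e2, map_sum, Finset.mul_sum]
    apply Finset.sum_congr rfl
    intro ν _
    by_cases hν : ν = 0
    · rw [hν, MulChar.map_zero]; simp
    · rw [Zt_dual D hν, map_mul]; ring
  have hm : χ (1 - D.iF) = -I * c := by
    have : (1 - D.iF) = D.iF ^ 3 * (1 + D.iF) := by
      rw [iF_pow_three]; linear_combination D.iF_mul
    rw [this, map_mul, map_pow, hi, pow_succ, I_sq]; ring
  have hne : (1 + I) * starRingEnd ℂ c - 1 ≠ 0 := by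
    intro h
    have h1 : (1 + I) = c := by
      linear_combination c * h - (1 + I) * hcc
    have h2 : Complex.normSq c = 1 := by
      have := hcc
      rw [mul_comm, Complex.mul_conj] at this
      exact_mod_cast this
    rw [← h1] at h2
    norm_num [Complex.normSq_apply] at h2
  have r2' := congrArg (starRingEnd ℂ) r2
  have r1' := congrArg (starRingEnd ℂ) r1
  rw [map_sub, map_mul, map_mul, slL_conj, map_sub, map_one, conj_I] at r2'
  rw [map_add, map_mul, map_mul, map_add, map_one, conj_I, conj_conj] at r1'
  rw [hm] at r3
  apply mul_left_cancel₀ hne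
  generalize starRingEnd ℂ (D.gs χ) = g at *
  generalize starRingEnd ℂ zd = zdc at *
  generalize starRingEnd ℂ z = zc at *
  generalize starRingEnd ℂ w = wc at *
  generalize starRingEnd ℂ c = cc at *
  have s1 : slL * wc = (1 - I) / 2 * (zc - zdc) := by
    linear_combination (-(1 - I) / 2) * r2' + (slL * wc / 2) * I_sq
  linear_combination (-g) * r1 + r3 + D.q * (-I * c) * s1 - D.q * (-I * c) * ((1 - I) / 2) * r1' + D.q * (1 + I) * c * zc * hcc + (D.q * c * zc * (1 - c + I * c / 2)) * I_sq

end PrimaryPrime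

/-- A symmetric Cauchy determinant. -/
lemma det_one_sub_mul_inv {K : Type*} [Field K] : ∀ (n : ℕ) (x : Fin n → K),
    (∀ i j, 1 - x i * x j ≠ 0) →
    (Matrix.of fun i j => (1 - x i * x j)⁻¹).det =
      (-1) ^ (∑ i ∈ Finset.range n, i) *
        ∏ i, ∏ j, if i = j then (1 - x i ^ 2)⁻¹ else (x i - x j) / (1 - x i * x j)
  | 0, x, _ => by simp
  | n + 1, x, h => by
    set A : Matrix (Fin (n + 1)) (Fin (n + 1)) K := Matrix.of fun i j => (1 - x i * x j)⁻¹ with hA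
    set c : Fin (n + 1) → K := fun i => if i = 0 then 0 else A i 0 / A 0 0 with hc
    set B : Matrix (Fin (n + 1)) (Fin (n + 1)) K :=
      Matrix.of fun i j => A i j - c i * A 0 j with hB
    have hA0 : A 0 0 ≠ 0 := inv_ne_zero (h 0 0)
    have c0 : c 0 = 0 := if_pos rfl
    have e1 : A.det = B.det := by
      refine Matrix.det_eq_of_forall_row_eq_smul_add_const c 0 c0 fun i j => ?_
      simp only [hB, Matrix.of_apply, c0]
      ring
    have e2 : B.det = (1 - x 0 ^ 2)⁻¹ * (B.submatrix Fin.succ Fin.succ).det := by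
      rw [Matrix.det_succ_column_zero, Fin.sum_univ_succ, Finset.sum_eq_zero]
      · have : B 0 0 = (1 - x 0 ^ 2)⁻¹ := by simp [hB, hA, c0, pow_two]
        rw [this]
        simp [Fin.succAbove_zero]
      · intro i _
        have : B i.succ 0 = 0 := by
          simp only [hB, Matrix.of_apply, hc, if_neg (Fin.succ_ne_zero i)]
          rw [div_mul_cancel₀ _ hA0, sub_self]
        rw [this]; ring
    have e3 : B.submatrix Fin.succ Fin.succ = Matrix.of fun i j : Fin n =>
        ((x i.succ - x 0) / (1 - x i.succ * x 0)) *
          (Matrix.of fun i j : Fin n => ((x j.succ - x 0) / (1 - x 0 * x j.succ)) *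
          (Matrix.of fun i j : Fin n => (1 - x i.succ * x j.succ)⁻¹) i j) i j := by
      ext i j
      simp only [hB, hA, hc, Matrix.submatrix_apply, Matrix.of_apply, if_neg (Fin.succ_ne_zero i)]
      have h1 := h i.succ j.succ
      have h2 := h i.succ 0
      have h3 := h 0 j.succ
      have h4 := h 0 0
      generalize x i.succ = a at *
      generalize x j.succ = b at *
      generalize x 0 = z at *
      rw [div_inv_eq_mul, div_eq_mul_inv, div_eq_mul_inv]
      have g1 := mul_inv_cancel₀ h1
      have g2 := mul_inv_cancel₀ h2
      have g3 := mul_inv_cancel₀ h3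
      generalize (1 - a * b)⁻¹ = A at *
      generalize (1 - a * z)⁻¹ = V at *
      generalize (1 - z * b)⁻¹ = W at *
      linear_combination (-A) * g2 - A * (1 - a * z) * V * g3 + V * W * (1 - z * z) * g1
    rw [e1, e2, e3, Matrix.det_mul_column, Matrix.det_mul_row,
      det_one_sub_mul_inv n _ (fun i j => h i.succ j.succ), Fin.prod_univ_succ, Fin.prod_univ_succ,
      if_pos rfl, Finset.sum_range_succ]
    simp only [Fin.prod_univ_succ (f := fun j => if _ = j then _ else _), Finset.prod_mul_distrib,
      if_neg (Fin.succ_ne_zero _), if_neg (Fin.succ_ne_zero _).symm, Fin.succ_inj]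
    have e4 : ∏ i : Fin n, (x 0 - x i.succ) / (1 - x 0 * x i.succ) =
        (-1) ^ n * ∏ i : Fin n, (x i.succ - x 0) / (1 - x 0 * x i.succ) := by
      rw [← Fin.prod_const n (-1 : K), ← Finset.prod_mul_distrib]
      refine Finset.prod_congr rfl fun i _ => ?_
      ring
    have e5 : ((-1 : K) ^ n) * (-1) ^ n = 1 := by rw [← mul_pow]; simp
    rw [e4, pow_add]
    linear_combination (-(1 - x 0 ^ 2)⁻¹ * (∏ i : Fin n, (x i.succ - x 0) / (1 - x i.succ * x 0)) *
      (∏ i : Fin n, (x i.succ - x 0) / (1 - x 0 * x i.succ)) *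
      ((-1) ^ (∑ i ∈ Finset.range n, i) *
        ∏ i : Fin n, ∏ j : Fin n, if i = j then (1 - x i.succ ^ 2)⁻¹ else (x i.succ - x j.succ) / (1 - x i.succ * x j.succ))) * e5

namespace PrimaryPrime
variable (D : PrimaryPrime)

lemma X_iF_pow (k : ℕ) (t : ZMod D.p) : D.X (D.iF ^ k * t) = I ^ k * D.X t := by
  induction k with
  | zero => simp
  | succ k ih => rw [pow_succ', mul_assoc, X_iF, ih, pow_succ']; ring

lemma I_pow_pow_four (k : ℕ) : (I ^ k) ^ 4 = 1 := by
  rw [← pow_mul, mul_comm, pow_mul, I_pow_four, one_pow]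

/-- The twisted periods of the additive character over the orbits of the units. -/
def K (a : ℂ) (x : ZMod D.p) : ℂ := ∑ k ∈ Finset.range 4, a ^ k * D.E (D.cb * (D.iF ^ k * x))

lemma sum_X_add (κ μ : ZMod D.p) : ∑ k ∈ Finset.range 4, D.X (κ + D.iF ^ k * μ) =
    4 * D.X κ * D.C μ * (1 - D.X κ ^ 4 * D.X μ ^ 4)⁻¹ := by
  rw [← div_eq_mul_inv, eq_div_iff (D.one_sub_X_mul_ne_zero κ μ)]
  have h0 := D.X_add_mul κ μ
  have h1 := D.X_add_mul κ (D.iF * μ)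
  have h2 := D.X_add_mul κ (-μ)
  have h3 := D.X_add_mul κ (-(D.iF * μ))
  simp only [X_neg, C_neg, X_iF, C_iF, neg_sq, mul_pow, I_sq] at h0 h1 h2 h3
  simp only [Finset.sum_range_succ, Finset.sum_range_zero, zero_add, pow_zero, one_mul, pow_one,
    iF_pow_two, iF_pow_three, neg_mul]
  linear_combination (1 - D.X κ ^ 2 * D.X μ ^ 2) * (h0 + h2) +
    (1 + D.X κ ^ 2 * D.X μ ^ 2) * (h1 + h3)

lemma prod_X_add (κ μ : ZMod D.p) : ∏ k ∈ Finset.range 4, D.X (κ + D.iF ^ k * μ) =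
    (D.X κ ^ 4 - D.X μ ^ 4) / (1 - D.X κ ^ 4 * D.X μ ^ 4) := by
  have h0 := D.X_add_mul κ μ
  have h1 := D.X_add_mul κ (D.iF * μ)
  have h2 := D.X_add_mul κ (-μ)
  have h3 := D.X_add_mul κ (-(D.iF * μ))
  have hn1 := D.X_add_denom_ne_zero κ μ
  have hn2 := D.X_add_denom_ne_zero κ (D.iF * μ)
  have c1 := D.C_sq κ
  have c2 := D.C_sq μ
  simp only [X_neg, C_neg, X_iF, C_iF, neg_sq, mul_pow, I_sq] at h0 h1 h2 h3 hn2
  rw [prod_range_four]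
  simp only [pow_zero, one_mul, pow_one, iF_pow_two, iF_pow_three, neg_mul]
  have e1 : D.X (κ + μ) * D.X (κ + -μ) * (1 + D.X κ ^ 2 * D.X μ ^ 2) = D.X κ ^ 2 - D.X μ ^ 2 := by
    apply mul_right_cancel₀ hn1
    linear_combination (D.X (κ + μ) * (1 + D.X κ ^ 2 * D.X μ ^ 2)) * h2 +
      (D.X κ * D.C μ - D.X μ * D.C κ) * h0 + (D.X κ ^ 2) * c2 - (D.X μ ^ 2) * c1
  have e2 : D.X (κ + D.iF * μ) * D.X (κ + -(D.iF * μ)) * (1 - D.X κ ^ 2 * D.X μ ^ 2) =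
      D.X κ ^ 2 + D.X μ ^ 2 := by
    apply mul_right_cancel₀ hn2
    linear_combination (D.X (κ + D.iF * μ) * (1 - D.X κ ^ 2 * D.X μ ^ 2)) * h3 +
      (D.X κ * D.C μ - I * D.X μ * D.C κ) * h1 + (D.X κ ^ 2) * c2 + (D.X μ ^ 2) * c1 -
      (D.X μ ^ 2 * D.C κ ^ 2) * I_sq
  rw [eq_div_iff (D.one_sub_X_mul_ne_zero κ μ)]
  linear_combination (D.X (κ + D.iF * μ) * D.X (κ + -(D.iF * μ)) * (1 - D.X κ ^ 2 * D.X μ ^ 2)) * e1 +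
    (D.X κ ^ 2 - D.X μ ^ 2) * e2

variable {D}
lemma IsQSet.X_mul_K {S : Finset (ZMod D.p)} (hS : D.IsQSet S) (ν μ : ZMod D.p) :
    D.q * starRingEnd ℂ (D.X ν) * D.K 1 (ν * μ) =
      -∑ κ ∈ S, D.K I (ν * κ) * (4 * D.X κ * D.C μ * (1 - D.X κ ^ 4 * D.X μ ^ 4)⁻¹) := by
  have h1 : ∀ k, (∑ t, D.E (-(D.cb * ν * t)) * D.X t) * D.E (D.cb * (D.iF ^ k * (ν * μ))) =
      -∑ s, D.E (D.cb * (ν * s)) * D.X (s - D.iF ^ k * μ) := by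
    intro k
    rw [Finset.sum_mul, ← Finset.sum_neg_distrib, ← Equiv.sum_comp (Equiv.subLeft (D.iF ^ k * μ))]
    refine Finset.sum_congr rfl fun s _ => ?_
    rw [Equiv.subLeft_apply, mul_right_comm, ← E_add,
      show D.X (s - D.iF ^ k * μ) = -D.X (D.iF ^ k * μ - s) by rw [← X_neg, neg_sub], mul_neg,
      neg_neg]
    congr 2
    ring
  have h2 : ∀ s, ∑ k ∈ Finset.range 4, D.X (s - D.iF ^ k * μ) =
      4 * D.X s * D.C μ * (1 - D.X s ^ 4 * D.X μ ^ 4)⁻¹ := by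
    intro s
    have := D.sum_X_add s (-μ)
    rw [X_neg, C_neg, Even.neg_pow (by decide : Even 4)] at this
    rw [← this]
    refine Finset.sum_congr rfl fun k _ => ?_
    rw [mul_neg, sub_eq_add_neg]
  rw [← X_dual, K, Finset.mul_sum]
  simp only [one_pow, one_mul]
  rw [Finset.sum_congr rfl fun k _ => h1 k, Finset.sum_neg_distrib, Finset.sum_comm]
  simp only [← Finset.mul_sum, h2]
  rw [← Finset.add_sum_erase _ _ (Finset.mem_univ 0), hS.sum_eq, X_zero, neg_inj]
  rw [mul_zero (4 : ℂ), zero_mul, zero_mul, mul_zero (D.E _), zero_add]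
  refine Finset.sum_congr rfl fun κ _ => ?_
  rw [K, Finset.sum_mul]
  refine Finset.sum_congr rfl fun k _ => ?_
  rw [X_iF_pow, mul_pow, I_pow_pow_four, one_mul, mul_left_comm ν]
  ring

lemma IsQSet.card_pos {S : Finset (ZMod D.p)} (hS : D.IsQSet S) : 0 < S.card := by
  have h1 := hS.card
  have h2 := D.hp.one_lt
  omega

lemma IsQSet.prod_X_pow {S : Finset (ZMod D.p)} (hS : D.IsQSet S) :
    (∏ ν ∈ S, D.X ν) ^ 4 = (-1) ^ S.card * D.q := by
  have := D.prod_X hS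
  rw [hS.prod_eq] at this
  have e : ∀ ν ∈ S, ∏ k ∈ Finset.range 4, D.X (D.iF ^ k * ν) = (-1) * D.X ν ^ 4 := by
    intro ν _
    rw [prod_range_four]
    simp only [X_iF_pow]
    linear_combination (D.X ν ^ 4) * (I ^ 4 - I ^ 2 + 1) * I_sq
  rw [Finset.prod_congr rfl e, Finset.prod_mul_distrib, Finset.prod_const, Finset.prod_pow] at this
  rw [← this, ← mul_assoc, ← mul_pow]
  simp

lemma IsQSet.add_ne_zero {S : Finset (ZMod D.p)} (hS : D.IsQSet S) {κ μ : ZMod D.p} (hκ : κ ∈ S)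
    (hμ : μ ∈ S) (hne : κ ≠ μ) (k : ℕ) : κ + D.iF ^ k * μ ≠ 0 := by
  intro h
  apply hne
  have e : D.iF ^ ((k + 2) % 4) * μ = κ := by
    have h4 : D.iF ^ 4 = 1 := by rw [pow_succ, iF_pow_three, neg_mul, iF_mul, neg_neg]
    rw [← pow_eq_pow_mod _ h4, pow_add, iF_pow_two]
    linear_combination -h
  have m1 : (κ, 0) ∈ ((S ×ˢ Finset.range 4 : Finset (ZMod D.p × ℕ)) : Set (ZMod D.p × ℕ)) :=
    Finset.mem_coe.2 (Finset.mk_mem_product hκ (by simp))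
  have m2 : (μ, (k + 2) % 4) ∈
      ((S ×ˢ Finset.range 4 : Finset (ZMod D.p × ℕ)) : Set (ZMod D.p × ℕ)) :=
    Finset.mem_coe.2 (Finset.mk_mem_product hμ (Finset.mem_range.2 (Nat.mod_lt _ (by norm_num))))
  have := hS.inj m1 m2 (by simp only [pow_zero, one_mul, e])
  exact congrArg Prod.fst this

lemma IsQSet.prod_sub {S : Finset (ZMod D.p)} (hS : D.IsQSet S) {κ : ZMod D.p} (hκ : κ ∈ S) :
    4 * D.X κ ^ 4 * D.C κ * ((1 - (D.X κ ^ 4) ^ 2)⁻¹ *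
      ∏ μ ∈ S.erase κ, (D.X κ ^ 4 - D.X μ ^ 4) / (1 - D.X κ ^ 4 * D.X μ ^ 4)) = D.q := by
  have hκ0 := hS.ne_zero hκ
  set f : ZMod D.p → ℂ := fun t => if t = 0 then 1 else D.X t with hf
  have f0 : ∀ {t}, t ≠ 0 → f t = D.X t := fun h => if_neg h
  have e1 : ∏ t, f t = D.q := by
    rw [← Finset.mul_prod_erase _ _ (Finset.mem_univ 0), ← D.prod_X hS, hf]
    simp only [if_true, one_mul]
    exact Finset.prod_congr rfl fun t ht => f0 (Finset.ne_of_mem_erase ht)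
  have e2 : D.X κ * ∏ t ∈ Finset.univ.erase 0, f (κ + t) = D.q := by
    rw [← e1, ← Equiv.prod_comp (Equiv.addLeft κ), ← Finset.mul_prod_erase _ _ (Finset.mem_univ 0),
      Equiv.coe_addLeft]
    beta_reduce
    rw [add_zero, f0 hκ0]
  rw [hS.prod_eq, ← Finset.mul_prod_erase _ _ hκ] at e2
  have e3 : ∏ μ ∈ S.erase κ, ∏ k ∈ Finset.range 4, f (κ + D.iF ^ k * μ) =
      ∏ μ ∈ S.erase κ, (D.X κ ^ 4 - D.X μ ^ 4) / (1 - D.X κ ^ 4 * D.X μ ^ 4) := by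
    refine Finset.prod_congr rfl fun μ hμ => ?_
    rw [← prod_X_add]
    refine Finset.prod_congr rfl fun k _ => f0 ?_
    exact hS.add_ne_zero hκ (Finset.mem_of_mem_erase hμ) (Finset.ne_of_mem_erase hμ).symm k
  rw [e3, prod_range_four] at e2
  have a0 : κ + D.iF ^ 0 * κ = 2 * κ := by ring
  have a1 : κ + D.iF ^ 1 * κ = (1 + D.iF) * κ := by ring
  have a2 : κ + D.iF ^ 2 * κ = 0 := by rw [iF_pow_two]; ring
  have a3 : κ + D.iF ^ 3 * κ = (1 - D.iF) * κ := by rw [iF_pow_three]; ring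
  have f00 : f 0 = 1 := if_pos rfl
  rw [a0, a1, a2, a3, f0 (mul_ne_zero D.two_ne_zero hκ0), f00,
    f0 (mul_ne_zero D.one_add_iF_ne_zero hκ0), f0 (mul_ne_zero D.one_sub_iF_ne_zero hκ0),
    X_one_add_iF_mul, X_one_sub_iF_mul] at e2
  have e4 := D.X_two_mul κ
  have hC := D.C_ne_zero κ
  have hsq := D.C_sq κ
  have hne : 1 - (D.X κ ^ 4) ^ 2 ≠ 0 := by
    have := D.one_sub_X_mul_ne_zero κ κ
    rwa [← pow_two] at this
  have hne2 : 1 + D.X κ ^ 4 ≠ 0 := by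
    intro h
    apply hne
    linear_combination (1 - D.X κ ^ 4) * h
  have e5 : (1 - (D.X κ ^ 4) ^ 2)⁻¹ = (D.C κ)⁻¹ ^ 2 * (1 + D.X κ ^ 4)⁻¹ := by
    rw [inv_pow, ← mul_inv, hsq]; congr 1; ring
  rw [← e2, e5, (eq_div_iff hne2).2 e4]
  generalize ∏ μ ∈ S.erase κ, (D.X κ ^ 4 - D.X μ ^ 4) / (1 - D.X κ ^ 4 * D.X μ ^ 4) = Q
  simp only [div_eq_mul_inv]
  linear_combination (2 * D.X κ ^ 4 * D.C κ * (D.C κ)⁻¹ ^ 2 * (1 + D.X κ ^ 4)⁻¹ * Q) * I_sq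

end PrimaryPrime

namespace PrimaryPrime
variable {D : PrimaryPrime}

/-- An enumeration of a finite set. -/
def en (S : Finset (ZMod D.p)) (i : Fin S.card) : ZMod D.p := S.equivFin.symm i

lemma en_mem (S : Finset (ZMod D.p)) (i : Fin S.card) : en S i ∈ S := (S.equivFin.symm i).2
lemma en_injective (S : Finset (ZMod D.p)) : Function.Injective (en S) :=
  Subtype.val_injective.comp S.equivFin.symm.injective

lemma image_en (S : Finset (ZMod D.p)) : Finset.univ.image (en S) = S := by
  ext x
  simp only [Finset.mem_image, Finset.mem_univ, true_and]
  refine ⟨fun ⟨i, hi⟩ => hi ▸ en_mem S i, fun h => ⟨S.equivFin ⟨x, h⟩, ?_⟩⟩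
  rw [en, Equiv.symm_apply_apply]

lemma prod_en {M : Type*} [CommMonoid M] (S : Finset (ZMod D.p)) (f : ZMod D.p → M) :
    ∏ i, f (en S i) = ∏ ν ∈ S, f ν := by
  conv_rhs => rw [← image_en S, Finset.prod_image (en_injective S).injOn]

lemma sum_en {M : Type*} [AddCommMonoid M] (S : Finset (ZMod D.p)) (f : ZMod D.p → M) :
    ∑ i, f (en S i) = ∑ ν ∈ S, f ν := by
  conv_rhs => rw [← image_en S, Finset.sum_image (en_injective S).injOn]

/-- The matrix of the twisted periods. -/
def KM (S : Finset (ZMod D.p)) (a : ℂ) : Matrix (Fin S.card) (Fin S.card) ℂ :=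
  Matrix.of fun i j => D.K a (en S i * en S j)

lemma IsQSet.prod_prod {S : Finset (ZMod D.p)} (hS : D.IsQSet S) :
    4 ^ S.card * (∏ ν ∈ S, D.X ν) ^ 4 * (∏ ν ∈ S, D.C ν) *
      (∏ i, ∏ j, if i = j then (1 - (D.X (en S i) ^ 4) ^ 2)⁻¹ else
        (D.X (en S i) ^ 4 - D.X (en S j) ^ 4) / (1 - D.X (en S i) ^ 4 * D.X (en S j) ^ 4)) =
      (D.q : ℂ) ^ S.card := by
  have e1 : ∀ i, (∏ j, if i = j then (1 - (D.X (en S i) ^ 4) ^ 2)⁻¹ else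
        (D.X (en S i) ^ 4 - D.X (en S j) ^ 4) / (1 - D.X (en S i) ^ 4 * D.X (en S j) ^ 4)) =
      (1 - (D.X (en S i) ^ 4) ^ 2)⁻¹ * ∏ μ ∈ S.erase (en S i),
        (D.X (en S i) ^ 4 - D.X μ ^ 4) / (1 - D.X (en S i) ^ 4 * D.X μ ^ 4) := by
    intro i
    have e := prod_en S (fun μ => if en S i = μ then (1 - (D.X (en S i) ^ 4) ^ 2)⁻¹ else
        (D.X (en S i) ^ 4 - D.X μ ^ 4) / (1 - D.X (en S i) ^ 4 * D.X μ ^ 4))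
    simp only [(en_injective S).eq_iff] at e
    rw [e, ← Finset.mul_prod_erase _ _ (en_mem S i), if_pos rfl]
    congr 1
    refine Finset.prod_congr rfl fun μ hμ => if_neg (Finset.ne_of_mem_erase hμ).symm
  rw [Finset.prod_congr rfl fun i _ => e1 i, prod_en S (fun κ => (1 - (D.X κ ^ 4) ^ 2)⁻¹ *
    ∏ μ ∈ S.erase κ, (D.X κ ^ 4 - D.X μ ^ 4) / (1 - D.X κ ^ 4 * D.X μ ^ 4)),
    ← Finset.prod_pow, ← Finset.prod_const, ← Finset.prod_mul_distrib, ← Finset.prod_mul_distrib,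
    ← Finset.prod_mul_distrib, ← Finset.prod_const]
  exact Finset.prod_congr rfl fun κ hκ => hS.prod_sub hκ

lemma IsQSet.prod_X_ne_zero {S : Finset (ZMod D.p)} (hS : D.IsQSet S) : ∏ ν ∈ S, D.X ν ≠ 0 :=
  Finset.prod_ne_zero_iff.2 fun _ h => D.X_ne_zero (hS.ne_zero h)

theorem IsQSet.det_K {S : Finset (ZMod D.p)} (hS : D.IsQSet S) :
    D.q * starRingEnd ℂ (∏ ν ∈ S, D.X ν) * (KM S 1).det =
      (-1) ^ (∑ i ∈ Finset.range S.card, i) * (KM S I).det * ∏ ν ∈ S, D.X ν := by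
  set P := ∏ ν ∈ S, D.X ν with hP
  have hq := D.q_coe_ne_zero
  set N : Matrix (Fin S.card) (Fin S.card) ℂ := Matrix.of fun i j => (4 * D.X (en S i)) *
    (Matrix.of fun i j : Fin S.card => D.C (en S j) * (Matrix.of fun i j : Fin S.card =>
      (1 - D.X (en S i) ^ 4 * D.X (en S j) ^ 4)⁻¹) i j) i j with hN
  have e1 : (Matrix.of fun i j => (D.q * starRingEnd ℂ (D.X (en S i))) * KM S 1 i j) =
      -(KM S I * N) := by
    ext i j
    rw [Matrix.neg_apply, Matrix.mul_apply, Matrix.of_apply, KM, Matrix.of_apply, hS.X_mul_K,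
      ← sum_en]
    congr 1
    refine Finset.sum_congr rfl fun k _ => ?_
    simp only [KM, hN, Matrix.of_apply]
    ring
  have e0 : ∏ ν ∈ S, starRingEnd ℂ (D.X ν) = starRingEnd ℂ P := (map_prod _ _ _).symm
  have e2 := congrArg Matrix.det e1
  rw [Matrix.det_neg, Matrix.det_mul, Matrix.det_mul_column, hN, Matrix.det_mul_column,
    Matrix.det_mul_row, det_one_sub_mul_inv _ _ (fun i j => D.one_sub_X_mul_ne_zero _ _),
    Fintype.card_fin, Finset.prod_mul_distrib, Finset.prod_mul_distrib, prod_en S D.X,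
    prod_en S D.C, prod_en S (fun x => starRingEnd ℂ (D.X x)), e0, ← hP] at e2
  simp only [Finset.prod_const, Finset.card_univ, Fintype.card_fin] at e2
  have e3 := hS.prod_prod
  have e4 := hS.prod_X_pow
  have hP0 : P ≠ 0 := hS.prod_X_ne_zero
  rw [← hP] at e3 e4
  apply mul_left_cancel₀ (pow_ne_zero S.card hq)
  apply mul_left_cancel₀ (pow_ne_zero 3 hP0)
  generalize (∏ i, ∏ j, if i = j then (1 - (D.X (en S i) ^ 4) ^ 2)⁻¹ else
        (D.X (en S i) ^ 4 - D.X (en S j) ^ 4) / (1 - D.X (en S i) ^ 4 * D.X (en S j) ^ 4)) = Q at *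
  linear_combination P ^ 3 * D.q * e2 + (-1) ^ S.card * (KM S I).det * D.q *
    (-1) ^ (∑ i ∈ Finset.range S.card, i) * e3 - (KM S I).det * (-1) ^ (∑ i ∈ Finset.range S.card, i) *
    (D.q : ℂ) ^ S.card * e4

end PrimaryPrime

lemma sum_eval_eq_neg_coeff {p : ℕ} [Fact p.Prime] (f : Polynomial (ZMod p))
    (hf : f.natDegree ≤ p - 1) : ∑ y, f.eval y = -f.coeff (p - 1) := by
  have hp := (Fact.out : p.Prime).two_le
  have hp1 : p - 1 + 1 = p := by omega
  simp only [f.eval_eq_sum_range' (show f.natDegree < p - 1 + 1 by omega)]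
  rw [Finset.sum_comm, Finset.sum_range_succ, Finset.sum_eq_zero, zero_add, ← Finset.mul_sum]
  · have : ∑ y : ZMod p, y ^ (p - 1) = -1 := by
      rw [← Finset.add_sum_erase _ _ (Finset.mem_univ 0), zero_pow (by omega), zero_add,
        Finset.sum_congr rfl (g := fun _ => (1 : ZMod p))
          fun y hy => ZMod.pow_card_sub_one_eq_one (Finset.ne_of_mem_erase hy)]
      rw [Finset.sum_const, Finset.card_erase_of_mem (Finset.mem_univ _), Finset.card_univ,
        ZMod.card, nsmul_eq_mul, mul_one, Nat.cast_pred (by omega), ZMod.natCast_self, zero_sub]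
    rw [this]; ring
  · intro i hi
    rw [← Finset.mul_sum, FiniteField.sum_pow_lt_card_sub_one, mul_zero]
    rw [ZMod.card]
    exact Finset.mem_range.1 hi

lemma sum_pow_mul_choose {p : ℕ} [Fact p.Prime] {N m : ℕ} (h : N + m ≤ p - 1) :
    (m.factorial : ZMod p) * ((∑ y : ZMod p, y.val ^ N * y.val.choose m : ℕ) : ZMod p) =
      if N + m = p - 1 then -1 else 0 := by
  have hm : (Polynomial.X ^ N * descPochhammer (ZMod p) m).Monic :=
    (Polynomial.monic_X_pow N).mul (monic_descPochhammer _ _)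
  have hd : (Polynomial.X ^ N * descPochhammer (ZMod p) m).natDegree = N + m := by
    rw [(Polynomial.monic_X_pow N).natDegree_mul (monic_descPochhammer _ _),
      Polynomial.natDegree_X_pow, descPochhammer_natDegree]
  have e := sum_eval_eq_neg_coeff (Polynomial.X ^ N * descPochhammer (ZMod p) m) (hd.le.trans h)
  have e2 : (m.factorial : ZMod p) * ((∑ y : ZMod p, y.val ^ N * y.val.choose m : ℕ) : ZMod p) =
      ∑ y, (Polynomial.X ^ N * descPochhammer (ZMod p) m).eval y := by
    rw [Nat.cast_sum, Finset.mul_sum]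
    refine Finset.sum_congr rfl fun y _ => ?_
    conv_rhs => rw [← ZMod.natCast_zmod_val y]
    rw [Polynomial.eval_mul, Polynomial.eval_pow, Polynomial.eval_X,
      descPochhammer_eval_eq_descFactorial, Nat.descFactorial_eq_factorial_mul_choose]
    push_cast
    ring
  rw [e2, e]
  split_ifs with h1
  · rw [← h1, ← hd]
    have : (Polynomial.X ^ N * descPochhammer (ZMod p) m).coeff
      (Polynomial.X ^ N * descPochhammer (ZMod p) m).natDegree = 1 := hm
    rw [this]
  · rw [Polynomial.coeff_eq_zero_of_natDegree_lt, neg_zero]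
    omega

/-- The leading term of a Gauss sum of a power of the Teichmüller character. -/
theorem stickelberger {p : ℕ} [Fact p.Prime] {R : Type*} [CommRing R] {z : R}
    (hz : (z - 1) ^ (p - 1) ∣ (p : R)) {ω : ZMod p → R}
    (hω : ∀ t, t ≠ 0 → (p : R) ∣ ω t - (t.val : R)) {k : ℕ} (hk : k < p - 1) :
    ∃ v, ∑ y ∈ Finset.univ.erase 0, ω y ^ (p - 1 - k) * z ^ y.val = (z - 1) ^ k * v ∧
      (z - 1) ∣ (k.factorial : R) * v + 1 := by
  set l := z - 1 with hl
  set N := p - 1 - k with hN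
  set A : ℕ → ℕ := fun m => ∑ y : ZMod p, y.val ^ N * y.val.choose m with hA
  have hlk : l ^ (k + 1) ∣ (p : R) := (pow_dvd_pow l hk).trans hz
  have d1 : (p : R) ∣ ∑ y ∈ Finset.univ.erase 0, ω y ^ N * z ^ y.val -
      ∑ y : ZMod p, (y.val : R) ^ N * z ^ y.val := by
    rw [← Finset.add_sum_erase _ (fun y : ZMod p => (y.val : R) ^ N * z ^ y.val) (Finset.mem_univ 0), ZMod.val_zero,
      Nat.cast_zero, zero_pow (by omega), zero_mul, zero_add, ← Finset.sum_sub_distrib]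
    refine Finset.dvd_sum fun y hy => ?_
    rw [← sub_mul]
    exact ((hω y (Finset.ne_of_mem_erase hy)).trans (sub_dvd_pow_sub_pow _ _ _)).mul_right _
  have e1 : ∑ y : ZMod p, (y.val : R) ^ N * z ^ y.val = ∑ m ∈ Finset.range p, l ^ m * (A m : R) := by
    have : ∀ y : ZMod p, (y.val : R) ^ N * z ^ y.val =
        ∑ m ∈ Finset.range p, l ^ m * ((y.val ^ N * y.val.choose m : ℕ) : R) := by
      intro y
      have hy := y.val_lt
      rw [show z = l + 1 by rw [hl]; ring, add_pow, Finset.mul_sum,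
        ← Finset.sum_subset (Finset.range_subset_range.2 (Nat.succ_le_of_lt hy))]
      · refine Finset.sum_congr rfl fun m _ => ?_
        push_cast
        ring
      · intro m _ hm
        rw [Finset.mem_range, not_lt] at hm
        rw [Nat.choose_eq_zero_of_lt (by omega)]
        simp
    rw [Finset.sum_congr rfl fun y _ => this y, Finset.sum_comm]
    refine Finset.sum_congr rfl fun m _ => ?_
    rw [hA, Nat.cast_sum, Finset.mul_sum]
  have d2 : ∀ m < k, (p : R) ∣ (A m : R) := by
    intro m hm
    have := sum_pow_mul_choose (p := p) (N := N) (m := m) (by omega)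
    rw [if_neg (by omega)] at this
    have hf : (m.factorial : ZMod p) ≠ 0 := by
      rw [Ne, ZMod.natCast_eq_zero_iff, (Fact.out : p.Prime).dvd_factorial]
      omega
    have := (mul_eq_zero.1 this).resolve_left hf
    rw [ZMod.natCast_eq_zero_iff] at this
    exact Nat.cast_dvd_cast this
  have d3 : (p : R) ∣ k.factorial * (A k : R) + 1 := by
    have := sum_pow_mul_choose (p := p) (N := N) (m := k) (by omega)
    rw [if_pos (by omega)] at this
    have h2 : ((k.factorial * A k + 1 : ℕ) : ZMod p) = 0 := by
      push_cast
      rw [hA, this]; ring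
    rw [ZMod.natCast_eq_zero_iff] at h2
    have := Nat.cast_dvd_cast (α := R) h2
    push_cast at this
    exact this
  have d4 : l ^ (k + 1) ∣ ∑ m ∈ Finset.range p, l ^ m * (A m : R) - l ^ k * A k := by
    rw [← Finset.add_sum_erase _ _ (Finset.mem_range.2 (show k < p by omega)), add_sub_cancel_left]
    refine Finset.dvd_sum fun m hm => ?_
    rcases lt_or_gt_of_ne (Finset.ne_of_mem_erase hm) with h | h
    · exact (hlk.trans (d2 m h)).mul_left _
    · exact (pow_dvd_pow l h).mul_right _
  obtain ⟨w, hw⟩ := (hlk.trans d1).add d4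
  refine ⟨A k + l * w, ?_, ?_⟩
  · rw [e1] at hw
    linear_combination hw
  · have : l ∣ (p : R) := (dvd_pow_self l (Nat.succ_ne_zero k)).trans hlk
    obtain ⟨x, hx⟩ := this.trans d3
    exact ⟨x + k.factorial * w, by linear_combination hx⟩

/-- Roots of unity of order prime to the residue characteristic are determined by their
residues. -/
lemma eq_of_map_eq_of_pow_eq_one {R k : Type*} [CommRing R] [IsDomain R] [Field k] (r : R →+* k)
    {n : ℕ} (hn : (n : k) ≠ 0) {a b : R} (ha : a ^ n = 1) (hb : b ^ n = 1) (h : r a = r b) :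
    a = b := by
  have e := (Commute.all a b).geom_sum₂_mul n
  rw [ha, hb, sub_self] at e
  refine sub_eq_zero.1 ((mul_eq_zero.1 e).resolve_left fun e0 => ?_)
  have e1 := congrArg r e0
  rw [map_sum, map_zero] at e1
  have e2 : ∀ i ∈ Finset.range n, r (a ^ i * b ^ (n - 1 - i)) = r a ^ (n - 1) := by
    intro i hi
    rw [Finset.mem_range] at hi
    rw [map_mul, map_pow, map_pow, ← h, ← pow_add]
    congr 1
    omega
  rw [Finset.sum_congr rfl e2, Finset.sum_const, Finset.card_range, nsmul_eq_mul] at e1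
  have h0 : r a ^ n = 1 := by rw [← map_pow, ha, map_one]
  have h1 : r a ^ (n - 1) ≠ 0 := by
    refine pow_ne_zero _ fun h2 => ?_
    rw [h2, zero_pow (by rintro rfl; simp at hn)] at h0
    exact zero_ne_one h0
  exact (mul_ne_zero hn h1) e1

/-- If `a ^ n = 1` with `n` invertible and `r ∣ b ^ n - 1`, `a ≡ b` residually, then
`r ∣ a - b`. -/
lemma dvd_sub_of_pow_eq_one {R : Type*} [CommRing R] [IsLocalRing R] {n : ℕ}
    (hn : (n : IsLocalRing.ResidueField R) ≠ 0) {a b c : R} (ha : a ^ n = 1)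
    (hb : c ∣ b ^ n - 1) (h : IsLocalRing.residue R a = IsLocalRing.residue R b) :
    c ∣ a - b := by
  have e := (Commute.all a b).geom_sum₂_mul n
  have hu : IsUnit (∑ i ∈ Finset.range n, a ^ i * b ^ (n - 1 - i)) := by
    rw [← IsLocalRing.residue_ne_zero_iff_isUnit, map_sum]
    have e2 : ∀ i ∈ Finset.range n, IsLocalRing.residue R (a ^ i * b ^ (n - 1 - i)) =
        IsLocalRing.residue R a ^ (n - 1) := by
      intro i hi
      rw [Finset.mem_range] at hi
      rw [map_mul, map_pow, map_pow, ← h, ← pow_add]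
      congr 1
      omega
    rw [Finset.sum_congr rfl e2, Finset.sum_const, Finset.card_range, nsmul_eq_mul]
    refine mul_ne_zero hn (pow_ne_zero _ fun h2 => ?_)
    have h0 : IsLocalRing.residue R a ^ n = 1 := by rw [← map_pow, ha, map_one]
    rw [h2, zero_pow (by rintro rfl; simp at hn)] at h0
    exact zero_ne_one h0
  rw [← hu.dvd_mul_left, e, ha]
  exact (dvd_sub_comm).1 hb

lemma mem_of_pow_eq_one {K : Type*} [Field K] (V : ValuationSubring K) {x : K} {n : ℕ} (hn : n ≠ 0)
    (h : x ^ n = 1) : x ∈ V := by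
  rcases V.mem_or_inv_mem x with h1 | h1
  · exact h1
  · have h0 : x ≠ 0 := by rintro rfl; rw [zero_pow hn] at h; exact zero_ne_one h
    have : x = x⁻¹ ^ (n - 1) := by
      rw [inv_pow, ← mul_eq_one_iff_eq_inv₀ (pow_ne_zero _ h0), ← pow_succ',
        Nat.sub_add_cancel (Nat.one_le_iff_ne_zero.2 hn), h]
    exact this ▸ pow_mem h1 _

/-- A valuation subring of `ℂ` containing `i` and having `q` as a non-unit. -/
structure PrimaryPrime.Place (D : PrimaryPrime) where
  V : ValuationSubring ℂ
  I_mem : I ∈ V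
  q_mem : (D.q : ℂ) ∈ V.nonunits

namespace PrimaryPrime.Place
variable {D : PrimaryPrime} (W : D.Place)

/-- The residue field. -/
abbrev k : Type := IsLocalRing.ResidueField W.V
/-- The residue map. -/
abbrev r : W.V →+* W.k := IsLocalRing.residue W.V

lemma r_eq_zero {x : W.V} : W.r x = 0 ↔ (x : ℂ) ∈ W.V.nonunits := by
  rw [IsLocalRing.residue_eq_zero_iff, ← ValuationSubring.coe_mem_nonunits_iff]

lemma coe_mem (z : GaussianInt) : (z : ℂ) ∈ W.V := by
  rw [GaussianInt.toComplex_def]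
  exact add_mem (intCast_mem _ _) (mul_mem (intCast_mem _ _) W.I_mem)

/-- The inclusion of the Gaussian integers. -/
def gi : GaussianInt →+* W.V := GaussianInt.toComplex.codRestrict W.V.toSubring W.coe_mem

lemma coe_gi (z : GaussianInt) : ((W.gi z : W.V) : ℂ) = (z : ℂ) := rfl

lemma r_gi_q : W.r (W.gi D.q) = 0 := W.r_eq_zero.2 W.q_mem

lemma r_p : (D.p : W.k) = 0 := by
  have h : W.gi (D.q * star D.q) = W.gi (D.p : GaussianInt) := by rw [D.q_mul_star]
  have := congrArg W.r h
  rw [map_mul, map_mul, r_gi_q, zero_mul, map_natCast, map_natCast] at this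
  exact this.symm

instance : CharP W.k D.p := by
  have h := CharP.ringChar_of_prime_eq_zero D.hp W.r_p
  exact h ▸ ringChar.charP W.k

/-- The embedding of the prime field. -/
def ι : ZMod D.p →+* W.k := ZMod.castHom dvd_rfl W.k

lemma ι_injective : Function.Injective W.ι := W.ι.injective

lemma ι_natCast_val (t : ZMod D.p) : ((t.val : ℕ) : W.k) = W.ι t := by
  rw [← map_natCast W.ι, ZMod.natCast_zmod_val]

lemma r_gi (z : GaussianInt) : W.r (W.gi z) = W.ι (D.red z) := by
  have h : D.red (z - ((D.red z).val : ℕ)) = 0 := by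
    rw [map_sub, map_natCast, ZMod.natCast_zmod_val, sub_self]
  obtain ⟨w, hw⟩ := D.red_eq_zero_iff.1 h
  have := congrArg (fun z => W.r (W.gi z)) hw
  simp only [map_sub, map_mul, map_natCast] at this
  rw [r_gi_q, zero_mul, sub_eq_zero, ι_natCast_val] at this
  exact this

/-- `ζ = e(1)`. -/
lemma exists_zeta : ∃ z : W.V, (z : ℂ) = D.E (D.cb * 1) :=
  ⟨⟨_, mem_of_pow_eq_one W.V D.hp.ne_zero (D.E_pow_p _)⟩, rfl⟩

/-- A `p`-th root of unity in the valuation ring. -/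
def z : W.V := W.exists_zeta.choose
lemma coe_z : (W.z : ℂ) = D.E (D.cb * 1) := W.exists_zeta.choose_spec

lemma coe_z_pow (y : ZMod D.p) : (W.z : ℂ) ^ y.val = D.E (D.cb * y) := by
  have : ∀ n : ℕ, (W.z : ℂ) ^ n = D.E (D.cb * n) := by
    intro n
    induction n with
    | zero => simp [D.E_zero]
    | succ n ih => rw [pow_succ, ih, coe_z, ← D.E_add]; congr 1; push_cast; ring
  rw [this, ZMod.natCast_zmod_val]

lemma z_pow_p : W.z ^ D.p = 1 := by
  apply Subtype.ext
  push_cast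
  rw [coe_z]
  exact D.E_pow_p _

lemma coe_z_ne_one : (W.z : ℂ) ≠ 1 := by
  rw [coe_z, mul_one]
  intro h
  have := (ZMod.injective_stdAddChar (N := D.p)) (h.trans (AddChar.map_zero_eq_one _).symm)
  exact D.cb_ne_zero this

lemma z_primitive : IsPrimitiveRoot W.z D.p :=
  IsPrimitiveRoot.iff_orderOf.2 (orderOf_eq_prime W.z_pow_p fun h =>
    W.coe_z_ne_one (by rw [h]; rfl))

lemma r_z : W.r W.z = 1 := by
  have h := congrArg W.r W.z_pow_p
  rw [map_pow, map_one] at h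
  have h2 : (W.r W.z - 1) ^ D.p = 0 := by rw [sub_pow_char, h, one_pow, sub_self]
  exact sub_eq_zero.1 (pow_eq_zero_iff D.hp.ne_zero |>.1 h2)

lemma z_sub_one_pow_dvd : (W.z - 1) ^ (D.p - 1) ∣ ((D.p : ℕ) : W.V) := by
  obtain ⟨n, hn⟩ : ∃ n, D.p = n + 1 := ⟨D.p - 1, (Nat.sub_add_cancel D.hp.one_le).symm⟩
  have h : IsPrimitiveRoot W.z (n + 1) := hn ▸ W.z_primitive
  have e := h.prod_one_sub_pow_eq_order
  rw [hn]
  push_cast at e ⊢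
  rw [← e]
  have : (W.z - 1) ^ n = ∏ _k ∈ Finset.range n, (W.z - 1) := by simp
  rw [this]
  refine Finset.prod_dvd_prod_of_dvd _ _ fun i _ => ?_
  rw [dvd_sub_comm]
  simpa using sub_dvd_pow_sub_pow W.z 1 (i + 1)

end PrimaryPrime.Place

namespace PrimaryPrime
variable (D : PrimaryPrime)

lemma four_dvd : 4 ∣ D.p - 1 := by
  obtain ⟨a, ha⟩ := D.odd_re
  obtain ⟨b, hb⟩ := D.even_im
  have h := D.norm_q
  rw [ha, hb] at h
  have : (D.p : ℤ) = 4 * (a ^ 2 + a + b ^ 2) + 1 := by rw [← h]; ring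
  omega

end PrimaryPrime

namespace PrimaryPrime.Place
variable {D : PrimaryPrime} (W : D.Place)

lemma cast_p_sub_one : ((D.p - 1 : ℕ) : W.k) = -1 := by
  rw [Nat.cast_sub D.hp.one_le, W.r_p]; simp

lemma cast_p_sub_one_ne_zero : ((D.p - 1 : ℕ) : W.k) ≠ 0 := by
  rw [cast_p_sub_one]; exact neg_ne_zero.2 one_ne_zero

lemma p_sub_one_ne_zero (D : PrimaryPrime) : D.p - 1 ≠ 0 := by
  have := D.hp.two_le; omega

lemma exists_om {t : ZMod D.p} (ht : t ≠ 0) : ∃ w : W.V, w ^ (D.p - 1) = 1 ∧ W.r w = W.ι t := by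
  have hn := p_sub_one_ne_zero D
  have h1 := Complex.isPrimitiveRoot_exp (D.p - 1) hn
  set y := Complex.exp (2 * Real.pi * I / ((D.p - 1 : ℕ) : ℂ)) with hy
  have hm : y ∈ W.V := mem_of_pow_eq_one W.V hn h1.pow_eq_one
  have h2 : IsPrimitiveRoot (⟨y, hm⟩ : W.V) (D.p - 1) :=
    IsPrimitiveRoot.of_map_of_injective (f := W.V.subtype) h1 Subtype.val_injective
  have e := congrArg (Polynomial.eval₂ W.r (W.ι t))
    (Polynomial.X_pow_sub_one_eq_prod (Nat.pos_of_ne_zero hn) h2)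
  rw [Polynomial.eval₂_finsetProd, Polynomial.eval₂_sub, Polynomial.eval₂_pow,
    Polynomial.eval₂_X, Polynomial.eval₂_one, ← map_pow, ZMod.pow_card_sub_one_eq_one ht, map_one,
    sub_self] at e
  obtain ⟨w, hw, hw2⟩ := Finset.prod_eq_zero_iff.1 e.symm
  rw [Polynomial.eval₂_sub, Polynomial.eval₂_X, Polynomial.eval₂_C, sub_eq_zero] at hw2
  exact ⟨w, (Polynomial.mem_nthRootsFinset (Nat.pos_of_ne_zero hn) _).1 hw, hw2.symm⟩

open Classical in
/-- The Teichmüller lift. -/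
def om (t : ZMod D.p) : W.V := if ht : t = 0 then 0 else (W.exists_om ht).choose

lemma om_zero : W.om 0 = 0 := dif_pos rfl

lemma om_pow {t : ZMod D.p} (ht : t ≠ 0) : W.om t ^ (D.p - 1) = 1 := by
  rw [om, dif_neg ht]
  exact (W.exists_om ht).choose_spec.1

lemma r_om (t : ZMod D.p) : W.r (W.om t) = W.ι t := by
  by_cases ht : t = 0
  · rw [ht, om_zero, map_zero, map_zero]
  · rw [om, dif_neg ht]
    exact (W.exists_om ht).choose_spec.2

lemma eq_om {t : ZMod D.p} (ht : t ≠ 0) {w : W.V} (h1 : w ^ (D.p - 1) = 1) (h2 : W.r w = W.ι t) :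
    w = W.om t :=
  eq_of_map_eq_of_pow_eq_one W.r W.cast_p_sub_one_ne_zero h1 (W.om_pow ht)
    (h2.trans (W.r_om t).symm)

lemma om_mul (s t : ZMod D.p) : W.om (s * t) = W.om s * W.om t := by
  by_cases hs : s = 0
  · rw [hs, zero_mul, om_zero, zero_mul]
  by_cases ht : t = 0
  · rw [ht, mul_zero, om_zero, mul_zero]
  refine (W.eq_om (mul_ne_zero hs ht) ?_ ?_).symm
  · rw [mul_pow, W.om_pow hs, W.om_pow ht, one_mul]
  · rw [map_mul, r_om, r_om, map_mul]

lemma om_injective : Function.Injective W.om := fun s t h => W.ι_injective (by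
  rw [← r_om, ← r_om, h])

lemma om_iF : (W.om D.iF : ℂ) = I := by
  have : W.gi gI = W.om D.iF := by
    refine W.eq_om D.iF_ne_zero ?_ ?_
    · obtain ⟨n, hn⟩ := D.four_dvd
      apply Subtype.ext
      push_cast
      rw [coe_gi, gI_coe, hn, pow_mul, I_pow_four, one_pow]
    · rw [r_gi, red_gI]
  rw [← this, coe_gi, gI_coe]

lemma dvd_om_sub {t : ZMod D.p} (ht : t ≠ 0) : ((D.p : ℕ) : W.V) ∣ W.om t - (t.val : W.V) := by
  refine dvd_sub_of_pow_eq_one W.cast_p_sub_one_ne_zero (W.om_pow ht) ?_ ?_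
  · have h : ((t.val ^ (D.p - 1) - 1 : ℤ) : ZMod D.p) = 0 := by
      push_cast
      rw [ZMod.natCast_zmod_val, ZMod.pow_card_sub_one_eq_one ht, sub_self]
    obtain ⟨c, hc⟩ := (ZMod.intCast_zmod_eq_zero_iff_dvd _ _).1 h
    refine ⟨(c : W.V), ?_⟩
    have := congrArg (Int.cast : ℤ → W.V) hc
    push_cast at this
    exact this
  · have h := W.r_om t
    rw [h, map_natCast, ι_natCast_val]

end PrimaryPrime.Place

lemma sum_range_four_mul {M : Type*} [AddCommMonoid M] (f : ℕ → M) (b : ℕ) :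
    ∑ k ∈ Finset.range (4 * b), f k =
      ∑ l ∈ Finset.range b, (f (4 * l) + f (4 * l + 1) + f (4 * l + 2) + f (4 * l + 3)) := by
  induction b with
  | zero => simp
  | succ b ih =>
    rw [show 4 * (b + 1) = 4 * b + 1 + 1 + 1 + 1 by ring, Finset.sum_range_succ,
      Finset.sum_range_succ, Finset.sum_range_succ, Finset.sum_range_succ, ih,
      Finset.sum_range_succ]
    simp only [add_assoc]

lemma PrimaryPrime.exists_eq_iF_pow {D : PrimaryPrime} {t : ZMod D.p} (ht : t ^ 4 = 1) :
    ∃ k ∈ Finset.range 4, t = D.iF ^ k := by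
  have h2 : D.iF ^ 2 = -1 := D.iF_pow_two
  have h : (t - 1) * (t + 1) * ((t - D.iF) * (t + D.iF)) = 0 := by
    linear_combination ht - (t ^ 2 - 1) * h2
  rcases mul_eq_zero.1 h with h | h <;> rcases mul_eq_zero.1 h with h | h
  · exact ⟨0, by simp, by linear_combination h⟩
  · exact ⟨2, by simp, by linear_combination h - h2⟩
  · exact ⟨1, by simp, by linear_combination h⟩
  · exact ⟨3, by simp, by linear_combination h - D.iF * h2⟩

namespace PrimaryPrime
variable {D : PrimaryPrime}

lemma IsQSet.eq_of_pow_four {S : Finset (ZMod D.p)} (hS : D.IsQSet S) {ν μ : ZMod D.p}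
    (hν : ν ∈ S) (hμ : μ ∈ S) (h : ν ^ 4 = μ ^ 4) : ν = μ := by
  have h0 := hS.ne_zero hμ
  obtain ⟨k, hk, e⟩ := PrimaryPrime.exists_eq_iF_pow (t := ν / μ) (by
    rw [div_pow, h, div_self (pow_ne_zero _ h0)])
  rw [div_eq_iff h0] at e
  have h1 : (ν, 0) ∈ ((S ×ˢ Finset.range 4 : Finset _) : Set (ZMod D.p × ℕ)) :=
    Finset.mem_coe.2 (Finset.mem_product.2 ⟨hν, by simp⟩)
  have h2 : (μ, k) ∈ ((S ×ˢ Finset.range 4 : Finset _) : Set (ZMod D.p × ℕ)) :=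
    Finset.mem_coe.2 (Finset.mem_product.2 ⟨hμ, hk⟩)
  have := hS.inj h1 h2 (by simpa using e)
  exact congrArg Prod.fst this

namespace Place
variable (W : D.Place)

/-- The Gauss sums of powers of the Teichmüller character. -/
def G (k : ℕ) : W.V := ∑ y ∈ Finset.univ.erase 0, W.om y ^ (D.p - 1 - k) * W.z ^ y.val

lemma orthogonality {x y : ZMod D.p} (hx : x ≠ 0) (hy : y ≠ 0) :
    ∑ k ∈ Finset.range (D.p - 1), W.om x ^ k * W.om y ^ (D.p - 1 - k) =
      if x = y then ((D.p - 1 : ℕ) : W.V) else 0 := by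
  split_ifs with h
  · rw [← h]
    have : ∀ k ∈ Finset.range (D.p - 1), W.om x ^ k * W.om x ^ (D.p - 1 - k) = 1 := by
      intro k hk
      rw [Finset.mem_range] at hk
      rw [← pow_add, Nat.add_sub_cancel' hk.le, W.om_pow hx]
    rw [Finset.sum_congr rfl this]
    simp
  · have : ∀ k ∈ Finset.range (D.p - 1), W.om x ^ k * W.om y ^ (D.p - 1 - k) =
        W.om y * (W.om x ^ k * W.om y ^ (D.p - 1 - 1 - k)) := by
      intro k hk
      rw [Finset.mem_range] at hk
      rw [show D.p - 1 - k = D.p - 1 - 1 - k + 1 by omega, pow_succ]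
      ring
    rw [Finset.sum_congr rfl this, ← Finset.mul_sum]
    have e := (Commute.all (W.om x) (W.om y)).geom_sum₂_mul (D.p - 1)
    rw [W.om_pow hx, W.om_pow hy, sub_self] at e
    rw [(mul_eq_zero.1 e).resolve_right (sub_ne_zero.2 fun h' => h (W.om_injective h')), mul_zero]

lemma sum_om_mul_G {x : ZMod D.p} (hx : x ≠ 0) :
    ∑ k ∈ Finset.range (D.p - 1), W.om x ^ k * W.G k = (D.p - 1 : ℕ) * W.z ^ x.val := by
  have : ∀ k ∈ Finset.range (D.p - 1), W.om x ^ k * W.G k = ∑ y ∈ Finset.univ.erase 0,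
      W.om x ^ k * W.om y ^ (D.p - 1 - k) * W.z ^ y.val := by
    intro k _
    rw [G, Finset.mul_sum]
    exact Finset.sum_congr rfl fun y _ => by ring
  rw [Finset.sum_congr rfl this, Finset.sum_comm]
  have : ∀ y ∈ Finset.univ.erase 0, ∑ k ∈ Finset.range (D.p - 1),
      W.om x ^ k * W.om y ^ (D.p - 1 - k) * W.z ^ y.val =
      if x = y then ((D.p - 1 : ℕ) : W.V) * W.z ^ y.val else 0 := by
    intro y hy
    rw [← Finset.sum_mul, W.orthogonality hx (Finset.ne_of_mem_erase hy)]
    split_ifs <;> simp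
  rw [Finset.sum_congr rfl this, Finset.sum_ite_eq, if_pos]
  exact Finset.mem_erase.2 ⟨hx, Finset.mem_univ _⟩

lemma mul_K (a : ℂ) {x : ZMod D.p} (hx : x ≠ 0) :
    ((D.p - 1 : ℕ) : ℂ) * D.K a x = ∑ k ∈ Finset.range (D.p - 1),
      (W.om x : ℂ) ^ k * W.G k * (1 + a * I ^ k + (a * I ^ k) ^ 2 + (a * I ^ k) ^ 3) := by
  have h : ∀ j, ((D.p - 1 : ℕ) : ℂ) * D.E (D.cb * (D.iF ^ j * x)) =
      ∑ k ∈ Finset.range (D.p - 1), (I ^ k) ^ j * ((W.om x : ℂ) ^ k * W.G k) := by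
    intro j
    have hj : D.iF ^ j * x ≠ 0 := mul_ne_zero (pow_ne_zero _ D.iF_ne_zero) hx
    have e := congrArg (Subtype.val) (W.sum_om_mul_G hj)
    have e1 : ∀ j, (W.om (D.iF ^ j * x) : ℂ) = I ^ j * W.om x := by
      intro j
      induction j with
      | zero => simp
      | succ j ih =>
        rw [pow_succ', mul_assoc, om_mul]
        push_cast
        rw [ih, om_iF]
        ring
    push_cast at e
    rw [W.coe_z_pow, e1] at e
    rw [← e]
    refine Finset.sum_congr rfl fun k _ => ?_
    rw [mul_pow, ← pow_mul, ← pow_mul, mul_comm j k]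
    ring
  have e2 : ∀ j, ((D.p - 1 : ℕ) : ℂ) * (a ^ j * D.E (D.cb * (D.iF ^ j * x))) =
      ∑ k ∈ Finset.range (D.p - 1), a ^ j * (I ^ k) ^ j * ((W.om x : ℂ) ^ k * W.G k) := by
    intro j
    rw [mul_left_comm, h, Finset.mul_sum]
    exact Finset.sum_congr rfl fun k _ => by ring
  rw [K, Finset.mul_sum, Finset.sum_congr rfl fun j _ => e2 j, Finset.sum_comm]
  refine Finset.sum_congr rfl fun k _ => ?_
  rw [← Finset.sum_mul]
  simp only [Finset.sum_range_succ, Finset.sum_range_zero]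
  ring

lemma mul_K_four {b : ℕ} (hb : D.p = 4 * b + 1) {a : ℂ} {c : ℕ}
    (hac : a = 1 ∧ c = 0 ∨ a = I ∧ c = 3) {x : ZMod D.p} (hx : x ≠ 0) :
    ((D.p - 1 : ℕ) : ℂ) * D.K a x =
      ∑ l ∈ Finset.range b, (W.om x : ℂ) ^ (4 * l + c) * (4 * W.G (4 * l + c)) := by
  have h1 : D.p - 1 = 4 * b := by omega
  have h2 : ∀ l, I ^ (4 * l) = 1 := fun l => by rw [pow_mul, I_pow_four, one_pow]
  have h3 : I ^ 3 = -I := I_pow_three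
  rw [W.mul_K a hx, h1, sum_range_four_mul]
  refine Finset.sum_congr rfl fun l _ => ?_
  rcases hac with ⟨rfl, rfl⟩ | ⟨rfl, rfl⟩
  · simp only [pow_add I, h2, one_mul, mul_one, pow_one, I_sq, h3, I_sq, add_zero]
    linear_combination ((W.om x : ℂ) ^ (4 * l + 3) * W.G (4 * l + 3) * (1 - I)) * I_sq
  · simp only [pow_add I, h2, one_mul, mul_one, pow_one, I_sq, h3]
    linear_combination ((W.om x : ℂ) ^ (4 * l + 3) * W.G (4 * l + 3) * (-3 + 2 * I ^ 2 - I ^ 4)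
      + (W.om x : ℂ) ^ (4 * l + 2) * W.G (4 * l + 2) * (1 - I)
      + (W.om x : ℂ) ^ (4 * l + 1) * W.G (4 * l + 1) * (1 + I ^ 4)) * I_sq

lemma det_KM {S : Finset (ZMod D.p)} (hS : D.IsQSet S) {a : ℂ} {c : ℕ}
    (hac : a = 1 ∧ c = 0 ∨ a = I ∧ c = 3) :
    ((D.p - 1 : ℕ) : ℂ) ^ S.card * (KM S a).det = ((∏ ν ∈ S, (W.om ν : ℂ)) ^ c) ^ 2 *
      (Matrix.vandermonde fun i => (W.om (en S i) : ℂ) ^ 4).det ^ 2 *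
      (4 ^ S.card * ∏ l ∈ Finset.range S.card, (W.G (4 * l + c) : ℂ)) := by
  set Vd := Matrix.vandermonde fun i => (W.om (en S i) : ℂ) ^ 4 with hVd
  have e : ((D.p - 1 : ℕ) : ℂ) • KM S a = Matrix.of fun i j => (W.om (en S i) : ℂ) ^ c *
      (Matrix.of fun i j => (W.om (en S j) : ℂ) ^ c * (Vd * (Matrix.of fun (i l : Fin S.card) =>
        (4 * (W.G (4 * l + c) : ℂ)) * Vd i l).transpose) i j) i j := by
    ext i j
    rw [Matrix.smul_apply, KM, Matrix.of_apply, smul_eq_mul, W.mul_K_four hS.card hac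
      (mul_ne_zero (hS.ne_zero (en_mem S i)) (hS.ne_zero (en_mem S j))), Matrix.of_apply,
      Matrix.of_apply, Matrix.mul_apply, Finset.mul_sum, Finset.mul_sum, Finset.sum_range]
    refine Finset.sum_congr rfl fun l _ => ?_
    rw [om_mul, Matrix.transpose_apply, Matrix.of_apply, hVd, Matrix.vandermonde_apply,
      Matrix.vandermonde_apply]
    push_cast
    rw [mul_pow, pow_add, pow_add, pow_mul, pow_mul]
    ring
  have e2 := congrArg Matrix.det e
  rw [Matrix.det_smul, Matrix.det_mul_column, Matrix.det_mul_row, Matrix.det_mul,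
    Matrix.det_transpose, Matrix.det_mul_row, Fintype.card_fin, Finset.prod_mul_distrib,
    prod_en S (fun x => (W.om x : ℂ) ^ c), Finset.prod_pow,
    ← Finset.prod_range (fun l => (W.G (4 * l + c) : ℂ))] at e2
  simp only [Finset.prod_const, Finset.card_univ, Fintype.card_fin] at e2
  rw [e2]
  ring

/-- The determinant identity, expressed through Gauss sums. -/
theorem prod_G {S : Finset (ZMod D.p)} (hS : D.IsQSet S) :
    D.q * starRingEnd ℂ (∏ ν ∈ S, D.X ν) * ∏ l ∈ Finset.range S.card, (W.G (4 * l) : ℂ) =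
      (-1) ^ (∑ i ∈ Finset.range S.card, i) * (∏ ν ∈ S, D.X ν) * (∏ ν ∈ S, (W.om ν : ℂ)) ^ 6 *
      ∏ l ∈ Finset.range S.card, (W.G (4 * l + 3) : ℂ) := by
  have h0 := W.det_KM hS (a := 1) (c := 0) (Or.inl ⟨rfl, rfl⟩)
  have h1 := W.det_KM hS (a := I) (c := 3) (Or.inr ⟨rfl, rfl⟩)
  have hv : (Matrix.vandermonde fun i => (W.om (en S i) : ℂ) ^ 4).det ≠ 0 := by
    rw [Matrix.det_vandermonde_ne_zero_iff]
    intro i j hij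
    have e : W.om (en S i ^ 4) = W.om (en S j ^ 4) := by
      apply Subtype.ext
      simp only [pow_succ, pow_zero, one_mul, om_mul] at hij ⊢
      push_cast
      exact hij
    exact en_injective S (hS.eq_of_pow_four (en_mem S i) (en_mem S j) (W.om_injective e))
  have h2 := hS.det_K
  simp only [add_zero, pow_zero, one_pow, one_mul] at h0
  have hp : ((D.p - 1 : ℕ) : ℂ) ^ S.card ≠ 0 :=
    pow_ne_zero _ (Nat.cast_ne_zero.2 (p_sub_one_ne_zero D))
  have h4 : (4 : ℂ) ^ S.card ≠ 0 := pow_ne_zero _ (by norm_num)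
  generalize (Matrix.vandermonde fun i => (W.om (en S i) : ℂ) ^ 4).det = v at *
  generalize (∏ l ∈ Finset.range S.card, (W.G (4 * l) : ℂ)) = g0 at *
  generalize (∏ l ∈ Finset.range S.card, (W.G (4 * l + 3) : ℂ)) = g3 at *
  apply mul_left_cancel₀ (mul_ne_zero (pow_ne_zero 2 hv) h4)
  linear_combination ((D.p - 1 : ℕ) : ℂ) ^ S.card * h2 -
    D.q * starRingEnd ℂ (∏ ν ∈ S, D.X ν) * h0 +
    (-1) ^ (∑ i ∈ Finset.range S.card, i) * (∏ ν ∈ S, D.X ν) * h1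

end Place
end PrimaryPrime

namespace PrimaryPrime
variable {D : PrimaryPrime}

/-- The quartic residue character. -/
structure IsQuartRes (D : PrimaryPrime) (χ : MulChar (ZMod D.p) ℂ) : Prop extends D.IsQuart χ where
  euler : ∀ t, ∃ g : GaussianInt, χ t = (g : ℂ) ∧ D.red g = t ^ ((D.p - 1) / 4)

variable {χ : MulChar (ZMod D.p) ℂ}

/-- The additive character of the Gauss sums. -/
def addChar (D : PrimaryPrime) : AddChar (ZMod D.p) ℂ := AddChar.mulShift ZMod.stdAddChar D.cb

lemma addChar_apply (t : ZMod D.p) : D.addChar t = D.E (D.cb * t) := rfl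

lemma addChar_isPrimitive : D.addChar.IsPrimitive := by
  intro a ha
  rw [addChar, AddChar.mulShift_mulShift]
  exact ZMod.isPrimitive_stdAddChar D.p (mul_ne_zero D.cb_ne_zero ha)

lemma gs_eq : D.gs χ = gaussSum χ D.addChar := rfl

lemma IsQuart.gs_mul_conj (hχ : D.IsQuart χ) : D.gs χ * starRingEnd ℂ (D.gs χ) = D.p := by
  have h := gaussSum_mul_gaussSum_eq_card hχ.ne_one D.addChar_isPrimitive
  rw [ZMod.card] at h
  rw [← h, gs_eq]
  congr 1
  rw [gaussSum, map_sum]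
  refine Finset.sum_congr rfl fun t _ => ?_
  rw [map_mul, addChar_apply, E_conj, AddChar.inv_apply, addChar_apply, mul_neg]
  congr 1
  by_cases ht : t = 0
  · rw [ht, MulChar.map_zero, MulChar.map_zero, map_zero]
  · have h1 := hχ.conj_mul ht
    have h0 : χ t ≠ 0 := right_ne_zero_of_mul_eq_one h1
    have h2 : χ⁻¹ t * χ t = 1 := by
      rw [← MulChar.mul_apply, inv_mul_cancel, MulChar.one_apply (isUnit_iff_ne_zero.2 ht)]
    exact mul_right_cancel₀ h0 (h1.trans h2.symm)

lemma IsQuartRes.sq_ne_one (hχ : D.IsQuartRes χ) : χ * χ ≠ 1 := by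
  intro h
  obtain ⟨b, hb⟩ := D.four_dvd
  have hb0 : b ≠ 0 := by
    rintro rfl
    have := D.hp.two_le
    omega
  obtain ⟨a, ha⟩ := exists_pow_ne_one_of_isCyclic (G := (ZMod D.p)ˣ) (k := 2 * b) (by omega) (by
    rw [Nat.card_eq_fintype_card, ZMod.card_units, hb]; omega)
  obtain ⟨g, hg, hr⟩ := hχ.euler a
  have h1 : χ a * χ a = 1 := by
    rw [← MulChar.mul_apply, h, MulChar.one_apply a.isUnit]
  rw [hg] at h1
  have h2 : g * g = 1 := GaussianInt.toComplex_injective (by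
    rw [GaussianInt.toComplex_mul, GaussianInt.toComplex_one]; exact h1)
  have h3 := congrArg D.red h2
  rw [map_mul, hr, map_one, hb, Nat.mul_div_cancel_left _ (by norm_num), ← pow_add] at h3
  apply ha
  ext
  push_cast
  rw [← h3]
  congr 1
  ring

lemma IsQuartRes.gs_pow (hχ : D.IsQuartRes χ) :
    ∃ j : GaussianInt, D.gs χ ^ 8 = (j : ℂ) ^ 4 * (D.p : ℂ) ^ 2 ∧
      (j : ℂ) * starRingEnd ℂ (j : ℂ) = D.p := by
  choose g hg _ using hχ.euler
  have hj : ((∑ x, g x * g (1 - x) : GaussianInt) : ℂ) = jacobiSum χ χ := by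
    have h : ((∑ x, g x * g (1 - x) : GaussianInt) : ℂ) =
        ∑ x, ((g x * g (1 - x) : GaussianInt) : ℂ) := map_sum GaussianInt.toComplex _ _
    rw [h, jacobiSum]
    refine Finset.sum_congr rfl fun x _ => ?_
    rw [GaussianInt.toComplex_mul, ← hg, ← hg]
  refine ⟨∑ x, g x * g (1 - x), ?_⟩
  rw [hj]
  have e1 := jacobiSum_mul_nontrivial hχ.sq_ne_one D.addChar
  have hq : (χ * χ).IsQuadratic := by
    intro t
    by_cases ht : t = 0
    · left; rw [ht, MulChar.map_zero]
    · right
      have h := hχ.pow_four t ht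
      rw [MulChar.mul_apply]
      have h2 : (χ t * χ t - 1) * (χ t * χ t + 1) = 0 := by linear_combination h
      rcases mul_eq_zero.1 h2 with h3 | h3
      · left; linear_combination h3
      · right; linear_combination h3
  have e2 := gaussSum_sq hχ.sq_ne_one hq D.addChar_isPrimitive
  rw [ZMod.card] at e2
  have e3 : (χ * χ) (-1) ^ 2 = 1 := by
    rw [← map_pow, neg_one_sq, map_one]
  rw [← gs_eq (χ := χ)] at e1
  generalize gaussSum (χ * χ) D.addChar = G at *
  generalize jacobiSum χ χ = J at *
  have e4 : G ^ 4 = (D.p : ℂ) ^ 2 := by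
    rw [show G ^ 4 = (G ^ 2) ^ 2 by ring, e2, mul_pow, e3, one_mul]
  have e8 : D.gs χ ^ 8 = J ^ 4 * (D.p : ℂ) ^ 2 := by
    rw [← e4, ← mul_pow, mul_comm, e1]; ring
  refine ⟨e8, ?_⟩
  have n1 : ‖D.gs χ‖ ^ 2 = D.p := by
    have := hχ.gs_mul_conj
    rw [Complex.mul_conj, Complex.normSq_eq_norm_sq] at this
    exact_mod_cast this
  have n2 := congrArg norm e8
  rw [norm_mul, norm_pow, norm_pow, norm_pow, Complex.norm_natCast,
    show ‖D.gs χ‖ ^ 8 = (‖D.gs χ‖ ^ 2) ^ 4 by ring, n1] at n2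
  have hp : (0 : ℝ) < D.p := Nat.cast_pos.2 D.hp.pos
  have n3 : (‖J‖ ^ 2) ^ 2 = (D.p : ℝ) ^ 2 := by
    apply mul_right_cancel₀ (pow_ne_zero 2 hp.ne')
    linear_combination -n2
  have n4 : ‖J‖ ^ 2 = D.p := by
    rwa [pow_left_inj₀ (by positivity) hp.le (by norm_num)] at n3
  rw [Complex.mul_conj, Complex.normSq_eq_norm_sq, n4]
  simp

end PrimaryPrime

lemma factorial_mul_factorial {p : ℕ} [Fact p.Prime] {k : ℕ} (hk : k < p) :
    (k.factorial : ZMod p) * ((p - 1 - k).factorial : ZMod p) = (-1) ^ (k + 1) := by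
  induction k with
  | zero => simp
  | succ k ih =>
    have h := ih (by omega)
    obtain ⟨m, hm⟩ : ∃ m, p = m + k + 2 := ⟨p - k - 2, by omega⟩
    have h0 : ((k + 1 : ℕ) : ZMod p) ≠ 0 := by
      rw [Ne, ZMod.natCast_eq_zero_iff]
      exact Nat.not_dvd_of_pos_of_lt (by omega) hk
    have h1 : ((m + 1 : ℕ) : ZMod p) = -((k + 1 : ℕ) : ZMod p) := by
      rw [eq_neg_iff_add_eq_zero, ← Nat.cast_add, show m + 1 + (k + 1) = p by omega,
        ZMod.natCast_self]
    rw [show p - 1 - k = m + 1 by omega, Nat.factorial_succ, Nat.cast_mul, h1] at h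
    rw [show p - 1 - (k + 1) = m by omega, Nat.factorial_succ, Nat.cast_mul, pow_succ, ← h]
    ring

lemma prod_factorial (b : ℕ) :
    (∏ l ∈ Finset.range b, (4 * l + 3).factorial) * (4 ^ b * b.factorial) =
      (∏ l ∈ Finset.range b, (4 * l).factorial) * (4 * b).factorial := by
  induction b with
  | zero => simp
  | succ b ih =>
    rw [Finset.prod_range_succ, Finset.prod_range_succ, show 4 * (b + 1) = 4 * b + 3 + 1 by ring,
      Nat.factorial_succ (4 * b + 3), Nat.factorial_succ b, pow_succ]
    linear_combination ((4 * b + 3).factorial * (4 * b + 4)) * ih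

lemma PrimaryPrime.prod_factorial_zmod {D : PrimaryPrime} {b : ℕ} (hb : D.p = 4 * b + 1) :
    ((3 * b).factorial : ZMod D.p) * ∏ l ∈ Finset.range b, ((4 * l).factorial : ZMod D.p) =
      ∏ l ∈ Finset.range b, ((4 * l + 3).factorial : ZMod D.p) := by
  have h1 := congrArg (Nat.cast : ℕ → ZMod D.p) (prod_factorial b)
  have h2 := factorial_mul_factorial (p := D.p) (k := b) (by omega)
  have h3 := ZMod.wilsons_lemma D.p
  rw [show D.p - 1 - b = 3 * b by omega] at h2
  rw [show D.p - 1 = 4 * b by omega] at h3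
  push_cast at h1
  rw [h3] at h1
  have h4 : (4 : ZMod D.p) ^ b = (-1) ^ b := by
    have e : (1 + D.iF) ^ 4 = -4 := by
      linear_combination (D.iF * D.iF + 4 * D.iF + 5) * D.iF_mul
    have e2 : (1 + D.iF) ^ (4 * b) = 1 := by
      rw [← show D.p - 1 = 4 * b by omega]
      exact ZMod.pow_card_sub_one_eq_one D.one_add_iF_ne_zero
    rw [pow_mul, e] at e2
    have e3 : ((-1 : ZMod D.p) ^ b) * (-1) ^ b = 1 := by rw [← mul_pow]; simp
    rw [neg_pow] at e2
    linear_combination (-1) ^ b * e2 - 4 ^ b * e3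
  rw [h4] at h1
  have e3 : ((-1 : ZMod D.p) ^ b) * (-1) ^ b = 1 := by rw [← mul_pow]; simp
  rw [pow_succ] at h2
  generalize ∏ l ∈ Finset.range b, ((4 * l).factorial : ZMod D.p) = A at *
  generalize ∏ l ∈ Finset.range b, ((4 * l + 3).factorial : ZMod D.p) = B at *
  linear_combination ((3 * b).factorial : ZMod D.p) * h1 - B * (-1) ^ b * h2 + B * e3

namespace PrimaryPrime
variable {D : PrimaryPrime}

namespace Place
variable (W : D.Place)

lemma exists_G {k : ℕ} (hk : k < D.p - 1) :
    ∃ v : W.V, W.G k = (W.z - 1) ^ k * v ∧ W.ι k.factorial * W.r v = -1 := by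
  obtain ⟨v, h1, h2⟩ := stickelberger W.z_sub_one_pow_dvd (fun t ht => W.dvd_om_sub ht) hk
  refine ⟨v, h1, ?_⟩
  obtain ⟨c, hc⟩ := h2
  have := congrArg W.r hc
  rw [map_mul, map_sub, r_z, map_one, sub_self, zero_mul, map_add, map_mul, map_one,
    map_natCast] at this
  rw [map_natCast]
  linear_combination this

/-- The coefficient of the Gauss sum. -/
def v (k : ℕ) : W.V := if hk : k < D.p - 1 then (W.exists_G hk).choose else 1

lemma G_eq {k : ℕ} (hk : k < D.p - 1) : W.G k = (W.z - 1) ^ k * W.v k := by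
  rw [v, dif_pos hk]; exact (W.exists_G hk).choose_spec.1

lemma r_v {k : ℕ} (hk : k < D.p - 1) : W.ι k.factorial * W.r (W.v k) = -1 := by
  rw [v, dif_pos hk]; exact (W.exists_G hk).choose_spec.2

lemma coe_om_pow {χ : MulChar (ZMod D.p) ℂ} (hχ : D.IsQuartRes χ) {b : ℕ} (hb : D.p = 4 * b + 1)
    {t : ZMod D.p} (ht : t ≠ 0) : χ t = (W.om t : ℂ) ^ b := by
  obtain ⟨g, hg, hr⟩ := hχ.euler t
  have h4 : ((4 : ℕ) : W.k) ≠ 0 := by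
    intro h
    have h2 : ((2 : ℕ) : W.k) ^ 2 = 0 := by rw [← h]; push_cast; norm_num
    have h3 := pow_eq_zero_iff (n := 2) (by norm_num) |>.1 h2
    rw [CharP.cast_eq_zero_iff W.k D.p] at h3
    have := Nat.le_of_dvd (by norm_num) h3
    have := D.hp.two_le
    omega
  have : W.gi g = W.om t ^ b := by
    refine eq_of_map_eq_of_pow_eq_one W.r h4 ?_ ?_ ?_
    · apply Subtype.ext
      push_cast
      rw [coe_gi, ← hg]
      exact hχ.pow_four t ht
    · rw [← pow_mul, mul_comm, ← show D.p - 1 = 4 * b by omega]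
      exact W.om_pow ht
    · rw [r_gi, hr, map_pow, map_pow, r_om, show (D.p - 1) / 4 = b by omega]
  rw [hg, ← coe_gi W, this]
  push_cast
  rfl

lemma gs_eq_G {χ : MulChar (ZMod D.p) ℂ} (hχ : D.IsQuartRes χ) {b : ℕ} (hb : D.p = 4 * b + 1) :
    D.gs χ = W.G (3 * b) := by
  rw [gs, ← Finset.add_sum_erase _ _ (Finset.mem_univ 0), MulChar.map_zero, zero_mul, zero_add, G]
  push_cast
  refine Finset.sum_congr rfl fun t ht => ?_
  rw [W.coe_om_pow hχ hb (Finset.ne_of_mem_erase ht), W.coe_z_pow,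
    show D.p - 1 - 3 * b = b by omega]

/-- The normalised quotient of the elliptic and the classical Gauss sum data, with its
residue. -/
theorem exists_unit {χ : MulChar (ZMod D.p) ℂ} (hχ : D.IsQuartRes χ) {S : Finset (ZMod D.p)}
    (hS : D.IsQSet S) :
    ∃ u : W.V, D.q * starRingEnd ℂ (∏ ν ∈ S, D.X ν) =
      (-1) ^ (∑ i ∈ Finset.range S.card, i) * D.gs χ * (∏ ν ∈ S, D.X ν) * u ∧
      W.r u = -W.ι (∏ ν ∈ S, ν) ^ 6 := by
  have hb := hS.card
  have hb0 := hS.card_pos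
  have e := W.prod_G hS
  rw [W.gs_eq_G hχ hb]
  set b := S.card with hbd
  set P := ∏ ν ∈ S, D.X ν
  set s : ℂ := (-1) ^ (∑ i ∈ Finset.range b, i) with hs
  have hss : s * s = 1 := by rw [hs, ← mul_pow]; simp
  set V0 := ∏ l ∈ Finset.range b, W.v (4 * l) with hV0
  set V3 := ∏ l ∈ Finset.range b, W.v (4 * l + 3) with hV3
  set L := ∏ l ∈ Finset.range b, (W.z - 1) ^ (4 * l) with hL
  set Om := ∏ ν ∈ S, W.om ν with hOm
  have g0 : ∏ l ∈ Finset.range b, W.G (4 * l) = L * V0 := by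
    rw [← Finset.prod_mul_distrib]
    refine Finset.prod_congr rfl fun l hl => W.G_eq ?_
    rw [Finset.mem_range] at hl
    omega
  have g3 : ∏ l ∈ Finset.range b, W.G (4 * l + 3) = (W.z - 1) ^ (3 * b) * L * V3 := by
    have : (W.z - 1) ^ (3 * b) = ∏ _l ∈ Finset.range b, (W.z - 1) ^ 3 := by
      rw [Finset.prod_const, Finset.card_range, pow_mul]
    rw [this, ← Finset.prod_mul_distrib, ← Finset.prod_mul_distrib]
    refine Finset.prod_congr rfl fun l hl => ?_
    rw [Finset.mem_range] at hl
    rw [W.G_eq (by omega), pow_add]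
    ring
  have gb := W.G_eq (k := 3 * b) (by omega)
  have vb := W.r_v (k := 3 * b) (by omega)
  have f0 : W.ι (∏ l ∈ Finset.range b, ((4 * l).factorial : ZMod D.p)) * W.r V0 = (-1) ^ b := by
    rw [map_prod, map_prod, ← Finset.prod_mul_distrib]
    rw [Finset.prod_congr rfl fun l hl => W.r_v (k := 4 * l) (by
      rw [Finset.mem_range] at hl; omega)]
    simp
  have f3 : W.ι (∏ l ∈ Finset.range b, ((4 * l + 3).factorial : ZMod D.p)) * W.r V3 =
      (-1) ^ b := by
    rw [map_prod, map_prod, ← Finset.prod_mul_distrib]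
    rw [Finset.prod_congr rfl fun l hl => W.r_v (k := 4 * l + 3) (by
      rw [Finset.mem_range] at hl; omega)]
    simp
  have hOmr : W.r Om = W.ι (∏ ν ∈ S, ν) := by
    rw [map_prod, map_prod]
    exact Finset.prod_congr rfl fun ν _ => W.r_om ν
  rw [← prod_factorial_zmod hb, map_mul] at f3
  have hsgn : ((-1 : W.k)) ^ b ≠ 0 := pow_ne_zero _ (neg_ne_zero.2 one_ne_zero)
  have hunit : IsUnit (W.v (3 * b) * V0) := by
    rw [← IsLocalRing.residue_ne_zero_iff_isUnit, map_mul]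
    refine mul_ne_zero (fun h => ?_) (fun h => ?_)
    · have : W.r (W.v (3 * b)) = 0 := h
      rw [this, mul_zero] at vb
      exact neg_ne_zero.2 one_ne_zero vb.symm
    · have : W.r V0 = 0 := h
      rw [this, mul_zero] at f0
      exact hsgn f0.symm
  obtain ⟨y, hy⟩ := hunit.exists_right_inv
  have hz0 : W.z - 1 ≠ 0 := sub_ne_zero.2 fun h => W.coe_z_ne_one (by rw [h]; rfl)
  have hL0 : (L : ℂ) ≠ 0 := by
    have : L ≠ 0 := Finset.prod_ne_zero_iff.2 fun _ _ => pow_ne_zero _ hz0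
    exact fun h => this (Subtype.ext h)
  refine ⟨Om ^ 6 * V3 * y, ?_, ?_⟩
  · have c0 := congrArg (Subtype.val : W.V → ℂ) g0
    have c3 := congrArg (Subtype.val : W.V → ℂ) g3
    have cb := congrArg (Subtype.val : W.V → ℂ) gb
    have cy := congrArg (Subtype.val : W.V → ℂ) hy
    have cO : (Om : ℂ) = ∏ ν ∈ S, (W.om ν : ℂ) := by rw [hOm]; push_cast; rfl
    push_cast at c0 c3 cb cy
    rw [c0, c3, ← cO] at e
    push_cast
    rw [cb]
    apply mul_left_cancel₀ hL0
    linear_combination (W.v (3 * b) * y : ℂ) * e +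
      (-D.q * starRingEnd ℂ P * L) * cy
  · have hyr := congrArg W.r hy
    rw [map_mul, map_mul, map_one] at hyr
    rw [map_mul, map_mul, map_pow, hOmr]
    generalize W.ι (∏ ν ∈ S, ν) = N at *
    generalize W.ι (∏ l ∈ Finset.range b, ((4 * l).factorial : ZMod D.p)) = A at *
    generalize W.ι ((3 * b).factorial : ZMod D.p) = B at *
    have h : W.r V3 * W.r y = -1 := by
      have hA : A ≠ 0 := left_ne_zero_of_mul (f0 ▸ hsgn)
      have hB : B ≠ 0 := left_ne_zero_of_mul (vb ▸ neg_ne_zero.2 one_ne_zero)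
      have k1 : W.r V3 = -(W.r (W.v (3 * b)) * W.r V0) := by
        apply mul_left_cancel₀ (mul_ne_zero hB hA)
        linear_combination f3 + A * W.r V0 * vb - f0
      rw [k1]
      linear_combination -hyr
    linear_combination N ^ 6 * h

end Place
end PrimaryPrime

lemma GaussianInt.pow_four_eq_one {w : GaussianInt} (h : (w : ℂ) * starRingEnd ℂ (w : ℂ) = 1) :
    (w : ℂ) ^ 4 = 1 := by
  have h1 : w.re * w.re + w.im * w.im = 1 := by
    rw [Complex.mul_conj, Complex.normSq_apply, ← GaussianInt.intCast_re,
      ← GaussianInt.intCast_im] at h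
    exact_mod_cast h
  have h2 : (w.re : ℂ) * w.re + w.im * w.im = 1 := by exact_mod_cast h1
  have h3 : w.re * w.im = 0 := by
    by_contra hne
    have a1 : 0 < w.re * w.re := mul_self_pos.2 (left_ne_zero_of_mul hne)
    have a2 : 0 < w.im * w.im := mul_self_pos.2 (right_ne_zero_of_mul hne)
    omega
  have h4 : (w.re : ℂ) * w.im = 0 := by exact_mod_cast h3
  rw [GaussianInt.toComplex_def]
  have hI := I_sq
  linear_combination ((w.re : ℂ) * w.re + w.im * w.im + 1) * h2
    + (4 * (w.re : ℂ) ^ 2 * I + 6 * w.re * w.im * I ^ 2 + 4 * (w.im : ℂ) ^ 2 * I ^ 3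
      - 2 * w.re * w.im) * h4 + (w.im : ℂ) ^ 4 * (I ^ 2 - 1) * hI

namespace PrimaryPrime
variable {D : PrimaryPrime}

namespace Place
variable (W : D.Place)

theorem conj_prod_X {χ : MulChar (ZMod D.p) ℂ} (hχ : D.IsQuartRes χ) {S : Finset (ZMod D.p)}
    (hS : D.IsQSet S) {γ : W.V} (hγ : γ ^ 8 = 1) (hr : W.r γ = W.ι (∏ ν ∈ S, ν)) :
    D.q * starRingEnd ℂ (∏ ν ∈ S, D.X ν) =
      -((-1) ^ (∑ i ∈ Finset.range S.card, i) * D.gs χ * (∏ ν ∈ S, D.X ν) * (γ : ℂ) ^ 6) := by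
  obtain ⟨u, hu, hur⟩ := W.exists_unit hχ hS
  obtain ⟨j, hj, hjp⟩ := hχ.gs_pow
  have hP := hS.prod_X_pow
  have hP0 := hS.prod_X_ne_zero
  have hq := D.q_coe_ne_zero
  have hp := D.coe_mul_conj
  have hp0 : (D.p : ℂ) ≠ 0 := Nat.cast_ne_zero.2 D.hp.ne_zero
  set s : ℂ := (-1) ^ (∑ i ∈ Finset.range S.card, i) with hs
  have hss : s ^ 2 = 1 := by rw [hs, ← pow_mul, mul_comm, pow_mul]; simp
  have hN : ∏ ν ∈ S, ν ≠ 0 := Finset.prod_ne_zero_iff.2 fun _ h => hS.ne_zero h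
  have key : (D.q : ℂ) ^ 4 = (j : ℂ) ^ 4 * (u : ℂ) ^ 8 := by
    have e := congrArg (fun x => x ^ 8) hu
    simp only [mul_pow, hj] at e
    have e1 : (∏ ν ∈ S, D.X ν) ^ 8 = (D.q : ℂ) ^ 2 := by
      rw [show (∏ ν ∈ S, D.X ν) ^ 8 = ((∏ ν ∈ S, D.X ν) ^ 4) ^ 2 by ring, hP, mul_pow, ← pow_mul,
        mul_comm S.card, pow_mul]
      simp
    have e2 : starRingEnd ℂ (∏ ν ∈ S, D.X ν) ^ 8 = starRingEnd ℂ (D.q : ℂ) ^ 2 := by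
      rw [← map_pow, e1, map_pow]
    rw [e1, e2, show s ^ 8 = (s ^ 2) ^ 4 by ring, hss] at e
    apply mul_left_cancel₀ (mul_ne_zero (pow_ne_zero 2 hq) (pow_ne_zero 2 hp0))
    rw [← hp] at e ⊢
    linear_combination e
  have hu0 : W.r u ≠ 0 := by
    rw [hur, neg_ne_zero]
    exact pow_ne_zero _ ((map_ne_zero W.ι).2 hN)
  have hjq : D.q ∣ j := by
    rw [← red_eq_zero_iff]
    apply W.ι_injective
    have h1 : W.gi D.q ^ 4 = W.gi j ^ 4 * u ^ 8 := by
      apply Subtype.ext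
      push_cast
      rw [coe_gi, coe_gi, key]
    have h2 := congrArg W.r h1
    rw [map_mul, map_pow, map_pow, map_pow, r_gi_q, r_gi] at h2
    rw [map_zero]
    have h3 := (mul_eq_zero.1 (h2.symm.trans (zero_pow (by norm_num)))).resolve_right
      (pow_ne_zero _ hu0)
    exact pow_eq_zero_iff (by norm_num) |>.1 h3
  obtain ⟨w, hw⟩ := hjq
  have hw4 : (w : ℂ) ^ 4 = 1 := by
    apply GaussianInt.pow_four_eq_one
    rw [hw, GaussianInt.toComplex_mul, map_mul] at hjp
    apply mul_left_cancel₀ hp0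
    linear_combination hjp - (w : ℂ) * starRingEnd ℂ (w : ℂ) * hp
  have hu8 : (u : ℂ) ^ 8 = 1 := by
    rw [hw, GaussianInt.toComplex_mul, mul_pow, hw4, mul_one] at key
    apply mul_left_cancel₀ (pow_ne_zero 4 hq)
    rw [← key, mul_one]
  have h8 : ((8 : ℕ) : W.k) ≠ 0 := by
    intro h
    have h2 : ((2 : ℕ) : W.k) ^ 3 = 0 := by rw [← h]; push_cast; norm_num
    have h3 := pow_eq_zero_iff (n := 3) (by norm_num) |>.1 h2
    rw [CharP.cast_eq_zero_iff W.k D.p] at h3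
    have h4 := Nat.le_of_dvd (by norm_num) h3
    have h5 := D.hp.two_le
    exact D.hp2 (by omega)
  have hfin : u = -γ ^ 6 := by
    refine eq_of_map_eq_of_pow_eq_one W.r h8 ?_ ?_ ?_
    · apply Subtype.ext
      push_cast
      exact hu8
    · rw [show (-γ ^ 6) ^ 8 = (γ ^ 8) ^ 6 by ring, hγ, one_pow]
    · rw [hur, map_neg, map_pow, hr]
  rw [hu, hfin]
  push_cast
  ring

end Place
end PrimaryPrime

namespace PrimaryPrime
variable {D : PrimaryPrime}

theorem Place.coefficient_eq (W : D.Place) {χ : MulChar (ZMod D.p) ℂ} (hχ : D.IsQuartRes χ)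
    {S : Finset (ZMod D.p)} (hS : D.IsQSet S) {γ : W.V}
    (hγ : (γ : ℂ) ^ 4 = (-1) ^ (S.card + 1)) (hr : W.r γ = W.ι (∏ ν ∈ S, ν)) {A κ : ℂ}
    (hA : starRingEnd ℂ (D.gs χ) * A = D.q * κ * starRingEnd ℂ A) :
    (((γ : ℂ)⁻¹ * ∏ ν ∈ S, D.X ν) ^ 3)⁻¹ * A =
      -(-1) ^ (∑ i ∈ Finset.range S.card, i) * κ *
        starRingEnd ℂ ((((γ : ℂ)⁻¹ * ∏ ν ∈ S, D.X ν) ^ 3)⁻¹ * A) := by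
  have hsgn : ∀ n : ℕ, ((-1 : ℂ) ^ n) ^ 2 = 1 := fun n => by rw [← pow_mul, mul_comm, pow_mul]; simp
  have hγ8 : (γ : ℂ) ^ 8 = 1 := by
    rw [show (γ : ℂ) ^ 8 = ((γ : ℂ) ^ 4) ^ 2 by ring, hγ, hsgn]
  have h1 := W.conj_prod_X hχ hS (γ := γ) (Subtype.ext (by push_cast; exact hγ8)) hr
  have hq := D.q_coe_ne_zero
  have hP := hS.prod_X_pow
  have hP0 := hS.prod_X_ne_zero
  have hgs := hχ.gs_mul_conj
  rw [← D.coe_mul_conj] at hgs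
  have hcγ : starRingEnd ℂ (γ : ℂ) * γ = 1 := by
    have : ‖(γ : ℂ)‖ = 1 := norm_eq_one_of_pow_eq_one hγ8 (by norm_num)
    rw [mul_comm, Complex.mul_conj, Complex.normSq_eq_norm_sq, this]; simp
  have hs2 := hsgn (∑ i ∈ Finset.range S.card, i)
  have hsc : starRingEnd ℂ ((-1) ^ (∑ i ∈ Finset.range S.card, i)) =
      (-1) ^ (∑ i ∈ Finset.range S.card, i) := by simp
  generalize (-1 : ℂ) ^ (∑ i ∈ Finset.range S.card, i) = s at *
  generalize (γ : ℂ) = g at *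
  generalize ∏ ν ∈ S, D.X ν = P at *
  generalize D.gs χ = G at *
  have hg0 : g ≠ 0 := by rintro rfl; simp at hγ8
  set T := g⁻¹ * P with hT
  have hPT : P = g * T := by rw [hT, mul_inv_cancel_left₀ hg0]
  have hT0 : T ≠ 0 := mul_ne_zero (inv_ne_zero hg0) hP0
  have hT4 : T ^ 4 = -D.q := by
    have h2 := hsgn (S.card + 1)
    rw [hPT, mul_pow, hγ, pow_succ] at hP
    rw [pow_succ] at h2
    have h3 := hsgn S.card
    apply mul_left_cancel₀ (pow_ne_zero S.card (neg_ne_zero.2 (one_ne_zero (α := ℂ))))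
    linear_combination -hP
  have hT4c : starRingEnd ℂ T ^ 4 = -starRingEnd ℂ (D.q : ℂ) := by
    rw [← map_pow, hT4, map_neg]
  have hTc0 : starRingEnd ℂ T ≠ 0 := (map_ne_zero _).2 hT0
  have key : D.q * starRingEnd ℂ T = -s * G * T := by
    rw [hPT, map_mul] at h1
    linear_combination g * h1 - (D.q : ℂ) * starRingEnd ℂ T * hcγ - s * G * T * hγ8
  have keyc := congrArg (starRingEnd ℂ) key
  rw [map_mul, conj_conj, map_mul, map_mul, map_neg, hsc] at keyc
  have main : D.q * starRingEnd ℂ T ^ 3 = -s * starRingEnd ℂ G * T ^ 3 := by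
    apply mul_right_cancel₀ hTc0
    linear_combination (D.q : ℂ) * hT4c + T ^ 3 * keyc - starRingEnd ℂ (D.q : ℂ) * hT4
  rw [map_mul, map_inv₀, map_pow, inv_mul_eq_iff_eq_mul₀ (pow_ne_zero 3 hT0)]
  apply mul_left_cancel₀ (mul_ne_zero hq (pow_ne_zero 3 hTc0))
  have e : (starRingEnd ℂ T ^ 3) * (starRingEnd ℂ T ^ 3)⁻¹ = 1 :=
    mul_inv_cancel₀ (pow_ne_zero 3 hTc0)
  generalize (starRingEnd ℂ T ^ 3)⁻¹ = Ti at *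
  linear_combination A * main + (-s * T ^ 3) * hA + s * T ^ 3 * D.q * κ * starRingEnd ℂ A * e

end PrimaryPrime

lemma mem_O4_iff {z : ℂ} : z ∈ O4 ↔ ∃ g : GaussianInt, z = g := by
  constructor
  · intro h
    have : O4 ≤ GaussianInt.toComplex.range := by
      rw [O4, Subring.closure_le]
      rintro _ rfl
      exact ⟨gI, gI_coe⟩
    obtain ⟨g, hg⟩ := this h
    exact ⟨g, hg.symm⟩
  · rintro ⟨g, rfl⟩
    rw [GaussianInt.coe_def]
    exact add_mem (intCast_mem _ _) (mul_mem (intCast_mem _ _) (Subring.subset_closure rfl))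

lemma coe_mem_O4 (g : GaussianInt) : (g : ℂ) ∈ O4 := mem_O4_iff.2 ⟨g, rfl⟩

namespace PrimaryPrime
variable (D : PrimaryPrime)

lemma gCong_iff {a b : GaussianInt} : GCong a b D.q ↔ D.red a = D.red b := by
  rw [← sub_eq_zero, ← map_sub, red_eq_zero_iff]
  constructor
  · rintro ⟨d, hd, h⟩
    obtain ⟨g, rfl⟩ := mem_O4_iff.1 hd
    refine ⟨g, GaussianInt.toComplex_injective ?_⟩
    rw [map_sub, map_mul, h]
  · rintro ⟨g, h⟩
    refine ⟨g, coe_mem_O4 g, ?_⟩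
    rw [← map_sub, h, map_mul]

lemma gCoprime_iff {a : GaussianInt} : GCoprime a D.q ↔ D.red a ≠ 0 := by
  constructor
  · rintro ⟨u, hu, v, hv, h⟩ h0
    obtain ⟨u, rfl⟩ := mem_O4_iff.1 hu
    obtain ⟨v, rfl⟩ := mem_O4_iff.1 hv
    rw [← map_mul, ← map_mul, ← map_add, ← map_one GaussianInt.toComplex] at h
    have e := congrArg D.red (GaussianInt.toComplex_injective h)
    rw [map_add, map_mul, map_mul, h0, red_q, map_one] at e
    simp at e
  · intro h
    obtain ⟨u, hu⟩ := D.red_surjective (D.red a)⁻¹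
    have e : D.red (1 - u * a) = 0 := by
      rw [map_sub, map_mul, hu, map_one, inv_mul_cancel₀ h, sub_self]
    obtain ⟨v, hv⟩ := D.red_eq_zero_iff.1 e
    refine ⟨u, coe_mem_O4 u, v, coe_mem_O4 v, ?_⟩
    have e2 := congrArg GaussianInt.toComplex hv
    rw [map_sub, map_mul, map_mul, map_one] at e2
    linear_combination -e2

/-- A proper ideal containing `q` of a subring of `ℂ` containing `i` gives a place. -/
lemma exists_place {A : Subring ℂ} (J : Ideal A) (hJ : J ≠ ⊤) (hI : I ∈ A)
    (hq : ∃ x ∈ J, (x : ℂ) = D.q) : ∃ W : D.Place, A ≤ W.V.toSubring ∧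
      ∀ x ∈ J, (x : ℂ) ∈ W.V.nonunits := by
  obtain ⟨V, h1, h2⟩ := Ideal.image_subset_nonunits_valuationSubring J hJ
  have h3 : ∀ x ∈ J, (x : ℂ) ∈ V.nonunits := fun x hx => h2 ⟨x, hx, rfl⟩
  obtain ⟨x, hx, hxq⟩ := hq
  exact ⟨⟨V, h1 hI, hxq ▸ h3 x hx⟩, h1, h3⟩

lemma Place.r_eq_of_sub_mem {D : PrimaryPrime} (W : D.Place) {γ : W.V} {z : GaussianInt}
    (h : (γ : ℂ) - z ∈ W.V.nonunits) : W.r γ = W.ι (D.red z) := by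
  rw [← W.r_gi, ← sub_eq_zero, ← map_sub, W.r_eq_zero]
  exact h

lemma exists_place_O4 : ∃ W : D.Place, ∀ d ∈ O4, (D.q : ℂ) * d ∈ W.V.nonunits := by
  have hI : I ∈ O4 := Subring.subset_closure rfl
  set Q : O4 := ⟨D.q, coe_mem_O4 _⟩ with hQ
  obtain ⟨W, -, h⟩ := D.exists_place (Ideal.span {Q}) (by
    rw [Ne, Ideal.span_singleton_eq_top]
    rintro hu
    obtain ⟨y, hy⟩ := hu.exists_right_inv
    obtain ⟨g, hg⟩ := mem_O4_iff.1 y.2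
    have e := congrArg (Subtype.val) hy
    push_cast at e
    rw [hg] at e
    have e2 : D.q * g = 1 := GaussianInt.toComplex_injective (by
      rw [map_mul, map_one]; exact e)
    have e3 := congrArg D.red e2
    rw [map_mul, red_q, zero_mul, map_one] at e3
    exact zero_ne_one e3) hI ⟨Q, Ideal.mem_span_singleton_self Q, rfl⟩
  refine ⟨W, fun d hd => ?_⟩
  have := h _ (Ideal.mul_mem_right (⟨d, hd⟩ : O4) _ (Ideal.mem_span_singleton_self Q))
  exact this

lemma zeta8_sq : zeta8 ^ 2 = I := by
  rw [zeta8, ← Complex.exp_nat_mul]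
  refine Eq.trans ?_ Complex.exp_pi_div_two_mul_I
  congr 1
  push_cast
  ring

lemma exists_place_O8 {P : O8} (hP : Prime P) (hQ : ∃ Q : O8, (D.q : ℂ) = P * Q) :
    ∃ W : D.Place, ∀ d ∈ O8, (P : ℂ) * d ∈ W.V.nonunits := by
  have hz : zeta8 ∈ O8 := Subring.subset_closure rfl
  have hI : I ∈ O8 := by
    rw [← zeta8_sq]
    exact pow_mem hz 2
  obtain ⟨Q, hQ⟩ := hQ
  obtain ⟨W, -, h⟩ := D.exists_place (Ideal.span {P}) (by
    rw [Ne, Ideal.span_singleton_eq_top]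
    exact hP.not_isUnit) hI
    ⟨P * Q, Ideal.mul_mem_right _ _ (Ideal.mem_span_singleton_self P), by push_cast; exact hQ.symm⟩
  refine ⟨W, fun d hd => ?_⟩
  exact h (P * ⟨d, hd⟩) (Ideal.mul_mem_right _ _ (Ideal.mem_span_singleton_self P))

end PrimaryPrime

lemma exists_primaryPrime {p : ℕ} (hp : p.Prime) (hp4 : p % 4 = 1) {π : ℂ} (hπ : π ∈ O4)
    (hprimary : GCong π 1 ((1 + I) ^ 3)) (hnorm : (p : ℂ) = π * starRingEnd ℂ π) :
    ∃ D : PrimaryPrime, D.p = p ∧ (D.q : ℂ) = π := by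
  obtain ⟨g, rfl⟩ := mem_O4_iff.1 hπ
  obtain ⟨d, hd, h⟩ := hprimary
  obtain ⟨d, rfl⟩ := mem_O4_iff.1 hd
  have h1 : g - 1 = (1 + gI) ^ 3 * d := GaussianInt.toComplex_injective (by
    rw [map_sub, map_mul, map_pow, map_add, map_one, gI_coe, h])
  have h2 : (1 + gI) ^ 3 = ⟨-2, 2⟩ := by
    have e : (1 + gI) ^ 3 = 1 + 3 * gI + 3 * (gI * gI) + gI * gI * gI := by ring
    rw [e, gI_mul_gI]
    ext <;> simp [gI]
  rw [h2] at h1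
  have hr := congrArg Zsqrtd.re h1
  have hi := congrArg Zsqrtd.im h1
  simp at hr hi
  refine ⟨⟨p, hp, by rintro rfl; omega, g, ?_, ⟨d.re - d.im, by omega⟩, ⟨-d.re, by omega⟩⟩, rfl, rfl⟩
  rw [Complex.mul_conj, Complex.normSq_apply, ← GaussianInt.intCast_re,
    ← GaussianInt.intCast_im] at hnorm
  have e : (p : ℤ) = g.re * g.re + g.im * g.im := by exact_mod_cast hnorm
  rw [e]; ring

namespace PrimaryPrime
variable {D : PrimaryPrime}

lemma exists_mulChar {χ : ℂ → ℂ} (h : IsQuarticChar D.q D.p χ) :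
    ∃ χ' : MulChar (ZMod D.p) ℂ, D.IsQuartRes χ' ∧ ∀ g : GaussianInt, χ g = χ' (D.red g) := by
  have hv : ∀ g : GaussianInt, χ g = χ ((D.red g).val : GaussianInt) := fun g =>
    h.resChar.periodic _ (coe_mem_O4 _) _ (coe_mem_O4 _)
      (D.gCong_iff.2 (D.red_natCast_val _).symm)
  have h0 : ∀ g : GaussianInt, D.red g = 0 → χ g = 0 := fun g hg =>
    h.resChar.vanish _ (coe_mem_O4 _) fun h' => D.gCoprime_iff.1 h' hg
  have hm : ∀ g k : GaussianInt, χ ((g * k : GaussianInt) : ℂ) = χ g * χ k := fun g k => by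
    rw [GaussianInt.toComplex_mul]
    exact h.resChar.map_mul _ (coe_mem_O4 _) _ (coe_mem_O4 _)
  let χ' : MulChar (ZMod D.p) ℂ :=
    { toFun := fun t => χ ((t.val : GaussianInt) : ℂ)
      map_one' := by
        have := hv 1
        rw [map_one D.red] at this
        rw [← this, GaussianInt.toComplex_one, h.resChar.map_one]
      map_mul' := fun s t => by
        rw [← hm]
        conv_rhs => rw [hv, map_mul, red_natCast_val, red_natCast_val]
      map_nonunit' := fun t ht => h0 _ (by
        rw [red_natCast_val]
        by_contra h'
        exact ht (isUnit_iff_ne_zero.2 h')) }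
  have hχ' : ∀ g : GaussianInt, χ g = χ' (D.red g) := hv
  obtain ⟨b, hb⟩ := D.four_dvd
  have hb0 : b ≠ 0 := by
    rintro rfl
    have := D.hp.two_le
    omega
  have hbd : (D.p - 1) / 4 = b := by omega
  have heuler : ∀ t, ∃ g : GaussianInt, χ' t = (g : ℂ) ∧ D.red g = t ^ ((D.p - 1) / 4) := by
    intro t
    obtain ⟨k, rfl⟩ := D.red_surjective t
    by_cases hk : D.red k = 0
    · refine ⟨0, ?_, ?_⟩
      · rw [hk, MulChar.map_zero, map_zero]
      · rw [hk, map_zero, hbd, zero_pow hb0]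
    · have e := h.euler k (coe_mem_O4 k) (D.gCoprime_iff.2 hk)
      obtain ⟨d, hd, e1⟩ := id e
      obtain ⟨d, rfl⟩ := mem_O4_iff.1 hd
      rw [← map_pow] at e e1
      have e2 : χ k = ((k ^ ((D.p - 1) / 4) + D.q * d : GaussianInt) : ℂ) := by
        rw [map_add, map_mul]
        linear_combination e1
      refine ⟨_, (hχ' k).symm.trans e2, ?_⟩
      rw [map_add, map_mul, red_q, zero_mul, add_zero, map_pow]
  refine ⟨χ', ⟨⟨fun t ht => ?_, fun h1 => ?_⟩, heuler⟩, hχ'⟩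
  · obtain ⟨k, rfl⟩ := D.red_surjective t
    rw [← hχ']
    exact h.quart k (coe_mem_O4 k) (D.gCoprime_iff.2 ht)
  · obtain ⟨a, ha⟩ := exists_pow_ne_one_of_isCyclic (G := (ZMod D.p)ˣ) (k := b) (by omega) (by
      rw [Nat.card_eq_fintype_card, ZMod.card_units, hb]; omega)
    obtain ⟨g, hg, hr⟩ := heuler a
    rw [h1, MulChar.one_apply a.isUnit] at hg
    have h2 : g = 1 := GaussianInt.toComplex_injective (by
      rw [GaussianInt.toComplex_one]; exact hg.symm)
    rw [h2, map_one, hbd] at hr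
    apply ha
    ext
    push_cast
    exact hr.symm

lemma IsQuartRes.iF_eq {χ : MulChar (ZMod D.p) ℂ} (hχ : D.IsQuartRes χ) :
    χ D.iF = I ^ ((D.p - 1) / 4) := by
  obtain ⟨g, hg, hr⟩ := hχ.euler D.iF
  have h4 := hχ.pow_four D.iF D.iF_ne_zero
  have hz : ((4 : ℕ) : ZMod D.p) ≠ 0 := by
    have : ((4 : ℕ) : ZMod D.p) = 2 * 2 := by norm_num
    rw [this]
    exact mul_ne_zero D.two_ne_zero D.two_ne_zero
  have hgI : gI ^ 4 = 1 := by
    rw [show gI ^ 4 = (gI * gI) * (gI * gI) by ring, gI_mul_gI]; ring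
  have e : g = gI ^ ((D.p - 1) / 4) := by
    refine eq_of_map_eq_of_pow_eq_one D.red hz ?_ ?_ ?_
    · apply GaussianInt.toComplex_injective
      rw [map_pow, map_one, ← hg, h4]
    · rw [← pow_mul, mul_comm, pow_mul, hgI, one_pow]
    · rw [hr, map_pow, red_gI]
  rw [hg, e, map_pow, gI_coe]

lemma sum_Icc_eq (h : ℕ → ℂ) :
    ∑ r ∈ Finset.Icc 1 (D.p - 1), h r = ∑ t ∈ Finset.univ.erase (0 : ZMod D.p), h t.val := by
  symm
  refine Finset.sum_nbij' (fun t => t.val) (fun r => (r : ZMod D.p)) ?_ ?_ ?_ ?_ ?_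
  · intro t ht
    have h0 : t.val ≠ 0 := by
      rw [Ne, ZMod.val_eq_zero]; exact Finset.ne_of_mem_erase ht
    have := ZMod.val_lt t
    exact Finset.mem_Icc.2 ⟨by omega, by omega⟩
  · intro r hr
    have := Finset.mem_Icc.1 hr
    refine Finset.mem_erase.2 ⟨?_, Finset.mem_univ _⟩
    rw [Ne, ZMod.natCast_eq_zero_iff]
    exact Nat.not_dvd_of_pos_of_lt (by omega) (by omega)
  · intro t _
    exact ZMod.natCast_zmod_val t
  · intro r hr
    have := Finset.mem_Icc.1 hr
    exact ZMod.val_cast_of_lt (by omega)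
  · intro t _
    rfl

lemma EGS4_eq {χ : ℂ → ℂ} {χ' : MulChar (ZMod D.p) ℂ} (h : ∀ g : GaussianInt, χ g = χ' (D.red g))
    {f : ℂ → ℂ} {F : ZMod D.p → ℂ} (hf : ∀ t : ZMod D.p, t ≠ 0 → f (t.val / D.q) = F t) :
    EGS4 D.p χ f D.q = 1 / 4 * ∑ t, χ' t * F t := by
  rw [EGS4, D.sum_Icc_eq (fun r => χ r * f (r / D.q)),
    ← Finset.add_sum_erase _ _ (Finset.mem_univ (0 : ZMod D.p)), MulChar.map_zero, zero_mul,
    zero_add]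
  congr 1
  refine Finset.sum_congr rfl fun t ht => ?_
  rw [hf t (Finset.ne_of_mem_erase ht)]
  have := h (t.val : GaussianInt)
  rw [red_natCast_val, map_natCast] at this
  rw [this]

end PrimaryPrime

lemma I_pow_mem_units (k : ℕ) : I ^ k ∈ ({1, -1, I, -I} : Set ℂ) := by
  rw [← Nat.div_add_mod k 4, pow_add, pow_mul, I_pow_four, one_pow, one_mul]
  have : k % 4 < 4 := Nat.mod_lt _ (by norm_num)
  interval_cases k % 4 <;> simp [I_sq, I_pow_three]

lemma exists_eq_I_pow {ε : ℂ} (h : ε ∈ ({1, -1, I, -I} : Set ℂ)) :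
    ∃ k ∈ Finset.range 4, ε = I ^ k := by
  rcases h with rfl | rfl | rfl | rfl
  · exact ⟨0, by simp, by simp⟩
  · exact ⟨2, by simp, by simp⟩
  · exact ⟨1, by simp, by simp⟩
  · exact ⟨3, by simp, I_pow_three.symm⟩

lemma I_pow_inj {k l : ℕ} (hk : k < 4) (hl : l < 4) (h : I ^ k = I ^ l) : k = l := by
  interval_cases k <;> interval_cases l <;>
    simp [I_sq, I_pow_three, Complex.ext_iff] at h ⊢ <;> norm_num at h

namespace PrimaryPrime
variable {D : PrimaryPrime}

open Classical in
/-- Reduction of Gaussian integers, as a function on `ℂ`. -/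
def redC (D : PrimaryPrime) (z : ℂ) : ZMod D.p :=
  if h : ∃ g : GaussianInt, z = g then D.red h.choose else 0

lemma redC_coe (g : GaussianInt) : D.redC g = D.red g := by
  have h : ∃ g' : GaussianInt, (g : ℂ) = g' := ⟨g, rfl⟩
  rw [redC, dif_pos h, ← GaussianInt.toComplex_injective h.choose_spec]

open Classical in
/-- The reduction of a quarter set. -/
def redS (D : PrimaryPrime) (S : Finset ℂ) : Finset (ZMod D.p) := S.image D.redC

variable {S : Finset ℂ}

lemma exists_coe_of_mem (hS : IsQuarterSet D.q S) {ν : ℂ} (h : ν ∈ S) :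
    ∃ g : GaussianInt, ν = g ∧ D.red g ≠ 0 ∧ D.redC ν = D.red g := by
  obtain ⟨h1, h2⟩ := hS.1 ν h
  obtain ⟨g, rfl⟩ := mem_O4_iff.1 h1
  exact ⟨g, rfl, D.gCoprime_iff.1 h2, redC_coe g⟩

lemma eq_of_iF_pow (hS : IsQuarterSet D.q S) {ν μ : ℂ} (hν : ν ∈ S) (hμ : μ ∈ S) {k l : ℕ}
    (h : D.iF ^ k * D.redC ν = D.iF ^ l * D.redC μ) : ν = μ ∧ I ^ k = I ^ l := by
  obtain ⟨g, hg, -, hg2⟩ := exists_coe_of_mem hS hν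
  obtain ⟨g', hg', -, hg2'⟩ := exists_coe_of_mem hS hμ
  refine hS.2.2 ν hν μ hμ _ (I_pow_mem_units k) _ (I_pow_mem_units l) ?_
  have e : GCong ((gI ^ k * g : GaussianInt) : ℂ) ((gI ^ l * g' : GaussianInt) : ℂ) D.q := by
    rw [D.gCong_iff, map_mul D.red, map_mul D.red, map_pow D.red, map_pow D.red, red_gI, ← hg2,
      ← hg2', h]
  rw [GaussianInt.toComplex_mul, GaussianInt.toComplex_mul, map_pow, map_pow, gI_coe, ← hg,
    ← hg'] at e
  exact e

lemma redC_injOn (hS : IsQuarterSet D.q S) : Set.InjOn D.redC (S : Set ℂ) := fun ν hν μ hμ h =>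
  (eq_of_iF_pow hS hν hμ (k := 0) (l := 0) (by rw [h])).1

lemma isQSet_redS (hS : IsQuarterSet D.q S) : D.IsQSet (D.redS S) := by
  classical
  have hmem : ∀ {t}, t ∈ D.redS S → ∃ ν ∈ S, D.redC ν = t := fun {t} h => by
    rwa [redS, Finset.mem_image] at h
  constructor
  · rintro ⟨t, k⟩ hx ⟨u, l⟩ hy h
    have hx' := Finset.mem_product.1 (Finset.mem_coe.1 hx)
    have hy' := Finset.mem_product.1 (Finset.mem_coe.1 hy)
    obtain ⟨ν, hν, e1⟩ := hmem hx'.1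
    obtain ⟨μ, hμ, e2⟩ := hmem hy'.1
    have hk := Finset.mem_range.1 hx'.2
    have hl := Finset.mem_range.1 hy'.2
    dsimp only at h e1 e2 hk hl
    rw [← e1, ← e2] at h
    obtain ⟨h1, h2⟩ := eq_of_iF_pow hS hν hμ h
    rw [← e1, ← e2, h1, I_pow_inj hk hl h2]
  · ext t
    rw [Finset.mem_image, Finset.mem_erase]
    constructor
    · rintro ⟨⟨u, k⟩, hx, rfl⟩
      obtain ⟨ν, hν, e1⟩ := hmem (Finset.mem_product.1 hx).1
      obtain ⟨g, -, h0, h1⟩ := exists_coe_of_mem hS hν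
      dsimp only at e1 ⊢
      refine ⟨mul_ne_zero (pow_ne_zero _ D.iF_ne_zero) ?_, Finset.mem_univ _⟩
      rwa [← e1, h1]
    · rintro ⟨h0, -⟩
      obtain ⟨g, rfl⟩ := D.red_surjective t
      obtain ⟨ν, hν, ε, hε, h⟩ := hS.2.1 g (coe_mem_O4 g) (D.gCoprime_iff.2 h0)
      obtain ⟨k, hk, rfl⟩ := exists_eq_I_pow hε
      obtain ⟨g', hg', -, h1⟩ := exists_coe_of_mem hS hν
      refine ⟨(D.redC ν, k), Finset.mem_product.2 ⟨Finset.mem_image_of_mem _ hν, hk⟩, ?_⟩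
      have e : I ^ k * ν = ((gI ^ k * g' : GaussianInt) : ℂ) := by
        rw [GaussianInt.toComplex_mul, map_pow, gI_coe, hg']
      rw [e, D.gCong_iff, map_mul D.red, map_pow D.red, red_gI] at h
      dsimp only
      rw [h, h1]

lemma prod_phi4 (hS : IsQuarterSet D.q S) : ∏ ν ∈ S, phi4 (ν / D.q) = ∏ t ∈ D.redS S, D.X t := by
  classical
  rw [redS, Finset.prod_image (redC_injOn hS)]
  refine Finset.prod_congr rfl fun ν hν => ?_
  obtain ⟨g, rfl, h0, h1⟩ := exists_coe_of_mem hS hν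
  rw [D.phi4_div h0, h1]

lemma exists_prod_eq (hS : IsQuarterSet D.q S) : ∃ G : GaussianInt, ∏ ν ∈ S, ν = (G : ℂ) ∧ D.red G = ∏ t ∈ D.redS S, t := by
  classical
  have h : ∀ ν, ∃ g : GaussianInt, ν ∈ S → ν = g ∧ D.redC ν = D.red g := fun ν => by
    by_cases hν : ν ∈ S
    · obtain ⟨g, h1, -, h2⟩ := exists_coe_of_mem hS hν
      exact ⟨g, fun _ => ⟨h1, h2⟩⟩
    · exact ⟨0, fun h => absurd h hν⟩
  choose g hg using h
  refine ⟨∏ ν ∈ S, g ν, ?_, ?_⟩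
  · rw [map_prod]
    exact Finset.prod_congr rfl fun ν hν => (hg ν hν).1
  · rw [map_prod, redS, Finset.prod_image (redC_injOn hS)]
    exact Finset.prod_congr rfl fun ν hν => (hg ν hν).2.symm

lemma exists_place_of_isGamma4 (hS : IsQuarterSet D.q S) {γ : ℂ} (hγ : IsGamma4 D.q D.p S γ) :
    ∃ (W : D.Place) (g : W.V), (g : ℂ) = γ ∧ γ ^ 4 = (-1) ^ ((D.redS S).card + 1) ∧
      W.r g = W.ι (∏ t ∈ D.redS S, t) := by
  obtain ⟨G, hG, hG2⟩ := exists_prod_eq hS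
  have hc := (isQSet_redS hS).card
  have hn : γ ^ 4 = (-1) ^ ((D.redS S).card + 1) ∧
      ∃ W : D.Place, γ - (G : ℂ) ∈ W.V.nonunits := by
    rw [← hG]
    rcases Nat.even_or_odd (D.redS S).card with h | h
    · obtain ⟨k, hk⟩ := id h
      obtain ⟨h1, P, hP, hQ, d, hd, h2⟩ := hγ.2 (by omega)
      obtain ⟨W, hW⟩ := D.exists_place_O8 hP hQ
      exact ⟨by rw [h1, h.add_one.neg_one_pow], W, h2 ▸ hW d hd⟩
    · obtain ⟨k, hk⟩ := id h
      obtain ⟨h1, d, hd, h2⟩ := hγ.1 (by omega)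
      obtain ⟨W, hW⟩ := D.exists_place_O4
      exact ⟨by rw [h1, h.add_one.neg_one_pow], W, h2 ▸ hW d hd⟩
  obtain ⟨h4, W, hW⟩ := hn
  have h8 : γ ^ 8 = 1 := by
    rw [show γ ^ 8 = (γ ^ 4) ^ 2 by ring, h4, ← pow_mul, mul_comm, pow_mul]
    simp
  refine ⟨W, ⟨γ, mem_of_pow_eq_one W.V (by norm_num) h8⟩, rfl, h4, ?_⟩
  rw [← hG2]
  exact W.r_eq_of_sub_mem hW

end PrimaryPrime

lemma neg_one_pow_sum_range_four_mul (m : ℕ) :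
    (-1 : ℂ) ^ (∑ i ∈ Finset.range (4 * m), i) = 1 := by
  induction m with
  | zero => simp
  | succ m ih =>
    rw [show 4 * (m + 1) = 4 * m + 1 + 1 + 1 + 1 by ring, Finset.sum_range_succ,
      Finset.sum_range_succ, Finset.sum_range_succ, Finset.sum_range_succ]
    simp only [pow_add, ih, pow_mul]
    norm_num

namespace PrimaryPrime
variable {D : PrimaryPrime}

/-- The functional equation for the coefficient of an elliptic Gauss sum. -/
lemma coefficient_EGS4_eq {χ : ℂ → ℂ} {χ' : MulChar (ZMod D.p) ℂ} (hχ : D.IsQuartRes χ')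
    (hχ' : ∀ g : GaussianInt, χ g = χ' (D.red g)) {S : Finset ℂ} (hS : IsQuarterSet D.q S) {γ : ℂ}
    (hγ : IsGamma4 D.q D.p S γ) {f : ℂ → ℂ} {F : ZMod D.p → ℂ} {c : ℝ} {κ : ℂ}
    (hf : ∀ t : ZMod D.p, t ≠ 0 → f (t.val / D.q) = c * F t)
    (hF : starRingEnd ℂ (D.gs χ') * ∑ t, χ' t * F t =
      D.q * κ * starRingEnd ℂ (∑ t, χ' t * F t)) :
    ((γ⁻¹ * ∏ ν ∈ S, phi4 (ν / D.q)) ^ 3)⁻¹ * EGS4 D.p χ f D.q =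
      -(-1) ^ (∑ i ∈ Finset.range ((D.p - 1) / 4), i) * κ *
        starRingEnd ℂ (((γ⁻¹ * ∏ ν ∈ S, phi4 (ν / D.q)) ^ 3)⁻¹ * EGS4 D.p χ f D.q) := by
  obtain ⟨W, g, rfl, h4, hr⟩ := exists_place_of_isGamma4 hS hγ
  have hQ := isQSet_redS hS
  have hb : (D.p - 1) / 4 = (D.redS S).card := by
    have := hQ.card
    omega
  rw [prod_phi4 hS, hb]
  refine W.coefficient_eq hχ hQ h4 hr ?_
  have e : EGS4 D.p χ f D.q = ((1 / 4 * c : ℝ) : ℂ) * ∑ t, χ' t * F t := by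
    rw [EGS4_eq hχ' hf, Finset.mul_sum, Finset.mul_sum]
    refine Finset.sum_congr rfl fun t _ => ?_
    push_cast
    ring
  rw [e, map_mul, conj_ofReal]
  linear_combination ((1 / 4 * c : ℝ) : ℂ) * hF

lemma IsQuart.map_one_sub {χ : MulChar (ZMod D.p) ℂ} :
    χ (1 - D.iF) = χ D.iF ^ 3 * χ (1 + D.iF) := by
  rw [← map_pow, ← map_mul, iF_pow_three]
  congr 1
  linear_combination D.iF_mul

lemma natCast_val_div {f : ℂ → ℂ} {F : ZMod D.p → ℂ}
    (h : ∀ {g : GaussianInt}, D.red g ≠ 0 → f (g / D.q) = F (D.red g)) (t : ZMod D.p)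
    (ht : t ≠ 0) : f (t.val / D.q) = ((1 : ℝ) : ℂ) * F t := by
  have := h (g := (t.val : GaussianInt)) (by rwa [red_natCast_val])
  rw [red_natCast_val, map_natCast] at this
  rw [this, ofReal_one, one_mul]

theorem coefficient_phi4 {χ : ℂ → ℂ} (hχ : IsQuarticChar D.q D.p χ) {S : Finset ℂ}
    (hS : IsQuarterSet D.q S) {γ : ℂ} (hγ : IsGamma4 D.q D.p S γ) {α : ℂ}
    (hα : α = ((γ⁻¹ * ∏ ν ∈ S, phi4 (ν / D.q)) ^ 3)⁻¹ * EGS4 D.p χ phi4 D.q)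
    (hp : D.p % 16 = 13) : α = starRingEnd ℂ α := by
  obtain ⟨χ', h1, h2⟩ := exists_mulChar hχ
  have h := coefficient_EGS4_eq h1 h2 hS hγ (natCast_val_div D.phi4_div) (κ := 1)
    (by rw [mul_one]; exact h1.dual_X)
  rw [← hα] at h
  rw [show (D.p - 1) / 4 = 4 * (D.p / 16) + 1 + 1 + 1 by omega, Finset.sum_range_succ,
    Finset.sum_range_succ, Finset.sum_range_succ] at h
  simp only [pow_add, neg_one_pow_sum_range_four_mul, pow_mul] at h
  norm_num at h
  exact h

theorem coefficient_psi4 {χ : ℂ → ℂ} (hχ : IsQuarticChar D.q D.p χ) {S : Finset ℂ}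
    (hS : IsQuarterSet D.q S) {γ : ℂ} (hγ : IsGamma4 D.q D.p S γ) {α : ℂ}
    (hα : α = ((γ⁻¹ * ∏ ν ∈ S, phi4 (ν / D.q)) ^ 3)⁻¹ * EGS4 D.p χ psi4 D.q) :
    (D.p % 16 = 1 → α = -starRingEnd ℂ (χ (1 + I)) * starRingEnd ℂ α) ∧
    (D.p % 16 = 9 → α = -I * starRingEnd ℂ (χ (1 + I)) * starRingEnd ℂ α) := by
  obtain ⟨χ', h1, h2⟩ := exists_mulChar hχ
  have hκ := h1.dual_Ps
  rw [map_mul (starRingEnd ℂ), ← mul_assoc, IsQuart.map_one_sub, h1.iF_eq] at hκ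
  have h := coefficient_EGS4_eq h1 h2 hS hγ (natCast_val_div D.psi4_div) hκ
  have hc : χ (1 + I) = χ' (1 + D.iF) := by
    have := h2 (1 + gI)
    rwa [map_add, map_add, map_one, map_one, gI_coe, red_gI] at this
  rw [← hα, ← hc] at h
  constructor
  · intro hp
    rw [show (D.p - 1) / 4 = 4 * (D.p / 16) by omega, neg_one_pow_sum_range_four_mul, pow_mul,
      I_pow_four, one_pow] at h
    simp only [map_mul, map_add, map_sub, map_div₀, map_one, conj_I, map_pow,
      map_ofNat] at h
    generalize starRingEnd ℂ (χ (1 + I)) = c at *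
    generalize starRingEnd ℂ α = a at *
    linear_combination h + c * a / 2 * I_sq
  · intro hp
    rw [show (D.p - 1) / 4 = 4 * (D.p / 16) + 1 + 1 by omega, Finset.sum_range_succ,
      Finset.sum_range_succ] at h
    simp only [pow_add, neg_one_pow_sum_range_four_mul, pow_mul, I_pow_four, one_pow] at h
    simp only [map_mul, map_add, map_sub, map_div₀, map_one, conj_I, map_neg, map_pow,
      map_ofNat] at h
    generalize starRingEnd ℂ (χ (1 + I)) = c at *
    generalize starRingEnd ℂ α = a at *
    have h6 : I ^ 6 = -1 := by linear_combination I ^ 2 * I_pow_four + I_sq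
    have h7 : I ^ 7 = -I := by linear_combination I ^ 3 * I_pow_four + I * I_sq
    have h9 : I ^ 9 = I := by linear_combination (I ^ 5 + I) * I_pow_four
    have h10 : I ^ 10 = -1 := by linear_combination (I ^ 6 + I ^ 2) * I_pow_four + I_sq
    linear_combination h + c * a / 2 * (h6 + h7 - h9 - h10)

theorem coefficient_Z4 {χ : ℂ → ℂ} (hχ : IsQuarticChar D.q D.p χ) {S : Finset ℂ}
    (hS : IsQuarterSet D.q S) {γ : ℂ} (hγ : IsGamma4 D.q D.p S γ) {α : ℂ}
    (hα : α = ((γ⁻¹ * ∏ ν ∈ S, phi4 (ν / D.q)) ^ 3)⁻¹ * EGS4 D.p χ Z4 D.q)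
    (hp : D.p % 16 = 5) : α = I * χ 2 * starRingEnd ℂ α := by
  obtain ⟨χ', h1, h2⟩ := exists_mulChar hχ
  have hb : (D.p - 1) / 4 = 4 * (D.p / 16) + 1 := by omega
  have hi : χ' D.iF = I := by
    rw [h1.iF_eq, hb, pow_add, pow_mul, I_pow_four, one_pow, one_mul, pow_one]
  have hκ := h1.dual_Z hi
  have hc : χ' (1 + D.iF) ^ 2 = I * χ 2 := by
    have h3 := h2 2
    rw [map_ofNat, map_ofNat] at h3
    rw [h3, ← hi, ← map_mul, ← map_pow]
    congr 1
    linear_combination D.iF_mul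
  rw [hc] at hκ
  obtain ⟨r, hr⟩ := conj_eq_iff_real.1 slL_conj
  have h := coefficient_EGS4_eq h1 h2 hS hγ (f := Z4) (F := fun t => Zp (t.val / D.q)) (c := r⁻¹)
    (κ := -(I * χ 2)) (fun t ht => by
      rw [Z4_eq, Zp_eq (not_isLat_val_div ht), hr, ofReal_inv])
    (by linear_combination hκ)
  rw [← hα, hb, Finset.sum_range_succ] at h
  simp only [pow_add, neg_one_pow_sum_range_four_mul, pow_mul] at h
  norm_num at h
  linear_combination h

end PrimaryPrime

/-- **Theorem II.4.** Let `π ∈ ℤ[i]` be a primary prime with `p = π·π̄`, and let `α_π`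
be the coefficient of the elliptic Gauss sum. Then `α_π = ᾱ_π` if `p ≡ 13 (mod 16)`;
`α_π = i·χ_π(2)·ᾱ_π` if `p ≡ 5 (mod 16)`; `α_π = −χ̄_π(1+i)·ᾱ_π` if `p ≡ 1 (mod 16)`;
and `α_π = −i·χ̄_π(1+i)·ᾱ_π` if `p ≡ 9 (mod 16)`. -/
theorem stmt_14
    (p : ℕ) (hp : p.Prime) (hp4 : p % 4 = 1)
    (π : ℂ) (hπ : π ∈ O4) (hprimary : GCong π 1 ((1 + Complex.I) ^ 3))
    (hnorm : (p : ℂ) = π * (starRingEnd ℂ) π)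
    (χ : ℂ → ℂ) (hχ : IsQuarticChar π p χ)
    (S : Finset ℂ) (hS : IsQuarterSet π S)
    (γ : ℂ) (hγ : IsGamma4 π p S γ)
    (πt : ℂ) (hπt : πt = γ⁻¹ * ∏ ν ∈ S, phi4 (ν / π))
    (α₁₃ α₅ α₁ : ℂ)
    (hα₁₃ : α₁₃ = (πt ^ 3)⁻¹ * EGS4 p χ phi4 π)
    (hα₅ : α₅ = (πt ^ 3)⁻¹ * EGS4 p χ Z4 π)
    (hα₁ : α₁ = (πt ^ 3)⁻¹ * EGS4 p χ psi4 π) :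
    (p % 16 = 13 → α₁₃ = (starRingEnd ℂ) α₁₃) ∧
    (p % 16 = 5 → α₅ = Complex.I * χ 2 * (starRingEnd ℂ) α₅) ∧
    (p % 16 = 1 →
      α₁ = -((starRingEnd ℂ) (χ (1 + Complex.I))) * (starRingEnd ℂ) α₁) ∧
    (p % 16 = 9 →
      α₁ = -Complex.I * (starRingEnd ℂ) (χ (1 + Complex.I)) * (starRingEnd ℂ) α₁) := by
  obtain ⟨D, rfl, rfl⟩ := exists_primaryPrime hp hp4 hπ hprimary hnorm
  subst hπt
  exact ⟨PrimaryPrime.coefficient_phi4 hχ hS hγ hα₁₃, PrimaryPrime.coefficient_Z4 hχ hS hγ hα₅,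
    PrimaryPrime.coefficient_psi4 hχ hS hγ hα₁⟩

end
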